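/- For a ∈ (0,a*) let u_a be a minimizer of e(a), ε_a = (∫_{ℝ²}|∇|u_a||² dx)^{−1/2}, x_a a global maximum point of |u_a|, and w_a(x) = ε_a u_a(ε_a x + x_a) e^{−i((ε_a Ω/2) x·x_a^⊥ − θ_a)}. Then the modulus converges: |w_a(x)| → (1/√a*) Q(x/√a*) strongly in H¹(ℝ²) as a ↗ a*, where Q is the unique positive radially symmetric solution of −Δu + u − u³ = 0 in ℝ². -/

import Mathlib

open MeasureTheory Filter Topology Set Metric

noncomputable section

/-- The plane `ℝ²` with the Euclidean norm. -/
abbrev Plane : Type := EuclideanSpace ℝ (Fin 2)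

def e0 : Plane := EuclideanSpace.single (0 : Fin 2) (1 : ℝ)
def e1 : Plane := EuclideanSpace.single (1 : Fin 2) (1 : ℝ)

/-- Partial derivatives of a complex-valued function. -/
def d0 (u : Plane → ℂ) (x : Plane) : ℂ := fderiv ℝ u x e0
def d1 (u : Plane → ℂ) (x : Plane) : ℂ := fderiv ℝ u x e1

/-- `|∇u|²` for complex-valued `u`. -/
def gradSq (u : Plane → ℂ) (x : Plane) : ℝ := ‖d0 u x‖ ^ 2 + ‖d1 u x‖ ^ 2

/-- `|∇|u||²`. -/
def gradAbsSq (u : Plane → ℂ) (x : Plane) : ℝ := ‖fderiv ℝ (fun y => ‖u y‖) x‖ ^ 2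

/-- Membership in `H¹(ℝ², ℂ)` (smooth-representative formulation). -/
def InH1 (u : Plane → ℂ) : Prop :=
  Differentiable ℝ u ∧ Integrable (fun x => ‖u x‖ ^ 2) ∧ Integrable (gradSq u)

/-- Membership in the space `𝓗 = {u ∈ H¹ : ∫ V |u|² < ∞}`. -/
def InH (V : Plane → ℝ) (u : Plane → ℂ) : Prop :=
  InH1 u ∧ Integrable (fun x => V x * ‖u x‖ ^ 2)

/-- The constraint set `S_a`. -/
def Sset (V : Plane → ℝ) (a : ℝ) : Set (Plane → ℂ) :=
  {u | InH V u ∧ (∫ x : Plane, ‖u x‖ ^ 2) = a}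

/-- The momentum density `x^⊥ · (iu, ∇u)`, with `x^⊥ = (-x₂, x₁)` and
`(iu,∇u)_j = Im(ū ∂_j u)`. -/
def momentum (u : Plane → ℂ) (x : Plane) : ℝ :=
  (-(x 1)) * ((starRingEnd ℂ) (u x) * d0 u x).im + (x 0) * ((starRingEnd ℂ) (u x) * d1 u x).im

/-- The logarithmic convolution term `∫∫ ln|x-y| |u(x)|²|u(y)|²`. -/
def logConv (u : Plane → ℂ) : ℝ :=
  ∫ x : Plane, ∫ y : Plane, Real.log ‖x - y‖ * ‖u x‖ ^ 2 * ‖u y‖ ^ 2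

/-- The energy functional `E_a`. -/
def Ea (V : Plane → ℝ) (Ω : ℝ) (u : Plane → ℂ) : ℝ :=
  (∫ x : Plane, (gradSq u x + V x * ‖u x‖ ^ 2)) + (1 / 2) * logConv u
    - (1 / 2) * (∫ x : Plane, ‖u x‖ ^ 4) - Ω * (∫ x : Plane, momentum u x)

/-- `u` is a minimizer of `e(a) = inf_{S_a} E_a`. -/
def IsMinimizer (V : Plane → ℝ) (Ω a : ℝ) (u : Plane → ℂ) : Prop :=
  u ∈ Sset V a ∧ ∀ v ∈ Sset V a, Ea V Ω u ≤ Ea V Ω v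

/-- `e(a) = inf_{u ∈ S_a} E_a(u)`. -/
def eInf (V : Plane → ℝ) (Ω a : ℝ) : ℝ := sInf (Ea V Ω '' Sset V a)

/-- `f(x) → ∞` as `|x| → ∞`. -/
def TendsInfty (f : Plane → ℝ) : Prop := ∀ M : ℝ, ∃ R : ℝ, ∀ x : Plane, R ≤ ‖x‖ → M ≤ f x

/-- Hypotheses (1.10): `0 ≤ V ∈ L^∞_loc` and `liminf_{|x|→∞} V(x)/|x|² > 0`. -/
def V110 (V : Plane → ℝ) : Prop :=
  Measurable V ∧ (∀ x, 0 ≤ V x) ∧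
  (∀ R : ℝ, ∃ C : ℝ, ∀ x : Plane, ‖x‖ ≤ R → V x ≤ C) ∧
  (∃ c : ℝ, 0 < c ∧ ∃ R : ℝ, ∀ x : Plane, R ≤ ‖x‖ → c * ‖x‖ ^ 2 ≤ V x)

/-- The set of rotational velocities `W > 0` with `V(x) - (W²/4)|x|² → ∞`;
`Ω* = sup RotSet V`. -/
def RotSet (V : Plane → ℝ) : Set ℝ :=
  {W : ℝ | 0 < W ∧ TendsInfty (fun x => V x - W ^ 2 / 4 * ‖x‖ ^ 2)}

/-- `Ω < Ω*` where `Ω* = sup RotSet V` (possibly `+∞`). -/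
def SubCritical (V : Plane → ℝ) (Ω : ℝ) : Prop := ∃ W ∈ RotSet V, Ω < W

def d0R (q : Plane → ℝ) (x : Plane) : ℝ := fderiv ℝ q x e0
def d1R (q : Plane → ℝ) (x : Plane) : ℝ := fderiv ℝ q x e1

/-- `|∇q|²` for real-valued `q`. -/
def gradSqR (q : Plane → ℝ) (x : Plane) : ℝ := (d0R q x) ^ 2 + (d1R q x) ^ 2

/-- The Laplacian of a real-valued function. -/
def lapR (q : Plane → ℝ) (x : Plane) : ℝ := fderiv ℝ (d0R q) x e0 + fderiv ℝ (d1R q) x e1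

/-- `Q` is the positive radially symmetric `H¹` solution of `-ΔQ + Q - Q³ = 0` on `ℝ²`. -/
def IsGroundState (Q : Plane → ℝ) : Prop :=
  ContDiff ℝ 2 Q ∧ (∀ x, 0 < Q x) ∧ (∀ x y : Plane, ‖x‖ = ‖y‖ → Q x = Q y) ∧
  Integrable (fun x => (Q x) ^ 2) ∧ Integrable (fun x => ‖fderiv ℝ Q x‖ ^ 2) ∧
  (∀ x, - lapR Q x + Q x - (Q x) ^ 3 = 0)

/-- The Laplacian of a complex-valued function. -/
def lapC (u : Plane → ℂ) (x : Plane) : ℂ := fderiv ℝ (d0 u) x e0 + fderiv ℝ (d1 u) x e1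

/-- The Euler–Lagrange equation (1.18):
`-Δu + V u + (∫ ln|x-y||u(y)|² dy) u + iΩ (x^⊥·∇u) = μ u + |u|² u`. -/
def EulerLagrange (V : Plane → ℝ) (Ω : ℝ) (u : Plane → ℂ) (μ : ℝ) : Prop :=
  ∀ x : Plane,
    - lapC u x + (V x : ℂ) * u x
      + (((∫ y : Plane, Real.log ‖x - y‖ * ‖u y‖ ^ 2) : ℝ) : ℂ) * u x
      + Complex.I * (Ω : ℂ) * (((-(x 1) : ℝ) : ℂ) * d0 u x + ((x 0 : ℝ) : ℂ) * d1 u x)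
    = (μ : ℂ) * u x + ((‖u x‖ ^ 2 : ℝ) : ℂ) * u x

/-- Condition (V): `0 ≤ V_Ω ∈ C^α_loc`, `V_Ω` vanishes only at the origin, and `V` has at
most exponential growth. Here `V_Ω(x) = V(x) - (Ω²/4)|x|²`. -/
def CondV (V : Plane → ℝ) (Ω α : ℝ) : Prop :=
  α ∈ Ioo (0 : ℝ) 1 ∧
  (∀ x : Plane, 0 ≤ V x - Ω ^ 2 / 4 * ‖x‖ ^ 2) ∧
  (∀ x : Plane, V x - Ω ^ 2 / 4 * ‖x‖ ^ 2 = 0 ↔ x = 0) ∧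
  (∀ R : ℝ, 0 < R → ∃ C : ℝ, ∀ x ∈ closedBall (0 : Plane) R, ∀ y ∈ closedBall (0 : Plane) R,
    |(V x - Ω ^ 2 / 4 * ‖x‖ ^ 2) - (V y - Ω ^ 2 / 4 * ‖y‖ ^ 2)| ≤ C * ‖x - y‖ ^ α) ∧
  (∃ C γ : ℝ, 0 < γ ∧ ∀ x : Plane, V x ≤ C * Real.exp (γ * ‖x‖))

/-- `ε_a = (∫ |∇|u_a||²)^{-1/2}` for a family of minimizers. -/
def epsOf (u : ℝ → Plane → ℂ) (a : ℝ) : ℝ :=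
  (∫ x : Plane, gradAbsSq (u a) x) ^ (-(1 : ℝ) / 2)

/-- The rescaled family
`w_a(y) = ε_a u_a(ε_a y + x_a) e^{-i((ε_a Ω/2) y·x_a^⊥ - θ)}`. -/
def wfam (Ω : ℝ) (u : ℝ → Plane → ℂ) (xa : ℝ → Plane) (a θv : ℝ) (y : Plane) : ℂ :=
  ((epsOf u a : ℝ) : ℂ) * u a ((epsOf u a) • y + xa a) *
    Complex.exp (-Complex.I *
      ((((epsOf u a * Ω / 2) * (-(y 0) * (xa a 1) + (y 1) * (xa a 0)) - θv) : ℝ) : ℂ))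

/-- The limit profile `(1/√a*) Q(x/√a*)` where `a* = ‖Q‖₂²`. -/
def Qstar (Q : Plane → ℝ) (x : Plane) : ℝ :=
  (Real.sqrt (∫ y : Plane, (Q y) ^ 2))⁻¹ * Q ((Real.sqrt (∫ y : Plane, (Q y) ^ 2))⁻¹ • x)

/-! ### Real-valued functions on the plane -/

theorem plane_decomp (x : Plane) : x = x 0 • e0 + x 1 • e1 := by
  ext i; fin_cases i <;> simp [e0, e1]

theorem clm_apply_plane (L : Plane →L[ℝ] ℝ) (x : Plane) : L x = x 0 * L e0 + x 1 * L e1 := by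
  conv_lhs => rw [plane_decomp x]
  simp

theorem plane_norm_sq (x : Plane) : ‖x‖ ^ 2 = x 0 ^ 2 + x 1 ^ 2 := by
  rw [EuclideanSpace.norm_sq_eq]; simp [Fin.sum_univ_two]

theorem clm_norm_sq (L : Plane →L[ℝ] ℝ) : ‖L‖ ^ 2 = L e0 ^ 2 + L e1 ^ 2 := by
  apply le_antisymm
  · have h : ‖L‖ ≤ Real.sqrt (L e0 ^ 2 + L e1 ^ 2) := by
      refine L.opNorm_le_bound (Real.sqrt_nonneg _) fun x => ?_
      rw [← Real.sqrt_sq (norm_nonneg x), ← Real.sqrt_mul (by positivity), Real.norm_eq_abs]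
      apply Real.abs_le_sqrt
      rw [clm_apply_plane, plane_norm_sq]
      nlinarith [sq_nonneg (x 0 * L e1 - x 1 * L e0)]
    calc ‖L‖ ^ 2 ≤ Real.sqrt (L e0 ^ 2 + L e1 ^ 2) ^ 2 := by gcongr
      _ = _ := Real.sq_sqrt (by positivity)
  · by_cases h0 : L e0 ^ 2 + L e1 ^ 2 = 0
    · rw [h0]; positivity
    have hp : 0 < L e0 ^ 2 + L e1 ^ 2 := lt_of_le_of_ne (by positivity) (Ne.symm h0)
    have h := L.le_opNorm (L e0 • e0 + L e1 • e1)
    have hn : ‖L e0 • e0 + L e1 • e1‖ ^ 2 = L e0 ^ 2 + L e1 ^ 2 := by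
      rw [plane_norm_sq]; simp [e0, e1]
    have hv : L (L e0 • e0 + L e1 • e1) = L e0 ^ 2 + L e1 ^ 2 := by simp; ring
    rw [hv, Real.norm_eq_abs, abs_of_pos hp] at h
    have h2 : (L e0 ^ 2 + L e1 ^ 2) ^ 2 ≤ ‖L‖ ^ 2 * (L e0 ^ 2 + L e1 ^ 2) := by
      calc _ ≤ (‖L‖ * ‖L e0 • e0 + L e1 • e1‖) ^ 2 := by gcongr
        _ = _ := by rw [mul_pow, hn]
    nlinarith

theorem gradSqR_eq (f : Plane → ℝ) (x : Plane) : gradSqR f x = ‖fderiv ℝ f x‖ ^ 2 :=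
  (clm_norm_sq _).symm

theorem gradSqR_nonneg (f : Plane → ℝ) (x : Plane) : 0 ≤ gradSqR f x := by
  unfold gradSqR; positivity

theorem measurable_d0R (f : Plane → ℝ) : Measurable (d0R f) :=
  (measurable_fderiv_apply_const ℝ f e0)

theorem measurable_d1R (f : Plane → ℝ) : Measurable (d1R f) :=
  (measurable_fderiv_apply_const ℝ f e1)

theorem measurable_gradSqR (f : Plane → ℝ) : Measurable (gradSqR f) :=
  ((measurable_d0R f).pow_const 2).add ((measurable_d1R f).pow_const 2)

theorem Differentiable.meas {f : Plane → ℝ} (h : Differentiable ℝ f) : Measurable f :=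
  h.continuous.measurable

/-! ### Elementary integration lemmas -/

section IntegralTools
variable {X : Type*} [MeasurableSpace X] {μ : Measure X}

theorem integrable_mul_of_sq {f g : X → ℝ} (hfm : AEStronglyMeasurable f μ)
    (hgm : AEStronglyMeasurable g μ)
    (hf : Integrable (fun x => f x ^ 2) μ) (hg : Integrable (fun x => g x ^ 2) μ) :
    Integrable (fun x => f x * g x) μ := by
  refine (hf.add hg).mono' (hfm.mul hgm) (ae_of_all _ fun x => ?_)
  rw [Real.norm_eq_abs, abs_le]
  simp only [Pi.add_apply]
  constructor <;> nlinarith [sq_nonneg (f x + g x), sq_nonneg (f x - g x)]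

theorem integrable_sq_add {f g : X → ℝ} (hfm : AEStronglyMeasurable f μ)
    (hgm : AEStronglyMeasurable g μ)
    (hf : Integrable (fun x => f x ^ 2) μ) (hg : Integrable (fun x => g x ^ 2) μ) :
    Integrable (fun x => (f x + g x) ^ 2) μ := by
  have := (hf.add hg).add ((integrable_mul_of_sq hfm hgm hf hg).const_mul 2)
  refine this.congr (ae_of_all _ fun x => ?_)
  simp only [Pi.add_apply]; ring

theorem integrable_sq_sub {f g : X → ℝ} (hfm : AEStronglyMeasurable f μ)
    (hgm : AEStronglyMeasurable g μ)
    (hf : Integrable (fun x => f x ^ 2) μ) (hg : Integrable (fun x => g x ^ 2) μ) :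
    Integrable (fun x => (f x - g x) ^ 2) μ := by
  have := (hf.add hg).sub ((integrable_mul_of_sq hfm hgm hf hg).const_mul 2)
  refine this.congr (ae_of_all _ fun x => ?_)
  simp only [Pi.add_apply, Pi.sub_apply]; ring

theorem sq_integral_mul_le {f g : X → ℝ} (hfm : AEStronglyMeasurable f μ)
    (hgm : AEStronglyMeasurable g μ)
    (hf : Integrable (fun x => f x ^ 2) μ) (hg : Integrable (fun x => g x ^ 2) μ) :
    (∫ x, f x * g x ∂μ) ^ 2 ≤ (∫ x, f x ^ 2 ∂μ) * ∫ x, g x ^ 2 ∂μ := by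
  have hfg := integrable_mul_of_sq hfm hgm hf hg
  have key : ∀ t : ℝ, 0 ≤ (∫ x, g x ^ 2 ∂μ) * (t * t) + (2 * ∫ x, f x * g x ∂μ) * t
      + ∫ x, f x ^ 2 ∂μ := by
    intro t
    have h0 : 0 ≤ ∫ x, (f x + t * g x) ^ 2 ∂μ := integral_nonneg fun x => sq_nonneg _
    have : ∫ x, (f x + t * g x) ^ 2 ∂μ = ∫ x, (f x ^ 2 + (2 * t) * (f x * g x))
        + (t * t) * g x ^ 2 ∂μ := by congr 1; ext x; ring
    rw [this, integral_add (hf.fun_add (hfg.const_mul _)) (hg.const_mul _),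
      integral_add hf (hfg.const_mul _), integral_const_mul, integral_const_mul] at h0
    linarith
  have := discrim_le_zero key
  unfold discrim at this
  nlinarith

theorem abs_integral_mul_le {f g : X → ℝ} (hfm : AEStronglyMeasurable f μ)
    (hgm : AEStronglyMeasurable g μ)
    (hf : Integrable (fun x => f x ^ 2) μ) (hg : Integrable (fun x => g x ^ 2) μ) :
    |∫ x, f x * g x ∂μ| ≤ Real.sqrt (∫ x, f x ^ 2 ∂μ) * Real.sqrt (∫ x, g x ^ 2 ∂μ) := by
  rw [← Real.sqrt_mul (integral_nonneg fun x => sq_nonneg _)]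
  exact Real.abs_le_sqrt (sq_integral_mul_le hfm hgm hf hg)

theorem fatou_real {f : ℕ → X → ℝ} {g : X → ℝ} {C : ℝ}
    (hf : ∀ n, Integrable (f n) μ) (h0 : ∀ n, ∀ᵐ x ∂μ, 0 ≤ f n x)
    (hlim : ∀ᵐ x ∂μ, Tendsto (fun n => f n x) atTop (𝓝 (g x)))
    (hC : ∀ n, ∫ x, f n x ∂μ ≤ C) :
    Integrable g μ ∧ ∫ x, g x ∂μ ≤ C := by
  have hgm : AEStronglyMeasurable g μ :=
    aestronglyMeasurable_of_tendsto_ae atTop (fun n => (hf n).aestronglyMeasurable) hlim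
  have hg0 : 0 ≤ᵐ[μ] g := by
    filter_upwards [hlim, ae_all_iff.2 h0] with x hx h0x
    exact ge_of_tendsto' hx h0x
  have hC0 : 0 ≤ C := (integral_nonneg_of_ae (h0 0)).trans (hC 0)
  have hle : ∫⁻ x, ENNReal.ofReal (g x) ∂μ ≤ ENNReal.ofReal C := by
    calc ∫⁻ x, ENNReal.ofReal (g x) ∂μ
        = ∫⁻ x, liminf (fun n => ENNReal.ofReal (f n x)) atTop ∂μ := by
          apply lintegral_congr_ae
          filter_upwards [hlim] with x hx
          exact ((ENNReal.tendsto_ofReal hx).liminf_eq).symm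
      _ ≤ liminf (fun n => ∫⁻ x, ENNReal.ofReal (f n x) ∂μ) atTop :=
          lintegral_liminf_le' fun n => (hf n).aestronglyMeasurable.aemeasurable.ennreal_ofReal
      _ ≤ ENNReal.ofReal C := by
          refine Filter.liminf_le_of_le (by isBoundedDefault) fun b hb => ?_
          obtain ⟨n, hn⟩ := hb.exists
          refine hn.trans ?_
          rw [← ofReal_integral_eq_lintegral_ofReal (hf n) (h0 n)]
          exact ENNReal.ofReal_le_ofReal (hC n)
  have hgi : Integrable g μ := by
    refine ⟨hgm, ?_⟩
    rw [hasFiniteIntegral_iff_ofReal hg0]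
    exact hle.trans_lt ENNReal.ofReal_lt_top
  refine ⟨hgi, ?_⟩
  rw [← ofReal_integral_eq_lintegral_ofReal hgi hg0] at hle
  exact (ENNReal.ofReal_le_ofReal_iff hC0).1 hle

/-- Convergence of products of sequences converging in `L²`. -/
theorem tendsto_integral_mul {f g : ℕ → X → ℝ} {F G : X → ℝ}
    (hfm : ∀ n, AEStronglyMeasurable (f n) μ) (hgm : ∀ n, AEStronglyMeasurable (g n) μ)
    (hFm : AEStronglyMeasurable F μ) (hGm : AEStronglyMeasurable G μ)
    (hf : ∀ n, Integrable (fun x => f n x ^ 2) μ) (hg : ∀ n, Integrable (fun x => g n x ^ 2) μ)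
    (hF : Integrable (fun x => F x ^ 2) μ) (hG : Integrable (fun x => G x ^ 2) μ)
    (h1 : Tendsto (fun n => ∫ x, (f n x - F x) ^ 2 ∂μ) atTop (𝓝 0))
    (h2 : Tendsto (fun n => ∫ x, (g n x - G x) ^ 2 ∂μ) atTop (𝓝 0)) :
    Tendsto (fun n => ∫ x, f n x * g n x ∂μ) atTop (𝓝 (∫ x, F x * G x ∂μ)) := by
  have hdf := fun n => integrable_sq_sub (hfm n) hFm (hf n) hF
  have hdg := fun n => integrable_sq_sub (hgm n) hGm (hg n) hG
  have hdfm := fun n => (hfm n).sub hFm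
  have hdgm := fun n => (hgm n).sub hGm
  have key : ∀ n, ∫ x, f n x * g n x ∂μ = (∫ x, F x * G x ∂μ) + ((∫ x, (f n x - F x) * G x ∂μ) +
      ((∫ x, F x * (g n x - G x) ∂μ) + ∫ x, (f n x - F x) * (g n x - G x) ∂μ)) := by
    intro n
    have i1 := integrable_mul_of_sq hFm hGm hF hG
    have i2 := integrable_mul_of_sq (hdfm n) hGm (hdf n) hG
    have i3 := integrable_mul_of_sq hFm (hdgm n) hF (hdg n)
    have i4 := integrable_mul_of_sq (hdfm n) (hdgm n) (hdf n) (hdg n)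
    simp only [Pi.sub_apply] at i2 i3 i4
    rw [← integral_add i3 i4, ← integral_add i2 (i3.fun_add i4),
      ← integral_add i1 (i2.fun_add (i3.fun_add i4))]
    congr 1; ext x; ring
  have z1 : Tendsto (fun n => ∫ x, (f n x - F x) * G x ∂μ) atTop (𝓝 0) := by
    apply squeeze_zero_norm (a := fun n => Real.sqrt (∫ x, (f n x - F x) ^ 2 ∂μ) *
      Real.sqrt (∫ x, G x ^ 2 ∂μ))
    · exact fun n => abs_integral_mul_le (hdfm n) hGm (hdf n) hG
    · simpa using (h1.sqrt).mul_const (Real.sqrt (∫ x, G x ^ 2 ∂μ))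
  have z2 : Tendsto (fun n => ∫ x, F x * (g n x - G x) ∂μ) atTop (𝓝 0) := by
    apply squeeze_zero_norm (a := fun n => Real.sqrt (∫ x, F x ^ 2 ∂μ) *
      Real.sqrt (∫ x, (g n x - G x) ^ 2 ∂μ))
    · exact fun n => abs_integral_mul_le hFm (hdgm n) hF (hdg n)
    · simpa using (h2.sqrt).const_mul (Real.sqrt (∫ x, F x ^ 2 ∂μ))
  have z3 : Tendsto (fun n => ∫ x, (f n x - F x) * (g n x - G x) ∂μ) atTop (𝓝 0) := by
    apply squeeze_zero_norm (a := fun n => Real.sqrt (∫ x, (f n x - F x) ^ 2 ∂μ) *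
      Real.sqrt (∫ x, (g n x - G x) ^ 2 ∂μ))
    · exact fun n => abs_integral_mul_le (hdfm n) (hdgm n) (hdf n) (hdg n)
    · simpa using h1.sqrt.mul h2.sqrt
  simp_rw [key]
  simpa using tendsto_const_nhds.add (z1.add (z2.add z3))

theorem tendsto_integral_sq {f : ℕ → X → ℝ} {F : X → ℝ}
    (hfm : ∀ n, AEStronglyMeasurable (f n) μ) (hFm : AEStronglyMeasurable F μ)
    (hf : ∀ n, Integrable (fun x => f n x ^ 2) μ) (hF : Integrable (fun x => F x ^ 2) μ)
    (h1 : Tendsto (fun n => ∫ x, (f n x - F x) ^ 2 ∂μ) atTop (𝓝 0)) :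
    Tendsto (fun n => ∫ x, f n x ^ 2 ∂μ) atTop (𝓝 (∫ x, F x ^ 2 ∂μ)) := by
  simpa only [sq] using tendsto_integral_mul hfm hfm hFm hFm hf hf hF hF h1 h1

theorem integrable_pow_four_of_bdd {f : X → ℝ} {K : ℝ} (hfm : AEStronglyMeasurable f μ)
    (hf : Integrable (fun x => f x ^ 2) μ) (hK : ∀ x, |f x| ≤ K) :
    Integrable (fun x => f x ^ 4) μ := by
  refine (hf.const_mul (K ^ 2)).mono' (hfm.pow 4) (ae_of_all _ fun x => ?_)
  rw [Real.norm_eq_abs, abs_of_nonneg (by positivity)]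
  have : f x ^ 2 ≤ K ^ 2 := by rw [← sq_abs]; gcongr; exact hK x
  nlinarith [sq_nonneg (f x)]

theorem tendsto_integral_sq_sub_sq {f : ℕ → X → ℝ} {F : X → ℝ} {K : ℝ}
    (hfm : ∀ n, AEStronglyMeasurable (f n) μ) (hFm : AEStronglyMeasurable F μ)
    (hf : ∀ n, Integrable (fun x => f n x ^ 2) μ) (hF : Integrable (fun x => F x ^ 2) μ)
    (hK : ∀ n x, |f n x| ≤ K) (hFK : ∀ x, |F x| ≤ K)
    (h1 : Tendsto (fun n => ∫ x, (f n x - F x) ^ 2 ∂μ) atTop (𝓝 0)) :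
    Tendsto (fun n => ∫ x, (f n x ^ 2 - F x ^ 2) ^ 2 ∂μ) atTop (𝓝 0) := by
  have hb : ∀ n x, (f n x ^ 2 - F x ^ 2) ^ 2 ≤ (2 * K) ^ 2 * (f n x - F x) ^ 2 := by
    intro n x
    have : |f n x + F x| ≤ 2 * K := (abs_add_le _ _).trans (by linarith [hK n x, hFK x])
    have h2 : (f n x + F x) ^ 2 ≤ (2 * K) ^ 2 := by rw [← sq_abs]; gcongr
    calc _ = (f n x + F x) ^ 2 * (f n x - F x) ^ 2 := by ring
      _ ≤ _ := by gcongr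
  refine squeeze_zero (fun n => integral_nonneg fun x => sq_nonneg _) (fun n => ?_)
    (by simpa using h1.const_mul ((2 * K) ^ 2))
  rw [← integral_const_mul]
  exact integral_mono_of_nonneg (ae_of_all _ fun x => sq_nonneg _)
    ((integrable_sq_sub (hfm n) hFm (hf n) hF).const_mul _) (ae_of_all _ (hb n))

theorem tendsto_integral_pow_four {f : ℕ → X → ℝ} {F : X → ℝ} {K : ℝ}
    (hfm : ∀ n, AEStronglyMeasurable (f n) μ) (hFm : AEStronglyMeasurable F μ)
    (hf : ∀ n, Integrable (fun x => f n x ^ 2) μ) (hF : Integrable (fun x => F x ^ 2) μ)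
    (hK : ∀ n x, |f n x| ≤ K) (hFK : ∀ x, |F x| ≤ K)
    (h1 : Tendsto (fun n => ∫ x, (f n x - F x) ^ 2 ∂μ) atTop (𝓝 0)) :
    Tendsto (fun n => ∫ x, f n x ^ 4 ∂μ) atTop (𝓝 (∫ x, F x ^ 4 ∂μ)) := by
  have e : ∀ y : ℝ, y ^ 4 = (y ^ 2) ^ 2 := fun y => by ring
  simp_rw [e]
  refine tendsto_integral_sq (fun n => (hfm n).pow 2) (hFm.pow 2) (fun n => ?_) ?_
    (tendsto_integral_sq_sub_sq hfm hFm hf hF hK hFK h1)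
  · simpa only [Pi.pow_apply, e] using integrable_pow_four_of_bdd (hfm n) (hf n) (hK n)
  · simpa only [Pi.pow_apply, e] using integrable_pow_four_of_bdd hFm hF hFK

end IntegralTools

/-- Differentiable real functions of class `H¹`. -/
def H1R (f : Plane → ℝ) : Prop :=
  Differentiable ℝ f ∧ Integrable (fun x => f x ^ 2) ∧ Integrable (gradSqR f)

theorem H1R.d0 {f : Plane → ℝ} (h : H1R f) : Integrable (fun x => d0R f x ^ 2) :=
  h.2.2.mono' ((measurable_d0R f).pow_const 2).aestronglyMeasurable (ae_of_all _ fun x => by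
    rw [Real.norm_eq_abs, abs_of_nonneg (by positivity)]
    unfold gradSqR; nlinarith [sq_nonneg (d1R f x)])

theorem H1R.d1 {f : Plane → ℝ} (h : H1R f) : Integrable (fun x => d1R f x ^ 2) :=
  h.2.2.mono' ((measurable_d1R f).pow_const 2).aestronglyMeasurable (ae_of_all _ fun x => by
    rw [Real.norm_eq_abs, abs_of_nonneg (by positivity)]
    unfold gradSqR; nlinarith [sq_nonneg (d0R f x)])

theorem d0R_add {f g : Plane → ℝ} {x : Plane} (hf : DifferentiableAt ℝ f x)
    (hg : DifferentiableAt ℝ g x) : d0R (fun y => f y + g y) x = d0R f x + d0R g x := by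
  simp [d0R, fderiv_fun_add hf hg]

theorem d1R_add {f g : Plane → ℝ} {x : Plane} (hf : DifferentiableAt ℝ f x)
    (hg : DifferentiableAt ℝ g x) : d1R (fun y => f y + g y) x = d1R f x + d1R g x := by
  simp [d1R, fderiv_fun_add hf hg]

theorem d0R_mul {f g : Plane → ℝ} {x : Plane} (hf : DifferentiableAt ℝ f x)
    (hg : DifferentiableAt ℝ g x) :
    d0R (fun y => f y * g y) x = f x * d0R g x + g x * d0R f x := by
  simp [d0R, fderiv_fun_mul hf hg]

theorem d1R_mul {f g : Plane → ℝ} {x : Plane} (hf : DifferentiableAt ℝ f x)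
    (hg : DifferentiableAt ℝ g x) :
    d1R (fun y => f y * g y) x = f x * d1R g x + g x * d1R f x := by
  simp [d1R, fderiv_fun_mul hf hg]

theorem d0R_const_mul (c : ℝ) {f : Plane → ℝ} {x : Plane} (hf : DifferentiableAt ℝ f x) :
    d0R (fun y => c * f y) x = c * d0R f x := by
  simp [d0R, fderiv_const_mul hf]

theorem d1R_const_mul (c : ℝ) {f : Plane → ℝ} {x : Plane} (hf : DifferentiableAt ℝ f x) :
    d1R (fun y => c * f y) x = c * d1R f x := by
  simp [d1R, fderiv_const_mul hf]

theorem d0R_comp {k : ℝ → ℝ} {f : Plane → ℝ} {x : Plane} {k' : ℝ} (hk : HasDerivAt k k' (f x))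
    (hf : DifferentiableAt ℝ f x) : d0R (fun y => k (f y)) x = k' * d0R f x := by
  have := (hk.comp_hasFDerivAt x hf.hasFDerivAt).fderiv
  simp only [d0R]
  rw [show (fun y => k (f y)) = k ∘ f from rfl, this]; simp

theorem d1R_comp {k : ℝ → ℝ} {f : Plane → ℝ} {x : Plane} {k' : ℝ} (hk : HasDerivAt k k' (f x))
    (hf : DifferentiableAt ℝ f x) : d1R (fun y => k (f y)) x = k' * d1R f x := by
  have := (hk.comp_hasFDerivAt x hf.hasFDerivAt).fderiv
  simp only [d1R]
  rw [show (fun y => k (f y)) = k ∘ f from rfl, this]; simp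

theorem gradSqR_add {f g : Plane → ℝ} {x : Plane} (hf : DifferentiableAt ℝ f x)
    (hg : DifferentiableAt ℝ g x) : gradSqR (fun y => f y + g y) x =
      gradSqR f x + gradSqR g x + 2 * (d0R f x * d0R g x + d1R f x * d1R g x) := by
  simp only [gradSqR, d0R_add hf hg, d1R_add hf hg]; ring

theorem gradSqR_const_mul (c : ℝ) {f : Plane → ℝ} {x : Plane} (hf : DifferentiableAt ℝ f x) :
    gradSqR (fun y => c * f y) x = c ^ 2 * gradSqR f x := by
  simp only [gradSqR, d0R_const_mul c hf, d1R_const_mul c hf]; ring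

theorem gradSqR_comp {k : ℝ → ℝ} {f : Plane → ℝ} {x : Plane} {k' : ℝ}
    (hk : HasDerivAt k k' (f x)) (hf : DifferentiableAt ℝ f x) :
    gradSqR (fun y => k (f y)) x = k' ^ 2 * gradSqR f x := by
  simp only [gradSqR, d0R_comp hk hf, d1R_comp hk hf]; ring

theorem H1R.grad_inner {f g : Plane → ℝ} (hf : H1R f) (hg : H1R g) :
    Integrable (fun x => d0R f x * d0R g x + d1R f x * d1R g x) :=
  (integrable_mul_of_sq (measurable_d0R f).aestronglyMeasurable
    (measurable_d0R g).aestronglyMeasurable hf.d0 hg.d0).add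
  (integrable_mul_of_sq (measurable_d1R f).aestronglyMeasurable
    (measurable_d1R g).aestronglyMeasurable hf.d1 hg.d1)

theorem H1R.add {f g : Plane → ℝ} (hf : H1R f) (hg : H1R g) : H1R (fun x => f x + g x) := by
  refine ⟨hf.1.add hg.1, integrable_sq_add hf.1.meas.aestronglyMeasurable
    hg.1.meas.aestronglyMeasurable hf.2.1 hg.2.1, ?_⟩
  refine ((hf.2.2.add hg.2.2).add ((hf.grad_inner hg).const_mul 2)).congr (ae_of_all _ fun x => ?_)
  rw [gradSqR_add (hf.1 x) (hg.1 x)]; rfl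

theorem H1R.integral_gradSqR_add {f g : Plane → ℝ} (hf : H1R f) (hg : H1R g) :
    ∫ x, gradSqR (fun y => f y + g y) x = (∫ x, gradSqR f x) + (∫ x, gradSqR g x) +
      2 * ∫ x, (d0R f x * d0R g x + d1R f x * d1R g x) := by
  rw [← integral_const_mul, ← integral_add hf.2.2 hg.2.2,
    ← integral_add (hf.2.2.fun_add hg.2.2) ((hf.grad_inner hg).const_mul 2)]
  exact integral_congr_ae (ae_of_all _ fun x => gradSqR_add (hf.1 x) (hg.1 x))

theorem H1R.const_mul {f : Plane → ℝ} (hf : H1R f) (c : ℝ) : H1R (fun x => c * f x) := by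
  refine ⟨hf.1.const_mul c, ?_, ?_⟩
  · simpa only [mul_pow] using hf.2.1.const_mul (c ^ 2)
  · exact (hf.2.2.const_mul (c ^ 2)).congr
      (ae_of_all _ fun x => (gradSqR_const_mul c (hf.1 x)).symm)

theorem H1R.integral_gradSqR_const_mul {f : Plane → ℝ} (hf : H1R f) (c : ℝ) :
    ∫ x, gradSqR (fun y => c * f y) x = c ^ 2 * ∫ x, gradSqR f x := by
  rw [← integral_const_mul]
  exact integral_congr_ae (ae_of_all _ fun x => gradSqR_const_mul c (hf.1 x))

/-- Product with a bounded differentiable function with bounded gradient. -/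
theorem H1R.bdd_mul {f χ : Plane → ℝ} (hf : H1R f) (hχ : Differentiable ℝ χ) {B D : ℝ}
    (hB : ∀ x, |χ x| ≤ B) (hD : ∀ x, gradSqR χ x ≤ D) : H1R (fun x => χ x * f x) := by
  have hd := hχ.mul hf.1
  have hB2 : ∀ x, χ x ^ 2 ≤ B ^ 2 := fun x => by rw [← sq_abs]; gcongr; exact hB x
  refine ⟨hd, ?_, ?_⟩
  · refine (hf.2.1.const_mul (B ^ 2)).mono' ((hd.meas.pow_const 2).aestronglyMeasurable)
      (ae_of_all _ fun x => ?_)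
    rw [Real.norm_eq_abs, abs_of_nonneg (by positivity), mul_pow]
    exact mul_le_mul_of_nonneg_right (hB2 x) (sq_nonneg _)
  · refine ((hf.2.2.const_mul (2 * B ^ 2)).add (hf.2.1.const_mul (2 * D))).mono'
      (measurable_gradSqR _).aestronglyMeasurable (ae_of_all _ fun x => ?_)
    rw [Real.norm_eq_abs, abs_of_nonneg (gradSqR_nonneg _ _)]
    have h1 : gradSqR (fun x => χ x * f x) x ≤ 2 * (χ x ^ 2 * gradSqR f x) +
        2 * (gradSqR χ x * f x ^ 2) := by
      simp only [gradSqR, d0R_mul (hχ x) (hf.1 x), d1R_mul (hχ x) (hf.1 x)]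
      nlinarith [sq_nonneg (χ x * d0R f x - f x * d0R χ x),
        sq_nonneg (χ x * d1R f x - f x * d1R χ x)]
    refine h1.trans ?_
    simp only [Pi.add_apply]
    have := mul_le_mul_of_nonneg_right (hB2 x) (gradSqR_nonneg f x)
    have := mul_le_mul_of_nonneg_right (hD x) (sq_nonneg (f x))
    linarith

/-- Integral of the square of the gradient: dominated by composition with a `1`-Lipschitz map. -/
theorem H1R.comp {f : Plane → ℝ} (hf : H1R f) {k k' : ℝ → ℝ} (hk : ∀ z, HasDerivAt k (k' z) z)
    (h1 : ∀ z, |k z| ≤ |z|) (h2 : ∀ z, |k' z| ≤ 1) :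
    H1R (fun x => k (f x)) ∧ ∀ x, gradSqR (fun y => k (f y)) x ≤ gradSqR f x := by
  have hd : Differentiable ℝ (fun x => k (f x)) := fun x =>
    (hk (f x)).differentiableAt.comp x (hf.1 x)
  have hle : ∀ x, gradSqR (fun y => k (f y)) x ≤ gradSqR f x := fun x => by
    rw [gradSqR_comp (hk _) (hf.1 x)]
    have : k' (f x) ^ 2 ≤ 1 := by rw [← sq_abs]; nlinarith [h2 (f x), abs_nonneg (k' (f x))]
    nlinarith [gradSqR_nonneg f x]
  refine ⟨⟨hd, ?_, ?_⟩, hle⟩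
  · refine hf.2.1.mono' (hd.meas.pow_const 2).aestronglyMeasurable (ae_of_all _ fun x => ?_)
    rw [Real.norm_eq_abs, abs_of_nonneg (by positivity)]
    exact sq_le_sq.2 (h1 _)
  · refine hf.2.2.mono' (measurable_gradSqR _).aestronglyMeasurable (ae_of_all _ fun x => ?_)
    rw [Real.norm_eq_abs, abs_of_nonneg (gradSqR_nonneg _ _)]
    exact hle x

/-- The Gagliardo–Nirenberg inequality with constant `2 / s`. -/
def GNIneq (s : ℝ) : Prop := ∀ f : Plane → ℝ, H1R f → Integrable (fun x => f x ^ 4) ∧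
  ∫ x, f x ^ 4 ≤ 2 / s * (∫ x, gradSqR f x) * ∫ x, f x ^ 2

/-! ### The radial ordinary differential equation -/

/-- Positive radial finite-energy profiles solving `g'' + g'/r = l g - g³`, with `p = g'`. -/
structure RadSol (l : ℝ) (g p : ℝ → ℝ) : Prop where
  zero_pos : 0 < g 0
  pos : ∀ r, 0 < r → 0 < g r
  dg : ∀ r, 0 < r → HasDerivAt g (p r) r
  dp : ∀ r, 0 < r → HasDerivAt p (-p r / r + l * g r - g r ^ 3) r
  g0 : Tendsto g (𝓝[>] 0) (𝓝 (g 0))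
  p0 : Tendsto p (𝓝[>] 0) (𝓝 0)
  ig : IntegrableOn (fun r => r * g r ^ 2) (Ioi 0)
  ip : IntegrableOn (fun r => r * p r ^ 2) (Ioi 0)

theorem strictMonoOn_of_hasDerivAt {f f' : ℝ → ℝ} {D : Set ℝ} (hD : Convex ℝ D) (ho : IsOpen D)
    (h : ∀ r ∈ D, HasDerivAt f (f' r) r) (h0 : ∀ r ∈ D, 0 < f' r) : StrictMonoOn f D := by
  apply strictMonoOn_of_deriv_pos hD
  · exact fun r hr => (h r hr).continuousAt.continuousWithinAt
  · intro r hr; rw [ho.interior_eq] at hr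
    rw [(h r hr).deriv]; exact h0 r hr

theorem monotoneOn_of_hasDerivAt {f f' : ℝ → ℝ} {D : Set ℝ} (hD : Convex ℝ D) (ho : IsOpen D)
    (h : ∀ r ∈ D, HasDerivAt f (f' r) r) (h0 : ∀ r ∈ D, 0 ≤ f' r) : MonotoneOn f D := by
  apply monotoneOn_of_deriv_nonneg hD
  · exact fun r hr => (h r hr).continuousAt.continuousWithinAt
  · exact fun r hr => (h r (interior_subset hr)).differentiableAt.differentiableWithinAt
  · intro r hr; rw [ho.interior_eq] at hr
    rw [(h r hr).deriv]; exact h0 r hr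

theorem antitoneOn_of_hasDerivAt {f f' : ℝ → ℝ} {D : Set ℝ} (hD : Convex ℝ D) (ho : IsOpen D)
    (h : ∀ r ∈ D, HasDerivAt f (f' r) r) (h0 : ∀ r ∈ D, f' r ≤ 0) : AntitoneOn f D := by
  have := (monotoneOn_of_hasDerivAt hD ho (fun r hr => (h r hr).neg)
    (fun r hr => neg_nonneg.2 (h0 r hr))).neg
  simpa using this

theorem strictMonoOn_gt_limit {f : ℝ → ℝ} {b c r : ℝ} (hm : StrictMonoOn f (Ioo 0 b))
    (h0 : Tendsto f (𝓝[>] 0) (𝓝 c)) (hr : r ∈ Ioo 0 b) : c < f r := by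
  have h1 : c ≤ f (r / 2) := by
    refine le_of_tendsto h0 ?_
    have : Ioo (0 : ℝ) (r / 2) ∈ 𝓝[>] (0 : ℝ) := Ioo_mem_nhdsGT (by linarith [hr.1])
    filter_upwards [this] with s hs
    exact hm.monotoneOn ⟨hs.1, by linarith [hs.2, hr.2, hr.1]⟩
      ⟨by linarith [hr.1], by linarith [hr.2, hr.1]⟩ hs.2.le
  exact h1.trans_lt (hm ⟨by linarith [hr.1], by linarith [hr.2, hr.1]⟩ hr (by linarith [hr.1]))

theorem antitoneOn_le_limit {f : ℝ → ℝ} {b c r : ℝ} (hm : AntitoneOn f (Ioo 0 b))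
    (h0 : Tendsto f (𝓝[>] 0) (𝓝 c)) (hr : r ∈ Ioo 0 b) : f r ≤ c := by
  refine ge_of_tendsto h0 ?_
  filter_upwards [Ioo_mem_nhdsGT hr.1] with s hs
  exact hm ⟨hs.1, hs.2.trans hr.2⟩ hr hs.2.le

/-- An integrable nonnegative function on the half-line is `o(1/r)` along a sequence. -/
theorem exists_small_of_integrableOn {F : ℝ → ℝ} (hF : IntegrableOn F (Ioi 0)) {e : ℝ}
    (he : 0 < e) (R : ℝ) : ∃ r, R < r ∧ 1 < r ∧ r * F r < e := by
  by_contra! hcon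
  set R' := max R 1
  have h1 : IntegrableOn F (Ioi R') :=
    hF.mono_set (Ioi_subset_Ioi (zero_le_one.trans (le_max_right _ _)))
  have h2 : IntegrableOn (fun r : ℝ => r⁻¹) (Ioi R') := by
    refine (h1.const_mul e⁻¹).mono' measurable_inv.aestronglyMeasurable ?_
    filter_upwards [self_mem_ae_restrict measurableSet_Ioi] with r hr
    have hr1 : 1 < r := (le_max_right _ _).trans_lt hr
    have := hcon r ((le_max_left _ _).trans_lt hr) hr1
    rw [Real.norm_eq_abs, abs_of_pos (by positivity), ← div_eq_inv_mul, le_div_iff₀ he,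
      inv_mul_le_iff₀ (by positivity)]
    exact this
  exact not_integrableOn_Ioi_inv h2

namespace RadSol
variable {l : ℝ} {g p : ℝ → ℝ}

theorem exists_small (h : RadSol l g p) {e : ℝ} (he : 0 < e) (R : ℝ) :
    ∃ r, R < r ∧ 1 < r ∧ r ^ 2 * (g r ^ 2 + p r ^ 2) < e := by
  obtain ⟨r, h1, h2, h3⟩ := exists_small_of_integrableOn (h.ig.add h.ip) he R
  refine ⟨r, h1, h2, ?_⟩
  simp only [Pi.add_apply] at h3
  nlinarith

def weight (r : ℝ) : ℝ := Real.exp (Real.log r / 3)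

theorem weight_deriv {r : ℝ} (hr : 0 < r) : HasDerivAt weight (weight r / (3 * r)) r := by
  have := ((Real.hasDerivAt_log hr.ne').div_const 3).exp
  refine this.congr_deriv ?_
  unfold weight; field_simp

def J (l : ℝ) (g p : ℝ → ℝ) (r : ℝ) : ℝ :=
  weight r * (1 / 2 * r * p r ^ 2 + 1 / 3 * (g r * p r) + g r ^ 2 / (9 * r)
    - 1 / 2 * l * r * g r ^ 2 + 1 / 4 * r * g r ^ 4)

theorem J_deriv (h : RadSol l g p) {r : ℝ} (hr : 0 < r) :
    HasDerivAt (J l g p) (-(weight r * (l / 3 + 2 / (27 * r ^ 2)) * g r ^ 2)) r := by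
  have hg := h.dg r hr
  have hp := h.dp r hr
  have hid := hasDerivAt_id' r
  have h1 := ((hid.const_mul (1 / 2)).mul (hp.pow 2))
  have h2 := ((hg.mul hp).const_mul (1 / 3))
  have h3 := ((hg.pow 2).div (hid.const_mul 9) (by positivity))
  have h4 := ((hid.const_mul (1 / 2 * l)).mul (hg.pow 2))
  have h5 := ((hid.const_mul (1 / 4)).mul (hg.pow 4))
  have := (weight_deriv hr).mul ((((h1.add h2).add h3).sub h4).add h5)
  refine this.congr_deriv ?_
  simp only [Pi.add_apply, Pi.sub_apply, Pi.mul_apply, Pi.div_apply, Pi.pow_apply]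
  field_simp
  ring

theorem weight_pos (r : ℝ) : 0 < weight r := Real.exp_pos _

theorem weight_le {r : ℝ} (hr : 1 ≤ r) : weight r ≤ r := by
  unfold weight
  conv_rhs => rw [← Real.exp_log (by linarith : 0 < r)]
  have := Real.log_nonneg hr
  exact Real.exp_le_exp.2 (by linarith)

theorem J_anti (hl : 0 < l) (h : RadSol l g p) : StrictAntiOn (J l g p) (Ioi 0) := by
  have := (strictMonoOn_of_hasDerivAt (convex_Ioi 0) isOpen_Ioi
    (fun r hr => (h.J_deriv hr).neg) (fun r hr => ?_)).neg
  · simpa using this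
  · have := h.pos r hr
    have := weight_pos r
    have : 0 < r := hr
    rw [neg_neg]; positivity

theorem J_small (hl : 0 < l) (h : RadSol l g p) {e : ℝ} (he : 0 < e) (R : ℝ) :
    ∃ r, R < r ∧ 1 < r ∧ |J l g p r| < e := by
  have hc : 0 < 2 + l := by linarith
  obtain ⟨r, h1, h2, h3⟩ := h.exists_small (e := min 1 (e / (2 + l)))
    (lt_min one_pos (by positivity)) R
  refine ⟨r, h1, h2, ?_⟩
  set s := r ^ 2 * (g r ^ 2 + p r ^ 2) with hs
  have hs1 : s < 1 := h3.trans_le (min_le_left _ _)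
  have hs2 : s * (2 + l) < e := by
    rw [← lt_div_iff₀ hc]; exact h3.trans_le (min_le_right _ _)
  have hr : 0 < r := by linarith
  have hw := weight_pos r
  have hwr := weight_le h2.le
  set X := 1 / 2 * r * p r ^ 2 + 1 / 3 * (g r * p r) + g r ^ 2 / (9 * r)
    - 1 / 2 * l * r * g r ^ 2 + 1 / 4 * r * g r ^ 4 with hX
  have hg2 : r ^ 2 * g r ^ 2 ≤ s := by rw [hs]; nlinarith [sq_nonneg (r * p r)]
  have hp2 : r ^ 2 * p r ^ 2 ≤ s := by rw [hs]; nlinarith [sq_nonneg (r * g r)]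
  have hr2 : 1 ≤ r ^ 2 := by nlinarith
  have hg1 : g r ^ 2 ≤ s := by
    linarith [mul_nonneg (sub_nonneg.2 hr2) (sq_nonneg (g r))]
  have hp1 : p r ^ 2 ≤ r ^ 2 * p r ^ 2 := by
    linarith [mul_nonneg (sub_nonneg.2 hr2) (sq_nonneg (p r))]
  have hrX : |r * X| ≤ s * (2 + l) := by
    have e : r * X = 1 / 2 * (r ^ 2 * p r ^ 2) + 1 / 3 * (r * (g r * p r)) + g r ^ 2 / 9
      - 1 / 2 * l * (r ^ 2 * g r ^ 2) + 1 / 4 * (r ^ 2 * g r ^ 2) * g r ^ 2 := by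
      rw [hX]; field_simp
    have hs0 : 0 ≤ s := by rw [hs]; positivity
    have c1 : |r * (g r * p r)| ≤ s := by
      rw [abs_le]
      have q1 := sq_nonneg (r * g r + p r)
      have q2 := sq_nonneg (r * g r - p r)
      have q3 : s = r ^ 2 * g r ^ 2 + r ^ 2 * p r ^ 2 := by rw [hs]; ring
      constructor <;> linarith
    have c2 : (r ^ 2 * g r ^ 2) * g r ^ 2 ≤ s := by
      calc _ ≤ s * 1 := mul_le_mul hg2 (hg1.trans hs1.le) (sq_nonneg _) hs0
        _ = s := mul_one s
    have c3 : l * (r ^ 2 * g r ^ 2) ≤ l * s := by gcongr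
    have c4 : 0 ≤ l * (r ^ 2 * g r ^ 2) := by positivity
    have c5 : 0 ≤ r ^ 2 * g r ^ 2 * g r ^ 2 := by positivity
    have c6 : 0 ≤ r ^ 2 * p r ^ 2 := by positivity
    have c7 := mul_nonneg hl.le hs0
    have c8 := sq_nonneg (g r)
    have c9 : s * (2 + l) = 2 * s + l * s := by ring
    rw [abs_le] at c1 ⊢
    rw [e, c9]
    obtain ⟨c10, c11⟩ := c1
    clear_value s X
    constructor <;> linarith
  calc |J l g p r| = weight r * |X| := by rw [J, ← hX, abs_mul, abs_of_pos hw]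
    _ ≤ r * |X| := by gcongr
    _ = |r * X| := by rw [abs_mul, abs_of_pos hr]
    _ < e := hrX.trans_lt hs2

theorem J_pos (hl : 0 < l) (h : RadSol l g p) {r : ℝ} (hr : 0 < r) : 0 < J l g p r := by
  by_contra! hcon
  have h1 : J l g p (r + 1) < 0 :=
    (h.J_anti hl hr (by simp; linarith : r + 1 ∈ Ioi (0 : ℝ)) (by linarith)).trans_le hcon
  obtain ⟨s, hs1, hs2, hs3⟩ := h.J_small hl (neg_pos.2 h1) (r + 1)
  have h2 := h.J_anti hl (by simp; linarith : r + 1 ∈ Ioi (0 : ℝ))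
    (by simp; linarith : s ∈ Ioi (0 : ℝ)) hs1
  rw [abs_lt] at hs3
  linarith [hs3.1]

section Uniqueness
variable {h q : ℝ → ℝ}

theorem not_gt (hl : 0 < l) (hu : RadSol l g p) (hv : RadSol l h q) : ¬ h 0 < g 0 := by
  intro h0
  set T : ℝ → ℝ := fun r => r * (g r * q r - h r * p r) with hT
  set w : ℝ → ℝ := fun r => h r / g r with hw
  set Y : ℝ → ℝ := fun r => J l g p r - J l h q r / w r ^ 2 with hY
  have dT : ∀ r, 0 < r → HasDerivAt T (r * g r * h r * (g r ^ 2 - h r ^ 2)) r := by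
    intro r hr
    refine ((hasDerivAt_id' r).mul (((hu.dg r hr).mul (hv.dp r hr)).sub
      ((hv.dg r hr).mul (hu.dp r hr)))).congr_deriv ?_
    simp only [Pi.sub_apply, Pi.mul_apply]
    field_simp; ring
  have dw : ∀ r, 0 < r → HasDerivAt w (T r / (r * g r ^ 2)) r := by
    intro r hr
    have := (hu.pos r hr).ne'
    refine ((hv.dg r hr).div (hu.dg r hr) this).congr_deriv ?_
    simp only [hT]; field_simp
  have wpos : ∀ r, 0 < r → 0 < w r := fun r hr => div_pos (hv.pos r hr) (hu.pos r hr)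
  have dY : ∀ r, 0 < r →
      HasDerivAt Y (2 * (T r / (r * g r ^ 2)) * (w r)⁻¹ ^ 3 * J l h q r) r := by
    intro r hr
    have hgr := (hu.pos r hr).ne'
    have hhr := (hv.pos r hr).ne'
    refine ((hu.J_deriv hr).sub ((hv.J_deriv hr).div ((dw r hr).pow 2)
      (pow_ne_zero 2 (wpos r hr).ne'))).congr_deriv ?_
    have hwr := (wpos r hr).ne'
    have e : h r = w r * g r := by simp only [hw]; field_simp
    simp only [Pi.pow_apply]
    rw [e]
    generalize J l h q r = j
    generalize T r = t
    generalize w r = z at hwr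
    field_simp; ring
  have Yeq : ∀ r, 0 < r → Y r = weight r * (1 / 2 * r * (p r ^ 2 - q r ^ 2 * (g r / h r) ^ 2)
      + 1 / 3 * g r * (p r - q r * (g r / h r)) + 1 / 4 * r * g r ^ 2 * (g r ^ 2 - h r ^ 2)) := by
    intro r hr
    have hgr := (hu.pos r hr).ne'
    have hhr := (hv.pos r hr).ne'
    simp only [hY, J, hw]
    field_simp; ring
  have lid : Tendsto (fun r : ℝ => r) (𝓝[>] 0) (𝓝 0) :=
      tendsto_nhdsWithin_of_tendsto_nhds tendsto_id
  have limT : Tendsto T (𝓝[>] 0) (𝓝 0) := by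
    simpa using lid.mul ((hu.g0.mul hv.p0).sub (hv.g0.mul hu.p0))
  have limw : Tendsto weight (𝓝[>] 0) (𝓝 0) := by
    unfold weight
    refine Real.tendsto_exp_atBot.comp ?_
    exact Real.tendsto_log_nhdsGT_zero.atBot_div_const (by norm_num)
  have limY : Tendsto Y (𝓝[>] 0) (𝓝 0) := by
    have hr := hu.g0.div hv.g0 hv.zero_pos.ne'
    have := limw.mul ((((lid.const_mul (1 / 2)).mul ((hu.p0.pow 2).sub
      ((hv.p0.pow 2).mul (hr.pow 2)))).add ((hu.g0.const_mul (1 / 3)).mul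
      (hu.p0.sub (hv.p0.mul hr)))).add (((lid.const_mul (1 / 4)).mul (hu.g0.pow 2)).mul
      ((hu.g0.pow 2).sub (hv.g0.pow 2))))
    rw [zero_mul] at this
    refine this.congr' ?_
    filter_upwards [self_mem_nhdsWithin] with r hr
    rw [Yeq r hr]; rfl
  have gtT : ∀ b, (∀ r ∈ Ioo 0 b, h r < g r) → ∀ r ∈ Ioo 0 b, 0 < T r := by
    intro b hb r hr
    refine strictMonoOn_gt_limit (strictMonoOn_of_hasDerivAt (convex_Ioo 0 b) isOpen_Ioo
      (fun s hs => dT s hs.1) (fun s hs => ?_)) limT hr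
    have h1 := hu.pos s hs.1
    have h2 := hv.pos s hs.1
    have h3 := hb s hs
    have h4 : 0 < g s ^ 2 - h s ^ 2 := by nlinarith
    have := hs.1
    positivity
  have posY : ∀ b, (∀ r ∈ Ioo 0 b, 0 < T r) → StrictMonoOn Y (Ioo 0 b) := by
    intro b hb
    refine strictMonoOn_of_hasDerivAt (convex_Ioo 0 b) isOpen_Ioo
      (fun s hs => dY s hs.1) (fun s hs => ?_)
    have h1 := hu.pos s hs.1
    have h2 := wpos s hs.1
    have h3 := hb s hs
    have h4 := hv.J_pos hl hs.1
    have := hs.1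
    positivity
  have Tpos : ∀ r, 0 < r → 0 < T r := by
    by_contra! hcon
    obtain ⟨r2, hr2, hTr2⟩ := hcon
    obtain ⟨d, hd0, hd⟩ : ∃ d, 0 < d ∧ ∀ r ∈ Ioo 0 d, h r < g r := by
      have := hv.g0.eventually_lt hu.g0 h0
      obtain ⟨d, hd, hd'⟩ := mem_nhdsGT_iff_exists_Ioo_subset.1 this
      exact ⟨d, hd, fun r hr => hd' hr⟩
    have hTd := gtT d hd
    set S : Set ℝ := {r | d / 2 ≤ r ∧ T r ≤ 0} with hS
    have hSne : S.Nonempty := ⟨r2, by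
      by_contra! hc
      exact absurd (hTd r2 ⟨hr2, by linarith⟩) (not_lt.2 hTr2), hTr2⟩
    have hSbd : BddBelow S := ⟨d / 2, fun r hr => hr.1⟩
    set r1 := sInf S with hr1
    have hr1d : d / 2 ≤ r1 := le_csInf hSne fun r hr => hr.1
    have hr10 : 0 < r1 := by linarith
    have hT1 : T r1 ≤ 0 := by
      obtain ⟨s, hs, hs1, hs2⟩ := exists_seq_tendsto_sInf hSne hSbd
      exact le_of_tendsto' (((dT r1 hr10).continuousAt.tendsto).comp hs1) fun n => (hs2 n).2
    have hTlt : ∀ r ∈ Ioo 0 r1, 0 < T r := by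
      intro r hr
      by_contra! hc
      by_cases hrd : r < d / 2
      · exact absurd (hTd r ⟨hr.1, by linarith⟩) (not_lt.2 hc)
      · exact absurd (csInf_le hSbd ⟨not_lt.1 hrd, hc⟩) (not_le.2 hr.2)
    have hT10 : T r1 = 0 := by
      refine le_antisymm hT1 ?_
      have := (dT r1 hr10).continuousAt.continuousWithinAt (s := Iio r1)
      refine ge_of_tendsto this ?_
      filter_upwards [Ioo_mem_nhdsLT hr10] with r hr using (hTlt r hr).le
    have hYm := posY r1 hTlt
    have hY1 : 0 < Y r1 := by
      have hh : 0 < Y (r1 / 2) :=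
        strictMonoOn_gt_limit hYm limY ⟨by linarith, by linarith⟩
      refine hh.trans_le ?_
      have := (dY r1 hr10).continuousAt.continuousWithinAt (s := Iio r1)
      refine ge_of_tendsto this ?_
      filter_upwards [Ioo_mem_nhdsLT (by linarith : r1 / 2 < r1)] with r hr
      exact hYm.monotoneOn ⟨by linarith, by linarith⟩ ⟨by linarith [hr.1], hr.2⟩ hr.1.le
    have hgp := hu.pos r1 hr10
    have hhp := hv.pos r1 hr10
    have hq : q r1 * (g r1 / h r1) = p r1 := by
      have : g r1 * q r1 - h r1 * p r1 = 0 := by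
        rcases mul_eq_zero.1 hT10 with h | h
        · exact absurd h hr10.ne'
        · exact h
      field_simp; linarith
    rw [Yeq r1 hr10, ← mul_pow, hq, sub_self, sub_self, mul_zero, mul_zero, zero_add, zero_add]
      at hY1
    have hlt : h r1 < g r1 := by
      by_contra! hc
      have h1 : g r1 ^ 2 - h r1 ^ 2 ≤ 0 := by nlinarith
      have h2 : 0 ≤ weight r1 * (1 / 4 * r1 * g r1 ^ 2) := by
        have := weight_pos r1; positivity
      have h3 := mul_nonpos_of_nonneg_of_nonpos h2 h1
      rw [mul_assoc] at h3
      linarith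
    have hwm : ∀ r ∈ Ioo 0 r1, h r < g r := by
      intro r hr
      have hm : StrictMonoOn w (Ioo 0 r1) := strictMonoOn_of_hasDerivAt (convex_Ioo 0 r1)
        isOpen_Ioo (fun s hs => dw s hs.1) (fun s hs => div_pos (hTlt s hs)
          (mul_pos hs.1 (pow_pos (hu.pos s hs.1) 2)))
      have h1 : w r ≤ w r1 := by
        have := (dw r1 hr10).continuousAt.continuousWithinAt (s := Iio r1)
        refine ge_of_tendsto this ?_
        filter_upwards [Ioo_mem_nhdsLT hr.2] with s hs
        exact hm.monotoneOn hr ⟨hr.1.trans hs.1, hs.2⟩ hs.1.le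
      have h2 : w r1 < 1 := (div_lt_one hgp).2 hlt
      exact (div_lt_one (hu.pos r hr.1)).1 (h1.trans_lt h2)
    have hsm : StrictMonoOn T (Ioo 0 r1) := strictMonoOn_of_hasDerivAt (convex_Ioo 0 r1)
      isOpen_Ioo (fun s hs => dT s hs.1) (fun s hs => by
        have h1 := hu.pos s hs.1
        have h2 := hv.pos s hs.1
        have h3 := hwm s hs
        have h4 : 0 < g s ^ 2 - h s ^ 2 := by nlinarith
        have := hs.1
        positivity)
    have hpos := hTlt (r1 / 2) ⟨by linarith, by linarith⟩
    have : T (r1 / 2) ≤ T r1 := by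
      have := (dT r1 hr10).continuousAt.continuousWithinAt (s := Iio r1)
      refine ge_of_tendsto this ?_
      filter_upwards [Ioo_mem_nhdsLT (by linarith : r1 / 2 < r1)] with r hr
      exact hsm.monotoneOn ⟨by linarith, by linarith⟩ ⟨by linarith [hr.1], hr.2⟩ hr.1.le
    linarith
  have hY1 : 0 < Y 1 := strictMonoOn_gt_limit (posY 2 fun r hr => Tpos r hr.1) limY
    ⟨by norm_num, by norm_num⟩
  obtain ⟨s, _, hs2, hs3⟩ := hu.J_small hl hY1 1
  have h1 : Y 1 < Y s := posY (s + 1) (fun r hr => Tpos r hr.1) ⟨by norm_num, by linarith⟩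
    ⟨by linarith, by linarith⟩ hs2
  have h2 : Y s ≤ J l g p s := by
    have := hv.J_pos hl (by linarith : 0 < s)
    have h3 := wpos s (by linarith)
    have : 0 ≤ J l h q s / w s ^ 2 := by positivity
    simp only [hY]; linarith
  linarith [(abs_lt.1 hs3).2]

theorem locally_bounded (hu : RadSol l g p) (R : ℝ) : ∃ K, ∀ r ∈ Ioo 0 R, g r ≤ K := by
  obtain ⟨d, hd, hd'⟩ := mem_nhdsGT_iff_exists_Ioo_subset.1
    (hu.g0.eventually_lt_const (lt_add_one (g 0)))
  have hd0 : (0 : ℝ) < d := hd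
  have hc : ContinuousOn g (Icc (d / 2) R) := fun r hr =>
    (hu.dg r (by linarith [hr.1])).continuousAt.continuousWithinAt
  obtain ⟨K, hK⟩ := isCompact_Icc.bddAbove_image hc
  refine ⟨max (g 0 + 1) K, fun r hr => ?_⟩
  by_cases h : r < d
  · exact (le_of_lt (hd' ⟨hr.1, h⟩)).trans (le_max_left _ _)
  · exact (hK ⟨r, ⟨by linarith, hr.2.le⟩, rfl⟩).trans (le_max_right _ _)

theorem eq_of_zero_eq (hl : 0 < l) (hu : RadSol l g p) (hv : RadSol l h q) (h0 : g 0 = h 0) :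
    ∀ r, 0 < r → g r = h r := by
  intro R hR
  obtain ⟨K1, hK1⟩ := hu.locally_bounded (R + 1)
  obtain ⟨K2, hK2⟩ := hv.locally_bounded (R + 1)
  set C := 1 + l + K1 ^ 2 + K1 * K2 + K2 ^ 2 with hC
  set F : ℝ → ℝ := fun r => (g r - h r) ^ 2 + (p r - q r) ^ 2 with hF
  have dF : ∀ r ∈ Ioo 0 (R + 1), HasDerivAt (fun r => F r * Real.exp (-(C * r)))
      ((2 * (g r - h r) * (p r - q r) + 2 * (p r - q r) * (-(p r - q r) / r + l * (g r - h r) -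
        (g r ^ 3 - h r ^ 3)) - C * F r) * Real.exp (-(C * r))) r := by
    intro r hr
    have h1 := ((hu.dg r hr.1).sub (hv.dg r hr.1)).pow 2
    have h2 := ((hu.dp r hr.1).sub (hv.dp r hr.1)).pow 2
    have h3 := ((hasDerivAt_id' r).const_mul C).neg.exp
    refine ((h1.add h2).mul h3).congr_deriv ?_
    simp only [hF, Pi.add_apply, Pi.sub_apply, Pi.pow_apply, Pi.neg_apply]
    have := hr.1.ne'
    field_simp; ring
  have anti : AntitoneOn (fun r => F r * Real.exp (-(C * r))) (Ioo 0 (R + 1)) := by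
    refine antitoneOn_of_hasDerivAt (convex_Ioo _ _) isOpen_Ioo dF fun r hr => ?_
    refine mul_nonpos_of_nonpos_of_nonneg ?_ (Real.exp_pos _).le
    have a1 := hK1 r hr
    have a2 := hK2 r hr
    have b1 := hu.pos r hr.1
    have b2 := hv.pos r hr.1
    set x := g r - h r with hx
    set y := p r - q r with hy
    have e1 : g r ^ 3 - h r ^ 3 = x * (g r ^ 2 + g r * h r + h r ^ 2) := by rw [hx]; ring
    set m := g r ^ 2 + g r * h r + h r ^ 2 with hm
    have hm0 : 0 ≤ m := by positivity
    have hmK : m ≤ K1 ^ 2 + K1 * K2 + K2 ^ 2 := by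
      have : 0 ≤ K1 := b1.le.trans a1
      rw [hm]; gcongr
    have e2 : 2 * y * (-y / r) ≤ 0 := by
      have : 2 * y * (-y / r) = -(2 * y ^ 2 / r) := by field_simp
      rw [this, neg_nonpos]; have := hr.1; positivity
    have e3 : 2 * x * y ≤ x ^ 2 + y ^ 2 := by nlinarith [sq_nonneg (x - y)]
    have e4 : l * (2 * x * y) ≤ l * (x ^ 2 + y ^ 2) := by gcongr
    have e5 : m * -(2 * x * y) ≤ m * (x ^ 2 + y ^ 2) := by
      gcongr; nlinarith [sq_nonneg (x + y)]
    have e6 : m * (x ^ 2 + y ^ 2) ≤ (K1 ^ 2 + K1 * K2 + K2 ^ 2) * (x ^ 2 + y ^ 2) := by gcongr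
    rw [e1]
    simp only [hF, ← hx, ← hy, hC]
    nlinarith
  have lim : Tendsto (fun r => F r * Real.exp (-(C * r))) (𝓝[>] 0) (𝓝 0) := by
    have h1 := ((hu.g0.sub hv.g0).pow 2).add ((hu.p0.sub hv.p0).pow 2)
    have h3 : Tendsto (fun r : ℝ => Real.exp (-(C * r))) (𝓝[>] 0) (𝓝 (Real.exp (-(C * 0)))) :=
      tendsto_nhdsWithin_of_tendsto_nhds (Continuous.tendsto (by fun_prop) 0)
    simpa [h0] using h1.mul h3
  have hle := antitoneOn_le_limit anti lim (r := R) ⟨hR, by linarith⟩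
  have hF0 : F R ≤ 0 := by
    by_contra! hc
    exact absurd hle (not_le.2 (mul_pos hc (Real.exp_pos _)))
  have : (g R - h R) ^ 2 ≤ 0 := by
    have := sq_nonneg (p R - q R); simp only [hF] at hF0; linarith
  have : g R - h R = 0 := by nlinarith
  linarith

theorem unique (hl : 0 < l) (hu : RadSol l g p) (hv : RadSol l h q) :
    ∀ r, 0 ≤ r → g r = h r := by
  have h0 : g 0 = h 0 := le_antisymm (not_lt.1 (not_gt hl hu hv)) (not_lt.1 (not_gt hl hv hu))
  intro r hr
  rcases hr.eq_or_lt with rfl | hr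
  · exact h0
  · exact eq_of_zero_eq hl hu hv h0 r hr

end Uniqueness

end RadSol

theorem integral_Ioi_deriv_eq_zero {F F' : ℝ → ℝ} (h : ∀ r, 0 < r → HasDerivAt F (F' r) r)
    (hi : IntegrableOn F' (Ioi 0)) (h0 : Tendsto F (𝓝[>] 0) (𝓝 0))
    (hs : ∀ e > 0, ∀ R, ∃ r, R < r ∧ |F r| < e) : ∫ r in Ioi 0, F' r = 0 := by
  have hlim := tendsto_limUnder_of_hasDerivAt_of_integrableOn_Ioi (fun r hr => h r hr) hi
  set m := limUnder atTop F
  have hm : m = 0 := by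
    by_contra hne
    have hp : 0 < |m| / 2 := by positivity
    obtain ⟨R, hR⟩ := Metric.tendsto_atTop.1 hlim _ hp
    obtain ⟨r, hr1, hr2⟩ := hs _ hp R
    have := hR r hr1.le
    rw [Real.dist_eq] at this
    have h3 := abs_sub_abs_le_abs_sub m (F r)
    rw [abs_sub_comm] at h3
    linarith
  set F2 : ℝ → ℝ := fun r => if r = 0 then 0 else F r with hF2
  have hev : ∀ r, 0 < r → F2 =ᶠ[𝓝 r] F := fun r hr => by
    filter_upwards [lt_mem_nhds hr] with s hs
    simp [hF2, hs.ne']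
  have := integral_Ioi_of_hasDerivAt_of_tendsto (f := F2) (a := 0) (m := 0) ?_
    (fun r hr => (h r hr).congr_of_eventuallyEq (hev r hr)) hi ?_
  · rw [this]; simp [hF2]
  · rw [← continuousWithinAt_sdiff_self, Ici_sdiff_left]
    have : F2 0 = 0 := by simp [hF2]
    rw [ContinuousWithinAt, this]
    refine h0.congr' ?_
    filter_upwards [self_mem_nhdsWithin] with s hs
    simp [hF2, (show (0 : ℝ) < s from hs).ne']
  · rw [← hm]
    refine hlim.congr' ?_
    filter_upwards [eventually_gt_atTop 0] with s hs
    simp [hF2, hs.ne']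

namespace RadSol
variable {l : ℝ} {g p : ℝ → ℝ}

def energy (l : ℝ) (g p : ℝ → ℝ) (r : ℝ) : ℝ :=
  1 / 2 * p r ^ 2 - l / 2 * g r ^ 2 + 1 / 4 * g r ^ 4

theorem energy_deriv (h : RadSol l g p) {r : ℝ} (hr : 0 < r) :
    HasDerivAt (energy l g p) (-(p r ^ 2 / r)) r := by
  have hg := h.dg r hr
  have hp := h.dp r hr
  refine ((((hp.pow 2).const_mul (1 / 2)).sub ((hg.pow 2).const_mul (l / 2))).add
    ((hg.pow 4).const_mul (1 / 4))).congr_deriv ?_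
  field_simp; ring

theorem energy_anti (h : RadSol l g p) : AntitoneOn (energy l g p) (Ioi 0) :=
  antitoneOn_of_hasDerivAt (convex_Ioi 0) isOpen_Ioi (fun _ hr => h.energy_deriv hr)
    fun r hr => by
      have : (0 : ℝ) < r := hr
      rw [neg_nonpos]; positivity

theorem energy_lim (h : RadSol l g p) : Tendsto (energy l g p) (𝓝[>] 0)
    (𝓝 (- (l / 2) * g 0 ^ 2 + 1 / 4 * g 0 ^ 4)) := by
  have := (((h.p0.pow 2).const_mul (1 / 2)).sub ((h.g0.pow 2).const_mul (l / 2))).add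
    ((h.g0.pow 4).const_mul (1 / 4))
  refine (this.congr fun r => rfl).trans (le_of_eq ?_)
  congr 1; ring

theorem energy_le (h : RadSol l g p) {r : ℝ} (hr : 0 < r) :
    energy l g p r ≤ - (l / 2) * g 0 ^ 2 + 1 / 4 * g 0 ^ 4 :=
  antitoneOn_le_limit (b := r + 1) (h.energy_anti.mono Ioo_subset_Ioi_self) h.energy_lim
    ⟨hr, by linarith⟩

theorem bounded (hl : 0 < l) (h : RadSol l g p) : ∃ K, ∀ r, 0 < r → g r ≤ K := by
  set C := |-(l / 2) * g 0 ^ 2 + 1 / 4 * g 0 ^ 4| with hC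
  refine ⟨4 * C + 2 * l + 2, fun r hr => ?_⟩
  have h1 := (h.energy_le hr).trans (le_abs_self _)
  rw [← hC, energy] at h1
  have hC0 : 0 ≤ C := abs_nonneg _
  have := sq_nonneg (p r)
  have h2 : g r ^ 4 ≤ 4 * C + 2 * l * g r ^ 2 := by linarith
  by_contra! hc
  have g1 : 1 < g r := by linarith
  have g2 : 1 < g r ^ 2 := by nlinarith
  have g3 : g r < g r ^ 2 := by nlinarith
  nlinarith [mul_pos (sub_pos.2 g1) (sub_pos.2 g2)]

theorem integrableOn_four (hl : 0 < l) (h : RadSol l g p) :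
    IntegrableOn (fun r => r * g r ^ 4) (Ioi 0) := by
  obtain ⟨K, hK⟩ := h.bounded hl
  have hm : AEStronglyMeasurable (fun r => r * g r ^ 4) (volume.restrict (Ioi 0)) := by
    refine ContinuousOn.aestronglyMeasurable (fun r hr => ?_) measurableSet_Ioi
    exact (continuousAt_id.mul ((h.dg r hr).continuousAt.pow 4)).continuousWithinAt
  refine (h.ig.const_mul (K ^ 2)).mono' hm ?_
  filter_upwards [self_mem_ae_restrict measurableSet_Ioi] with r hr
  have hr0 : (0 : ℝ) < r := hr
  have h1 := h.pos r hr
  rw [Real.norm_eq_abs, abs_of_nonneg (by positivity)]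
  have h2 : g r ^ 2 ≤ K ^ 2 := by gcongr; exact hK r hr
  have h3 : 0 ≤ r * g r ^ 2 := by positivity
  nlinarith [mul_le_mul_of_nonneg_left h2 h3]

theorem small_fun (h : RadSol l g p) {F : ℝ → ℝ} {c : ℝ}
    (hF : ∀ r, 1 < r → r ^ 2 * (g r ^ 2 + p r ^ 2) < 1 →
      |F r| ≤ c * (r ^ 2 * (g r ^ 2 + p r ^ 2))) :
    ∀ e > 0, ∀ R, ∃ r, R < r ∧ |F r| < e := by
  intro e he R
  have hc : 0 < |c| + 1 := by positivity
  obtain ⟨r, h1, h2, h3⟩ := h.exists_small (e := min 1 (e / (|c| + 1)))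
    (lt_min one_pos (by positivity)) R
  refine ⟨r, h1, (hF r h2 (h3.trans_le (min_le_left _ _))).trans_lt ?_⟩
  have h4 := h3.trans_le (min_le_right _ _)
  rw [lt_div_iff₀ hc] at h4
  have : 0 ≤ r ^ 2 * (g r ^ 2 + p r ^ 2) := by positivity
  nlinarith [le_abs_self c]

theorem pohozaev (hl : 0 < l) (h : RadSol l g p) :
    ∫ r in Ioi 0, r * g r ^ 4 = 2 * l * ∫ r in Ioi 0, r * g r ^ 2 := by
  have h4 := h.integrableOn_four hl
  have hi : IntegrableOn (fun r => 1 / 2 * (r * g r ^ 4) - l * (r * g r ^ 2)) (Ioi 0) :=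
    Integrable.sub (h4.const_mul _) (h.ig.const_mul _)
  have key := integral_Ioi_deriv_eq_zero (F := fun r => r ^ 2 * energy l g p r)
    (F' := fun r => 1 / 2 * (r * g r ^ 4) - l * (r * g r ^ 2)) ?_
    hi ?_ (h.small_fun (c := 2 + l) ?_)
  · rw [integral_sub (h4.const_mul _) (h.ig.const_mul _), integral_const_mul,
      integral_const_mul] at key
    linarith
  · intro r hr
    refine (((hasDerivAt_id' r).pow 2).mul (h.energy_deriv hr)).congr_deriv ?_
    simp only [energy, Pi.pow_apply]
    field_simp; ring
  · have : Tendsto (fun r : ℝ => r ^ 2) (𝓝[>] 0) (𝓝 (0 ^ 2)) :=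
      tendsto_nhdsWithin_of_tendsto_nhds (Continuous.tendsto (by fun_prop) 0)
    simpa using this.mul h.energy_lim
  · intro r hr hs
    set s := r ^ 2 * (g r ^ 2 + p r ^ 2) with hs'
    have hr2 : 1 ≤ r ^ 2 := by nlinarith
    have a1 : r ^ 2 * g r ^ 2 ≤ s := by rw [hs']; nlinarith [sq_nonneg (r * p r)]
    have a2 : r ^ 2 * p r ^ 2 ≤ s := by rw [hs']; nlinarith [sq_nonneg (r * g r)]
    have a3 : g r ^ 2 ≤ 1 := by
      linarith [mul_nonneg (sub_nonneg.2 hr2) (sq_nonneg (g r))]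
    have a0 : 0 ≤ r ^ 2 * g r ^ 2 := by positivity
    have a0' : 0 ≤ r ^ 2 * p r ^ 2 := by positivity
    have a4 : (r ^ 2 * g r ^ 2) * g r ^ 2 ≤ r ^ 2 * g r ^ 2 := mul_le_of_le_one_right a0 a3
    have a5 : 0 ≤ (r ^ 2 * g r ^ 2) * g r ^ 2 := by positivity
    have a6 : l * (r ^ 2 * g r ^ 2) ≤ l * s := by gcongr
    have a7 : 0 ≤ l * (r ^ 2 * g r ^ 2) := by positivity
    have e : r ^ 2 * energy l g p r = 1 / 2 * (r ^ 2 * p r ^ 2) - 1 / 2 * (l * (r ^ 2 * g r ^ 2))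
      + 1 / 4 * ((r ^ 2 * g r ^ 2) * g r ^ 2) := by rw [energy]; ring
    have e2 : (2 + l) * s = 2 * s + l * s := by ring
    rw [abs_le, e, e2]
    clear_value s
    constructor <;> linarith

theorem nehari (hl : 0 < l) (h : RadSol l g p) :
    ∫ r in Ioi 0, r * p r ^ 2 = l * ∫ r in Ioi 0, r * g r ^ 2 := by
  have h4 := h.integrableOn_four hl
  have i1 : IntegrableOn (fun r => r * p r ^ 2 + l * (r * g r ^ 2)) (Ioi 0) :=
    h.ip.fun_add (h.ig.const_mul l)
  have key := integral_Ioi_deriv_eq_zero (F := fun r => r * g r * p r)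
    (F' := fun r => r * p r ^ 2 + l * (r * g r ^ 2) - r * g r ^ 4) ?_
    (i1.sub h4) ?_ (h.small_fun (c := 1) ?_)
  · rw [integral_sub i1 h4, integral_add h.ip (h.ig.const_mul l), integral_const_mul,
      h.pohozaev hl] at key
    linarith
  · intro r hr
    refine (((hasDerivAt_id' r).mul (h.dg r hr)).mul (h.dp r hr)).congr_deriv ?_
    simp only [Pi.mul_apply]
    field_simp; ring
  · have : Tendsto (fun r : ℝ => r) (𝓝[>] 0) (𝓝 0) :=
      tendsto_nhdsWithin_of_tendsto_nhds tendsto_id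
    simpa using (this.mul h.g0).mul h.p0
  · intro r hr hs
    have hr2 : 1 ≤ r ^ 2 := by nlinarith
    have hp1 := mul_nonneg (sub_nonneg.2 hr2) (sq_nonneg (p r))
    have q1 := sq_nonneg (r * g r + p r)
    have q2 := sq_nonneg (r * g r - p r)
    have q3 := sq_nonneg (r * g r)
    rw [abs_le]
    constructor <;> linarith

theorem energy_nonneg (h : RadSol l g p) (hl : 0 < l) {r : ℝ} (hr : 0 < r) :
    0 ≤ energy l g p r := by
  by_contra! hc
  obtain ⟨s, hs1, hs2⟩ := h.small_fun (F := fun r => energy l g p r) (c := 2 + l) (by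
    intro r hr hs
    set s := r ^ 2 * (g r ^ 2 + p r ^ 2) with hs'
    have hr2 : 1 ≤ r ^ 2 := by nlinarith
    have b1 := mul_nonneg (sub_nonneg.2 hr2) (sq_nonneg (g r))
    have b2 := mul_nonneg (sub_nonneg.2 hr2) (sq_nonneg (p r))
    have b3 := sq_nonneg (g r)
    have b4 := sq_nonneg (p r)
    have a1 : g r ^ 2 ≤ s := by rw [hs']; linarith
    have a2 : p r ^ 2 ≤ s := by rw [hs']; linarith
    have a5 : 0 ≤ g r ^ 4 := by positivity
    have a4 : g r ^ 4 ≤ g r ^ 2 := by nlinarith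
    have a6 : l * (g r ^ 2) ≤ l * s := by gcongr
    have a7 : 0 ≤ l * (g r ^ 2) := by positivity
    have e2 : (2 + l) * s = 2 * s + l * s := by ring
    rw [abs_le, energy, e2]
    clear_value s
    constructor <;> linarith) (-energy l g p r) (by linarith) r
  have := h.energy_anti hr (hr.trans hs1 : (0 : ℝ) < s) hs1.le
  linarith [(abs_lt.1 hs2).1]

theorem crit (h : RadSol l g p) (hl : 0 < l) {r : ℝ} (hr : 0 < r) (hp : p r = 0) :
    2 * l ≤ g r ^ 2 := by
  have := h.energy_nonneg hl hr
  rw [energy, hp] at this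
  have hg := h.pos r hr
  by_contra! hc
  have : g r ^ 2 * (g r ^ 2 - 2 * l) < 0 := mul_neg_of_pos_of_neg (by positivity) (by linarith)
  nlinarith

theorem crit_zero (h : RadSol l g p) (hl : 0 < l) : 2 * l ≤ g 0 ^ 2 := by
  have h1 := (h.energy_nonneg hl one_pos).trans (h.energy_le one_pos)
  have hg := h.zero_pos
  by_contra! hc
  have : g 0 ^ 2 * (g 0 ^ 2 - 2 * l) < 0 := mul_neg_of_pos_of_neg (by positivity) (by linarith)
  nlinarith

theorem p_neg (h : RadSol l g p) (hl : 0 < l) : ∀ r, 0 < r → p r < 0 := by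
  have dT : ∀ r, 0 < r → HasDerivAt (fun r => r * p r) (r * g r * (l - g r ^ 2)) r := by
    intro r hr
    refine ((hasDerivAt_id' r).mul (h.dp r hr)).congr_deriv ?_
    field_simp; ring
  by_contra! hcon
  obtain ⟨r2, hr2, hp2⟩ := hcon
  have h0 : l < g 0 ^ 2 := by linarith [h.crit_zero hl]
  obtain ⟨d, hd0, hd⟩ := mem_nhdsGT_iff_exists_Ioo_subset.1
    ((h.g0.pow 2).eventually_const_lt h0)
  have hd0 : (0 : ℝ) < d := hd0
  have hTd : ∀ r ∈ Ioo 0 d, r * p r < 0 := by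
    intro r hr
    have := strictMonoOn_gt_limit (f := fun r => -(r * p r)) (c := 0) (strictMonoOn_of_hasDerivAt
      (convex_Ioo 0 d) isOpen_Ioo (fun s hs => (dT s hs.1).neg) (fun s hs => ?_)) ?_ hr
    · linarith
    · have h1 := h.pos s hs.1
      have h2 : l < g s ^ 2 := hd hs
      have := mul_pos (mul_pos hs.1 h1) (sub_pos.2 h2)
      linarith
    · have : Tendsto (fun r : ℝ => r) (𝓝[>] 0) (𝓝 0) :=
        tendsto_nhdsWithin_of_tendsto_nhds tendsto_id
      simpa using (this.mul h.p0).neg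
  set S : Set ℝ := {r | d / 2 ≤ r ∧ 0 ≤ r * p r} with hS
  have hSne : S.Nonempty := ⟨r2, by
    by_contra! hc
    exact absurd (hTd r2 ⟨hr2, by linarith⟩) (not_lt.2 (mul_nonneg hr2.le hp2)),
    mul_nonneg hr2.le hp2⟩
  have hSbd : BddBelow S := ⟨d / 2, fun r hr => hr.1⟩
  set r1 := sInf S with hr1
  have hr1d : d / 2 ≤ r1 := le_csInf hSne fun r hr => hr.1
  have hr10 : 0 < r1 := by linarith
  have hT1 : 0 ≤ r1 * p r1 := by
    obtain ⟨s, hs, hs1, hs2⟩ := exists_seq_tendsto_sInf hSne hSbd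
    exact ge_of_tendsto' (((dT r1 hr10).continuousAt.tendsto).comp hs1) fun n => (hs2 n).2
  have hTlt : ∀ r ∈ Ioo 0 r1, r * p r < 0 := by
    intro r hr
    by_contra! hc
    by_cases hrd : r < d / 2
    · exact absurd (hTd r ⟨hr.1, by linarith⟩) (not_lt.2 hc)
    · exact absurd (csInf_le hSbd ⟨not_lt.1 hrd, hc⟩) (not_le.2 hr.2)
  have hT10 : r1 * p r1 = 0 := by
    refine le_antisymm ?_ hT1
    have := (dT r1 hr10).continuousAt.continuousWithinAt (s := Iio r1)
    refine le_of_tendsto this ?_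
    filter_upwards [Ioo_mem_nhdsLT hr10] with r hr using (hTlt r hr).le
  have hp1 : p r1 = 0 := (mul_eq_zero.1 hT10).resolve_left hr10.ne'
  have hg1 := h.crit hl hr10 hp1
  have hg1' : l < g r1 ^ 2 := by linarith
  have hcg : ContinuousAt (fun r => g r ^ 2) r1 := (h.dg r1 hr10).continuousAt.pow 2
  obtain ⟨a, ha, ha'⟩ := (mem_nhdsLE_iff_exists_Ioc_subset' hr10).1
    (nhdsWithin_le_nhds (hcg.eventually_const_lt hg1'))
  have ham : max a 0 < r1 := max_lt ha hr10
  have hanti : AntitoneOn (fun r => r * p r) (Ioo (max a 0) r1) :=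
    antitoneOn_of_hasDerivAt (convex_Ioo _ _) isOpen_Ioo
      (fun s hs => dT s ((le_max_right _ _).trans_lt hs.1)) fun s hs => by
        have hs0 := (le_max_right _ _).trans_lt hs.1
        have h1 := h.pos s hs0
        have h2 : l < g s ^ 2 := ha' ⟨(le_max_left _ _).trans_lt hs.1, hs.2.le⟩
        have := mul_pos (mul_pos hs0 h1) (sub_pos.2 h2)
        linarith
  set m := (max a 0 + r1) / 2 with hm
  have hm1 : max a 0 < m := by linarith
  have hm2 : m < r1 := by linarith
  have : r1 * p r1 ≤ m * p m := by
    have := (dT r1 hr10).continuousAt.continuousWithinAt (s := Iio r1)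
    refine le_of_tendsto this ?_
    filter_upwards [Ioo_mem_nhdsLT hm2] with r hr
    exact hanti ⟨hm1, hm2⟩ ⟨hm1.trans hr.1, hr.2⟩ hr.1.le
  linarith [hTlt m ⟨(le_max_right a 0).trans_lt hm1, hm2⟩]

theorem decay (h : RadSol 1 g p) : ∃ C, ∀ r, 0 < r → g r ≤ C * Real.exp (-(r / 2)) := by
  have hanti : StrictAntiOn g (Ioi 0) := by
    have := (strictMonoOn_of_hasDerivAt (convex_Ioi 0) isOpen_Ioi
      (fun r hr => (h.dg r hr).neg) (fun r hr => neg_pos.2 (h.p_neg one_pos r hr))).neg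
    simpa using this
  obtain ⟨R, hR1, hR2⟩ := h.small_fun (F := fun r => g r ^ 2) (c := 1) (by
    intro r hr hs
    have hr2 : 1 ≤ r ^ 2 := by nlinarith
    have b1 := mul_nonneg (sub_nonneg.2 hr2) (sq_nonneg (g r))
    have b2 : 0 ≤ r ^ 2 * p r ^ 2 := by positivity
    rw [abs_of_nonneg (sq_nonneg _)]
    linarith) 1 one_pos 1
  rw [abs_of_nonneg (sq_nonneg _)] at hR2
  have hR0 : 0 < R := by linarith
  have hp : ∀ r, R ≤ r → p r ≤ -(g r / 2) := by
    intro r hr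
    have hr0 : 0 < r := by linarith
    have h1 := h.energy_nonneg one_pos hr0
    have h2 := h.p_neg one_pos r hr0
    have h3 := h.pos r hr0
    have h4 : g r ≤ g R := hanti.antitoneOn hR0 hr0 hr
    have h5 : g r ^ 2 ≤ 1 := by
      have : g r ^ 2 ≤ g R ^ 2 := by gcongr
      linarith
    rw [energy] at h1
    have h6 : g r ^ 4 ≤ g r ^ 2 := by nlinarith [sq_nonneg (g r)]
    have h7 : (g r / 2) ^ 2 ≤ (-p r) ^ 2 := by nlinarith
    have := (sq_le_sq₀ (by positivity) (by linarith)).1 h7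
    linarith
  have hE : AntitoneOn (fun r => g r * Real.exp (r / 2)) (Ioi R) :=
    antitoneOn_of_hasDerivAt (f' := fun r => (p r + g r / 2) * Real.exp (r / 2))
      (convex_Ioi _) isOpen_Ioi
      (fun r hr => by
        refine ((h.dg r (hR0.trans hr)).mul ((hasDerivAt_id' r).div_const 2).exp).congr_deriv ?_
        ring)
      (fun r hr => mul_nonpos_of_nonpos_of_nonneg
        (by linarith [hp r (le_of_lt hr)]) (Real.exp_pos _).le)
  obtain ⟨K, hK⟩ := h.bounded one_pos
  have hK0 : 0 ≤ K := (h.pos 1 one_pos).le.trans (hK 1 one_pos)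
  refine ⟨K * Real.exp ((R + 1) / 2), fun r hr => ?_⟩
  rw [mul_assoc, ← Real.exp_add]
  by_cases hrR : r ≤ R + 1
  · refine (hK r hr).trans (le_mul_of_one_le_right hK0 (Real.one_le_exp (by linarith)))
  · have := hE (by simp : R + 1 ∈ Ioi R) (by simp; linarith : r ∈ Ioi R) (by linarith)
    simp only at this
    rw [Real.exp_add, Real.exp_neg, ← div_eq_mul_inv, ← mul_div_assoc,
      le_div_iff₀ (Real.exp_pos _)]
    refine this.trans ?_
    gcongr; exact hK _ (by linarith)

end RadSol

/-! ### Gaussian weights, test functions, integration by parts -/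

/-- Gaussian weight centred at `c`. -/
def gw (k : ℝ) (c y : Plane) : ℝ := Real.exp (-k * ‖y - c‖ ^ 2)

theorem gw_pos (k : ℝ) (c y : Plane) : 0 < gw k c y := Real.exp_pos _

theorem gw_le_one {k : ℝ} (hk : 0 ≤ k) (c y : Plane) : gw k c y ≤ 1 := by
  refine Real.exp_le_one_iff.2 ?_
  have : 0 ≤ k * ‖y - c‖ ^ 2 := by positivity
  linarith

theorem continuous_gw (k : ℝ) (c : Plane) : Continuous (gw k c) := by
  unfold gw; fun_prop

theorem integral_gw {k : ℝ} (hk : 0 < k) (c : Plane) : ∫ y, gw k c y = Real.pi / k := by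
  unfold gw
  rw [integral_sub_right_eq_self (fun y : Plane => Real.exp (-k * ‖y‖ ^ 2)) c]
  simpa using GaussianFourier.integral_rexp_neg_mul_sq_norm (V := Plane) hk

theorem integrable_gw {k : ℝ} (hk : 0 < k) (c : Plane) : Integrable (gw k c) :=
  Integrable.of_integral_ne_zero (by rw [integral_gw hk]; positivity)

theorem gw_sq (k : ℝ) (c y : Plane) : gw k c y ^ 2 = gw (2 * k) c y := by
  unfold gw; rw [← Real.exp_nat_mul]; congr 1; push_cast; ring

/-- Functions integrable against every Gaussian weight. -/
def GaussInt (f : Plane → ℝ) : Prop :=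
  AEStronglyMeasurable f ∧ ∀ k, 0 < k → ∀ c, Integrable (fun y => f y * gw k c y)

theorem GaussInt.of_integrable {f : Plane → ℝ} (hf : Integrable f) : GaussInt f := by
  refine ⟨hf.1, fun k hk c => hf.mul_bdd (c := 1) (continuous_gw k c).aestronglyMeasurable
    (ae_of_all _ fun y => ?_)⟩
  rw [Real.norm_eq_abs, abs_of_pos (gw_pos _ _ _)]
  exact gw_le_one hk.le c y

theorem GaussInt.of_sq {f : Plane → ℝ} (hm : AEStronglyMeasurable f)
    (hf : Integrable (fun y => f y ^ 2)) : GaussInt f := by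
  refine ⟨hm, fun k hk c => integrable_mul_of_sq hm (continuous_gw k c).aestronglyMeasurable hf ?_⟩
  simp only [gw_sq]
  exact integrable_gw (by positivity) c

theorem GaussInt.of_bdd {f : Plane → ℝ} (hm : AEStronglyMeasurable f) {K : ℝ}
    (hK : ∀ y, |f y| ≤ K) : GaussInt f :=
  ⟨hm, fun _ hk c => (integrable_gw hk c).bdd_mul hm (ae_of_all _ hK)⟩

theorem GaussInt.integrable_mul {f φ : Plane → ℝ} (hf : GaussInt f)
    (hφ : AEStronglyMeasurable φ) {C k : ℝ} (hk : 0 < k) {c : Plane}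
    (hb : ∀ y, |φ y| ≤ C * gw k c y) : Integrable (fun y => f y * φ y) := by
  refine ((hf.2 k hk c).norm.const_mul C).mono' (hf.1.mul hφ) (ae_of_all _ fun y => ?_)
  simp only [Real.norm_eq_abs, abs_mul, abs_of_pos (gw_pos k c y)]
  nlinarith [hb y, abs_nonneg (f y)]

/-- Twice differentiable functions with Gaussian decay. -/
structure TestFn (φ : Plane → ℝ) : Prop where
  d : Differentiable ℝ φ
  dd0 : Differentiable ℝ (d0R φ)
  dd1 : Differentiable ℝ (d1R φ)
  bd : ∃ C k : ℝ, ∃ c : Plane, 0 < k ∧ ∀ y, |φ y| ≤ C * gw k c y ∧ |d0R φ y| ≤ C * gw k c y ∧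
    |d1R φ y| ≤ C * gw k c y ∧ |fderiv ℝ (d0R φ) y e0| ≤ C * gw k c y ∧
    |fderiv ℝ (d1R φ) y e1| ≤ C * gw k c y

theorem TestFn.lap_bd {φ : Plane → ℝ} (h : TestFn φ) : ∃ C k : ℝ, ∃ c : Plane, 0 < k ∧
    ∀ y, |lapR φ y| ≤ C * gw k c y := by
  obtain ⟨C, k, c, hk, hb⟩ := h.bd
  refine ⟨2 * C, k, c, hk, fun y => ?_⟩
  obtain ⟨_, _, _, h4, h5⟩ := hb y
  unfold lapR
  exact (abs_add_le _ _).trans (by linarith)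

theorem measurable_lapR (φ : Plane → ℝ) : Measurable (lapR φ) :=
  (measurable_fderiv_apply_const ℝ _ e0).add (measurable_fderiv_apply_const ℝ _ e1)

theorem TestFn.int {φ f : Plane → ℝ} (h : TestFn φ) (hf : GaussInt f) :
    Integrable (fun y => f y * φ y) := by
  obtain ⟨C, k, c, hk, hb⟩ := h.bd
  exact hf.integrable_mul h.d.meas.aestronglyMeasurable hk fun y => (hb y).1

theorem integrable_sq_of_gw {φ : Plane → ℝ} (hm : AEStronglyMeasurable φ) {C k : ℝ} (hk : 0 < k)
    {c : Plane} (hb : ∀ y, |φ y| ≤ C * gw k c y) : Integrable (fun y => φ y ^ 2) := by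
  refine ((integrable_gw (k := 2 * k) (by positivity) c).const_mul (C ^ 2)).mono' (hm.pow 2)
    (ae_of_all _ fun y => ?_)
  rw [Real.norm_eq_abs, abs_of_nonneg (sq_nonneg _), ← gw_sq, ← mul_pow, ← sq_abs]
  exact pow_le_pow_left₀ (abs_nonneg _) (hb y) 2

theorem TestFn.int_lap_sq {φ : Plane → ℝ} (h : TestFn φ) :
    Integrable (fun y => lapR φ y ^ 2) := by
  obtain ⟨C, k, c, hk, hb⟩ := h.lap_bd
  exact integrable_sq_of_gw (measurable_lapR φ).aestronglyMeasurable hk hb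

theorem TestFn.H1R {φ : Plane → ℝ} (h : TestFn φ) : H1R φ := by
  obtain ⟨C, k, c, hk, hb⟩ := h.bd
  exact ⟨h.d, integrable_sq_of_gw h.d.meas.aestronglyMeasurable hk fun y => (hb y).1,
    (integrable_sq_of_gw (measurable_d0R φ).aestronglyMeasurable hk fun y => (hb y).2.1).add
    (integrable_sq_of_gw (measurable_d1R φ).aestronglyMeasurable hk fun y => (hb y).2.2.1)⟩

theorem gw_coef_nonneg {φ : Plane → ℝ} {C k : ℝ} {c : Plane} (hb : ∀ y, |φ y| ≤ C * gw k c y) :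
    0 ≤ C := by
  by_contra! h
  have h1 := (abs_nonneg _).trans (hb 0)
  have := mul_neg_of_neg_of_pos h (gw_pos k c 0)
  linarith

theorem TestFn.bdd {φ : Plane → ℝ} (h : TestFn φ) :
    ∃ B, 0 ≤ B ∧ (∀ y, |φ y| ≤ B) ∧ (∀ y, gradSqR φ y ≤ B) ∧ ∀ y, |lapR φ y| ≤ B := by
  obtain ⟨C, k, c, hk, hb⟩ := h.bd
  have hC : 0 ≤ C := gw_coef_nonneg fun y => (hb y).1
  have h1 : ∀ y, C * gw k c y ≤ C := fun y => mul_le_of_le_one_right hC (gw_le_one hk.le c y)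
  refine ⟨2 * C + 2 * C ^ 2, by positivity, fun y => ?_, fun y => ?_, fun y => ?_⟩
  · nlinarith [(hb y).1, h1 y]
  · unfold gradSqR
    have e0 : |d0R φ y| ≤ C := (hb y).2.1.trans (h1 y)
    have e1 : |d1R φ y| ≤ C := (hb y).2.2.1.trans (h1 y)
    have := sq_le_sq.2 (e0.trans (le_abs_self C))
    have := sq_le_sq.2 (e1.trans (le_abs_self C))
    linarith
  · unfold lapR
    refine (abs_add_le _ _).trans ?_
    nlinarith [(hb y).2.2.2.1, (hb y).2.2.2.2, h1 y]

theorem integral_grad_mul_grad {f φ : Plane → ℝ} (hf : Differentiable ℝ f) (h0 : GaussInt f)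
    (h1 : GaussInt (d0R f)) (h2 : GaussInt (d1R f)) (h : TestFn φ) :
    ∫ y, (d0R f y * d0R φ y + d1R f y * d1R φ y) = -∫ y, f y * lapR φ y := by
  obtain ⟨C, k, c, hk, hb⟩ := h.bd
  have m0 := (measurable_d0R φ).aestronglyMeasurable (μ := volume)
  have m1 := (measurable_d1R φ).aestronglyMeasurable (μ := volume)
  have i0 := h1.integrable_mul m0 hk fun y => (hb y).2.1
  have i1 := h2.integrable_mul m1 hk fun y => (hb y).2.2.1
  have j0 := h0.integrable_mul m0 hk fun y => (hb y).2.1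
  have j1 := h0.integrable_mul m1 hk fun y => (hb y).2.2.1
  have k0 := h0.integrable_mul (measurable_fderiv_apply_const ℝ (d0R φ) e0).aestronglyMeasurable
    hk fun y => (hb y).2.2.2.1
  have k1 := h0.integrable_mul (measurable_fderiv_apply_const ℝ (d1R φ) e1).aestronglyMeasurable
    hk fun y => (hb y).2.2.2.2
  have p0 := integral_mul_fderiv_eq_neg_fderiv_mul_of_integrable (v := e0) i0 k0 j0
    (fun x _ => hf x) (fun x _ => h.dd0 x)
  have p1 := integral_mul_fderiv_eq_neg_fderiv_mul_of_integrable (v := e1) i1 k1 j1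
    (fun x _ => hf x) (fun x _ => h.dd1 x)
  rw [integral_add i0 i1]
  simp only [lapR, mul_add]
  rw [integral_add k0 k1, p0, p1]
  simp only [d0R, d1R]
  ring

theorem H1R.ibp {f φ : Plane → ℝ} (hf : H1R f) (h : TestFn φ) :
    ∫ y, (d0R f y * d0R φ y + d1R f y * d1R φ y) = -∫ y, f y * lapR φ y :=
  integral_grad_mul_grad hf.1 (.of_sq hf.1.meas.aestronglyMeasurable hf.2.1)
    (.of_sq (measurable_d0R f).aestronglyMeasurable hf.d0)
    (.of_sq (measurable_d1R f).aestronglyMeasurable hf.d1) h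

theorem hasFDerivAt_sqdist (c y : Plane) :
    HasFDerivAt (fun z : Plane => ‖z - c‖ ^ 2) (2 • (innerSL ℝ (y - c))) y := by
  have h := (hasStrictFDerivAt_norm_sq (y - c)).hasFDerivAt.comp y ((hasFDerivAt_id y).sub_const c)
  rw [ContinuousLinearMap.comp_id] at h
  exact h

theorem inner_e0 (z : Plane) : inner ℝ z e0 = z 0 := by
  simp [e0, PiLp.inner_apply]

theorem inner_e1 (z : Plane) : inner ℝ z e1 = z 1 := by
  simp [e1, PiLp.inner_apply]

section Radial
variable {P P1 P2 : ℝ → ℝ} {c : Plane}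

theorem d0R_radial (h : ∀ t, HasDerivAt P (P1 t) t) :
    d0R (fun y => P (‖y - c‖ ^ 2)) = fun y => P1 (‖y - c‖ ^ 2) * (2 * (y 0 - c 0)) := by
  ext y
  have := ((h (‖y - c‖ ^ 2)).comp_hasFDerivAt y (hasFDerivAt_sqdist c y)).fderiv
  rw [d0R, show (fun y => P (‖y - c‖ ^ 2)) = P ∘ fun y => ‖y - c‖ ^ 2 from rfl, this]
  simp only [smul_apply, innerSL_apply_apply, inner_e0]
  simp

theorem d1R_radial (h : ∀ t, HasDerivAt P (P1 t) t) :
    d1R (fun y => P (‖y - c‖ ^ 2)) = fun y => P1 (‖y - c‖ ^ 2) * (2 * (y 1 - c 1)) := by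
  ext y
  have := ((h (‖y - c‖ ^ 2)).comp_hasFDerivAt y (hasFDerivAt_sqdist c y)).fderiv
  rw [d1R, show (fun y => P (‖y - c‖ ^ 2)) = P ∘ fun y => ‖y - c‖ ^ 2 from rfl, this]
  simp only [smul_apply, innerSL_apply_apply, inner_e1]
  simp

theorem differentiable_radial (h : ∀ t, HasDerivAt P (P1 t) t) :
    Differentiable ℝ (fun y : Plane => P (‖y - c‖ ^ 2)) := fun y =>
  (h _).differentiableAt.comp y (hasFDerivAt_sqdist c y).differentiableAt

theorem coord_diff (i : Fin 2) (c : Plane) :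
    Differentiable ℝ (fun y : Plane => 2 * (y i - c i)) := by fun_prop

theorem coord_fderiv (i : Fin 2) (c y v : Plane) :
    fderiv ℝ (fun y : Plane => 2 * (y i - c i)) y v = 2 * v i := by
  have h1 : HasFDerivAt (fun y : Plane => y i) (EuclideanSpace.proj (𝕜 := ℝ) i : Plane →L[ℝ] ℝ) y :=
    (EuclideanSpace.proj (𝕜 := ℝ) i : Plane →L[ℝ] ℝ).hasFDerivAt
  rw [((h1.sub_const (c i)).const_mul 2).fderiv]
  simp

theorem d0d0_radial (h : ∀ t, HasDerivAt P (P1 t) t) (h1 : ∀ t, HasDerivAt P1 (P2 t) t)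
    (y : Plane) : fderiv ℝ (d0R (fun y => P (‖y - c‖ ^ 2))) y e0 =
      2 * P1 (‖y - c‖ ^ 2) + 4 * (y 0 - c 0) ^ 2 * P2 (‖y - c‖ ^ 2) := by
  rw [d0R_radial h, ← d0R, d0R_mul (differentiable_radial h1 y) (coord_diff 0 c y),
    d0R_radial h1, d0R, coord_fderiv]
  simp [e0]; ring

theorem d1d1_radial (h : ∀ t, HasDerivAt P (P1 t) t) (h1 : ∀ t, HasDerivAt P1 (P2 t) t)
    (y : Plane) : fderiv ℝ (d1R (fun y => P (‖y - c‖ ^ 2))) y e1 =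
      2 * P1 (‖y - c‖ ^ 2) + 4 * (y 1 - c 1) ^ 2 * P2 (‖y - c‖ ^ 2) := by
  rw [d1R_radial h, ← d1R, d1R_mul (differentiable_radial h1 y) (coord_diff 1 c y),
    d1R_radial h1, d1R, coord_fderiv]
  simp [e1]; ring

theorem sqdist_coord (c y : Plane) : ‖y - c‖ ^ 2 = (y 0 - c 0) ^ 2 + (y 1 - c 1) ^ 2 := by
  rw [plane_norm_sq]; simp

theorem lapR_radial (h : ∀ t, HasDerivAt P (P1 t) t) (h1 : ∀ t, HasDerivAt P1 (P2 t) t)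
    (y : Plane) : lapR (fun y => P (‖y - c‖ ^ 2)) y =
      4 * P1 (‖y - c‖ ^ 2) + 4 * ‖y - c‖ ^ 2 * P2 (‖y - c‖ ^ 2) := by
  rw [lapR, d0d0_radial h h1, d1d1_radial h h1, sqdist_coord]; ring

theorem mul_exp_le {k t : ℝ} (hk : 0 < k) : t * Real.exp (-k * t) ≤ 2 / k * Real.exp
    (-(k / 2) * t) := by
  have e : Real.exp (-k * t) = Real.exp (-(k / 2) * t) * Real.exp (-(k / 2) * t) := by
    rw [← Real.exp_add]; congr 1; ring
  have h1 : t * Real.exp (-(k / 2) * t) ≤ 2 / k := by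
    have := Real.add_one_le_exp (k / 2 * t)
    rw [neg_mul, Real.exp_neg, ← div_eq_mul_inv, div_le_iff₀ (Real.exp_pos _)]
    have h2 : 2 / k * (k / 2 * t) = t := by field_simp
    have h3 : 2 / k * (k / 2 * t + 1) ≤ 2 / k * Real.exp (k / 2 * t) := by gcongr
    have : 0 < 2 / k := by positivity
    linarith
  rw [e, ← mul_assoc]
  gcongr

theorem testFn_radial (h : ∀ t, HasDerivAt P (P1 t) t) (h1 : ∀ t, HasDerivAt P1 (P2 t) t)
    {C k : ℝ} (hk : 0 < k) (hb : ∀ t, 0 ≤ t → |P t| ≤ C * Real.exp (-k * t) ∧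
      |P1 t| ≤ C * Real.exp (-k * t) ∧ |P2 t| ≤ C * Real.exp (-k * t)) :
    TestFn (fun y => P (‖y - c‖ ^ 2)) where
  d := differentiable_radial h
  dd0 := by rw [d0R_radial h]; exact (differentiable_radial h1).mul (coord_diff 0 c)
  dd1 := by rw [d1R_radial h]; exact (differentiable_radial h1).mul (coord_diff 1 c)
  bd := by
    have hC : 0 ≤ C := by
      have := (abs_nonneg _).trans (hb 0 le_rfl).1
      simpa using this
    refine ⟨C * (3 + 8 / k), k / 2, c, by positivity, fun y => ?_⟩
    set t := ‖y - c‖ ^ 2 with ht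
    have ht0 : 0 ≤ t := by positivity
    obtain ⟨b0, b1, b2⟩ := hb t ht0
    have hg : gw (k / 2) c y = Real.exp (-(k / 2) * t) := rfl
    rw [hg]
    set E := Real.exp (-(k / 2) * t) with hE
    have hE0 : 0 < E := Real.exp_pos _
    have hEk : Real.exp (-k * t) ≤ E := Real.exp_le_exp.2 (by nlinarith)
    have hmul := mul_exp_le (t := t) hk
    rw [← hE] at hmul
    set F := Real.exp (-k * t) with hF
    have hF0 : 0 < F := Real.exp_pos _
    have hx : (y 0 - c 0) ^ 2 ≤ t := by
      rw [ht, sqdist_coord]; linarith [sq_nonneg (y 1 - c 1)]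
    have hy : (y 1 - c 1) ^ 2 ≤ t := by
      rw [ht, sqdist_coord]; linarith [sq_nonneg (y 0 - c 0)]
    have hCF : C * F ≤ C * E := by gcongr
    have hCE : 0 ≤ C * E := by positivity
    have hkE : 0 ≤ C * E * (8 / k) := by positivity
    have main : C * (3 + 8 / k) * E = 3 * (C * E) + C * E * (8 / k) := by ring
    have hCt : C * (t * F) ≤ C * E * (8 / k) / 4 := by
      calc C * (t * F) ≤ C * (2 / k * E) := by gcongr
        _ = _ := by ring
    have lin : ∀ x : ℝ, x ^ 2 ≤ t → |P1 t * (2 * x)| ≤ C * (3 + 8 / k) * E := by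
      intro x hx
      have : |2 * x| ≤ 1 + t := by
        rw [abs_le]; constructor <;> nlinarith [sq_nonneg (x - 1), sq_nonneg (x + 1)]
      rw [abs_mul, main]
      calc |P1 t| * |2 * x| ≤ (C * F) * (1 + t) := by gcongr
        _ = C * F + C * (t * F) := by ring
        _ ≤ _ := by linarith
    have quad : ∀ x : ℝ, x ^ 2 ≤ t → |2 * P1 t + 4 * x ^ 2 * P2 t| ≤ C * (3 + 8 / k) * E := by
      intro x hx
      rw [main]
      calc |2 * P1 t + 4 * x ^ 2 * P2 t| ≤ |2 * P1 t| + |4 * x ^ 2 * P2 t| := abs_add_le _ _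
        _ = 2 * |P1 t| + 4 * x ^ 2 * |P2 t| := by
          rw [abs_mul, abs_mul, abs_of_pos (by norm_num : (0 : ℝ) < 2),
            abs_of_nonneg (by positivity : 0 ≤ 4 * x ^ 2)]
        _ ≤ 2 * (C * F) + 4 * t * (C * F) := by gcongr
        _ = 2 * (C * F) + 4 * (C * (t * F)) := by ring
        _ ≤ _ := by linarith
    refine ⟨?_, ?_, ?_, ?_, ?_⟩
    · rw [main]; linarith
    · rw [d0R_radial h]; exact lin _ hx
    · rw [d1R_radial h]; exact lin _ hy
    · rw [d0d0_radial h h1]; exact quad _ hx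
    · rw [d1d1_radial h h1]; exact quad _ hy

end Radial

/-! ### The heat kernel -/

/-- The heat kernel of the plane. -/
def G (s : ℝ) (x y : Plane) : ℝ := (4 * Real.pi * s)⁻¹ * gw (4 * s)⁻¹ x y

/-- The Laplacian, equivalently the time derivative, of the heat kernel. -/
def LG (s : ℝ) (x y : Plane) : ℝ := G s x y * (‖y - x‖ ^ 2 / (4 * s ^ 2) - 1 / s)

theorem G_pos {s : ℝ} (hs : 0 < s) (x y : Plane) : 0 < G s x y := by
  have := gw_pos (4 * s)⁻¹ x y
  unfold G; have := Real.pi_pos; positivity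

theorem continuous_G (s : ℝ) (x : Plane) : Continuous (G s x) :=
  continuous_const.mul (continuous_gw _ _)

theorem continuous_LG (s : ℝ) (x : Plane) : Continuous (LG s x) := by
  have := continuous_G s x
  unfold LG; fun_prop

theorem integrable_G {s : ℝ} (hs : 0 < s) (x : Plane) : Integrable (G s x) :=
  (integrable_gw (by positivity) x).const_mul _

theorem integral_G {s : ℝ} (hs : 0 < s) (x : Plane) : ∫ y, G s x y = 1 := by
  unfold G
  rw [integral_const_mul, integral_gw (by positivity)]
  have := Real.pi_pos
  field_simp

theorem G_sq {s : ℝ} (hs : 0 < s) (x y : Plane) :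
    G s x y ^ 2 = (8 * Real.pi * s)⁻¹ * G (s / 2) x y := by
  unfold G
  rw [mul_pow, gw_sq]
  have := Real.pi_pos
  have e : 2 * (4 * s)⁻¹ = (4 * (s / 2))⁻¹ := by field_simp
  rw [e]; field_simp; ring

theorem integrable_G_sq {s : ℝ} (hs : 0 < s) (x : Plane) : Integrable (fun y => G s x y ^ 2) := by
  simp only [G_sq hs]; exact (integrable_G (by positivity) x).const_mul _

theorem integral_G_sq {s : ℝ} (hs : 0 < s) (x : Plane) :
    ∫ y, G s x y ^ 2 = (8 * Real.pi * s)⁻¹ := by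
  simp only [G_sq hs]; rw [integral_const_mul, integral_G (by positivity), mul_one]

theorem GaussInt.mul_G {F : Plane → ℝ} (hF : GaussInt F) {s : ℝ} (hs : 0 < s) (x : Plane) :
    Integrable (fun y => F y * G s x y) :=
  hF.integrable_mul (continuous_G s x).aestronglyMeasurable (k := (4 * s)⁻¹) (by positivity)
    (C := (4 * Real.pi * s)⁻¹) (c := x) fun y => by
      rw [abs_of_pos (G_pos hs x y)]; rfl

theorem testFn_G {s : ℝ} (hs : 0 < s) (x : Plane) : TestFn (G s x) := by
  set k := (4 * s)⁻¹ with hk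
  have hk0 : 0 < k := by positivity
  set b := (4 * Real.pi * s)⁻¹ with hb
  have hb0 : 0 < b := by have := Real.pi_pos; positivity
  have he : ∀ t, HasDerivAt (fun t => Real.exp (-k * t)) (Real.exp (-k * t) * -k) t := fun t => by
    simpa using ((hasDerivAt_id' t).const_mul (-k)).exp
  refine testFn_radial (P := fun t => b * Real.exp (-k * t))
    (P1 := fun t => b * (Real.exp (-k * t) * -k))
    (P2 := fun t => b * (Real.exp (-k * t) * -k * -k)) (C := b * (1 + k + k * k))
    (fun t => (he t).const_mul b) (fun t => ((he t).mul_const (-k)).const_mul b) hk0 fun t ht => ?_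
  have hE := Real.exp_pos (-k * t)
  set E := Real.exp (-k * t)
  have hbE : 0 < b * E := by positivity
  have hbEk : 0 < b * E * k := by positivity
  have hbEkk : 0 < b * E * k * k := by positivity
  have e : b * (1 + k + k * k) * E = b * E + b * E * k + b * E * k * k := by ring
  rw [e]
  refine ⟨?_, ?_, ?_⟩ <;> rw [abs_le] <;> constructor <;> linarith

theorem lapR_G {s : ℝ} (hs : 0 < s) (x y : Plane) : lapR (G s x) y = LG s x y := by
  set k := (4 * s)⁻¹ with hk
  set b := (4 * Real.pi * s)⁻¹ with hb
  have he : ∀ t, HasDerivAt (fun t => Real.exp (-k * t)) (Real.exp (-k * t) * -k) t := fun t => by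
    simpa using ((hasDerivAt_id' t).const_mul (-k)).exp
  have := lapR_radial (P := fun t => b * Real.exp (-k * t))
    (P1 := fun t => b * (Real.exp (-k * t) * -k))
    (P2 := fun t => b * (Real.exp (-k * t) * -k * -k)) (c := x)
    (fun t => (he t).const_mul b) (fun t => ((he t).mul_const (-k)).const_mul b) y
  refine this.trans ?_
  simp only [LG, G, gw, ← hk, ← hb]
  rw [hk]; field_simp; ring

theorem G_hasDerivAt {s : ℝ} (hs : 0 < s) (x y : Plane) :
    HasDerivAt (fun s => G s x y) (LG s x y) s := by
  have hpi := Real.pi_pos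
  have h1 : HasDerivAt (fun s : ℝ => (4 * Real.pi * s)⁻¹) (-(4 * Real.pi) / (4 * Real.pi * s) ^ 2)
      s := by
    exact (((hasDerivAt_id' s).const_mul
        (4 * Real.pi)).fun_inv (by positivity)).congr_deriv (by simp)
  have h2 : HasDerivAt (fun s : ℝ => (4 * s)⁻¹) (-4 / (4 * s) ^ 2) s := by
    exact (((hasDerivAt_id' s).const_mul 4).fun_inv (by positivity)).congr_deriv (by simp)
  have h3 := ((h2.neg).mul_const (‖y - x‖ ^ 2)).exp
  refine (h1.mul h3).congr_deriv ?_
  simp only [LG, G, gw, Pi.neg_apply]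
  field_simp; ring

/-- The heat semigroup. -/
def heat (F : Plane → ℝ) (s : ℝ) (x : Plane) : ℝ := ∫ y, F y * G s x y

theorem heat_hasDerivAt {F : Plane → ℝ} (hF : GaussInt F) {s : ℝ} (hs : 0 < s) (x : Plane) :
    HasDerivAt (fun s => heat F s x) (∫ y, F y * LG s x y) s := by
  have hpi := Real.pi_pos
  have hk : 0 < (8 * s)⁻¹ := by positivity
  set C := (2 * Real.pi * s)⁻¹ * (1 / s ^ 2 * (2 / (8 * s)⁻¹) + 2 / s) with hC
  refine (hasDerivAt_integral_of_dominated_loc_of_deriv_le (s := Ioo (s / 2) (2 * s))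
    (F := fun r y => F y * G r x y) (F' := fun r y => F y * LG r x y)
    (bound := fun y => C * ‖F y * gw ((8 * s)⁻¹ / 2) x y‖)
    (Ioo_mem_nhds (by linarith) (by linarith))
    (Eventually.of_forall fun r => hF.1.mul (continuous_G r x).aestronglyMeasurable)
    (hF.mul_G hs x) (hF.1.mul (continuous_LG s x).aestronglyMeasurable)
    (ae_of_all _ fun y r hr => ?_) ((hF.2 _ (by positivity) x).norm.const_mul C)
    (ae_of_all _ fun y r hr => ?_)).2
  · have hr0 : 0 < r := by linarith [hr.1]
    rw [norm_mul, norm_mul, mul_left_comm]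
    refine mul_le_mul_of_nonneg_left ?_ (norm_nonneg _)
    rw [Real.norm_eq_abs, Real.norm_eq_abs, abs_of_pos (gw_pos _ _ _), LG, abs_mul,
      abs_of_pos (G_pos hr0 x y)]
    set t := ‖y - x‖ ^ 2 with ht
    have ht0 : 0 ≤ t := by positivity
    have b1 : G r x y ≤ (2 * Real.pi * s)⁻¹ * Real.exp (-(8 * s)⁻¹ * t) := by
      unfold G gw
      gcongr ?_ * Real.exp (?_ * _)
      · rw [inv_le_inv₀ (by positivity) (by positivity)]; nlinarith [hr.1]
      · rw [neg_le_neg_iff, inv_le_inv₀ (by positivity) (by positivity)]; linarith [hr.2]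
    have b2 : |t / (4 * r ^ 2) - 1 / r| ≤ 1 / s ^ 2 * t + 2 / s := by
      have c1 : t / (4 * r ^ 2) ≤ 1 / s ^ 2 * t := by
        rw [div_eq_inv_mul, one_div]; gcongr
        nlinarith [hr.1]
      have c2 : 1 / r ≤ 2 / s := by
        rw [div_le_div_iff₀ hr0 hs]; linarith [hr.1]
      have c3 : 0 ≤ t / (4 * r ^ 2) := by positivity
      have c4 : 0 < 1 / r := by positivity
      have c5 : 0 ≤ 1 / s ^ 2 * t := by positivity
      rw [abs_le]; constructor <;> linarith
    have b3 := mul_exp_le (t := t) hk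
    have b4 : Real.exp (-(8 * s)⁻¹ * t) ≤ Real.exp (-((8 * s)⁻¹ / 2) * t) :=
      Real.exp_le_exp.2 (by nlinarith [mul_nonneg hk.le ht0])
    calc G r x y * |t / (4 * r ^ 2) - 1 / r|
        ≤ ((2 * Real.pi * s)⁻¹ * Real.exp (-(8 * s)⁻¹ * t)) * (1 / s ^ 2 * t + 2 / s) := by
          gcongr
      _ = (2 * Real.pi * s)⁻¹ * (1 / s ^ 2 * (t * Real.exp (-(8 * s)⁻¹ * t)) +
          2 / s * Real.exp (-(8 * s)⁻¹ * t)) := by ring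
      _ ≤ (2 * Real.pi * s)⁻¹ * (1 / s ^ 2 * (2 / (8 * s)⁻¹ * Real.exp (-((8 * s)⁻¹ / 2) * t)) +
          2 / s * Real.exp (-((8 * s)⁻¹ / 2) * t)) := by gcongr
      _ = C * gw ((8 * s)⁻¹ / 2) x y := by rw [hC]; unfold gw; ring
  · exact (G_hasDerivAt (by linarith [hr.1]) x y).const_mul (F y)

theorem sq_mul_G_le {s : ℝ} (hs : 0 < s) (x y : Plane) :
    ‖y - x‖ ^ 2 * G s x y ≤ 16 * s * G (2 * s) x y := by
  have hpi := Real.pi_pos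
  have := mul_exp_le (k := (4 * s)⁻¹) (t := ‖y - x‖ ^ 2) (by positivity)
  unfold G gw
  have e : (4 * s)⁻¹ / 2 = (4 * (2 * s))⁻¹ := by field_simp
  rw [e] at this
  calc _ = (4 * Real.pi * s)⁻¹ * (‖y - x‖ ^ 2 * Real.exp (-(4 * s)⁻¹ * ‖y - x‖ ^ 2)) := by ring
    _ ≤ (4 * Real.pi * s)⁻¹ * (2 / (4 * s)⁻¹ * Real.exp (-(4 * (2 * s))⁻¹ * ‖y - x‖ ^ 2)) := by
      gcongr
    _ = _ := by field_simp; ring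

/-- Mass of the heat kernel away from the centre. -/
theorem heat_tendsto {F : Plane → ℝ} (hm : AEStronglyMeasurable F) {K : ℝ} (hK : ∀ y, |F y| ≤ K)
    {x : Plane} (hc : ContinuousAt F x) : Tendsto (fun s => heat F s x) (𝓝[>] 0) (𝓝 (F x)) := by
  have hK0 : 0 ≤ K := (abs_nonneg _).trans (hK x)
  rw [Metric.tendsto_nhds]
  intro e he
  obtain ⟨d, hd, hdd⟩ := Metric.continuousAt_iff.1 hc (e / 2) (by positivity)
  have hpos : 0 < e * d ^ 2 / (64 * (K + 1)) := by positivity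
  filter_upwards [Ioo_mem_nhdsGT hpos] with s hs
  have hs0 := hs.1
  have h1 : heat F s x - F x = ∫ y, (F y - F x) * G s x y := by
    have : F x = ∫ y, F x * G s x y := by rw [integral_const_mul, integral_G hs0, mul_one]
    conv_lhs => rw [this]
    rw [heat, ← integral_sub ((GaussInt.of_bdd hm hK).mul_G hs0 x)
      ((integrable_G hs0 x).const_mul _)]
    congr 1; ext y; ring
  have h2 : ∀ y, ‖(F y - F x) * G s x y‖ ≤ e / 2 * G s x y +
      2 * K / d ^ 2 * (16 * s * G (2 * s) x y) := by
    intro y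
    have hg := G_pos hs0 x y
    have hg2 := G_pos (by linarith : 0 < 2 * s) x y
    rw [norm_mul, Real.norm_eq_abs (G s x y), abs_of_pos hg]
    by_cases hy : dist y x < d
    · have := hdd hy
      rw [Real.dist_eq] at this
      have h3 : 0 ≤ 2 * K / d ^ 2 * (16 * s * G (2 * s) x y) := by positivity
      rw [Real.norm_eq_abs]
      nlinarith
    · have hd1 : d ^ 2 ≤ ‖y - x‖ ^ 2 := by
        rw [← dist_eq_norm]; gcongr; exact not_lt.1 hy
      have h3 : ‖F y - F x‖ ≤ 2 * K := by
        rw [Real.norm_eq_abs]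
        exact (abs_sub _ _).trans (by linarith [hK y, hK x])
      have h4 := sq_mul_G_le hs0 x y
      have h5 : G s x y ≤ 1 / d ^ 2 * (16 * s * G (2 * s) x y) := by
        rw [one_div, ← div_eq_inv_mul, le_div_iff₀ (by positivity)]
        nlinarith
      calc ‖F y - F x‖ * G s x y ≤ 2 * K * (1 / d ^ 2 * (16 * s * G (2 * s) x y)) := by gcongr
        _ = 0 + 2 * K / d ^ 2 * (16 * s * G (2 * s) x y) := by ring
        _ ≤ _ := by gcongr; positivity
  rw [Real.dist_eq, h1]
  have hi1 := (integrable_G hs0 x).const_mul (e / 2)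
  have hi2 := ((integrable_G (by linarith : 0 < 2 * s) x).const_mul (16 * s)).const_mul
    (2 * K / d ^ 2)
  have h6 := norm_integral_le_of_norm_le (hi1.add hi2) (ae_of_all _ h2)
  rw [Real.norm_eq_abs] at h6
  refine h6.trans_lt ?_
  simp only [Pi.add_apply]
  rw [integral_add hi1 hi2, integral_const_mul, integral_const_mul, integral_const_mul,
    integral_G hs0, integral_G (by linarith)]
  have h7 := hs.2
  rw [lt_div_iff₀ (by positivity)] at h7
  have h8 : 2 * K / d ^ 2 * (16 * s * 1) < e / 2 := by
    rw [div_mul_eq_mul_div, div_lt_iff₀ (by positivity)]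
    nlinarith
  linarith

theorem ofReal_sq_sub_le {F : Plane → ℝ} (hF : Differentiable ℝ F) (x z : Plane) :
    ENNReal.ofReal ((F (x + z) - F x) ^ 2) ≤
      ∫⁻ t in Ioc (0 : ℝ) 1, ENNReal.ofReal (‖z‖ ^ 2 * gradSqR F (x + t • z)) := by
  by_cases hfin : (∫⁻ t in Ioc (0 : ℝ) 1, ENNReal.ofReal (‖z‖ ^ 2 * gradSqR F (x + t • z))) = ⊤
  · rw [hfin]; exact le_top
  have hmm : Measurable fun t : ℝ => x + t • z := by fun_prop
  have hm : Measurable fun t : ℝ => ‖z‖ ^ 2 * gradSqR F (x + t • z) :=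
    ((measurable_gradSqR F).comp hmm).const_mul _
  have h0 : ∀ t : ℝ, 0 ≤ ‖z‖ ^ 2 * gradSqR F (x + t • z) := fun t =>
    mul_nonneg (sq_nonneg _) (gradSqR_nonneg _ _)
  have hi : IntegrableOn (fun t : ℝ => ‖z‖ ^ 2 * gradSqR F (x + t • z)) (Ioc 0 1) :=
    (lintegral_ofReal_ne_top_iff_integrable hm.aestronglyMeasurable (ae_of_all _ h0)).1 hfin
  have hd : ∀ t : ℝ, HasDerivAt (fun t : ℝ => F (x + t • z)) (fderiv ℝ F (x + t • z) z) t := by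
    intro t
    have h1 : HasDerivAt (fun t : ℝ => x + t • z) z t := by
      simpa using ((hasDerivAt_id t).smul_const z).const_add x
    exact (hF (x + t • z)).hasFDerivAt.comp_hasDerivAt t h1
  have hdm : Measurable fun t : ℝ => fderiv ℝ F (x + t • z) z :=
    (measurable_fderiv_apply_const ℝ F z).comp hmm
  have hle : ∀ t : ℝ, (fderiv ℝ F (x + t • z) z) ^ 2 ≤ ‖z‖ ^ 2 * gradSqR F (x + t • z) := by
    intro t
    rw [gradSqR_eq, ← mul_pow, ← sq_abs, mul_comm]
    gcongr
    exact (fderiv ℝ F (x + t • z)).le_opNorm z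
  have hsq : IntegrableOn (fun t : ℝ => (fderiv ℝ F (x + t • z) z) ^ 2) (Ioc 0 1) :=
    hi.mono' (hdm.pow_const 2).aestronglyMeasurable (ae_of_all _ fun t => by
      rw [Real.norm_of_nonneg (sq_nonneg _)]; exact hle t)
  have h1sq : IntegrableOn (fun _ : ℝ => (1 : ℝ) ^ 2) (Ioc 0 1) := by simp
  have hfi : IntegrableOn (fun t : ℝ => fderiv ℝ F (x + t • z) z) (Ioc 0 1) := by
    simpa [IntegrableOn] using integrable_mul_of_sq hdm.aestronglyMeasurable
        aestronglyMeasurable_const hsq h1sq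
  have hftc := intervalIntegral.integral_eq_sub_of_hasDerivAt (a := 0) (b := 1)
    (fun t _ => hd t) ((intervalIntegrable_iff_integrableOn_Ioc_of_le zero_le_one).2 hfi)
  rw [intervalIntegral.integral_of_le zero_le_one] at hftc
  simp only [one_smul, zero_smul, add_zero] at hftc
  rw [← hftc, ← ofReal_integral_eq_lintegral_ofReal hi (ae_of_all _ h0)]
  apply ENNReal.ofReal_le_ofReal
  have hcs := sq_integral_mul_le hdm.aestronglyMeasurable aestronglyMeasurable_const hsq h1sq
  simp only [mul_one, one_pow, integral_const, MeasurableSet.univ, measureReal_restrict_apply,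
    univ_inter, Real.volume_real_Ioc, sub_zero, smul_eq_mul, max_eq_left zero_le_one] at hcs
  exact hcs.trans (integral_mono hsq hi hle)

theorem lintegral_sq_sub_le {F : Plane → ℝ} (hF : H1R F) (z : Plane) :
    ∫⁻ x, ENNReal.ofReal ((F (x + z) - F x) ^ 2) ≤
      ENNReal.ofReal (‖z‖ ^ 2 * ∫ x, gradSqR F x) := by
  have hm : Measurable fun p : Plane × ℝ => ENNReal.ofReal (‖z‖ ^ 2 * gradSqR F (p.1 + p.2 • z)) :=
    (((measurable_gradSqR F).comp (by fun_prop)).const_mul _).ennreal_ofReal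
  calc _ ≤ ∫⁻ x, ∫⁻ t in Ioc (0 : ℝ) 1, ENNReal.ofReal (‖z‖ ^ 2 * gradSqR F (x + t • z)) :=
        lintegral_mono fun x => ofReal_sq_sub_le hF.1 x z
    _ = ∫⁻ t in Ioc (0 : ℝ) 1, ∫⁻ x, ENNReal.ofReal (‖z‖ ^ 2 * gradSqR F (x + t • z)) :=
        lintegral_lintegral_swap hm.aemeasurable
    _ = ∫⁻ t in Ioc (0 : ℝ) 1, ENNReal.ofReal (‖z‖ ^ 2 * ∫ x, gradSqR F x) := by
        refine lintegral_congr fun t => ?_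
        rw [lintegral_add_right_eq_self (fun x => ENNReal.ofReal (‖z‖ ^ 2 * gradSqR F x)),
          ← integral_const_mul, ofReal_integral_eq_lintegral_ofReal (hF.2.2.const_mul _)
            (ae_of_all _ fun x => mul_nonneg (sq_nonneg _) (gradSqR_nonneg _ _))]
    _ = _ := by simp

theorem G_add (s : ℝ) (x z : Plane) : G s x (x + z) = G s 0 z := by simp [G, gw]

theorem sq_integral_mul_G_le {f : Plane → ℝ} (hm : AEStronglyMeasurable f) {s : ℝ} (hs : 0 < s)
    (x : Plane) (hf : Integrable fun y => f y ^ 2 * G s x y) :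
    (∫ y, f y * G s x y) ^ 2 ≤ ∫ y, f y ^ 2 * G s x y := by
  have hg : ∀ y, Real.sqrt (G s x y) ^ 2 = G s x y := fun y => Real.sq_sqrt (G_pos hs x y).le
  have hgm : Continuous fun y => Real.sqrt (G s x y) := (continuous_G s x).sqrt
  have := sq_integral_mul_le (f := fun y => f y * Real.sqrt (G s x y))
    (g := fun y => Real.sqrt (G s x y)) (hm.mul hgm.aestronglyMeasurable) hgm.aestronglyMeasurable
    (by simpa only [mul_pow, hg] using hf) (by simpa only [hg] using integrable_G hs x)
  simp only [mul_pow, hg, integral_G hs, mul_one, mul_assoc, ← pow_two] at this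
  exact this

theorem measurable_heat {F : Plane → ℝ} (hF : Measurable F) (s : ℝ) : Measurable (heat F s) := by
  have hG : Continuous fun p : Plane × Plane => G s p.1 p.2 := by
    unfold G gw; fun_prop
  have : StronglyMeasurable fun p : Plane × Plane => F p.2 * G s p.1 p.2 :=
    ((hF.comp measurable_snd).mul hG.measurable).stronglyMeasurable
  exact this.integral_prod_right'.measurable

theorem abs_heat_le {F : Plane → ℝ} {K : ℝ} (hK : ∀ y, |F y| ≤ K) {s : ℝ} (hs : 0 < s) (x : Plane) :
    |heat F s x| ≤ K := by
  have := norm_integral_le_of_norm_le (f := fun y => F y * G s x y)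
    ((integrable_G hs x).const_mul K) (ae_of_all _ fun y => by
      rw [norm_mul, Real.norm_of_nonneg (G_pos hs x y).le]
      exact mul_le_mul_of_nonneg_right (hK y) (G_pos hs x y).le)
  rwa [integral_const_mul, integral_G hs, mul_one] at this

theorem heat_approx {F : Plane → ℝ} (hF : H1R F) {K : ℝ} (hK : ∀ y, |F y| ≤ K) {s : ℝ}
    (hs : 0 < s) : Integrable (fun x => (F x - heat F s x) ^ 2) ∧
      ∫ x, (F x - heat F s x) ^ 2 ≤ 16 * s * ∫ x, gradSqR F x := by
  have hFm := hF.1.meas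
  have hA : 0 ≤ ∫ x, gradSqR F x := integral_nonneg fun x => gradSqR_nonneg _ _
  have hpt : ∀ x, ENNReal.ofReal ((F x - heat F s x) ^ 2) ≤
      ∫⁻ z, ENNReal.ofReal ((F (x + z) - F x) ^ 2) * ENNReal.ofReal (G s 0 z) := by
    intro x
    have hb : ∀ y, |F y - F x| ≤ 2 * K := fun y => by
      have := abs_sub (F y) (F x); linarith [hK y, hK x]
    have hi2 : Integrable fun y => (F y - F x) ^ 2 * G s x y :=
      GaussInt.mul_G (GaussInt.of_bdd ((hFm.sub_const _).pow_const 2).aestronglyMeasurable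
        (K := (2 * K) ^ 2) fun y => by
          rw [abs_pow]; exact pow_le_pow_left₀ (abs_nonneg _) (hb y) 2) hs x
    have e : heat F s x - F x = ∫ y, (F y - F x) * G s x y := by
      have h1 : F x = ∫ y, F x * G s x y := by rw [integral_const_mul, integral_G hs, mul_one]
      conv_lhs => rw [h1]
      rw [heat, ← integral_sub ((GaussInt.of_bdd hFm.aestronglyMeasurable hK).mul_G hs x)
        ((integrable_G hs x).const_mul _)]
      congr 1; ext y; ring
    rw [← neg_sub (heat F s x), neg_sq, e]
    refine (ENNReal.ofReal_le_ofReal (sq_integral_mul_G_le (hFm.sub_const _).aestronglyMeasurable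
      hs x hi2)).trans ?_
    rw [ofReal_integral_eq_lintegral_ofReal hi2
      (ae_of_all _ fun y => mul_nonneg (sq_nonneg _) (G_pos hs x y).le),
      ← lintegral_add_left_eq_self _ x]
    refine lintegral_mono fun z => ?_
    rw [G_add, ENNReal.ofReal_mul (sq_nonneg _)]
  have hm : Measurable fun p : Plane × Plane =>
      ENNReal.ofReal ((F (p.1 + p.2) - F p.1) ^ 2) * ENNReal.ofReal (G s 0 p.2) := by
    refine Measurable.mul ?_ ((continuous_G s 0).measurable.comp measurable_snd).ennreal_ofReal
    exact (((hFm.comp (by fun_prop)).sub (hFm.comp measurable_fst)).pow_const 2).ennreal_ofReal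
  have hl : ∫⁻ x, ENNReal.ofReal ((F x - heat F s x) ^ 2) ≤
      ENNReal.ofReal (16 * s * ∫ x, gradSqR F x) := by
    calc _ ≤ ∫⁻ x, ∫⁻ z, ENNReal.ofReal ((F (x + z) - F x) ^ 2) * ENNReal.ofReal (G s 0 z) :=
          lintegral_mono hpt
      _ = ∫⁻ z, ∫⁻ x, ENNReal.ofReal ((F (x + z) - F x) ^ 2) * ENNReal.ofReal (G s 0 z) :=
          lintegral_lintegral_swap hm.aemeasurable
      _ ≤ ∫⁻ z, ENNReal.ofReal (16 * s * (∫ x, gradSqR F x) * G (2 * s) 0 z) := by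
          refine lintegral_mono fun z => ?_
          rw [lintegral_mul_const' _ _ ENNReal.ofReal_ne_top]
          refine (mul_le_mul_left (lintegral_sq_sub_le hF z) _).trans ?_
          rw [← ENNReal.ofReal_mul (by positivity)]
          refine ENNReal.ofReal_le_ofReal ?_
          have := sq_mul_G_le hs 0 z
          rw [sub_zero] at this
          nlinarith
      _ = _ := by
          rw [← ofReal_integral_eq_lintegral_ofReal ((integrable_G (by linarith) 0).const_mul _)
            (ae_of_all _ fun z => mul_nonneg (by positivity) (G_pos (by linarith) _ _).le),
            integral_const_mul, integral_G (by linarith), mul_one]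
  have hmm := ((hFm.sub (measurable_heat hFm s)).pow_const 2)
  have hi : Integrable (fun x => (F x - heat F s x) ^ 2) :=
    (lintegral_ofReal_ne_top_iff_integrable hmm.aestronglyMeasurable
      (ae_of_all _ fun _ => sq_nonneg _)).1 (ne_top_of_le_ne_top ENNReal.ofReal_ne_top hl)
  refine ⟨hi, ?_⟩
  rw [← ofReal_integral_eq_lintegral_ofReal hi (ae_of_all _ fun _ => sq_nonneg _)] at hl
  exact (ENNReal.ofReal_le_ofReal_iff (by positivity)).1 hl

section L2
variable {X : Type*} [MeasurableSpace X] {μ : Measure X}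

theorem norm_toLp_sq {f : X → ℝ} (hf : MemLp f 2 μ) : ‖hf.toLp f‖ ^ 2 = ∫ x, f x ^ 2 ∂μ := by
  rw [← real_inner_self_eq_norm_sq, L2.inner_def]
  refine integral_congr_ae ?_
  filter_upwards [hf.coeFn_toLp] with x hx
  rw [hx, real_inner_self_eq_norm_sq, Real.norm_eq_abs, sq_abs]

theorem exists_ae_limit_of_cauchy {f : ℕ → X → ℝ} (hf : ∀ n, MemLp (f n) 2 μ)
    (h : Tendsto (fun p : ℕ × ℕ => ∫ x, (f p.1 x - f p.2 x) ^ 2 ∂μ) atTop (𝓝 0)) :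
    ∃ φ : ℕ → ℕ, StrictMono φ ∧ ∃ U : X → ℝ, ∀ᵐ x ∂μ,
      Tendsto (fun n => f (φ n) x) atTop (𝓝 (U x)) := by
  have hc : CauchySeq fun n => (hf n).toLp (f n) := by
    rw [cauchySeq_iff_tendsto_dist_atTop_0]
    have : ∀ p : ℕ × ℕ, dist ((hf p.1).toLp (f p.1)) ((hf p.2).toLp (f p.2)) =
        Real.sqrt (∫ x, (f p.1 x - f p.2 x) ^ 2 ∂μ) := by
      intro p
      rw [dist_eq_norm, ← MemLp.toLp_sub]
      rw [← Real.sqrt_sq (norm_nonneg _), norm_toLp_sq]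
      rfl
    simp only [this]
    simpa using h.sqrt
  obtain ⟨U, hU⟩ := cauchySeq_tendsto_of_complete hc
  obtain ⟨φ, hφ, hae⟩ := (tendstoInMeasure_of_tendsto_Lp hU).exists_seq_tendsto_ae
  refine ⟨φ, hφ, U, ?_⟩
  filter_upwards [hae, ae_all_iff.2 fun n => (hf n).coeFn_toLp] with x hx hx2
  simpa only [hx2] using hx

end L2

/-- Bounded sequences in `L²` have weakly convergent subsequences. -/
theorem exists_weak_subseq {f : ℕ → Plane → ℝ} (hfm : ∀ n, AEStronglyMeasurable (f n))
    (hf : ∀ n, Integrable fun x => f n x ^ 2) {m : ℝ} (hm : ∀ n, ∫ x, f n x ^ 2 ≤ m) :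
    ∃ φ : ℕ → ℕ, StrictMono φ ∧ ∀ g : Plane → ℝ, AEStronglyMeasurable g →
      (Integrable fun x => g x ^ 2) →
      ∃ l, Tendsto (fun n => ∫ x, f (φ n) x * g x) atTop (𝓝 l) := by
  have : Fact ((2 : ENNReal) ≠ ⊤) := ⟨by simp⟩
  have hL : ∀ n, MemLp (f n) 2 := fun n => (memLp_two_iff_integrable_sq (hfm n)).2 (hf n)
  let T : ℕ → WeakDual ℝ (Lp ℝ 2 (volume : Measure Plane)) := fun n =>
    StrongDual.toWeakDual (InnerProductSpace.toDual ℝ _ ((hL n).toLp (f n)))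
  have hT : ∀ n, T n ∈ (WeakDual.toStrongDual ⁻¹' Metric.closedBall
      (0 : StrongDual ℝ (Lp ℝ 2 (volume : Measure Plane))) (Real.sqrt m)) := by
    intro n
    rw [mem_preimage, mem_closedBall_zero_iff]
    change ‖InnerProductSpace.toDual ℝ _ ((hL n).toLp (f n))‖ ≤ _
    rw [LinearIsometryEquiv.norm_map]
    apply Real.le_sqrt_of_sq_le
    rw [norm_toLp_sq]; exact hm n
  obtain ⟨a, -, φ, hφ, ha⟩ := WeakDual.isSeqCompact_closedBall ℝ _ 0 (Real.sqrt m) hT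
  refine ⟨φ, hφ, fun g hgm hg => ?_⟩
  have hgL : MemLp g 2 := (memLp_two_iff_integrable_sq hgm).2 hg
  refine ⟨a (hgL.toLp g), ?_⟩
  refine (((WeakDual.eval_continuous (hgL.toLp g)).tendsto a).comp ha).congr fun n => ?_
  change inner ℝ ((hL (φ n)).toLp (f (φ n))) (hgL.toLp g) = _
  rw [L2.inner_def]
  refine integral_congr_ae ?_
  filter_upwards [(hL (φ n)).coeFn_toLp, hgL.coeFn_toLp] with x h1 h2
  rw [h1, h2]; simp [mul_comm]

theorem sq_sub_le_three (a b c d : ℝ) :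
    (a - b) ^ 2 ≤ 3 * (a - c) ^ 2 + 3 * (b - d) ^ 2 + 3 * (c - d) ^ 2 := by
  nlinarith [sq_nonneg ((a - c) + (b - d)), sq_nonneg ((a - c) - (c - d)),
    sq_nonneg ((b - d) + (c - d))]

/-- Local compactness of bounded sequences in `H¹`. -/
theorem exists_ae_subseq {f : ℕ → Plane → ℝ} {K A m : ℝ} (hf : ∀ n, H1R (f n))
    (h0 : ∀ n x, 0 ≤ f n x) (hK : ∀ n x, f n x ≤ K) (hA : ∀ n, ∫ x, gradSqR (f n) x ≤ A)
    (hm : ∀ n, ∫ x, f n x ^ 2 ≤ m) :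
    ∃ φ : ℕ → ℕ, StrictMono φ ∧ ∃ W : Plane → ℝ, Measurable W ∧ (∀ x, 0 ≤ W x) ∧ (∀ x, W x ≤ K) ∧
      ∀ᵐ x, Tendsto (fun n => f (φ n) x) atTop (𝓝 (W x)) := by
  have hK0 : 0 ≤ K := (h0 0 0).trans (hK 0 0)
  have hA0 : 0 ≤ A := (integral_nonneg fun x => gradSqR_nonneg (f 0) x).trans (hA 0)
  have habs : ∀ n x, |f n x| ≤ K := fun n x => by rw [abs_of_nonneg (h0 n x)]; exact hK n x
  obtain ⟨φ, hφ, hw⟩ := exists_weak_subseq (fun n => (hf n).1.meas.aestronglyMeasurable)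
    (fun n => (hf n).2.1) hm
  have hheat : ∀ s, 0 < s → ∀ x, ∃ l, Tendsto (fun n => heat (f (φ n)) s x) atTop (𝓝 l) :=
    fun s hs x => hw (G s x) (continuous_G s x).aestronglyMeasurable (integrable_G_sq hs x)
  set g : Plane → ℝ := gw 1 0 with hg
  have hg1 : ∀ x, g x ^ 2 ≤ 1 := fun x => by
    rw [hg, gw_sq]; exact gw_le_one (by norm_num) _ _
  have hgi : Integrable fun x => g x ^ 2 := by
    simp only [hg, gw_sq]; exact integrable_gw (by norm_num) _
  have hgm : Continuous g := continuous_gw 1 0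
  have hmem : ∀ n, MemLp (fun x => f (φ n) x * g x) 2 := fun n => by
    have hmm := ((hf (φ n)).1.meas.mul hgm.measurable).aestronglyMeasurable (μ := volume)
    refine (memLp_two_iff_integrable_sq hmm).2 ((hf (φ n)).2.1.mono' (hmm.pow 2)
      (ae_of_all _ fun x => ?_))
    change ‖(f (φ n) x * g x) ^ 2‖ ≤ _
    rw [Real.norm_of_nonneg (sq_nonneg _), mul_pow]
    exact mul_le_of_le_one_right (sq_nonneg _) (hg1 x)
  have hcau : Tendsto (fun p : ℕ × ℕ => ∫ x, (f (φ p.1) x * g x - f (φ p.2) x * g x) ^ 2)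
      atTop (𝓝 0) := by
    rw [Metric.tendsto_nhds]
    intro e he
    set s := e / (200 * (A + 1)) with hs
    have hs0 : 0 < s := by positivity
    have hsA : s * A < e / 200 := by
      have : s * (A + 1) = e / 200 := by rw [hs]; field_simp
      nlinarith
    have hd : Tendsto (fun p : ℕ × ℕ => ∫ x,
        (heat (f (φ p.1)) s x - heat (f (φ p.2)) s x) ^ 2 * g x ^ 2) atTop (𝓝 0) := by
      have := tendsto_integral_filter_of_dominated_convergence (μ := (volume : Measure Plane))
        (l := (atTop : Filter (ℕ × ℕ)))
        (F := fun p x => (heat (f (φ p.1)) s x - heat (f (φ p.2)) s x) ^ 2 * g x ^ 2)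
        (f := fun _ => 0) (fun x => (2 * K) ^ 2 * g x ^ 2)
        (Eventually.of_forall fun p => ((((measurable_heat (hf _).1.meas s).sub
          (measurable_heat (hf _).1.meas s)).pow_const 2).mul
            (hgm.measurable.pow_const 2)).aestronglyMeasurable)
        (Eventually.of_forall fun p => ae_of_all _ fun x => by
          rw [Real.norm_of_nonneg (by positivity), ← sq_abs (_ - _)]
          gcongr
          have h1 := abs_heat_le (habs (φ p.1)) hs0 x
          have h2 := abs_heat_le (habs (φ p.2)) hs0 x
          exact (abs_sub _ _).trans (by linarith))
        (hgi.const_mul _)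
        (ae_of_all _ fun x => by
          obtain ⟨l, hl⟩ := hheat s hs0 x
          rw [← prod_atTop_atTop_eq]
          have := (((hl.comp tendsto_fst).sub (hl.comp tendsto_snd)).pow 2).mul_const (g x ^ 2)
          simpa using this)
      simpa using this
    filter_upwards [(Metric.tendsto_nhds.1 hd) (e / 6) (by positivity)] with p hp
    rw [Real.dist_eq, sub_zero, abs_of_nonneg (integral_nonneg fun x => by positivity)] at hp ⊢
    obtain ⟨i1, b1⟩ := heat_approx (hf (φ p.1)) (habs _) hs0
    obtain ⟨i2, b2⟩ := heat_approx (hf (φ p.2)) (habs _) hs0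
    have i3 : Integrable fun x => (heat (f (φ p.1)) s x - heat (f (φ p.2)) s x) ^ 2 * g x ^ 2 := by
      refine (hgi.const_mul ((2 * K) ^ 2)).mono' ((((measurable_heat (hf _).1.meas s).sub
          (measurable_heat (hf _).1.meas s)).pow_const 2).mul
            (hgm.measurable.pow_const 2)).aestronglyMeasurable (ae_of_all _ fun x => ?_)
      rw [Real.norm_of_nonneg (by positivity), ← sq_abs (_ - _)]
      gcongr
      have h1 := abs_heat_le (habs (φ p.1)) hs0 x
      have h2 := abs_heat_le (habs (φ p.2)) hs0 x
      exact (abs_sub _ _).trans (by linarith)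
    have i4 := ((i1.const_mul 3).fun_add (i2.const_mul 3)).fun_add (i3.const_mul 3)
    have hpt : ∀ x, (f (φ p.1) x * g x - f (φ p.2) x * g x) ^ 2 ≤
        3 * (f (φ p.1) x - heat (f (φ p.1)) s x) ^ 2 +
        3 * (f (φ p.2) x - heat (f (φ p.2)) s x) ^ 2 +
        3 * ((heat (f (φ p.1)) s x - heat (f (φ p.2)) s x) ^ 2 * g x ^ 2) := by
      intro x
      have h3 := sq_sub_le_three (f (φ p.1) x) (f (φ p.2) x) (heat (f (φ p.1)) s x)
        (heat (f (φ p.2)) s x)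
      have h4 := hg1 x
      have h5 : 0 ≤ g x ^ 2 := sq_nonneg _
      rw [← sub_mul, mul_pow]
      have h6 := mul_le_mul_of_nonneg_right h3 h5
      have h7 := mul_le_mul_of_nonneg_left h4 (sq_nonneg (f (φ p.1) x - heat (f (φ p.1)) s x))
      have h8 := mul_le_mul_of_nonneg_left h4 (sq_nonneg (f (φ p.2) x - heat (f (φ p.2)) s x))
      nlinarith
    have hle := integral_mono_of_nonneg (ae_of_all _ fun x => sq_nonneg
      (f (φ p.1) x * g x - f (φ p.2) x * g x)) i4 (ae_of_all _ hpt)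
    rw [integral_add ((i1.const_mul 3).fun_add (i2.const_mul 3)) (i3.const_mul 3),
      integral_add (i1.const_mul 3) (i2.const_mul 3), integral_const_mul, integral_const_mul,
      integral_const_mul] at hle
    have b1' := b1.trans (mul_le_mul_of_nonneg_left (hA (φ p.1)) (by positivity))
    have b2' := b2.trans (mul_le_mul_of_nonneg_left (hA (φ p.2)) (by positivity))
    nlinarith
  obtain ⟨ψ, hψ, U, hU⟩ := exists_ae_limit_of_cauchy hmem hcau
  have hae : ∀ᵐ x, Tendsto (fun n => f (φ (ψ n)) x) atTop (𝓝 (U x / g x)) := by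
    filter_upwards [hU] with x hx
    have hgx : g x ≠ 0 := (gw_pos _ _ _).ne'
    refine (hx.div_const (g x)).congr fun n => ?_
    field_simp
  obtain ⟨W, hWm, hW⟩ := measurable_limit_of_tendsto_metrizable_ae (μ := volume) (L := atTop)
    (f := fun n => f (φ (ψ n))) (fun n => (hf _).1.meas.aemeasurable)
    (by filter_upwards [hae] with x hx using ⟨_, hx⟩)
  refine ⟨φ ∘ ψ, hφ.comp hψ, fun x => max 0 (min (W x) K), by fun_prop, fun x => le_max_left _ _,
    fun x => max_le hK0 (min_le_right _ _), ?_⟩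
  filter_upwards [hW] with x hx
  have h1 : 0 ≤ W x := ge_of_tendsto' hx fun n => h0 _ _
  have h2 : W x ≤ K := le_of_tendsto' hx fun n => hK _ _
  rw [min_eq_left h2, max_eq_right h1]; exact hx

/-- The profile `(1 + (kt)²)^{-1/2}` of the inner localization function. -/
def cutIn (k t : ℝ) : ℝ := (Real.sqrt (1 + (k * t) ^ 2))⁻¹

theorem cutIn_pos (k t : ℝ) : 0 < cutIn k t := by unfold cutIn; positivity

theorem cutIn_sq (k t : ℝ) : cutIn k t ^ 2 = (1 + (k * t) ^ 2)⁻¹ := by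
  unfold cutIn; rw [inv_pow, Real.sq_sqrt (by positivity)]

theorem cutIn_sq_add (k t : ℝ) : cutIn k t ^ 2 + (k * t * cutIn k t) ^ 2 = 1 := by
  rw [mul_pow, cutIn_sq]; field_simp

theorem cutIn_le_one (k t : ℝ) : cutIn k t ≤ 1 := by
  nlinarith [cutIn_pos k t, cutIn_sq_add k t, sq_nonneg (k * t * cutIn k t)]

theorem cutIn_hasDerivAt (k t : ℝ) :
    HasDerivAt (cutIn k) (-(k ^ 2 * t * cutIn k t ^ 3)) t := by
  have h1 : HasDerivAt (fun t : ℝ => 1 + (k * t) ^ 2) (2 * (k * t) * k) t := by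
    have := (((hasDerivAt_id' t).const_mul k).pow 2).const_add 1
    exact this.congr_deriv (by simp)
  have h2 := (h1.sqrt (by positivity)).fun_inv (by positivity)
  refine h2.congr_deriv ?_
  unfold cutIn
  have : Real.sqrt (1 + (k * t) ^ 2) ≠ 0 := by positivity
  field_simp

theorem cutOut_hasDerivAt (k t : ℝ) :
    HasDerivAt (fun t => k * t * cutIn k t) (k * cutIn k t ^ 3) t := by
  refine (((hasDerivAt_id' t).const_mul k).fun_mul (cutIn_hasDerivAt k t)).congr_deriv ?_
  have h : cutIn k t = cutIn k t * (cutIn k t ^ 2 + (k * t * cutIn k t) ^ 2) := by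
    rw [cutIn_sq_add, mul_one]
  linear_combination k * h

/-- The weight `(1 + (k‖x‖²)²)⁻¹`. -/
def cwt (k : ℝ) (x : Plane) : ℝ := (1 + (k * ‖x‖ ^ 2) ^ 2)⁻¹

theorem cwt_pos (k : ℝ) (x : Plane) : 0 < cwt k x := by unfold cwt; positivity

theorem cwt_le_one (k : ℝ) (x : Plane) : cwt k x ≤ 1 := by
  unfold cwt; apply inv_le_one_of_one_le₀; nlinarith [sq_nonneg (k * ‖x‖ ^ 2)]

theorem continuous_cwt (k : ℝ) : Continuous (cwt k) := by
  unfold cwt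
  exact Continuous.inv₀ (by fun_prop) fun x => by positivity

theorem integrable_cwt {k : ℝ} (hk : 0 < k) : Integrable (cwt k) := by
  have h := integrable_rpow_neg_one_add_norm_sq (E := Plane) (μ := volume) (r := 4)
      (by simp; norm_num)
  refine (h.const_mul (2 + 2 / k ^ 2)).mono' (continuous_cwt k).aestronglyMeasurable
    (ae_of_all _ fun x => ?_)
  rw [Real.norm_of_nonneg (cwt_pos k x).le]
  have e : ((1 : ℝ) + ‖x‖ ^ 2) ^ (-(4 : ℝ) / 2) = ((1 + ‖x‖ ^ 2) ^ 2)⁻¹ := by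
    rw [show (-(4 : ℝ) / 2) = -((2 : ℕ) : ℝ) by norm_num, Real.rpow_neg (by positivity),
      Real.rpow_natCast]
  rw [e, cwt, ← div_eq_mul_inv, le_div_iff₀ (by positivity), inv_mul_le_iff₀ (by positivity)]
  set t := ‖x‖ ^ 2
  have h1 : (1 + (k * t) ^ 2) * (2 + 2 / k ^ 2) = 2 + 2 * t ^ 2 +
      (2 * k ^ 2 * t ^ 2 + 2 / k ^ 2) := by
    field_simp; ring
  rw [h1]
  have : 0 ≤ 2 * k ^ 2 * t ^ 2 + 2 / k ^ 2 := by positivity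
  nlinarith [sq_nonneg (1 - t)]

theorem cwt_tendsto (x : Plane) : Tendsto (fun n : ℕ => cwt (1 / ((n : ℝ) + 1)) x) atTop (𝓝 1) := by
  have h := tendsto_one_div_add_atTop_nhds_zero_nat (𝕜 := ℝ)
  have := (((h.mul_const (‖x‖ ^ 2)).pow 2).const_add 1).inv₀ (by simp)
  simpa [cwt] using this

/-- Localization of the Gagliardo--Nirenberg inequality. -/
theorem ims {s : ℝ} (hs : 0 < s) (hGN : GNIneq s) {f : Plane → ℝ} (hf : H1R f) {k : ℝ} (hk : 0 < k)
    {B : ℝ} (hB1 : ∫ x, cwt k x * f x ^ 2 ≤ B) (hB2 : (∫ x, f x ^ 2) - ∫ x, cwt k x * f x ^ 2 ≤ B) :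
    (∫ x, f x ^ 4) - 2 * (∫ x, cwt k x * (1 - cwt k x) * f x ^ 4) ≤
      2 / s * ((∫ x, gradSqR f x) + 4 * k * ∫ x, f x ^ 2) * B := by
  set χ : Plane → ℝ := fun x => cutIn k (‖x - 0‖ ^ 2) with hχ
  set ζ : Plane → ℝ := fun x => k * ‖x - 0‖ ^ 2 * cutIn k (‖x - 0‖ ^ 2) with hζ
  have hχd : Differentiable ℝ χ := differentiable_radial (cutIn_hasDerivAt k)
  have hζd : Differentiable ℝ ζ := differentiable_radial (cutOut_hasDerivAt k)
  have hc : ∀ x, χ x ^ 2 = cwt k x := fun x => by simp only [hχ, cutIn_sq, sub_zero, cwt]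
  have hc2 : ∀ x, ζ x ^ 2 = 1 - cwt k x := fun x => by
    rw [← hc, eq_sub_iff_add_eq, add_comm]; exact cutIn_sq_add k _
  have g0 : d0R χ = _ := d0R_radial (c := 0) (cutIn_hasDerivAt k)
  have g1 : d1R χ = _ := d1R_radial (c := 0) (cutIn_hasDerivAt k)
  have g2 : d0R ζ = _ := d0R_radial (c := 0) (cutOut_hasDerivAt k)
  have g3 : d1R ζ = _ := d1R_radial (c := 0) (cutOut_hasDerivAt k)
  have hχ' : ∀ x, gradSqR χ x + gradSqR ζ x ≤ 4 * k := by
    intro x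
    simp only [gradSqR, g0, g1, g2, g3]
    have ht := sqdist_coord 0 x
    set t := ‖x - 0‖ ^ 2
    have ht0 : 0 ≤ t := by positivity
    set w := cutIn k t with hw
    have hw2 : w ^ 2 + (k * t * w) ^ 2 = 1 := cutIn_sq_add k t
    have e : (-(k ^ 2 * t * w ^ 3) * (2 * (x 0 - (0 : Plane) 0))) ^ 2 +
        (-(k ^ 2 * t * w ^ 3) * (2 * (x 1 - (0 : Plane) 1))) ^ 2 +
        ((k * w ^ 3 * (2 * (x 0 - (0 : Plane) 0))) ^ 2 +
        (k * w ^ 3 * (2 * (x 1 - (0 : Plane) 1))) ^ 2) =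
        4 * k ^ 2 * t * w ^ 4 * (w ^ 2 + (k * t * w) ^ 2) := by
      linear_combination (-(4 * k ^ 4 * t ^ 2 * w ^ 6 + 4 * k ^ 2 * w ^ 6)) * ht
    rw [e, hw2, mul_one]
    have hw0 : 0 < w := cutIn_pos k t
    have hw1 : w ≤ 1 := cutIn_le_one k t
    have h1 : k * t * w ≤ 1 := by
      have : 0 ≤ k * t * w := by positivity
      nlinarith [sq_nonneg w]
    have h2 : w ^ 3 ≤ 1 := pow_le_one₀ hw0.le hw1
    have h3 : k * t * w * w ^ 3 ≤ 1 := mul_le_one₀ h1 (by positivity) h2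
    nlinarith
  have hχ1 : ∀ x, |χ x| ≤ 1 := fun x => by
    rw [← sq_le_one_iff_abs_le_one, hc]; exact cwt_le_one k x
  have hζ1 : ∀ x, |ζ x| ≤ 1 := fun x => by
    rw [← sq_le_one_iff_abs_le_one, hc2]; linarith [cwt_pos k x]
  have hA := hf.bdd_mul hχd (B := 1) (D := 4 * k) hχ1 fun x => by
    linarith [hχ' x, gradSqR_nonneg ζ x]
  have hZ := hf.bdd_mul hζd (B := 1) (D := 4 * k) hζ1 fun x => by
    linarith [hχ' x, gradSqR_nonneg χ x]
  obtain ⟨iA, bA⟩ := hGN _ hA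
  obtain ⟨iZ, bZ⟩ := hGN _ hZ
  have i4 := (hGN _ hf).1
  have hpt : ∀ x, gradSqR (fun y => χ y * f y) x + gradSqR (fun y => ζ y * f y) x ≤
      gradSqR f x + 4 * k * f x ^ 2 := by
    intro x
    have q0 : χ x * d0R χ x + ζ x * d0R ζ x = 0 := by
      rw [g0, g2]; simp only [hχ, hζ]; ring
    have q1 : χ x * d1R χ x + ζ x * d1R ζ x = 0 := by
      rw [g1, g3]; simp only [hχ, hζ]; ring
    have q2 : χ x ^ 2 + ζ x ^ 2 = 1 := by rw [hc, hc2]; ring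
    have q3 := mul_le_mul_of_nonneg_right (hχ' x) (sq_nonneg (f x))
    refine le_trans (le_of_eq ?_) (add_le_add_right q3 (gradSqR f x))
    simp only [gradSqR, d0R_mul (hχd x) (hf.1 x), d1R_mul (hχd x) (hf.1 x),
      d0R_mul (hζd x) (hf.1 x), d1R_mul (hζd x) (hf.1 x)]
    linear_combination (2 * f x * d0R f x) * q0 + (2 * f x * d1R f x) * q1 +
      (d0R f x ^ 2 + d1R f x ^ 2) * q2
  have hgrad : (∫ x, gradSqR (fun y => χ y * f y) x) + (∫ x, gradSqR (fun y => ζ y * f y) x) ≤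
      (∫ x, gradSqR f x) + 4 * k * ∫ x, f x ^ 2 := by
    rw [← integral_add hA.2.2 hZ.2.2, ← integral_const_mul,
        ← integral_add hf.2.2 (hf.2.1.const_mul _)]
    exact integral_mono (hA.2.2.add hZ.2.2) (hf.2.2.add (hf.2.1.const_mul _)) hpt
  have ic : Integrable fun x => cwt k x * f x ^ 2 := by
    simpa only [mul_pow, hc] using hA.2.1
  have mA : ∫ x, (χ x * f x) ^ 2 = ∫ x, cwt k x * f x ^ 2 := by simp only [mul_pow, hc]
  have mZ : ∫ x, (ζ x * f x) ^ 2 = (∫ x, f x ^ 2) - ∫ x, cwt k x * f x ^ 2 := by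
    rw [← integral_sub hf.2.1 ic]
    congr 1; ext x; rw [mul_pow, hc2]; ring
  have ic4 : Integrable fun x => cwt k x * (1 - cwt k x) * f x ^ 4 := by
    refine i4.bdd_mul (c := 1) (((continuous_cwt k).mul (continuous_const.sub
      (continuous_cwt k))).aestronglyMeasurable) (ae_of_all _ fun x => ?_)
    have := cwt_pos k x
    have := cwt_le_one k x
    rw [Real.norm_eq_abs, abs_le]; constructor <;> nlinarith
  have m4 : (∫ x, (χ x * f x) ^ 4) + (∫ x, (ζ x * f x) ^ 4) =
      (∫ x, f x ^ 4) - 2 * (∫ x, cwt k x * (1 - cwt k x) * f x ^ 4) := by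
    rw [← integral_add iA iZ, ← integral_const_mul, ← integral_sub i4 (ic4.const_mul 2)]
    congr 1; ext x
    have e1 : (χ x * f x) ^ 4 = (χ x ^ 2) ^ 2 * f x ^ 4 := by ring
    have e2 : (ζ x * f x) ^ 4 = (ζ x ^ 2) ^ 2 * f x ^ 4 := by ring
    rw [e1, e2, hc, hc2]; ring
  rw [mA] at bA
  rw [mZ] at bZ
  rw [← m4]
  have n1 : 0 ≤ ∫ x, gradSqR (fun y => χ y * f y) x := integral_nonneg fun x => gradSqR_nonneg _ _
  have n2 : 0 ≤ ∫ x, gradSqR (fun y => ζ y * f y) x := integral_nonneg fun x => gradSqR_nonneg _ _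
  have hB0 : 0 ≤ B := (integral_nonneg fun x => mul_nonneg (cwt_pos k x).le (sq_nonneg _)).trans hB1
  have hs2 : 0 ≤ 2 / s := by positivity
  calc _ ≤ 2 / s * (∫ x, gradSqR (fun y => χ y * f y) x) * B +
        2 / s * (∫ x, gradSqR (fun y => ζ y * f y) x) * B := by
        refine add_le_add (bA.trans ?_) (bZ.trans ?_) <;> gcongr
    _ = 2 / s * ((∫ x, gradSqR (fun y => χ y * f y) x) +
        ∫ x, gradSqR (fun y => ζ y * f y) x) * B := by ring
    _ ≤ _ := by gcongr

theorem tendsto_integral_of_ae {f : ℕ → Plane → ℝ} {W : Plane → ℝ} {K : ℝ}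
    (hfm : ∀ n, Measurable (f n)) (h0 : ∀ n x, 0 ≤ f n x) (hK : ∀ n x, f n x ≤ K)
    (hae : ∀ᵐ x, Tendsto (fun n => f n x) atTop (𝓝 (W x))) {c : Plane → ℝ} (hc : Integrable c)
    (p : ℕ) : Tendsto (fun n => ∫ x, c x * f n x ^ p) atTop (𝓝 (∫ x, c x * W x ^ p)) := by
  refine tendsto_integral_of_dominated_convergence (fun x => K ^ p * ‖c x‖)
    (fun n => hc.aestronglyMeasurable.mul ((hfm n).pow_const p).aestronglyMeasurable)
    (hc.norm.const_mul _) (fun n => ae_of_all _ fun x => ?_) ?_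
  · rw [norm_mul, norm_pow, Real.norm_of_nonneg (h0 n x), mul_comm]
    have := h0 n x
    have := hK n x
    gcongr
  · filter_upwards [hae] with x hx
    exact (hx.pow p).const_mul _

/-- Compactness of maximizing sequences for the Gagliardo--Nirenberg inequality. -/
theorem exists_strong_limit {s : ℝ} (hs : 0 < s) (hGN : GNIneq s) {f : ℕ → Plane → ℝ} {K : ℝ}
    (hf : ∀ n, H1R (f n)) (h0 : ∀ n x, 0 ≤ f n x) (hK : ∀ n x, f n x ≤ K)
    (hA : ∀ n, ∫ x, gradSqR (f n) x ≤ 1)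
    (hm : Tendsto (fun n => ∫ x, f n x ^ 2) atTop (𝓝 s))
    (h4 : Tendsto (fun n => ∫ x, f n x ^ 4) atTop (𝓝 2))
    {σ c : ℝ} (hσ : 0 < σ) (hc : 0 < c) (hlow : ∀ n, c ≤ ∫ x, G σ 0 x * f n x ^ 2) :
    ∃ φ : ℕ → ℕ, StrictMono φ ∧ ∃ W : Plane → ℝ, Measurable W ∧ (∀ x, 0 ≤ W x) ∧ (∀ x, W x ≤ K) ∧
      (∀ᵐ x, Tendsto (fun n => f (φ n) x) atTop (𝓝 (W x))) ∧ (Integrable fun x => W x ^ 2) ∧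
      ∫ x, W x ^ 2 = s ∧ Tendsto (fun n => ∫ x, (f (φ n) x - W x) ^ 2) atTop (𝓝 0) := by
  obtain ⟨m0, hm0⟩ := hm.bddAbove_range
  obtain ⟨φ, hφ, W, hWm, hW0, hWK, hae⟩ := exists_ae_subseq hf h0 hK hA
    (fun n => hm0 (mem_range_self n))
  have hm' := hm.comp hφ.tendsto_atTop
  have h4' := h4.comp hφ.tendsto_atTop
  have hfm : ∀ n, Measurable (f (φ n)) := fun n => (hf _).1.meas
  have hfat : ∀ e, 0 < e → Integrable (fun x => W x ^ 2) ∧ ∫ x, W x ^ 2 ≤ s + e := by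
    intro e he
    obtain ⟨N, hN⟩ := eventually_atTop.1 (hm'.eventually (ge_mem_nhds (by linarith : s < s + e)))
    refine fatou_real (f := fun n x => f (φ (n + N)) x ^ 2) (fun n => (hf _).2.1)
      (fun n => ae_of_all _ fun x => sq_nonneg _) ?_ (fun n => hN (n + N) (by omega))
    filter_upwards [hae] with x hx
    exact (hx.comp (tendsto_add_atTop_nat N)).pow 2
  have hWi := (hfat 1 one_pos).1
  have hWs : ∫ x, W x ^ 2 ≤ s := le_of_forall_pos_le_add fun e he => (hfat e he).2
  have hconv : ∀ {c : Plane → ℝ}, Integrable c → ∀ p : ℕ,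
      Tendsto (fun n => ∫ x, c x * f (φ n) x ^ p) atTop (𝓝 (∫ x, c x * W x ^ p)) :=
    fun hc p => tendsto_integral_of_ae hfm (fun n => h0 _) (fun n => hK _) hae hc p
  have hpos : 0 < ∫ x, W x ^ 2 := by
    refine (integral_nonneg fun x => sq_nonneg (W x)).lt_of_ne fun h => ?_
    have hz := (integral_eq_zero_iff_of_nonneg (fun x => sq_nonneg (W x)) hWi).1 h.symm
    have h1 := ge_of_tendsto' (hconv (integrable_G hσ 0) 2) fun n => hlow (φ n)
    have h2 : ∫ x, G σ 0 x * W x ^ 2 = 0 := by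
      rw [integral_eq_zero_of_ae]
      filter_upwards [hz] with x hx
      simp only [Pi.zero_apply] at hx ⊢
      rw [hx, mul_zero]
    linarith
  have habs : ∀ x, |W x| ≤ K := fun x => by rw [abs_of_nonneg (hW0 x)]; exact hWK x
  have hW4 := integrable_pow_four_of_bdd hWm.aestronglyMeasurable hWi habs
  have hk : ∀ k, 0 < k → 2 - 2 * (∫ x, cwt k x * (1 - cwt k x) * W x ^ 4) ≤
      2 / s * (1 + 4 * k * s) * max (∫ x, cwt k x * W x ^ 2) (s - ∫ x, cwt k x * W x ^ 2) := by
    intro k hk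
    have hcc : Integrable fun x => cwt k x * (1 - cwt k x) :=
      (integrable_cwt hk).mul_bdd (c := 1) ((continuous_const.sub
        (continuous_cwt k)).aestronglyMeasurable) (ae_of_all _ fun x => by
          rw [Real.norm_eq_abs, abs_le]; constructor <;> linarith [cwt_pos k x, cwt_le_one k x])
    have t1 := hconv (integrable_cwt hk) 2
    have t2 := h4'.sub ((hconv hcc 4).const_mul 2)
    have t3 := ((hm'.const_mul (4 * k)).const_add 1).const_mul (2 / s)
    refine le_of_tendsto_of_tendsto' t2 (t3.mul (t1.max (hm'.sub t1))) fun n => ?_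
    refine (ims hs hGN (hf (φ n)) hk (le_max_left _ _) (le_max_right _ _)).trans ?_
    have : 0 ≤ max (∫ x, cwt k x * f (φ n) x ^ 2)
        ((∫ x, f (φ n) x ^ 2) - ∫ x, cwt k x * f (φ n) x ^ 2) :=
      le_max_of_le_left (integral_nonneg fun x => mul_nonneg (cwt_pos k x).le (sq_nonneg _))
    have := hA (φ n)
    simp only [Function.comp]
    gcongr
  have hlim : ∀ {g : Plane → ℝ}, Integrable g →
      Tendsto (fun n : ℕ => ∫ x, cwt (1 / ((n : ℝ) + 1)) x * g x) atTop (𝓝 (∫ x, g x)) := by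
    intro g hg
    refine tendsto_integral_of_dominated_convergence (fun x => ‖g x‖)
      (fun n => (continuous_cwt _).aestronglyMeasurable.mul hg.aestronglyMeasurable) hg.norm
      (fun n => ae_of_all _ fun x => ?_) (ae_of_all _ fun x => ?_)
    · rw [norm_mul, Real.norm_of_nonneg (cwt_pos _ x).le]
      exact mul_le_of_le_one_left (norm_nonneg _) (cwt_le_one _ x)
    · simpa using (cwt_tendsto x).mul_const (g x)
  have hlim2 : Tendsto (fun n : ℕ => ∫ x, cwt (1 / ((n : ℝ) + 1)) x *
      (1 - cwt (1 / ((n : ℝ) + 1)) x) * W x ^ 4) atTop (𝓝 0) := by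
    have := tendsto_integral_of_dominated_convergence (F := fun (n : ℕ) x =>
        cwt (1 / ((n : ℝ) + 1)) x * (1 - cwt (1 / ((n : ℝ) + 1)) x) * W x ^ 4) (f := fun _ => 0)
      (fun x => ‖W x ^ 4‖)
      (fun n => ((continuous_cwt _).mul (continuous_const.sub
        (continuous_cwt _))).aestronglyMeasurable.mul hW4.aestronglyMeasurable) hW4.norm
      (fun n => ae_of_all _ fun x => by
        rw [norm_mul]
        refine mul_le_of_le_one_left (norm_nonneg _) ?_
        have := cwt_pos (1 / ((n : ℝ) + 1)) x
        have := cwt_le_one (1 / ((n : ℝ) + 1)) x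
        rw [Real.norm_eq_abs, abs_le]; constructor <;> nlinarith)
      (ae_of_all _ fun x => by
        simpa using ((cwt_tendsto x).mul ((cwt_tendsto x).const_sub 1)).mul_const (W x ^ 4))
    simpa using this
  have hmass : ∫ x, W x ^ 2 = s := by
    refine le_antisymm hWs ?_
    have hk0 := tendsto_one_div_add_atTop_nhds_zero_nat (𝕜 := ℝ)
    have t1 := (hlim2.const_mul 2).const_sub 2
    have t2 := ((((hk0.const_mul 4).mul_const s).const_add 1).const_mul (2 / s)).mul
      ((hlim hWi).max ((hlim hWi).const_sub s))
    have := le_of_tendsto_of_tendsto' t1 t2 fun n => hk _ (by positivity)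
    simp only [mul_zero, zero_mul, sub_zero, add_zero, mul_one] at this
    rw [div_mul_eq_mul_div, le_div_iff₀ hs] at this
    rcases le_max_iff.1 (by linarith : s ≤ max (∫ x, W x ^ 2) (s - ∫ x, W x ^ 2)) with h | h
    · exact h
    · linarith
  refine ⟨φ, hφ, W, hWm, hW0, hWK, hae, hWi, hmass, ?_⟩
  have hmi : ∀ n, Integrable fun x => min (f (φ n) x) (W x) * W x := fun n =>
    hWi.mono' (((hfm n).min hWm).mul hWm).aestronglyMeasurable (ae_of_all _ fun x => by
      rw [Real.norm_of_nonneg (mul_nonneg (le_min (h0 _ x) (hW0 x)) (hW0 x)), sq]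
      exact mul_le_mul_of_nonneg_right (min_le_right _ _) (hW0 x))
  have hmin : Tendsto (fun n => ∫ x, min (f (φ n) x) (W x) * W x) atTop (𝓝 (∫ x, W x ^ 2)) := by
    refine tendsto_integral_of_dominated_convergence (fun x => W x ^ 2)
      (fun n => (hmi n).aestronglyMeasurable) hWi (fun n => ae_of_all _ fun x => ?_) ?_
    · rw [Real.norm_of_nonneg (mul_nonneg (le_min (h0 _ x) (hW0 x)) (hW0 x)), sq]
      exact mul_le_mul_of_nonneg_right (min_le_right _ _) (hW0 x)
    · filter_upwards [hae] with x hx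
      have := (hx.min (tendsto_const_nhds (x := W x))).mul_const (W x)
      rwa [min_self, ← sq] at this
  have hup := (hm'.add_const (∫ x, W x ^ 2)).sub (hmin.const_mul 2)
  rw [hmass] at hup
  have e0 : s + s - 2 * s = 0 := by ring
  rw [e0] at hup
  refine squeeze_zero (fun n => integral_nonneg fun x => sq_nonneg _) (fun n => ?_) hup
  simp only [Function.comp]
  rw [← hmass, ← integral_add (hf _).2.1 hWi, ← integral_const_mul, ← integral_sub
    ((hf _).2.1.fun_add hWi) ((hmi n).const_mul 2)]
  refine integral_mono (integrable_sq_sub (hfm n).aestronglyMeasurable hWm.aestronglyMeasurable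
    (hf _).2.1 hWi) (((hf _).2.1.fun_add hWi).sub ((hmi n).const_mul 2)) fun x => ?_
  have := mul_le_mul_of_nonneg_right (min_le_left (f (φ n) x) (W x)) (hW0 x)
  simp only
  nlinarith

theorem linear_coeff_eq_zero {l M : ℝ} (h : ∀ t : ℝ, |t| ≤ 1 → 0 ≤ l * t + M * t ^ 2) : l = 0 := by
  set N := |M| + |l| + 1 with hN
  have hNp : 0 < N := by positivity
  have hlN : |l| ≤ N := by rw [hN]; linarith [abs_nonneg M]
  have ht : |-(l / (2 * N))| ≤ 1 := by
    rw [abs_neg, abs_div, abs_of_pos (by positivity : (0 : ℝ) < 2 * N), div_le_one (by positivity)]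
    linarith
  have h1 := h _ ht
  have h2 : M ≤ N := by rw [hN]; linarith [le_abs_self M, abs_nonneg l]
  have h3 := mul_le_mul_of_nonneg_right h2 (sq_nonneg (-(l / (2 * N))))
  have h4 : l * -(l / (2 * N)) + N * (-(l / (2 * N))) ^ 2 = -(l ^ 2 / (4 * N)) := by
    field_simp; ring
  have h5 : l ^ 2 / (4 * N) ≤ 0 := by linarith
  have h6 : 0 ≤ l ^ 2 / (4 * N) := by positivity
  have h7 : l ^ 2 / (4 * N) = 0 := le_antisymm h5 h6
  have : l ^ 2 = 0 := by
    rcases div_eq_zero_iff.1 h7 with h | h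
    · exact h
    · linarith
  exact pow_eq_zero_iff (two_ne_zero) |>.1 this

/-- `L²` limits of bounded sequences with Dirichlet energy at most one. -/
def H1Lim (K : ℝ) (f : Plane → ℝ) : Prop :=
  Measurable f ∧ (∀ x, |f x| ≤ K) ∧ (Integrable fun x => f x ^ 2) ∧
  ∃ F : ℕ → Plane → ℝ, (∀ n, H1R (F n)) ∧ (∀ n x, |F n x| ≤ K) ∧
    (∀ n, ∫ x, gradSqR (F n) x ≤ 1) ∧ Tendsto (fun n => ∫ x, (F n x - f x) ^ 2) atTop (𝓝 0)

theorem pow_four_convex (a b : ℝ) : a ^ 4 + 4 * a ^ 3 * b ≤ (a + b) ^ 4 := by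
  nlinarith [sq_nonneg (b * (b + 2 * a)), sq_nonneg (a * b)]

theorem integrable_of_bdd_mul_test {f φ : Plane → ℝ} {K : ℝ} (hf : Measurable f)
    (hK : ∀ x, |f x| ≤ K) (hφ : TestFn φ) (p : ℕ) : Integrable fun x => f x ^ p * φ x :=
  hφ.int (GaussInt.of_bdd (hf.pow_const p).aestronglyMeasurable (K := K ^ p) fun x => by
    rw [abs_pow]; exact pow_le_pow_left₀ (abs_nonneg _) (hK x) p)

/-- The Euler--Lagrange equation of optimizers of the Gagliardo--Nirenberg inequality. -/
theorem H1Lim.euler {s : ℝ} (hs : 0 < s) (hGN : GNIneq s) {f : Plane → ℝ} {K : ℝ} (h : H1Lim K f)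
    (hm : ∫ x, f x ^ 2 = s) (h4 : ∫ x, f x ^ 4 = 2) {φ : Plane → ℝ} (hφ : TestFn φ) :
    ∫ x, f x ^ 3 * φ x = -(∫ x, f x * lapR φ x) + 1 / s * ∫ x, f x * φ x := by
  obtain ⟨hfm, hK, hf2, F, hF, hFK, hFA, hconv⟩ := h
  obtain ⟨B, hB0, hB, -, -⟩ := hφ.bdd
  have hφH := hφ.H1R
  have hφm := hφH.1.meas.aestronglyMeasurable (μ := volume)
  have hFm : ∀ n, AEStronglyMeasurable (F n) volume := fun n => (hF n).1.meas.aestronglyMeasurable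
  have hfm' := hfm.aestronglyMeasurable (μ := volume)
  have hlm := (measurable_lapR φ).aestronglyMeasurable (μ := volume)
  have hz : Tendsto (fun n : ℕ => ∫ x, (lapR φ x - lapR φ x) ^ 2) atTop (𝓝 0) := by simp
  have cL := tendsto_integral_mul hFm (fun _ => hlm) hfm' hlm (fun n => (hF n).2.1)
    (fun _ => hφ.int_lap_sq) hf2 hφ.int_lap_sq hconv hz
  set b := ∫ x, f x * lapR φ x with hb
  set D := ∫ x, gradSqR φ x with hD
  set p := ∫ x, f x * φ x with hp
  set q := ∫ x, φ x ^ 2 with hq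
  set c := ∫ x, f x ^ 3 * φ x with hc
  have key : ∀ t : ℝ, 2 + 4 * t * c ≤ 2 / s * (1 - 2 * t * b + t ^ 2 * D) *
      (s + 2 * t * p + t ^ 2 * q) := by
    intro t
    have htφ := hφH.const_mul t
    have htm := htφ.1.meas.aestronglyMeasurable (μ := volume)
    have hs2 := integrable_sq_add hfm' htm hf2 htφ.2.1
    have hbd : ∀ {g : Plane → ℝ}, (∀ x, |g x| ≤ K) → ∀ x, |g x + t * φ x| ≤ K + |t| * B := by
      intro g hg x
      refine (abs_add_le _ _).trans (add_le_add (hg x) ?_)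
      rw [abs_mul]; exact mul_le_mul_of_nonneg_left (hB x) (abs_nonneg t)
    have hcv : Tendsto (fun n => ∫ x, ((F n x + t * φ x) - (f x + t * φ x)) ^ 2) atTop (𝓝 0) := by
      simpa using hconv
    have c4 := tendsto_integral_pow_four (fun n => (hFm n).add htm) (hfm'.add htm)
      (fun n => ((hF n).add htφ).2.1) hs2 (fun n => hbd (hFK n)) (hbd hK) hcv
    have c2 := tendsto_integral_sq (fun n => (hFm n).add htm) (hfm'.add htm)
      (fun n => ((hF n).add htφ).2.1) hs2 hcv
    have step : ∀ n, ∫ x, (F n x + t * φ x) ^ 4 ≤ 2 / s *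
        (1 - 2 * t * (∫ x, F n x * lapR φ x) + t ^ 2 * D) * ∫ x, (F n x + t * φ x) ^ 2 := by
      intro n
      refine (hGN _ ((hF n).add htφ)).2.trans ?_
      have h0 : 0 ≤ ∫ x, (F n x + t * φ x) ^ 2 := integral_nonneg fun x => sq_nonneg _
      have e1 : ∫ x, (d0R (F n) x * d0R (fun y => t * φ y) x +
          d1R (F n) x * d1R (fun y => t * φ y) x) = -(t * ∫ x, F n x * lapR φ x) := by
        rw [← mul_neg, ← (hF n).ibp hφ, ← integral_const_mul]
        congr 1; ext x
        rw [d0R_const_mul _ (hφH.1 x), d1R_const_mul _ (hφH.1 x)]; ring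
      rw [(hF n).integral_gradSqR_add htφ, e1, hφH.integral_gradSqR_const_mul]
      have := hFA n
      have e2 : (∫ x, gradSqR (F n) x) + t ^ 2 * D + 2 * -(t * ∫ x, F n x * lapR φ x) ≤
          1 - 2 * t * (∫ x, F n x * lapR φ x) + t ^ 2 * D := by linarith
      exact mul_le_mul_of_nonneg_right (mul_le_mul_of_nonneg_left e2 (by positivity)) h0
    have lim := le_of_tendsto_of_tendsto' c4
      ((((cL.const_mul (2 * t)).const_sub 1).add_const (t ^ 2 * D)).const_mul (2 / s) |>.mul
          c2) step
    have e3 : ∫ x, (f x + t * φ x) ^ 2 = s + 2 * t * p + t ^ 2 * q := by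
      have i1 := (hφ.int (GaussInt.of_bdd hfm' hK)).const_mul (2 * t)
      have i2 := hφH.2.1.const_mul (t ^ 2)
      rw [← hm, hp, hq, ← integral_const_mul, ← integral_const_mul, ← integral_add hf2 i1,
        ← integral_add (hf2.fun_add i1) i2]
      congr 1; ext x; ring
    have e4 : 2 + 4 * t * c ≤ ∫ x, (f x + t * φ x) ^ 4 := by
      have i1 := (integrable_of_bdd_mul_test hfm hK hφ 3).const_mul (4 * t)
      have i0 := integrable_pow_four_of_bdd hfm' hf2 hK
      rw [← h4, hc, ← integral_const_mul, ← integral_add i0 i1]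
      refine integral_mono (i0.add i1) (integrable_pow_four_of_bdd (hfm'.add htm) hs2 (hbd hK))
        fun x => ?_
      have := pow_four_convex (f x) (t * φ x)
      change f x ^ 4 + 4 * t * (f x ^ 3 * φ x) ≤ (f x + t * φ x) ^ 4
      linarith
    simp only [Pi.add_apply] at lim
    rw [e3] at lim
    exact e4.trans lim
  have hlin : 2 / s * (2 * p - 2 * b * s) - 4 * c = 0 := by
    refine linear_coeff_eq_zero
      (M := 2 / s * (|q| + |4 * b * p| + |D| * s + |2 * b * q| + |2 * D * p| + |D * q|))
          fun t ht => ?_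
    have k := key t
    have e : 2 / s * (1 - 2 * t * b + t ^ 2 * D) * (s + 2 * t * p + t ^ 2 * q) =
        2 + 2 / s * (2 * p - 2 * b * s) * t + 2 / s * (q - 4 * b * p + D * s +
          t * (2 * D * p - 2 * b * q) + t ^ 2 * (D * q)) * t ^ 2 := by
      field_simp; ring
    have ht2 : t ^ 2 ≤ 1 := by rw [← sq_abs]; exact pow_le_one₀ (abs_nonneg t) ht
    have b1 : q - 4 * b * p + D * s + t * (2 * D * p - 2 * b * q) + t ^ 2 * (D * q) ≤
        |q| + |4 * b * p| + |D| * s + |2 * b * q| + |2 * D * p| + |D * q| := by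
      have a1 := le_abs_self q
      have a2 := neg_abs_le (4 * b * p)
      have a3 := mul_le_mul_of_nonneg_right (le_abs_self D) hs.le
      have a4 : t * (2 * D * p - 2 * b * q) ≤ |2 * D * p| + |2 * b * q| := by
        refine (le_abs_self _).trans ?_
        rw [abs_mul]
        exact (mul_le_of_le_one_left (abs_nonneg _) ht).trans (abs_sub _ _)
      have a5 : t ^ 2 * (D * q) ≤ |D * q| :=
        (mul_le_mul_of_nonneg_left (le_abs_self _) (sq_nonneg t)).trans
          (mul_le_of_le_one_left (abs_nonneg _) ht2)
      linarith
    have b2 := mul_le_mul_of_nonneg_right (mul_le_mul_of_nonneg_left b1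
      (by positivity : (0 : ℝ) ≤ 2 / s)) (sq_nonneg t)
    rw [e] at k
    linarith
  field_simp at hlin ⊢
  linarith

theorem exists_subseq_ae_of_tendsto_sq {F : ℕ → Plane → ℝ} {f : Plane → ℝ}
    (hi : ∀ n, Integrable fun x => (F n x - f x) ^ 2)
    (h : Tendsto (fun n => ∫ x, (F n x - f x) ^ 2) atTop (𝓝 0)) :
    ∃ φ : ℕ → ℕ, StrictMono φ ∧ ∀ᵐ x, Tendsto (fun n => F (φ n) x) atTop (𝓝 (f x)) := by
  have h1 : Tendsto (fun n => eLpNorm ((fun x => (F n x - f x) ^ 2) - fun _ => (0 : ℝ)) 1 volume)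
      atTop (𝓝 0) := by
    have : ∀ n, eLpNorm ((fun x => (F n x - f x) ^ 2) - fun _ => (0 : ℝ)) 1 volume =
        ENNReal.ofReal (∫ x, (F n x - f x) ^ 2) := fun n => by
      rw [eLpNorm_one_eq_lintegral_enorm, ofReal_integral_eq_lintegral_ofReal (hi n)
        (ae_of_all _ fun x => sq_nonneg _)]
      congr 1; ext x
      simp only [Pi.sub_apply, sub_zero]
      rw [Real.enorm_eq_ofReal (sq_nonneg _)]
    simp only [this]
    simpa using ENNReal.tendsto_ofReal h
  obtain ⟨φ, hφ, hae⟩ := (tendstoInMeasure_of_tendsto_eLpNorm one_ne_zero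
    (fun n => (hi n).1) aestronglyMeasurable_const h1).exists_seq_tendsto_ae
  refine ⟨φ, hφ, hae.mono fun x hx => ?_⟩
  have h2 := hx.sqrt
  simp only [Real.sqrt_sq_eq_abs, Real.sqrt_zero] at h2
  have h3 := (tendsto_zero_iff_abs_tendsto_zero _).2 h2
  simpa using h3.add_const (f x)

theorem continuous_heat {f : Plane → ℝ} (hm : Measurable f) {K : ℝ} (hK : ∀ x, |f x| ≤ K) {s : ℝ}
    (hs : 0 < s) : Continuous (heat f s) := by
  have hpi := Real.pi_pos
  refine continuous_iff_continuousAt.2 fun x0 => ?_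
  refine continuousAt_of_dominated (bound := fun y => K * ((4 * Real.pi * s)⁻¹ *
    (Real.exp (4 * s)⁻¹ * gw (8 * s)⁻¹ x0 y)))
    (Eventually.of_forall fun x =>
        hm.aestronglyMeasurable.mul (continuous_G s x).aestronglyMeasurable)
    ?_ (((integrable_gw (by positivity) x0).const_mul _ |>.const_mul _).const_mul _)
    (ae_of_all _ fun y => ?_)
  · filter_upwards [Metric.ball_mem_nhds x0 one_pos] with x hx
    refine ae_of_all _ fun y => ?_
    rw [norm_mul, Real.norm_of_nonneg (G_pos hs x y).le]
    refine mul_le_mul (hK y) ?_ (G_pos hs x y).le ((abs_nonneg _).trans (hK y))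
    unfold G
    refine mul_le_mul_of_nonneg_left ?_ (by positivity)
    unfold gw
    rw [← Real.exp_add]
    refine Real.exp_le_exp.2 ?_
    have h1 : ‖x - x0‖ ≤ 1 := (mem_ball_iff_norm.1 hx).le
    have h2 : ‖y - x0‖ ≤ ‖y - x‖ + ‖x - x0‖ := norm_sub_le_norm_sub_add_norm_sub y x x0
    have h3 : ‖y - x0‖ ^ 2 ≤ 2 * ‖y - x‖ ^ 2 + 2 := by
      nlinarith [norm_nonneg (y - x0), norm_nonneg (y - x), sq_nonneg (‖y - x‖ - 1)]
    have e : (4 * s)⁻¹ + -(8 * s)⁻¹ * ‖y - x0‖ ^ 2 - -(4 * s)⁻¹ * ‖y - x‖ ^ 2 =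
        (8 * s)⁻¹ * (2 + 2 * ‖y - x‖ ^ 2 - ‖y - x0‖ ^ 2) := by field_simp; ring
    have : 0 ≤ (8 * s)⁻¹ * (2 + 2 * ‖y - x‖ ^ 2 - ‖y - x0‖ ^ 2) :=
      mul_nonneg (by positivity) (by linarith)
    linarith
  · refine Continuous.continuousAt ?_
    unfold G gw; fun_prop

/-- Bounded weak solutions of `-Δf + l f = f³`. -/
structure WeakSol (l K : ℝ) (f : Plane → ℝ) : Prop where
  meas : Measurable f
  bdd : ∀ x, |f x| ≤ K
  eq : ∀ φ, TestFn φ → ∫ x, f x ^ 3 * φ x = -(∫ x, f x * lapR φ x) + l * ∫ x, f x * φ x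

namespace WeakSol
variable {l K : ℝ} {f : Plane → ℝ}

theorem abs_cube (h : WeakSol l K f) (x : Plane) : |f x ^ 3| ≤ K ^ 3 := by
  rw [abs_pow]; exact pow_le_pow_left₀ (abs_nonneg _) (h.bdd x) 3

theorem heat_deriv (h : WeakSol l K f) {s : ℝ} (hs : 0 < s) (x : Plane) :
    HasDerivAt (fun s => heat f s x) (l * heat f s x - heat (fun y => f y ^ 3) s x) s := by
  convert heat_hasDerivAt (GaussInt.of_bdd h.meas.aestronglyMeasurable h.bdd) hs x using 1
  have := h.eq _ (testFn_G hs x)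
  simp only [lapR_G hs] at this
  unfold heat
  linarith

theorem abs_heat_sub_le (h : WeakSol l K f) {s t : ℝ} (hs : 0 < s) (ht : 0 < t) (x : Plane) :
    |heat f s x - heat f t x| ≤ (|l| * K + K ^ 3) * |s - t| := by
  have := (convex_Ioi (0 : ℝ)).norm_image_sub_le_of_norm_hasDerivWithin_le
    (f := fun s => heat f s x) (fun r hr => (h.heat_deriv hr x).hasDerivWithinAt)
    (C := |l| * K + K ^ 3) (fun r hr => ?_) ht hs
  · simpa using this
  · refine (norm_sub_le _ _).trans (add_le_add ?_ (abs_heat_le h.abs_cube hr x))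
    rw [norm_mul]
    exact mul_le_mul_of_nonneg_left (abs_heat_le h.bdd hr x) (norm_nonneg _)

theorem exists_limit (h : WeakSol l K f) : ∃ w : Plane → ℝ, Continuous w ∧ (∀ x, |w x| ≤ K) ∧
    ∀ s, 0 < s → ∀ x, |heat f s x - w x| ≤ (|l| * K + K ^ 3) * s := by
  set C := |l| * K + K ^ 3
  have hC : 0 ≤ C := by
    have : 0 ≤ K := (abs_nonneg _).trans (h.bdd 0)
    positivity
  have hlim : ∀ x, ∃ w, Tendsto (fun s => heat f s x) (𝓝[>] 0) (𝓝 w) := by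
    intro x
    refine cauchy_map_iff_exists_tendsto.1 (Metric.cauchy_iff.2 ⟨inferInstance, fun e he => ?_⟩)
    refine ⟨(fun s => heat f s x) '' Ioo 0 (e / (C + 1)),
      image_mem_map (Ioo_mem_nhdsGT (by positivity)), ?_⟩
    rintro _ ⟨s, hs, rfl⟩ _ ⟨t, ht, rfl⟩
    rw [Real.dist_eq]
    refine (h.abs_heat_sub_le hs.1 ht.1 x).trans_lt ?_
    have h1 : |s - t| ≤ e / (C + 1) :=
        abs_sub_le_iff.2 ⟨by linarith [hs.2, ht.1], by linarith [hs.1, ht.2]⟩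
    have h2 : C * |s - t| ≤ C * (e / (C + 1)) := mul_le_mul_of_nonneg_left h1 hC
    have h3 : C * (e / (C + 1)) < e := by
      rw [mul_div_assoc', div_lt_iff₀ (by positivity)]; nlinarith
    linarith
  choose w hw using hlim
  have hb : ∀ s, 0 < s → ∀ x, |heat f s x - w x| ≤ C * s := by
    intro s hs x
    have h1 : Tendsto (fun t => |heat f s x - heat f t x|) (𝓝[>] 0) (𝓝 |heat f s x - w x|) :=
      ((hw x).const_sub _).abs
    refine le_of_tendsto h1 ?_
    filter_upwards [Ioo_mem_nhdsGT hs] with t ht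
    refine (h.abs_heat_sub_le hs ht.1 x).trans (mul_le_mul_of_nonneg_left ?_ hC)
    rw [abs_of_pos (by linarith [ht.2])]; linarith [ht.1]
  refine ⟨w, ?_, fun x => ?_, hb⟩
  · have hu : TendstoUniformly (fun s x => heat f s x) w (𝓝[>] 0) := by
      rw [Metric.tendstoUniformly_iff]
      intro e he
      filter_upwards [Ioo_mem_nhdsGT (show (0 : ℝ) < e / (C + 1) by positivity)] with s hs x
      rw [dist_comm, Real.dist_eq]
      refine (hb s hs.1 x).trans_lt ?_
      have h2 : C * s ≤ C * (e / (C + 1)) := mul_le_mul_of_nonneg_left hs.2.le hC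
      have h3 : C * (e / (C + 1)) < e := by
        rw [mul_div_assoc', div_lt_iff₀ (by positivity)]; nlinarith
      linarith
    refine hu.continuous (Eventually.frequently ?_)
    filter_upwards [self_mem_nhdsWithin] with s hs
    exact continuous_heat h.meas h.bdd hs
  · refine le_of_tendsto (hw x).abs ?_
    filter_upwards [self_mem_nhdsWithin] with s hs
    exact abs_heat_le h.bdd hs x

/-- Strong maximum principle for continuous weak solutions. -/
theorem pos (h : WeakSol l K f) (hc : Continuous f) (h0 : ∀ x, 0 ≤ f x)
    (hne : ∃ x, f x ≠ 0) (x : Plane) : 0 < f x := by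
  have hG := GaussInt.of_bdd h.meas.aestronglyMeasurable h.bdd
  have hpos : 0 < heat f 1 x := by
    refine (integral_pos_iff_support_of_nonneg (fun y => mul_nonneg (h0 y) (G_pos one_pos x y).le)
      (hG.mul_G one_pos x)).2 ?_
    have : Function.support (fun y => f y * G 1 x y) = Function.support f := by
      ext y; simp [(G_pos one_pos x y).ne']
    rw [this]
    refine IsOpen.measure_pos _ hc.isOpen_support ?_
    exact hne
  have hanti : AntitoneOn (fun s => Real.exp (-(l * s)) * heat f s x) (Ioi 0) := by
    have hd : ∀ s, 0 < s → HasDerivAt (fun s => Real.exp (-(l * s)) * heat f s x)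
        (-(Real.exp (-(l * s)) * heat (fun y => f y ^ 3) s x)) s := by
      intro s hs
      have h1 : HasDerivAt (fun s => Real.exp (-(l * s))) (Real.exp (-(l * s)) * -(l * 1)) s :=
        (((hasDerivAt_id s).const_mul l).neg).exp
      refine (h1.mul (h.heat_deriv hs x)).congr_deriv ?_
      ring
    refine antitoneOn_of_deriv_nonpos (convex_Ioi 0)
      (fun s hs => (hd s hs).continuousAt.continuousWithinAt)
      (fun s hs => (hd s (by simpa using hs)).differentiableAt.differentiableWithinAt)
          fun s hs => ?_
    have hs' : 0 < s := by simpa using hs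
    rw [(hd s hs').deriv, neg_nonpos]
    exact mul_nonneg (Real.exp_pos _).le
      (integral_nonneg fun y => mul_nonneg (pow_nonneg (h0 y) 3) (G_pos hs' x y).le)
  have ht : Tendsto (fun s => Real.exp (-(l * s)) * heat f s x) (𝓝[>] 0) (𝓝 (f x)) := by
    have h1 : Tendsto (fun s : ℝ => Real.exp (-(l * s))) (𝓝[>] 0) (𝓝 1) := by
      have : Continuous fun s : ℝ => Real.exp (-(l * s)) := by fun_prop
      simpa using (this.tendsto 0).mono_left nhdsWithin_le_nhds
    simpa using h1.mul (heat_tendsto h.meas.aestronglyMeasurable h.bdd hc.continuousAt)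
  have hge : Real.exp (-(l * 1)) * heat f 1 x ≤ f x := by
    refine ge_of_tendsto ht ?_
    filter_upwards [Ioo_mem_nhdsGT one_pos] with s hs
    exact hanti (mem_Ioi.2 hs.1) (mem_Ioi.2 one_pos) hs.2.le
  exact (mul_pos (Real.exp_pos _) hpos).trans_le hge

end WeakSol

theorem H1Lim.heat_approx {K : ℝ} {f : Plane → ℝ} (h : H1Lim K f) {s : ℝ} (hs : 0 < s) :
    Integrable (fun x => (f x - heat f s x) ^ 2) ∧ ∫ x, (f x - heat f s x) ^ 2 ≤ 16 * s := by
  obtain ⟨hm, hK, hf2, F, hF, hFK, hA, hconv⟩ := h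
  have hFm := fun n => (hF n).1.meas
  have hi : ∀ n, Integrable fun x => (F n x - f x) ^ 2 := fun n =>
    integrable_sq_sub (hFm n).aestronglyMeasurable hm.aestronglyMeasurable (hF n).2.1 hf2
  obtain ⟨φ, hφ, hae⟩ := exists_subseq_ae_of_tendsto_sq hi hconv
  have hheat : ∀ x, Tendsto (fun n => heat (F n) s x) atTop (𝓝 (heat f s x)) := by
    intro x
    have hb : ∀ n, (heat (F n) s x - heat f s x) ^ 2 ≤
        (∫ y, (F n y - f y) ^ 2) * ∫ y, G s x y ^ 2 := by
      intro n
      have e : heat (F n) s x - heat f s x = ∫ y, (F n y - f y) * G s x y := by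
        unfold heat
        rw [← integral_sub ((GaussInt.of_bdd (hFm n).aestronglyMeasurable (hFK n)).mul_G hs x)
          ((GaussInt.of_bdd hm.aestronglyMeasurable hK).mul_G hs x)]
        congr 1; ext y; ring
      rw [e]
      exact sq_integral_mul_le ((hFm n).sub hm).aestronglyMeasurable
        (continuous_G s x).aestronglyMeasurable (hi n) (integrable_G_sq hs x)
    have h2 : Tendsto (fun n => (heat (F n) s x - heat f s x) ^ 2) atTop (𝓝 0) :=
      squeeze_zero (fun n => sq_nonneg _) hb (by simpa using hconv.mul_const _)
    have h3 := h2.sqrt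
    simp only [Real.sqrt_sq_eq_abs, Real.sqrt_zero] at h3
    simpa using ((tendsto_zero_iff_abs_tendsto_zero _).2 h3).add_const (heat f s x)
  refine fatou_real (f := fun n x => (F (φ n) x - heat (F (φ n)) s x) ^ 2)
    (fun n => (_root_.heat_approx (hF _) (hFK _) hs).1) (fun n => ae_of_all _ fun x => sq_nonneg _)
    (hae.mono fun x hx => (hx.sub ((hheat x).comp hφ.tendsto_atTop)).pow 2) fun n => ?_
  refine (_root_.heat_approx (hF _) (hFK _) hs).2.trans ?_
  have := mul_le_mul_of_nonneg_left (hA (φ n)) (by positivity : 0 ≤ 16 * s)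
  linarith

theorem H1Lim.exists_continuous {l K : ℝ} {f : Plane → ℝ} (h : H1Lim K f) (hw : WeakSol l K f) :
    ∃ w : Plane → ℝ, Continuous w ∧ (∀ x, |w x| ≤ K) ∧ f =ᵐ[volume] w := by
  obtain ⟨w, hwc, hwK, hb⟩ := hw.exists_limit
  refine ⟨w, hwc, hwK, ?_⟩
  set C := |l| * K + K ^ 3
  have hlim : ∀ x, Tendsto (fun n : ℕ => heat f (1 / (n + 1)) x) atTop (𝓝 (w x)) := by
    intro x
    rw [tendsto_iff_norm_sub_tendsto_zero]
    refine squeeze_zero (fun n => norm_nonneg _) (fun n => hb _ Nat.one_div_pos_of_nat x) ?_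
    simpa using (tendsto_one_div_add_atTop_nhds_zero_nat (𝕜 := ℝ)).const_mul C
  have hle : ∀ e : ℝ, 0 < e → Integrable (fun x => (f x - w x) ^ 2) ∧ ∫ x, (f x - w x) ^ 2 ≤ e := by
    intro e he
    obtain ⟨N, hN⟩ := exists_nat_gt (16 / e)
    have hNp : (0 : ℝ) < N := lt_trans (by positivity) hN
    refine fatou_real (f := fun n x => (f x - heat f (1 / ((n + N : ℕ) + 1)) x) ^ 2)
      (fun n => (h.heat_approx Nat.one_div_pos_of_nat).1) (fun n => ae_of_all _ fun x =>
          sq_nonneg _)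
      (ae_of_all _ fun x => (((hlim x).comp (tendsto_add_atTop_nat N)).const_sub _).pow 2)
          fun n => ?_
    refine (h.heat_approx Nat.one_div_pos_of_nat).2.trans ?_
    rw [mul_one_div, div_le_iff₀ (by positivity)]
    rw [div_lt_iff₀ he] at hN
    push_cast
    have : (0 : ℝ) ≤ n := Nat.cast_nonneg n
    nlinarith
  have h0 : ∫ x, (f x - w x) ^ 2 = 0 :=
    le_antisymm (le_of_forall_pos_le_add fun e he => by simpa using (hle e he).2)
      (integral_nonneg fun x => sq_nonneg _)
  rw [integral_eq_zero_iff_of_nonneg (fun x => sq_nonneg _) (hle 1 one_pos).1] at h0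
  filter_upwards [h0] with x hx
  have : (f x - w x) ^ 2 = 0 := hx
  nlinarith [pow_eq_zero_iff (two_ne_zero) |>.1 this]

theorem H1Lim.congr {K : ℝ} {f g : Plane → ℝ} (h : H1Lim K f) (hg : Measurable g)
    (hb : ∀ x, |g x| ≤ K) (he : f =ᵐ[volume] g) : H1Lim K g := by
  obtain ⟨hm, hK, hf2, F, hF, hFK, hA, hconv⟩ := h
  refine ⟨hg, hb, hf2.congr (he.mono fun x hx => by simp only [hx]), F, hF, hFK, hA, ?_⟩
  refine hconv.congr fun n => integral_congr_ae (he.mono fun x hx => by simp only [hx])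

/-- Reflection across the line `⟪z, e⟫ = c` for a unit vector `e`. -/
def mirror (e : Plane) (c : ℝ) (z : Plane) : Plane := z + (2 * (c - inner ℝ z e)) • e

theorem inner_mirror {e : Plane} (he : ‖e‖ = 1) (c : ℝ) (z : Plane) : inner ℝ
    (mirror e c z) e = 2 * c - inner ℝ z e := by
  rw [mirror, inner_add_left, inner_smul_left, real_inner_self_eq_norm_sq, he]
  simp; ring

theorem mirror_mirror {e : Plane} (he : ‖e‖ = 1) (c : ℝ) (z : Plane) : mirror e c
    (mirror e c z) = z := by
  conv_lhs => rw [mirror, inner_mirror he]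
  rw [mirror, add_assoc, ← add_smul]
  have : 2 * (c - inner ℝ z e) + 2 * (c - (2 * c - inner ℝ z e)) = 0 := by ring
  rw [this, zero_smul, add_zero]

theorem mirror_dist_sq {e : Plane} (he : ‖e‖ = 1) (c : ℝ) (z w : Plane) :
    ‖mirror e c z - w‖ ^ 2 = ‖z - w‖ ^ 2 + 4 * (c - inner ℝ z e) * (c - inner ℝ w e) := by
  have : mirror e c z - w = (z - w) + (2 * (c - inner ℝ z e)) • e := by rw [mirror]; abel
  rw [this, norm_add_sq_real, inner_smul_right, norm_smul, he, inner_sub_left, mul_one,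
    Real.norm_eq_abs, sq_abs]
  ring

theorem mirror_eq_reflection {e : Plane} (he : ‖e‖ = 1) (c : ℝ) (z : Plane) :
    mirror e c z = (Submodule.span ℝ {e})ᗮ.reflection z + (2 * c) • e := by
  rw [Submodule.reflection_orthogonal_apply, Submodule.reflection_singleton_apply, mirror, he,
      real_inner_comm]
  simp only [RCLike.ofReal_real_eq_id, id, one_pow, div_one]
  module

theorem measurePreserving_mirror {e : Plane} (he : ‖e‖ = 1) (c : ℝ) : MeasurePreserving
    (mirror e c) := by
  have h1 := (Submodule.reflection (Submodule.span ℝ {e})ᗮ).measurePreserving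
  have h2 := measurePreserving_add_right (volume : Measure Plane) ((2 * c) • e)
  have : mirror e c = (fun z => z +
      (2 * c) • e) ∘ (Submodule.reflection (Submodule.span ℝ {e})ᗮ) := by
    ext1 z; exact mirror_eq_reflection he c z
  rw [this]
  exact h2.comp h1

theorem continuous_mirror (e : Plane) (c : ℝ) : Continuous (mirror e c) :=
    by unfold mirror; fun_prop

theorem integral_comp_mirror {e : Plane} (he : ‖e‖ = 1) (c : ℝ) (f : Plane → ℝ) : ∫ z, f
    (mirror e c z) = ∫ z, f z := by
  have hemb : MeasurableEmbedding (mirror e c) :=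
    (MeasurableEquiv.mk ⟨mirror e c, mirror e c, mirror_mirror he c, mirror_mirror he c⟩
      (continuous_mirror e c).measurable (continuous_mirror e c).measurable).measurableEmbedding
  exact (measurePreserving_mirror he c).integral_comp hemb f

theorem integrable_comp_mirror {e : Plane} (he : ‖e‖ = 1) (c : ℝ) {f : Plane → ℝ}
    (hf : Integrable f) :
    Integrable fun z => f (mirror e c z) :=
  (measurePreserving_mirror he c).integrable_comp_of_integrable hf

theorem hasFDerivAt_comp_mirror {e : Plane} (he : ‖e‖ = 1) (c : ℝ) {F : Plane → ℝ}
    (hF : Differentiable ℝ F) (z : Plane) :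
    HasFDerivAt (fun y => F (mirror e c y)) ((fderiv ℝ F (mirror e c z)).comp
      ((Submodule.span ℝ {e})ᗮ.reflection.toContinuousLinearEquiv : Plane →L[ℝ] Plane)) z := by
  refine (hF _).hasFDerivAt.comp z ?_
  have : mirror e c = fun z => (Submodule.span ℝ {e})ᗮ.reflection z + (2 * c) • e := by
    ext1 z; exact mirror_eq_reflection he c z
  rw [this]
  exact ((Submodule.span ℝ {e})ᗮ.reflection.toContinuousLinearEquiv.hasFDerivAt).add_const _

theorem gradSqR_comp_mirror {e : Plane} (he : ‖e‖ = 1) (c : ℝ) {F : Plane → ℝ}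
    (hF : Differentiable ℝ F) (z : Plane) :
    gradSqR (fun y => F (mirror e c y)) z = gradSqR F (mirror e c z) := by
  rw [gradSqR_eq, gradSqR_eq, (hasFDerivAt_comp_mirror he c hF z).fderiv]
  congr 1
  exact ContinuousLinearMap.opNorm_comp_linearIsometryEquiv _ _

theorem H1R.comp_mirror {e : Plane} (he : ‖e‖ = 1) (c : ℝ) {F : Plane → ℝ} (hF : H1R F) :
    H1R fun y => F (mirror e c y) := by
  refine ⟨fun z => (hasFDerivAt_comp_mirror he c hF.1 z).differentiableAt,
    integrable_comp_mirror he c hF.2.1, ?_⟩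
  refine (integrable_comp_mirror he c hF.2.2).congr (ae_of_all _ fun z => ?_)
  exact (gradSqR_comp_mirror he c hF.1 z).symm

theorem integral_gradSqR_comp_mirror {e : Plane} (he : ‖e‖ = 1) (c : ℝ) {F : Plane → ℝ}
    (hF : H1R F) :
    ∫ z, gradSqR (fun y => F (mirror e c y)) z = ∫ z, gradSqR F z := by
  simp only [gradSqR_comp_mirror he c hF.1]
  exact integral_comp_mirror he c _


/-- The sign distinguishing the two sides of the mirror. -/
def side (e : Plane) (c : ℝ) (z : Plane) : ℝ := if inner ℝ z e < c then 1 else -1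

theorem abs_side (e : Plane) (c : ℝ) (z : Plane) : |side e c z| = 1 := by
  unfold side; split_ifs <;> simp

theorem hasFDerivAt_side_mul {e : Plane} {c : ℝ} {g : Plane → ℝ} {z : Plane}
    (hg : DifferentiableAt ℝ g z) (hz : inner ℝ z e = c → g z = 0 ∧ fderiv ℝ g z = 0) :
    HasFDerivAt (fun y => side e c y * g y) (side e c z • fderiv ℝ g z) z := by
  have hcont : Continuous fun y : Plane => (inner ℝ y e : ℝ) := by fun_prop
  rcases lt_trichotomy (inner ℝ z e) c with h | h | h
  · refine (hg.hasFDerivAt.const_mul (side e c z)).congr_of_eventuallyEq ?_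
    filter_upwards [(isOpen_lt hcont continuous_const).mem_nhds h] with y hy
    have hy' : inner ℝ y e < c := hy
    simp [side, h, hy']
  · obtain ⟨h0, h1⟩ := hz h
    have hd := hg.hasFDerivAt
    rw [h1] at hd ⊢
    rw [smul_zero]
    rw [hasFDerivAt_iff_isLittleO_nhds_zero] at hd ⊢
    rw [← Asymptotics.isLittleO_norm_left] at hd ⊢
    refine hd.congr_left fun y => ?_
    simp [h0, abs_side]
  · refine (hg.hasFDerivAt.const_mul (side e c z)).congr_of_eventuallyEq ?_
    filter_upwards [(isOpen_lt continuous_const hcont).mem_nhds h] with y hy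
    have hy' : ¬ inner ℝ y e < c := not_lt.2 (le_of_lt hy)
    simp [side, not_lt.2 h.le, hy']

/-- A smooth approximation of the absolute value. -/
def softAbs (d z : ℝ) : ℝ := Real.sqrt (z ^ 2 + d ^ 2) - d

theorem softAbs_zero {d : ℝ} (hd : 0 < d) : softAbs d 0 = 0 := by
  simp [softAbs, Real.sqrt_sq hd.le]

theorem softAbs_deriv {d : ℝ} (hd : 0 < d) (z : ℝ) :
    HasDerivAt (softAbs d) (z / Real.sqrt (z ^ 2 + d ^ 2)) z := by
  have h1 : HasDerivAt (fun z : ℝ => z ^ 2 + d ^ 2) (2 * z) z := by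
    simpa using (hasDerivAt_pow 2 z).add_const (d ^ 2)
  refine ((h1.sqrt (by positivity)).sub_const d).congr_deriv ?_
  field_simp

theorem softAbs_nonneg {d : ℝ} (z : ℝ) : 0 ≤ softAbs d z := by
  unfold softAbs
  have := Real.le_sqrt_of_sq_le (show d ^ 2 ≤ z ^ 2 + d ^ 2 by nlinarith [sq_nonneg z])
  linarith

theorem softAbs_le {d : ℝ} (hd : 0 < d) (z : ℝ) : softAbs d z ≤ |z| := by
  unfold softAbs
  have := Real.sqrt_le_sqrt (show z ^ 2 + d ^ 2 ≤ (|z| + d) ^ 2 by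
    nlinarith [abs_nonneg z, sq_abs z])
  rw [Real.sqrt_sq (by positivity)] at this
  linarith

theorem abs_sub_softAbs_le {d : ℝ} (z : ℝ) : |z| - softAbs d z ≤ d := by
  unfold softAbs
  have := Real.le_sqrt_of_sq_le (show |z| ^ 2 ≤ z ^ 2 + d ^ 2 by
    rw [sq_abs]; nlinarith [sq_nonneg d])
  linarith

theorem softAbs_deriv_le {d : ℝ} (hd : 0 < d) (z : ℝ) : |z / Real.sqrt (z ^ 2 + d ^ 2)| ≤ 1 := by
  have hp : 0 < Real.sqrt (z ^ 2 + d ^ 2) := by positivity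
  rw [abs_div, abs_of_pos hp, div_le_one hp]
  exact Real.le_sqrt_of_sq_le (by rw [sq_abs]; nlinarith [sq_nonneg d])

theorem softAbs_lip {d : ℝ} (hd : 0 < d) (x y : ℝ) : |softAbs d x - softAbs d y| ≤ |x - y| := by
  have := convex_univ.norm_image_sub_le_of_norm_hasDerivWithin_le (f := softAbs d) (C := 1)
    (fun z _ => (softAbs_deriv hd z).hasDerivWithinAt) (fun z _ => softAbs_deriv_le hd z)
    (mem_univ y) (mem_univ x)
  simpa using this

theorem abs_softAbs_le {d : ℝ} (hd : 0 < d) (z : ℝ) : |softAbs d z| ≤ |z| := by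
  rw [abs_of_nonneg (softAbs_nonneg z)]; exact softAbs_le hd z

theorem side_mirror {e : Plane} (he : ‖e‖ = 1) {c : ℝ} {z : Plane} (hz : inner ℝ z e ≠ c) :
    side e c (mirror e c z) = -side e c z := by
  unfold side
  rw [inner_mirror he]
  rcases lt_or_gt_of_ne hz with h | h
  · rw [if_pos h, if_neg (by linarith)]
  · rw [if_pos (by linarith), if_neg (by linarith)]; simp

theorem mirror_of_eq {e : Plane} {c : ℝ} {z : Plane} (hz : inner ℝ z e = c) : mirror e c z = z := by
  simp [mirror, hz]

/-- Smoothed polarization of a differentiable function. -/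
theorem exists_soft_polarization {e : Plane} (he : ‖e‖ = 1) (c : ℝ) {F : Plane → ℝ} (hF : H1R F)
    {K : ℝ}
    (hK : ∀ x, |F x| ≤ K) {d : ℝ} (hd : 0 < d) :
    let P := fun z => 1 / 2 * F z + 1 / 2 * F (mirror e c z)
    let N := fun z => 1 / 2 * F z + -1 / 2 * F (mirror e c z)
    let E := fun z => P z + side e c z * softAbs d (N z)
    H1R E ∧ (∀ z, |E z| ≤ K) ∧ ∫ z, gradSqR E z ≤ ∫ z, gradSqR F z := by
  intro P N E
  have hFm := hF.comp_mirror he c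
  have hP : H1R P := (hF.const_mul _).add (hFm.const_mul _)
  have hN : H1R N := (hF.const_mul _).add (hFm.const_mul _)
  obtain ⟨hk, hkle⟩ := hN.comp (softAbs_deriv hd) (abs_softAbs_le hd) (softAbs_deriv_le hd)
  have hN0 : ∀ z, inner ℝ z e = c → N z = 0 := fun z hz => by
    simp only [N, mirror_of_eq hz]; ring
  have hder : ∀ z, HasFDerivAt (fun y => side e c y * softAbs d (N y))
      (side e c z • fderiv ℝ (fun y => softAbs d (N y)) z) z := fun z => by
    refine hasFDerivAt_side_mul (hk.1 z) fun hz => ?_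
    refine ⟨by simp only [hN0 z hz, softAbs_zero hd], ?_⟩
    have h1 : HasFDerivAt (fun y => softAbs d (N y)) _ z :=
      (softAbs_deriv hd (N z)).comp_hasFDerivAt z (hN.1 z).hasFDerivAt
    rw [h1.fderiv, hN0 z hz]; simp
  set M := fun y => side e c y * softAbs d (N y) with hM
  have hMg : ∀ z, gradSqR M z = gradSqR (fun y => softAbs d (N y)) z := fun z => by
    rw [gradSqR_eq, gradSqR_eq, (hder z).fderiv, norm_smul, Real.norm_eq_abs, abs_side, one_mul]
  have hM2 : ∀ z, M z ^ 2 = softAbs d (N z) ^ 2 := fun z => by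
    rw [hM, mul_pow, ← sq_abs (side e c z), abs_side, one_pow, one_mul]
  have hMH : H1R M := by
    exact ⟨fun z => (hder z).differentiableAt, hk.2.1.congr (ae_of_all _ fun z => (hM2 z).symm),
      hk.2.2.congr (ae_of_all _ fun z => (hMg z).symm)⟩
  have hE : E = fun z => P z + M z := rfl
  have hEH : H1R E := hP.add hMH
  refine ⟨hEH, fun z => ?_, ?_⟩
  · have h1 : |E z| ≤ |P z| + |N z| := by
      refine (abs_add_le _ _).trans ?_
      rw [abs_mul, abs_side, one_mul]
      exact add_le_add_right (abs_softAbs_le hd _) _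
    refine h1.trans ?_
    have h2 := abs_le.1 (hK z)
    have h3 := abs_le.1 (hK (mirror e c z))
    simp only [P, N]
    rcases abs_cases (1 / 2 * F z + 1 / 2 * F (mirror e c z)) with h | h <;>
    rcases abs_cases (1 / 2 * F z + -1 / 2 * F (mirror e c z)) with h' | h' <;>
    linarith [h.1, h'.1]
  · have e1 := hP.integral_gradSqR_add hMH
    have hEm : (fun z => E (mirror e c z)) = fun z => P z + -1 * M z := by
      ext z
      have hPm : P (mirror e c z) = P z := by simp only [P, mirror_mirror he]; ring
      have hMm : M (mirror e c z) = -1 * M z := by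
        have hNm : N (mirror e c z) = -N z := by simp only [N, mirror_mirror he]; ring
        have : softAbs d (N (mirror e c z)) = softAbs d (N z) := by rw [hNm]; simp [softAbs]
        simp only [hM]
        rw [this]
        by_cases hz : inner ℝ z e = c
        · rw [hN0 z hz, softAbs_zero hd]; simp
        · rw [side_mirror he hz]; ring
      change P (mirror e c z) + M (mirror e c z) = _
      rw [hPm, hMm]
    have e2 := hP.integral_gradSqR_add (hMH.const_mul (-1))
    have e3 := integral_gradSqR_comp_mirror he c hEH
    rw [hEm, e2, hMH.integral_gradSqR_const_mul] at e3
    have e4 : ∫ z, (d0R P z * d0R (fun y => -1 * M y) z + d1R P z * d1R (fun y => -1 * M y) z) =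
        -∫ z, (d0R P z * d0R M z + d1R P z * d1R M z) := by
      rw [← integral_neg]
      congr 1; ext z
      rw [d0R_const_mul _ (hMH.1 z), d1R_const_mul _ (hMH.1 z)]; ring
    have e5 : ∫ z, gradSqR M z ≤ ∫ z, gradSqR N z :=
      integral_mono hMH.2.2 hN.2.2 fun z => by rw [hMg]; exact hkle z
    have e6 := (hF.const_mul (1 / 2)).integral_gradSqR_add (hFm.const_mul (1 / 2))
    have e7 := (hF.const_mul (1 / 2)).integral_gradSqR_add (hFm.const_mul (-1 / 2))
    rw [hF.integral_gradSqR_const_mul, hFm.integral_gradSqR_const_mul,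
      integral_gradSqR_comp_mirror he c hF] at e6 e7
    have e8 : ∫ z, (d0R (fun y => 1 / 2 * F y) z * d0R (fun y => -1 / 2 * F (mirror e c y)) z +
        d1R (fun y => 1 / 2 * F y) z * d1R (fun y => -1 / 2 * F (mirror e c y)) z) =
        -∫ z, (d0R (fun y => 1 / 2 * F y) z * d0R (fun y => 1 / 2 * F (mirror e c y)) z +
        d1R (fun y => 1 / 2 * F y) z * d1R (fun y => 1 / 2 * F (mirror e c y)) z) := by
      rw [← integral_neg]
      congr 1; ext z
      rw [d0R_const_mul _ (hFm.1 z), d1R_const_mul _ (hFm.1 z), d0R_const_mul _ (hFm.1 z),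
        d1R_const_mul _ (hFm.1 z)]; ring
    rw [e8] at e7
    rw [e4] at e3
    have hEe : ∫ z, gradSqR E z = ∫ z, gradSqR (fun z => P z + M z) z := rfl
    have hPe : ∫ z, gradSqR P z = ∫ z, gradSqR (fun x => 1 / 2 * F x +
        1 / 2 * F (mirror e c x)) z := rfl
    have hNe : ∫ z, gradSqR N z = ∫ z, gradSqR (fun x => 1 / 2 * F x +
        -1 / 2 * F (mirror e c x)) z := rfl
    linarith

/-- Two-point rearrangement (polarization) across a mirror. -/
def polar (e : Plane) (c : ℝ) (f : Plane → ℝ) (z : Plane) : ℝ :=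
  if inner ℝ z e < c then max (f z) (f (mirror e c z)) else min (f z) (f (mirror e c z))

theorem polar_eq (e : Plane) (c : ℝ) (f : Plane → ℝ) (z : Plane) :
    polar e c f z = (1 / 2 * f z + 1 / 2 * f (mirror e c z)) +
      side e c z * |1 / 2 * f z + -1 / 2 * f (mirror e c z)| := by
  unfold polar side
  rcases le_total (f z) (f (mirror e c z)) with h | h
  · rw [max_eq_right h, min_eq_left h, abs_of_nonpos (by linarith)]
    split_ifs <;> ring
  · rw [max_eq_left h, min_eq_right h, abs_of_nonneg (by linarith)]
    split_ifs <;> ring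

theorem polar_pow_add {e : Plane} (he : ‖e‖ = 1) (c : ℝ) (f : Plane → ℝ) (p : ℕ) (z : Plane) :
    polar e c f z ^ p + polar e c f (mirror e c z) ^ p = f z ^ p + f (mirror e c z) ^ p := by
  unfold polar
  rw [mirror_mirror he, inner_mirror he]
  rcases lt_trichotomy (inner ℝ z e) c with hz | hz | hz
  · rw [if_pos hz, if_neg (by linarith)]
    rcases le_total (f z) (f (mirror e c z)) with h | h
    · rw [max_eq_right h, min_eq_right h]; ring
    · rw [max_eq_left h, min_eq_left h]
  · rw [mirror_of_eq hz]; simp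
  · rw [if_neg (by linarith), if_pos (by linarith)]
    rcases le_total (f z) (f (mirror e c z)) with h | h
    · rw [min_eq_left h, max_eq_left h]
    · rw [min_eq_right h, max_eq_right h]; ring

theorem measurable_polar (e : Plane) (c : ℝ) {f : Plane → ℝ} (hf : Measurable f) :
    Measurable (polar e c f) :=
  Measurable.ite (isOpen_lt (by fun_prop) continuous_const).measurableSet
    (hf.max (hf.comp (continuous_mirror e c).measurable))
    (hf.min (hf.comp (continuous_mirror e c).measurable))

theorem abs_polar_le (e : Plane) (c : ℝ) {f : Plane → ℝ} {K : ℝ} (hK : ∀ x, |f x| ≤ K) (z : Plane) :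
    |polar e c f z| ≤ K := by
  unfold polar
  split_ifs
  · rcases max_choice (f z) (f (mirror e c z)) with h | h <;> rw [h] <;> exact hK _
  · rcases min_choice (f z) (f (mirror e c z)) with h | h <;> rw [h] <;> exact hK _

theorem polar_pow_le {e : Plane} (he : ‖e‖ = 1) (c : ℝ) (f : Plane → ℝ) (z : Plane) :
    polar e c f z ^ 2 ≤ f z ^ 2 + f (mirror e c z) ^ 2 := by
  rw [← polar_pow_add he c f 2 z]
  exact le_add_of_nonneg_right (sq_nonneg _)

theorem integral_polar_pow {e : Plane} (he : ‖e‖ = 1) (c : ℝ) {f : Plane → ℝ} {p : ℕ}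
    (h : Integrable fun z => polar e c f z ^ p) (hf : Integrable fun z => f z ^ p) :
    ∫ z, polar e c f z ^ p = ∫ z, f z ^ p := by
  have e1 := integral_comp_mirror he c (fun z => polar e c f z ^ p)
  have e2 := integral_comp_mirror he c (fun z => f z ^ p)
  have e3 : (∫ z, polar e c f z ^ p) + ∫ z, polar e c f (mirror e c z) ^ p =
      (∫ z, f z ^ p) + ∫ z, f (mirror e c z) ^ p := by
    rw [← integral_add h (integrable_comp_mirror he c h),
      ← integral_add hf (integrable_comp_mirror he c hf)]
    simp only [polar_pow_add he c f p]
  linarith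

theorem H1Lim.polar {e : Plane} (he : ‖e‖ = 1) (c : ℝ) {K : ℝ} {f : Plane → ℝ} (h : H1Lim K f) :
    H1Lim K (polar e c f) := by
  obtain ⟨hm, hK, hf2, F, hF, hFK, hA, hconv⟩ := h
  have hpm := measurable_polar e c hm
  have hσ : Measurable (mirror e c) := (continuous_mirror e c).measurable
  have hp2 : Integrable fun z => _root_.polar e c f z ^ 2 := by
    refine (hf2.add (integrable_comp_mirror he c hf2)).mono' (hpm.pow_const 2).aestronglyMeasurable
      (ae_of_all _ fun z => ?_)
    rw [Real.norm_of_nonneg (sq_nonneg _)]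
    exact polar_pow_le he c f z
  refine ⟨hpm, abs_polar_le e c hK, hp2, ?_⟩
  have hd : ∀ n : ℕ, (0 : ℝ) < 1 / (n + 1) := fun n => Nat.one_div_pos_of_nat
  have hS := fun n => exists_soft_polarization he c (hF n) (hFK n) (hd n)
  simp only at hS
  set E : ℕ → Plane → ℝ := fun n z => (1 / 2 * F n z + 1 / 2 * F n (mirror e c z)) +
    side e c z * softAbs (1 / (n + 1)) (1 / 2 * F n z + -1 / 2 * F n (mirror e c z)) with hE
  refine ⟨E, fun n => (hS n).1, fun n => (hS n).2.1, fun n => (hS n).2.2.trans (hA n), ?_⟩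
  set N : Plane → ℝ := fun z => 1 / 2 * f z + -1 / 2 * f (mirror e c z) with hN
  have hNm : Measurable N := (hm.const_mul _).add ((hm.comp hσ).const_mul _)
  have hN2 : Integrable fun z => N z ^ 2 := by
    refine (hf2.add (integrable_comp_mirror he c hf2)).mono' (hNm.pow_const 2).aestronglyMeasurable
      (ae_of_all _ fun z => ?_)
    rw [Real.norm_of_nonneg (sq_nonneg _)]
    simp only [hN, Pi.add_apply]
    nlinarith [sq_nonneg (f z + f (mirror e c z)), sq_nonneg (f z), sq_nonneg (f (mirror e c z))]
  set r : ℕ → Plane → ℝ := fun n z => |N z| - softAbs (1 / (n + 1)) (N z) with hr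
  have hr0 : ∀ n z, 0 ≤ r n z := fun n z => sub_nonneg.2 (softAbs_le (hd n) _)
  have hrN : ∀ n z, r n z ^ 2 ≤ N z ^ 2 := fun n z => by
    rw [← sq_abs (N z)]
    exact pow_le_pow_left₀ (hr0 n z) (sub_le_self _ (softAbs_nonneg _)) 2
  have hrm : ∀ n, Measurable (r n) := fun n => by
    refine hNm.norm.sub ?_
    unfold softAbs; fun_prop
  have hr2 : ∀ n, Integrable fun z => r n z ^ 2 := fun n =>
    hN2.mono' ((hrm n).pow_const 2).aestronglyMeasurable (ae_of_all _ fun z => by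
      rw [Real.norm_of_nonneg (sq_nonneg _)]; exact hrN n z)
  have hrlim : Tendsto (fun n => ∫ z, r n z ^ 2) atTop (𝓝 0) := by
    have := tendsto_integral_of_dominated_convergence (F := fun n z => r n z ^ 2) (f := fun _ =>
        (0 : ℝ))
      (μ := volume) (fun z => N z ^ 2) (fun n => ((hrm n).pow_const 2).aestronglyMeasurable) hN2
      (fun n => ae_of_all _ fun z => by
        rw [Real.norm_of_nonneg (sq_nonneg _)]; exact hrN n z)
      (ae_of_all _ fun z => ?_)
    · simpa using this
    · have : Tendsto (fun n => r n z) atTop (𝓝 0) :=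
        squeeze_zero (fun n => hr0 n z) (fun n => abs_sub_softAbs_le (N z))
          tendsto_one_div_add_atTop_nhds_zero_nat
      simpa using this.pow 2
  set D : ℕ → Plane → ℝ := fun n z => F n z - f z with hD
  have hD2 : ∀ n, Integrable fun z => D n z ^ 2 := fun n =>
    integrable_sq_sub (hF n).1.meas.aestronglyMeasurable hm.aestronglyMeasurable (hF n).2.1 hf2
  have hpt : ∀ n z, (E n z - _root_.polar e c f z) ^ 2 ≤
      3 * (1 / 2 * D n z ^ 2 + 1 / 2 * D n (mirror e c z) ^ 2 + r n z ^ 2) := by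
    intro n z
    set a := softAbs (1 / (n + 1)) (1 / 2 * F n z + -1 / 2 * F n (mirror e c z)) with ha
    have h1 : |a - abs (N z)| ≤ |1 / 2 * D n z + -1 / 2 * D n (mirror e c z)| + r n z := by
      have h2 := softAbs_lip (hd n) (1 / 2 * F n z + -1 / 2 * F n (mirror e c z)) (N z)
      have h3 : 1 / 2 * F n z + -1 / 2 * F n (mirror e c z) - N z =
          1 / 2 * D n z + -1 / 2 * D n (mirror e c z) := by simp only [hN, hD]; ring
      rw [h3] at h2
      have h4 : a - |N z| = (a - softAbs (1 / (n + 1)) (N z)) - r n z := by simp only [hr]; ring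
      rw [h4]
      refine (abs_sub _ _).trans (add_le_add h2 (abs_of_nonneg (hr0 n z)).le)
    have h5 : |E n z - _root_.polar e c f z| ≤ |1 / 2 * D n z + 1 / 2 * D n (mirror e c z)| +
        |1 / 2 * D n z + -1 / 2 * D n (mirror e c z)| + r n z := by
      have h6 : E n z - _root_.polar e c f z = (1 / 2 * D n z + 1 / 2 * D n (mirror e c z)) +
          side e c z * (a - |N z|) := by rw [polar_eq]; simp only [hE, hD, hN, ha]; ring
      rw [h6]
      refine (abs_add_le _ _).trans ?_
      rw [abs_mul, abs_side, one_mul]; linarith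
    have h7 := pow_le_pow_left₀ (abs_nonneg _) h5 2
    rw [sq_abs] at h7
    refine h7.trans ?_
    set u := |1 / 2 * D n z + 1 / 2 * D n (mirror e c z)|
    set v := |1 / 2 * D n z + -1 / 2 * D n (mirror e c z)|
    have h8 : 1 / 2 * D n z ^ 2 + 1 / 2 * D n (mirror e c z) ^ 2 = u ^ 2 + v ^ 2 := by
      simp only [u, v, sq_abs]; ring
    rw [h8]
    nlinarith [sq_nonneg (u - v), sq_nonneg (u - r n z), sq_nonneg (v - r n z)]
  have hub : ∀ n, ∫ z, (E n z - _root_.polar e c f z) ^ 2 ≤ 3 * ((∫ z, D n z ^ 2) +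
      ∫ z, r n z ^ 2) := by
    intro n
    have i1 := (hD2 n).const_mul (1 / 2)
    have i2 := (integrable_comp_mirror he c (hD2 n)).const_mul (1 / 2)
    refine (integral_mono (integrable_sq_sub (hS n).1.1.meas.aestronglyMeasurable
      hpm.aestronglyMeasurable (hS n).1.2.1 hp2)
      (((i1.fun_add i2).fun_add (hr2 n)).const_mul 3) (hpt n)).trans ?_
    rw [integral_const_mul, integral_add (i1.fun_add i2) (hr2 n), integral_add i1 i2,
      integral_const_mul, integral_const_mul, integral_comp_mirror he c (fun z => D n z ^ 2)]
    apply le_of_eq; ring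
  refine squeeze_zero (fun n => integral_nonneg fun z => sq_nonneg _) hub ?_
  simpa using (hconv.add hrlim).const_mul 3

theorem G_zero_mirror_le {e : Plane} (he : ‖e‖ = 1) {c : ℝ} (hc : 0 < c) {s : ℝ} (hs : 0 < s)
    {z : Plane}
    (hz : inner ℝ z e < c) : G s 0 (mirror e c z) < G s 0 z := by
  have hpi := Real.pi_pos
  have h := mirror_dist_sq he c z 0
  simp only [sub_zero, inner_zero_left] at h
  unfold G gw
  refine mul_lt_mul_of_pos_left (Real.exp_lt_exp.2 ?_) (by positivity)
  simp only [sub_zero]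
  rw [neg_mul, neg_mul, neg_lt_neg_iff]
  refine mul_lt_mul_of_pos_left ?_ (by positivity)
  rw [h]
  have : 0 < 4 * (c - inner ℝ z e) * c := mul_pos (by linarith) hc
  linarith

theorem integral_mul_G_antisymm {e : Plane} (he : ‖e‖ = 1) (c : ℝ) {s : ℝ}
    (hs : 0 < s) {h : Plane → ℝ} (hi : GaussInt h) (ha : ∀ z, h (mirror e c z) = -h z) :
    Integrable (fun z => h z * (G s 0 z - G s 0 (mirror e c z))) ∧
    ∫ z, h z * G s 0 z = 1 / 2 * ∫ z, h z * (G s 0 z - G s 0 (mirror e c z)) := by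
  have i1 := hi.mul_G hs 0
  have i2 : Integrable fun z => h z * G s 0 (mirror e c z) := by
    have := (integrable_comp_mirror he c i1).neg
    refine this.congr (ae_of_all _ fun z => ?_)
    simp only [Pi.neg_apply, ha]; ring
  have e1 : ∫ z, h z * G s 0 (mirror e c z) = -∫ z, h z * G s 0 z := by
    rw [← integral_comp_mirror he c (fun z => h z * G s 0 z), ← integral_neg]
    congr 1; ext z; simp only [ha]; ring
  have e2 : (fun z => h z * (G s 0 z - G s 0 (mirror e c z))) =
      fun z => h z * G s 0 z - h z * G s 0 (mirror e c z) := by ext z; ring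
  rw [e2]
  refine ⟨i1.sub i2, ?_⟩
  rw [integral_sub i1 i2, e1]; ring

theorem antisymm_mul_nonneg {e : Plane} (he : ‖e‖ = 1) {c : ℝ} (hc : 0 < c) {s : ℝ} (hs : 0 < s)
    {h : Plane → ℝ} (ha : ∀ z, h (mirror e c z) = -h z) (h0 : ∀ z, inner ℝ z e < c → 0 ≤ h z)
    (z : Plane) : 0 ≤ h z * (G s 0 z - G s 0 (mirror e c z)) := by
  rcases lt_trichotomy (inner ℝ z e) c with hz | hz | hz
  · exact mul_nonneg (h0 z hz) (sub_nonneg.2 (G_zero_mirror_le he hc hs hz).le)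
  · rw [mirror_of_eq hz]; simp
  · have h1 : inner ℝ (mirror e c z) e < c := by rw [inner_mirror he]; linarith
    have h2 := G_zero_mirror_le he hc hs h1
    rw [mirror_mirror he] at h2
    have h3 := h0 _ h1
    rw [ha] at h3
    exact mul_nonneg_of_nonpos_of_nonpos (by linarith) (by linarith)

/-- A continuous weak solution with its maximum at the origin whose polarizations are weak
solutions is monotone across mirrors. -/
theorem WeakSol.mirror_le {l K : ℝ} {f : Plane → ℝ} (h : WeakSol l K f) (hc : Continuous f)
    (hmax : ∀ x, f x ≤ f 0) {e : Plane} (he : ‖e‖ = 1) {c : ℝ} (hcp : 0 < c)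
    (hp : WeakSol l K (polar e c f)) {x : Plane} (hx : inner ℝ x e < c) :
        f (mirror e c x) ≤ f x := by
  set D : Plane → ℝ := fun z => polar e c f z - f z with hD
  have hDm : Measurable D := hp.meas.sub h.meas
  have hDb : ∀ z, |D z| ≤ 2 * K := fun z => by
    refine (abs_sub _ _).trans ?_
    linarith [hp.bdd z, h.bdd z]
  have hpow : ∀ (p : ℕ) z, polar e c f (mirror e c z) ^ p - f (mirror e c z) ^ p =
      -(polar e c f z ^ p - f z ^ p) := fun p z => by linarith [polar_pow_add he c f p z]
  have hDa : ∀ z, D (mirror e c z) = -D z := fun z => by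
    have := hpow 1 z
    simp only [pow_one] at this
    exact this
  have hge : ∀ z, inner ℝ z e < c → f z ≤ polar e c f z := fun z hz => by
    rw [polar, if_pos hz]; exact le_max_left _ _
  have hD0 : ∀ z, inner ℝ z e < c → 0 ≤ D z := fun z hz => sub_nonneg.2 (hge z hz)
  have hcont : ∀ z, inner ℝ z e < c → ContinuousAt D z := fun z hz => by
    have h1 : Continuous fun y => max (f y) (f (mirror e c y)) - f y :=
      (hc.max (hc.comp (continuous_mirror e c))).sub hc
    refine h1.continuousAt.congr ?_
    have hin : Continuous fun y : Plane => (inner ℝ y e : ℝ) := by fun_prop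
    filter_upwards [(isOpen_lt hin continuous_const).mem_nhds hz] with y hy
    simp only [hD, polar]
    rw [if_pos hy]
  have hDz : D 0 = 0 := by
    have : polar e c f 0 = f 0 := by
      rw [polar, if_pos (by simpa using hcp)]; exact max_eq_left (hmax _)
    simp [hD, this]
  have hDG := GaussInt.of_bdd hDm.aestronglyMeasurable hDb
  have hheat : ∀ s, 0 < s → heat D s 0 = heat (polar e c f) s 0 - heat f s 0 := fun s hs => by
    unfold heat
    rw [← integral_sub ((GaussInt.of_bdd hp.meas.aestronglyMeasurable hp.bdd).mul_G hs 0)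
      ((GaussInt.of_bdd h.meas.aestronglyMeasurable h.bdd).mul_G hs 0)]
    congr 1; ext z; simp only [hD]; ring
  have hcube : ∀ s, 0 < s → 0 ≤ heat (fun y => polar e c f y ^ 3) s 0 - heat (fun y =>
      f y ^ 3) s 0 := by
    intro s hs
    set k : Plane → ℝ := fun z => polar e c f z ^ 3 - f z ^ 3 with hk
    have i1 := GaussInt.of_bdd (hp.meas.pow_const 3).aestronglyMeasurable hp.abs_cube
    have i2 := GaussInt.of_bdd (h.meas.pow_const 3).aestronglyMeasurable h.abs_cube
    have hkG : GaussInt k := GaussInt.of_bdd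
        ((hp.meas.pow_const 3).sub (h.meas.pow_const 3)).aestronglyMeasurable
      (K := K ^ 3 + K ^ 3) fun z => (abs_sub _ _).trans (add_le_add (hp.abs_cube z) (h.abs_cube z))
    have e1 : heat (fun y => polar e c f y ^ 3) s 0 - heat (fun y => f y ^ 3) s 0 =
        ∫ z, k z * G s 0 z := by
      unfold heat
      rw [← integral_sub (i1.mul_G hs 0) (i2.mul_G hs 0)]
      congr 1; ext z; simp only [hk]; ring
    rw [e1, (integral_mul_G_antisymm he c hs hkG (hpow 3)).2]
    refine mul_nonneg (by norm_num) (integral_nonneg fun z =>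
      antisymm_mul_nonneg he hcp hs (hpow 3) (fun z hz => ?_) z)
    exact sub_nonneg.2 ((Odd.strictMono_pow (by decide : Odd 3)).monotone (hge z hz))
  have hanti : AntitoneOn (fun s => Real.exp (-(l * s)) * heat D s 0) (Ioi 0) := by
    have hd : ∀ s, 0 < s → HasDerivAt (fun s => Real.exp (-(l * s)) *
        (heat (polar e c f) s 0 - heat f s 0)) (-(Real.exp (-(l * s)) *
          (heat (fun y => polar e c f y ^ 3) s 0 - heat (fun y => f y ^ 3) s 0))) s := by
      intro s hs
      have h1 : HasDerivAt (fun s => Real.exp (-(l * s))) (Real.exp (-(l * s)) * -(l * 1)) s :=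
        (((hasDerivAt_id s).const_mul l).neg).exp
      refine (h1.mul ((hp.heat_deriv hs 0).sub (h.heat_deriv hs 0))).congr_deriv ?_
      simp only [Pi.sub_apply]
      ring
    have h2 : AntitoneOn (fun s => Real.exp (-(l * s)) *
        (heat (polar e c f) s 0 - heat f s 0)) (Ioi 0) := by
      refine antitoneOn_of_deriv_nonpos (convex_Ioi 0)
        (fun s hs => (hd s hs).continuousAt.continuousWithinAt)
        (fun s hs => (hd s (by simpa using hs)).differentiableAt.differentiableWithinAt)
            fun s hs => ?_
      have hs' : 0 < s := by simpa using hs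
      rw [(hd s hs').deriv, neg_nonpos]
      exact mul_nonneg (Real.exp_pos _).le (hcube s hs')
    intro s hs t ht hst
    simp only [hheat s hs, hheat t ht]
    exact h2 hs ht hst
  have ht : Tendsto (fun s => Real.exp (-(l * s)) * heat D s 0) (𝓝[>] 0) (𝓝 0) := by
    have h1 : Tendsto (fun s : ℝ => Real.exp (-(l * s))) (𝓝[>] 0) (𝓝 1) := by
      have : Continuous fun s : ℝ => Real.exp (-(l * s)) := by fun_prop
      simpa using (this.tendsto 0).mono_left nhdsWithin_le_nhds
    simpa [hDz] using h1.mul (heat_tendsto hDm.aestronglyMeasurable hDb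
        (hcont 0 (by simpa using hcp)))
  have hle : Real.exp (-(l * 1)) * heat D 1 0 ≤ 0 := by
    refine ge_of_tendsto ht ?_
    filter_upwards [Ioo_mem_nhdsGT one_pos] with s hs
    exact hanti (mem_Ioi.2 hs.1) (mem_Ioi.2 one_pos) hs.2.le
  obtain ⟨hI, hI2⟩ := integral_mul_G_antisymm he c one_pos hDG hDa
  have hnn := antisymm_mul_nonneg he hcp one_pos hDa hD0
  have hz : ∫ z, D z * (G 1 0 z - G 1 0 (mirror e c z)) = 0 := by
    refine le_antisymm ?_ (integral_nonneg hnn)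
    have : heat D 1 0 ≤ 0 := by
      by_contra hcon
      exact absurd hle (not_le.2 (mul_pos (Real.exp_pos _) (not_le.1 hcon)))
    unfold heat at this
    linarith
  rw [integral_eq_zero_iff_of_nonneg hnn hI] at hz
  by_contra hcon
  have hDx : 0 < D x := by
    simp only [hD, polar]
    rw [if_pos hx]
    have := le_max_right (f x) (f (mirror e c x))
    linarith [not_le.1 hcon]
  have hin : Continuous fun y : Plane => (inner ℝ y e : ℝ) := by fun_prop
  have hev : ∀ᶠ y in 𝓝 x, 0 < D y ∧ inner ℝ y e < c :=
    ((hcont x hx).eventually (lt_mem_nhds hDx)).and ((isOpen_lt hin continuous_const).mem_nhds hx)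
  obtain ⟨U, hU, hUo, hxU⟩ := _root_.eventually_nhds_iff.1 hev
  have hmeas := hUo.measure_pos (volume : Measure Plane) ⟨x, hxU⟩
  refine hmeas.ne' (measure_mono_null (fun y hy => ?_) hz)
  obtain ⟨h1, h2⟩ := hU y hy
  exact (mul_pos h1 (sub_pos.2 (G_zero_mirror_le he hcp one_pos h2))).ne'

/-- Optimizers of the Gagliardo--Nirenberg inequality with maximum at the origin are radially
nonincreasing. -/
theorem H1Lim.radial_anti {s : ℝ} (hs : 0 < s) (hGN : GNIneq s) {f : Plane → ℝ} {K : ℝ}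
    (h : H1Lim K f)
    (hm : ∫ x, f x ^ 2 = s) (h4 : ∫ x, f x ^ 4 = 2) (hc : Continuous f) (hmax : ∀ x, f x ≤ f 0)
    {x y : Plane} (hxy : ‖x‖ ≤ ‖y‖) : f y ≤ f x := by
  have hW : WeakSol (1 / s) K f := ⟨h.1, h.2.1, fun φ hφ => h.euler hs hGN hm h4 hφ⟩
  have strict : ∀ {x y : Plane}, ‖x‖ < ‖y‖ → f y ≤ f x := by
    intro x y hxy
    have hne : 0 < ‖y - x‖ := norm_pos_iff.2 fun h0 => by
      rw [sub_eq_zero] at h0; rw [h0] at hxy; exact lt_irrefl _ hxy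
    set e : Plane := ‖y - x‖⁻¹ • (y - x) with he'
    have he : ‖e‖ = 1 := by
      rw [he', norm_smul, norm_inv, norm_norm, inv_mul_cancel₀ hne.ne']
    set c := (‖y‖ ^ 2 - ‖x‖ ^ 2) / (2 * ‖y - x‖) with hcdef
    have hc0 : 0 < c := div_pos (sub_pos.2 (pow_lt_pow_left₀ hxy (norm_nonneg _) two_ne_zero))
        (by positivity)
    have hin : c - inner ℝ x e = ‖y - x‖ / 2 := by
      have h1 : inner ℝ x e = ‖y - x‖⁻¹ * (inner ℝ x y - ‖x‖ ^ 2) := by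
        rw [he', inner_smul_right, inner_sub_right, real_inner_self_eq_norm_sq]
      have h2 : ‖y - x‖ ^ 2 = ‖y‖ ^ 2 - 2 * inner ℝ x y + ‖x‖ ^ 2 := by
        rw [norm_sub_sq_real, real_inner_comm]
      rw [h1, hcdef]
      field_simp
      linarith
    have hmx : mirror e c x = y := by
      rw [mirror, hin, he', smul_smul]
      have : 2 * (‖y - x‖ / 2) * ‖y - x‖⁻¹ = 1 := by field_simp
      rw [this, one_smul]; abel
    have hp := h.polar he c
    have i4 := integrable_pow_four_of_bdd hp.1.aestronglyMeasurable hp.2.2.1 hp.2.1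
    have i4' := integrable_pow_four_of_bdd h.1.aestronglyMeasurable h.2.2.1 h.2.1
    have hpW : WeakSol (1 / s) K (_root_.polar e c f) := ⟨hp.1, hp.2.1, fun φ hφ =>
      hp.euler hs hGN ((integral_polar_pow he c hp.2.2.1 h.2.2.1).trans hm)
        ((integral_polar_pow he c i4 i4').trans h4) hφ⟩
    have := hW.mirror_le hc hmax he hc0 hpW (x := x) (by linarith)
    rwa [hmx] at this
  rcases hxy.lt_or_eq with h1 | h1
  · exact strict h1
  · rcases eq_or_ne y 0 with h0 | h0
    · have : x = 0 := norm_eq_zero.1 (by rw [h1, h0, norm_zero])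
      rw [h0, this]
    · have hyp : 0 < ‖y‖ := norm_pos_iff.2 h0
      have hlim : Tendsto (fun t : ℝ => f (t • y)) (𝓝[>] 1) (𝓝 (f y)) := by
        have : Continuous fun t : ℝ => f (t • y) := by fun_prop
        simpa using (this.tendsto 1).mono_left nhdsWithin_le_nhds
      refine le_of_tendsto hlim ?_
      filter_upwards [self_mem_nhdsWithin] with t ht
      refine strict ?_
      rw [norm_smul, Real.norm_of_nonneg (by linarith [mem_Ioi.1 ht]), h1]
      nlinarith [mem_Ioi.1 ht]

theorem setIntegral_Ioi_eq_intervalIntegral {f : ℝ → ℝ} {a b : ℝ} (hab : a ≤ b)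
    (h : ∀ t, b ≤ t → f t = 0) : ∫ t in Ioi a, f t = ∫ t in a..b, f t := by
  rw [intervalIntegral.integral_of_le hab]
  refine setIntegral_eq_of_subset_of_forall_sdiff_eq_zero measurableSet_Ioi
    (fun x (hx : x ∈ Ioc a b) => hx.1) fun t ht => h t ?_
  by_contra hc
  exact ht.2 ⟨ht.1, (not_le.1 hc).le⟩

section Radial

variable {γ F : ℝ → ℝ}

/-- Radial test functions, written in the variable `t = r²`. -/
structure RadialTest (P P1 P2 : ℝ → ℝ) : Prop where
  d1 : ∀ t, HasDerivAt P (P1 t) t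
  d2 : ∀ t, HasDerivAt P1 (P2 t) t
  cont : Continuous P2
  supp : ∃ T : ℝ, 0 < T ∧ ∀ t, T ≤ t → P t = 0 ∧ P1 t = 0 ∧ P2 t = 0

theorem RadialTest.identity (hγ : Continuous γ) (hF : Continuous F)
    (h : ∀ P P1 P2, RadialTest P P1 P2 →
      ∫ t in Ioi (0 : ℝ), γ t * (4 * P1 t + 4 * t * P2 t) = ∫ t in Ioi (0 : ℝ), F t * P t)
    {η : ℝ → ℝ} (hη : Continuous η) {δ T : ℝ} (hδ : 0 < δ) (hT : δ ≤ T)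
    (h0 : ∀ t, t ≤ δ → η t = 0) (h1 : ∀ t, T ≤ t → η t = 0) (hi : ∫ t in δ..T, η t = 0) :
    ∫ t in δ..T, (4 * γ t - ∫ τ in (1 : ℝ)..t, (∫ z in (0 : ℝ)..τ, F z) / τ) * η t = 0 := by
  have hT0 : 0 < T := hδ.trans_le hT
  set ψ : ℝ → ℝ := fun t => ∫ z in δ..t, η z with hψ
  have dψ : ∀ t, HasDerivAt ψ (η t) t := fun t =>
    intervalIntegral.integral_hasDerivAt_right (hη.intervalIntegrable _ _)
      (hη.stronglyMeasurableAtFilter _ _) hη.continuousAt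
  have ψ0 : ∀ t, t ≤ δ → ψ t = 0 := fun t ht => by
    rw [hψ]
    refine (intervalIntegral.integral_congr (g := fun _ => (0 : ℝ)) fun z hz => ?_).trans (by simp)
    rw [uIcc_of_ge ht] at hz
    exact h0 z hz.2
  have ψT : ∀ t, T ≤ t → ψ t = 0 := fun t ht => by
    rw [hψ]
    simp only
    rw [← intervalIntegral.integral_add_adjacent_intervals (hη.intervalIntegrable δ T)
      (hη.intervalIntegrable T t), hi, zero_add]
    refine (intervalIntegral.integral_congr (g := fun _ => (0 : ℝ)) fun z hz => ?_).trans (by simp)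
    rw [uIcc_of_le ht] at hz
    exact h1 z hz.1
  set P1 : ℝ → ℝ := fun t => ψ t / t with hP1
  set P2 : ℝ → ℝ := fun t => (η t * t - ψ t * 1) / t ^ 2 with hP2
  have near0 : ∀ᶠ t in 𝓝 (0 : ℝ), t ≤ δ := eventually_le_nhds hδ
  have dP1 : ∀ t, HasDerivAt P1 (P2 t) t := fun t => by
    rcases eq_or_ne t 0 with rfl | ht
    · have e : P1 =ᶠ[𝓝 0] fun _ => 0 := near0.mono fun t ht => by simp [hP1, ψ0 t ht]
      have : P2 0 = 0 := by simp [hP2]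
      rw [this]
      exact (hasDerivAt_const _ _).congr_of_eventuallyEq e
    · exact (dψ t).div (hasDerivAt_id t) ht
  have cP1 : Continuous P1 := continuous_iff_continuousAt.2 fun t => (dP1 t).continuousAt
  have cψ : Continuous ψ := continuous_iff_continuousAt.2 fun t => (dψ t).continuousAt
  have cP2 : Continuous P2 := continuous_iff_continuousAt.2 fun t => by
    rcases eq_or_ne t 0 with rfl | ht
    · have e : P2 =ᶠ[𝓝 0] fun _ => 0 := near0.mono fun t ht => by simp [hP2, ψ0 t ht, h0 t ht]
      exact continuousAt_const.congr e.symm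
    · exact ((hη.mul continuous_id).sub (cψ.mul continuous_const)).continuousAt.div
        (continuous_pow 2).continuousAt (pow_ne_zero 2 ht)
  set P : ℝ → ℝ := fun t => ∫ z in T..t, P1 z with hP
  have dP : ∀ t, HasDerivAt P (P1 t) t := fun t =>
    intervalIntegral.integral_hasDerivAt_right (cP1.intervalIntegrable _ _)
      (cP1.stronglyMeasurableAtFilter _ _) cP1.continuousAt
  have PT : ∀ t, T ≤ t → P t = 0 := fun t ht => by
    rw [hP]
    refine (intervalIntegral.integral_congr (g := fun _ => (0 : ℝ)) fun z hz => ?_).trans (by simp)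
    rw [uIcc_of_le ht] at hz
    simp [hP1, ψT z hz.1]
  have P0 : ∀ t, t ≤ δ → P t = P δ := fun t ht => by
    rw [hP]
    simp only
    rw [← intervalIntegral.integral_add_adjacent_intervals (cP1.intervalIntegrable T δ)
      (cP1.intervalIntegrable δ t), add_eq_left]
    refine (intervalIntegral.integral_congr (g := fun _ => (0 : ℝ)) fun z hz => ?_).trans (by simp)
    rw [uIcc_of_ge ht] at hz
    simp [hP1, ψ0 z hz.2]
  have cP : Continuous P := continuous_iff_continuousAt.2 fun t => (dP t).continuousAt
  have key := h P P1 P2 ⟨dP, dP1, cP2, T, hT0, fun t ht =>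
    ⟨PT t ht, by simp [hP1, ψT t ht], by simp [hP2, ψT t ht, h1 t ht]⟩⟩
  have e1 : ∫ t in Ioi (0 : ℝ), γ t * (4 * P1 t + 4 * t * P2 t) = ∫ t in δ..T, 4 * γ t * η t := by
    have : ∫ t in Ioi (0 : ℝ), γ t * (4 * P1 t + 4 * t * P2 t) =
        ∫ t in Ioi (0 : ℝ), 4 * γ t * η t := by
      refine setIntegral_congr_fun measurableSet_Ioi fun t (ht : 0 < t) => ?_
      simp only [hP1, hP2]
      field_simp
      ring
    rw [this, ← setIntegral_Ioi_eq_intervalIntegral hT (fun t ht => by simp [h1 t ht])]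
    refine (setIntegral_eq_of_subset_of_forall_sdiff_eq_zero measurableSet_Ioi
      (Ioi_subset_Ioi hδ.le) fun t ht => ?_)
    simp [h0 t (not_lt.1 ht.2)]
  set m : ℝ → ℝ := fun t => ∫ z in (0 : ℝ)..t, F z with hm
  have dm : ∀ t, HasDerivAt m (F t) t := fun t =>
    intervalIntegral.integral_hasDerivAt_right (hF.intervalIntegrable _ _)
      (hF.stronglyMeasurableAtFilter _ _) hF.continuousAt
  have cm : Continuous m := continuous_iff_continuousAt.2 fun t => (dm t).continuousAt
  set n : ℝ → ℝ := fun t => ∫ τ in (1 : ℝ)..t, m τ / τ with hn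
  have dn : ∀ t, 0 < t → HasDerivAt n (m t / t) t := fun t ht => by
    have hc : ContinuousOn (fun τ => m τ / τ) (Ioi 0) :=
      cm.continuousOn.div continuousOn_id fun x hx => (ne_of_gt hx)
    refine intervalIntegral.integral_hasDerivAt_right
      (ContinuousOn.intervalIntegrable (hc.mono fun x hx => ?_))
      (hc.stronglyMeasurableAtFilter isOpen_Ioi t ht)
      (hc.continuousAt (Ioi_mem_nhds ht))
    exact (lt_min one_pos ht).trans_le hx.1
  have e2 : ∫ t in Ioi (0 : ℝ), F t * P t = ∫ t in δ..T, n t * η t := by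
    have i0 : ∀ a b, IntervalIntegrable (fun t => F t * P t) volume a b :=
      fun a b => (hF.mul cP).intervalIntegrable a b
    rw [setIntegral_Ioi_eq_intervalIntegral hT0.le (fun t ht => by simp [PT t ht]),
      ← intervalIntegral.integral_add_adjacent_intervals
        (i0 0 δ) (i0 δ T)]
    have a1 : ∫ t in (0 : ℝ)..δ, F t * P t = m δ * P δ := by
      rw [hm]
      simp only
      rw [← intervalIntegral.integral_mul_const]
      refine intervalIntegral.integral_congr fun t ht => ?_
      rw [uIcc_of_le hδ.le] at ht
      simp only [P0 t ht.2]
    have cn : ContinuousOn n (Icc δ T) := fun t ht =>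
      (dn t (hδ.trans_le ht.1)).continuousAt.continuousWithinAt
    have i2 : IntervalIntegrable (fun t => n t * η t) volume δ T := by
      refine ContinuousOn.intervalIntegrable ?_
      rw [uIcc_of_le hT]
      exact cn.mul hη.continuousOn
    have a2 : ∫ t in δ..T, (F t * P t - n t * η t) = -(m δ * P δ) := by
      rw [intervalIntegral.integral_eq_sub_of_hasDerivAt (f := fun t => m t * P t - n t * ψ t)
        (fun t ht => ?_) ((i0 δ T).sub i2)]
      · simp [PT T le_rfl, ψT T le_rfl, ψ0 δ le_rfl]
      · rw [uIcc_of_le hT] at ht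
        have ht0 : 0 < t := hδ.trans_le ht.1
        refine (((dm t).mul (dP t)).sub ((dn t ht0).mul (dψ t))).congr_deriv ?_
        simp only [hP1]
        field_simp
        ring
    rw [intervalIntegral.integral_sub (i0 δ T) i2] at a2
    linarith
  have cw : ContinuousOn n (uIcc δ T) := fun t ht => by
    rw [uIcc_of_le hT] at ht
    exact (dn t (hδ.trans_le ht.1)).continuousAt.continuousWithinAt
  have i1 : IntervalIntegrable (fun t => 4 * γ t * η t) volume δ T :=
    ((continuous_const.mul hγ).mul hη).intervalIntegrable _ _
  have i2 : IntervalIntegrable (fun t => n t * η t) volume δ T :=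
    (cw.mul hη.continuousOn).intervalIntegrable
  have := intervalIntegral.integral_sub i1 i2
  rw [← e1, key, e2, sub_self] at this
  refine Eq.trans ?_ this
  exact intervalIntegral.integral_congr fun t _ => sub_mul _ _ _

/-- The du Bois-Reymond lemma on the half line. -/
theorem RadialTest.integrated (hγ : Continuous γ) (hF : Continuous F)
    (h : ∀ P P1 P2, RadialTest P P1 P2 →
      ∫ t in Ioi (0 : ℝ), γ t * (4 * P1 t + 4 * t * P2 t) = ∫ t in Ioi (0 : ℝ), F t * P t)
    {x y : ℝ} (hx : 0 < x) (hy : 0 < y) :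
    4 * γ x - ∫ τ in (1 : ℝ)..x, (∫ z in (0 : ℝ)..τ, F z) / τ =
      4 * γ y - ∫ τ in (1 : ℝ)..y, (∫ z in (0 : ℝ)..τ, F z) / τ := by
  set H : ℝ → ℝ := fun x => 4 * γ x - ∫ τ in (1 : ℝ)..x, (∫ z in (0 : ℝ)..τ, F z) / τ with hH
  set δ := min x y / 2
  set T := max x y + 1
  have hm : 0 < min x y := lt_min hx hy
  have hδ : 0 < δ := half_pos hm
  have hxl : δ < x := (half_lt_self hm).trans_le (min_le_left _ _)
  have hyl : δ < y := (half_lt_self hm).trans_le (min_le_right _ _)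
  have hxT : x < T := (le_max_left _ _).trans_lt (lt_add_one _)
  have hyT : y < T := (le_max_right _ _).trans_lt (lt_add_one _)
  have hT : δ < T := hxl.trans hxT
  have cH : ContinuousOn H (Icc δ T) := fun t ht => by
    have ht0 : 0 < t := hδ.trans_le ht.1
    have cm : Continuous fun t => ∫ z in (0 : ℝ)..t, F z :=
      intervalIntegral.continuous_primitive (fun a b => hF.intervalIntegrable a b) 0
    have hc : ContinuousOn (fun τ => (∫ z in (0 : ℝ)..τ, F z) / τ) (Ioi 0) :=
      cm.continuousOn.div continuousOn_id fun x hx => (ne_of_gt hx)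
    refine ((continuous_const.mul hγ).continuousAt.sub ?_).continuousWithinAt
    refine (intervalIntegral.integral_hasDerivAt_right
      (ContinuousOn.intervalIntegrable (hc.mono fun x hx => ?_))
      (hc.stronglyMeasurableAtFilter isOpen_Ioi t ht0)
      (hc.continuousAt (Ioi_mem_nhds ht0))).continuousAt
    exact (lt_min one_pos ht0).trans_le hx.1
  set κ : ℝ → ℝ := fun t => max δ (min t T) with hκ
  have κc : Continuous κ := by fun_prop
  have κm : ∀ t, κ t ∈ Icc δ T := fun t => ⟨le_max_left _ _, max_le hT.le (min_le_right _ _)⟩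
  have κi : ∀ t ∈ Icc δ T, κ t = t := fun t ht => by simp [hκ, ht.1, ht.2]
  have cHκ : Continuous fun t => H (κ t) := cH.comp_continuous κc κm
  set w : ℝ → ℝ := fun t => max 0 ((t - δ) * (T - t)) with hw
  have cw : Continuous w := by fun_prop
  have w0 : ∀ t, 0 ≤ w t := fun t => le_max_left _ _
  have wp : ∀ t, δ < t → t < T → 0 < w t := fun t h1 h2 =>
    lt_max_of_lt_right (mul_pos (sub_pos.2 h1) (sub_pos.2 h2))
  have wl : ∀ t, t ≤ δ → w t = 0 := fun t ht =>
    max_eq_left (mul_nonpos_of_nonpos_of_nonneg (by linarith) (by linarith))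
  have wr : ∀ t, T ≤ t → w t = 0 := fun t ht =>
    max_eq_left (mul_nonpos_of_nonneg_of_nonpos (by linarith) (by linarith))
  have iw : 0 < ∫ t in δ..T, w t := by
    refine intervalIntegral.intervalIntegral_pos_of_pos_on (cw.intervalIntegrable _ _) ?_ hT
    exact fun t ht => wp t ht.1 ht.2
  set c := (∫ t in δ..T, H (κ t) * w t) / ∫ t in δ..T, w t with hc
  set η : ℝ → ℝ := fun t => (H (κ t) - c) * w t with hη
  have cη : Continuous η := (cHκ.sub continuous_const).mul cw
  have iη : ∫ t in δ..T, η t = 0 := by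
    have : ∀ t, η t = H (κ t) * w t - c * w t := fun t => by simp only [hη]; ring
    simp only [this]
    have i1 : IntervalIntegrable (fun t => H (κ t) * w t) volume δ T :=
      (cHκ.mul cw).intervalIntegrable _ _
    have i2 : IntervalIntegrable (fun t => c * w t) volume δ T :=
      (continuous_const.mul cw).intervalIntegrable _ _
    rw [intervalIntegral.integral_sub i1 i2, intervalIntegral.integral_const_mul, hc,
      div_mul_cancel₀ _ iw.ne', sub_self]
  have key := RadialTest.identity hγ hF h cη hδ hT.le (fun t ht => by simp [hη, wl t ht])
    (fun t ht => by simp [hη, wr t ht]) iη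
  have key2 : ∫ t in δ..T, (H (κ t) - c) * η t = 0 := by
    have e : ∀ t, (H (κ t) - c) * η t = H (κ t) * η t - c * η t := fun t => by ring
    simp only [e]
    have i1 : IntervalIntegrable (fun t => H (κ t) * η t) volume δ T :=
      (cHκ.mul cη).intervalIntegrable _ _
    have i2 : IntervalIntegrable (fun t => c * η t) volume δ T :=
      (continuous_const.mul cη).intervalIntegrable _ _
    rw [intervalIntegral.integral_sub i1 i2, intervalIntegral.integral_const_mul, iη,
      mul_zero, sub_zero, ← key]
    refine intervalIntegral.integral_congr fun t ht => ?_
    rw [uIcc_of_le hT.le] at ht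
    simp only [κi t ht, hH]
  have zero : ∀ t, δ < t → t < T → H t = c := fun t h1 h2 => by
    by_contra hne
    have : 0 < ∫ t in δ..T, (H (κ t) - c) * η t := by
      refine intervalIntegral.integral_pos hT ((cHκ.sub continuous_const).mul cη).continuousOn
        (fun z _ => ?_) ⟨t, ⟨h1.le, h2.le⟩, ?_⟩
      · simp only [hη]; nlinarith [mul_nonneg (sq_nonneg (H (κ z) - c)) (w0 z)]
      · simp only [hη, κi t ⟨h1.le, h2.le⟩]
        have := mul_pos (pow_pos (abs_pos.2 (sub_ne_zero.2 hne)) 2) (wp t h1 h2)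
        rw [sq_abs] at this
        nlinarith
    exact this.ne' key2
  exact (zero x hxl hxT).trans (zero y hyl hyT).symm

end Radial

theorem integrable_radial_iff {k : ℝ → ℝ} :
    Integrable (fun x : Plane => k ‖x‖) ↔ IntegrableOn (fun r => r * k r) (Ioi 0) := by
  have := integrable_fun_norm_addHaar (E := Plane) volume (f := k)
  simpa [finrank_euclideanSpace] using this

theorem integral_radial (k : ℝ → ℝ) :
    ∫ x : Plane, k ‖x‖ = 2 * volume.real (ball (0 : Plane) 1) * ∫ r in Ioi (0 : ℝ), r * k r := by
  have := integral_fun_norm_addHaar (E := Plane) volume k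
  rw [this]
  simp [finrank_euclideanSpace, mul_assoc]

theorem volume_real_ball_pos : 0 < volume.real (ball (0 : Plane) 1) := by
  rw [Measure.real, ENNReal.toReal_pos_iff]
  exact ⟨measure_ball_pos _ _ one_pos, measure_ball_lt_top⟩

theorem integral_radial_sq (k : ℝ → ℝ) :
    ∫ x : Plane, k (‖x‖ ^ 2) = volume.real (ball (0 : Plane) 1) * ∫ t in Ioi (0 : ℝ), k t := by
  rw [integral_radial (fun r => k (r ^ 2)), ← integral_comp_rpow_Ioi_of_pos (g := k) two_pos]
  have : ∀ x : ℝ, (2 * x ^ ((2 : ℝ) - 1)) • k (x ^ (2 : ℝ)) = 2 * (x * k (x ^ 2)) := fun x => by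
    rw [show (2 : ℝ) - 1 = 1 by norm_num, Real.rpow_one, Real.rpow_two, smul_eq_mul, mul_assoc]
  rw [setIntegral_congr_fun measurableSet_Ioi fun x _ => this x, integral_const_mul]
  ring

theorem RadialTest.testFn {P P1 P2 : ℝ → ℝ} (h : RadialTest P P1 P2) :
    TestFn fun y => P (‖y - 0‖ ^ 2) := by
  obtain ⟨T, hT, hs⟩ := h.supp
  have c0 : Continuous P := continuous_iff_continuousAt.2 fun t => (h.d1 t).continuousAt
  have c1 : Continuous P1 := continuous_iff_continuousAt.2 fun t => (h.d2 t).continuousAt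
  have hb : ∀ f : ℝ → ℝ, Continuous f → ∃ B, ∀ t ∈ Icc 0 T, |f t| ≤ B := fun f hf => by
    obtain ⟨B, hB⟩ := isCompact_Icc.exists_bound_of_continuousOn (hf.continuousOn (s := Icc 0 T))
    exact ⟨B, hB⟩
  obtain ⟨B0, h0⟩ := hb P c0
  obtain ⟨B1, h1⟩ := hb P1 c1
  obtain ⟨B2, h2⟩ := hb P2 h.cont
  set B := max B0 (max B1 B2) with hB
  have hBn : 0 ≤ B := (abs_nonneg _).trans ((h0 0 ⟨le_rfl, hT.le⟩).trans (le_max_left _ _))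
  have key : ∀ z t : ℝ, 0 ≤ t → (t ≤ T → |z| ≤ B) → (T ≤ t → z = 0) →
      |z| ≤ B * Real.exp T * Real.exp (-1 * t) := fun z t ht hz hz0 => by
    rcases le_total t T with htT | htT
    · refine (hz htT).trans ?_
      rw [mul_assoc, ← Real.exp_add]
      exact le_mul_of_one_le_right hBn (Real.one_le_exp (by linarith))
    · rw [hz0 htT, abs_zero]; positivity
  refine testFn_radial h.d1 h.d2 (k := 1) one_pos (C := B * Real.exp T) fun t ht => ⟨?_, ?_, ?_⟩
  · exact key _ t ht (fun hh => (h0 t ⟨ht, hh⟩).trans (le_max_left _ _)) fun hh => (hs t hh).1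
  · exact key _ t ht (fun hh => (h1 t ⟨ht, hh⟩).trans ((le_max_left _ _).trans (le_max_right _ _)))
      fun hh => (hs t hh).2.1
  · exact key _ t ht (fun hh => (h2 t ⟨ht, hh⟩).trans ((le_max_right _ _).trans (le_max_right _ _)))
      fun hh => (hs t hh).2.2

theorem norm_smul_e0 {r : ℝ} (hr : 0 ≤ r) : ‖r • e0‖ = r := by
  simp [e0, norm_smul, abs_of_nonneg hr]

theorem WeakSol.radSol {l K : ℝ} {w : Plane → ℝ} (h : WeakSol l K w)
    (hl : 0 ≤ l) (hc : Continuous w) (hpos : ∀ x, 0 < w x) (ha :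
        ∀ x y : Plane, ‖x‖ ≤ ‖y‖ → w y ≤ w x)
    (hi : Integrable fun x => w x ^ 2) :
    ∃ p, RadSol l (fun r => w (r • e0)) p := by
  set γ : ℝ → ℝ := fun t => w (Real.sqrt t • e0) with hγ
  have cγ : Continuous γ := hc.comp (Real.continuous_sqrt.smul continuous_const)
  set F : ℝ → ℝ := fun t => l * γ t - γ t ^ 3 with hF
  have cF : Continuous F := by fun_prop
  have hw : ∀ y : Plane, w y = w (‖y‖ • e0) := fun y => by
    have e := norm_smul_e0 (norm_nonneg y)
    exact le_antisymm (ha _ _ e.le) (ha _ _ e.ge)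
  have hwγ : ∀ y : Plane, w y = γ (‖y‖ ^ 2) := fun y => by
    rw [hw, hγ]; simp only [Real.sqrt_sq (norm_nonneg y)]
  have identity : ∀ P P1 P2, RadialTest P P1 P2 →
      ∫ t in Ioi (0 : ℝ), γ t * (4 * P1 t + 4 * t * P2 t) = ∫ t in Ioi (0 : ℝ), F t * P t := by
    intro P P1 P2 hP
    have ht := hP.testFn
    have gw1 : GaussInt w := GaussInt.of_bdd h.meas.aestronglyMeasurable h.bdd
    have gw3 : GaussInt fun x => w x ^ 3 :=
      GaussInt.of_bdd (h.meas.pow_const 3).aestronglyMeasurable h.abs_cube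
    have e := h.eq _ ht
    have e2 : ∫ x, w x * lapR (fun y => P (‖y - 0‖ ^ 2)) x =
        ∫ x : Plane, (fun t => γ t * (4 * P1 t + 4 * t * P2 t)) (‖x‖ ^ 2) := by
      refine integral_congr_ae (Eventually.of_forall fun x => ?_)
      simp only [lapR_radial hP.d1 hP.d2 (c := 0) x, hwγ x]
      simp only [sub_zero]
    have e3 : ∫ x : Plane, (fun t => F t * P t) (‖x‖ ^ 2) =
        l * (∫ x, w x * P (‖x - 0‖ ^ 2)) - ∫ x, w x ^ 3 * P (‖x - 0‖ ^ 2) := by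
      rw [← integral_const_mul, ← integral_sub ((ht.int gw1).const_mul l) (ht.int gw3)]
      refine integral_congr_ae (Eventually.of_forall fun x => ?_)
      simp only [hF, ← hwγ x, sub_zero]
      ring
    have e4 : ∫ x : Plane, (fun t => γ t * (4 * P1 t + 4 * t * P2 t)) (‖x‖ ^ 2) =
        ∫ x : Plane, (fun t => F t * P t) (‖x‖ ^ 2) := by
      rw [← e2, e3]; linarith
    rw [integral_radial_sq (fun t => γ t * (4 * P1 t + 4 * t * P2 t)),
      integral_radial_sq (fun t => F t * P t)] at e4
    exact mul_left_cancel₀ volume_real_ball_pos.ne' e4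
  have hfi := fun x (hx : (0 : ℝ) < x) =>
    RadialTest.integrated cγ cF identity hx one_pos
  set m : ℝ → ℝ := fun t => ∫ z in (0 : ℝ)..t, F z with hm
  have dm : ∀ t, HasDerivAt m (F t) t := fun t =>
    intervalIntegral.integral_hasDerivAt_right (cF.intervalIntegrable _ _)
      (cF.stronglyMeasurableAtFilter _ _) cF.continuousAt
  have cm : Continuous m := continuous_iff_continuousAt.2 fun t => (dm t).continuousAt
  have dγ : ∀ t, 0 < t → HasDerivAt γ (m t / t / 4) t := fun t ht => by
    have hc : ContinuousOn (fun τ => m τ / τ) (Ioi 0) :=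
      cm.continuousOn.div continuousOn_id fun x hx => (ne_of_gt hx)
    have dn : HasDerivAt (fun t => ∫ τ in (1 : ℝ)..t, m τ / τ) (m t / t) t := by
      refine intervalIntegral.integral_hasDerivAt_right
        (ContinuousOn.intervalIntegrable (hc.mono fun x hx => ?_))
        (hc.stronglyMeasurableAtFilter isOpen_Ioi t ht)
        (hc.continuousAt (Ioi_mem_nhds ht))
      exact (lt_min one_pos ht).trans_le hx.1
    have e : γ =ᶠ[𝓝 t] fun t => ((∫ τ in (1 : ℝ)..t, m τ / τ) +
        (4 * γ 1 - ∫ τ in (1 : ℝ)..1, m τ / τ)) / 4 := by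
      filter_upwards [Ioi_mem_nhds ht] with x hx
      rw [← hfi x hx]; ring
    exact ((dn.add_const _).div_const 4).congr_of_eventuallyEq e
  set g : ℝ → ℝ := fun r => w (r • e0) with hg
  set p : ℝ → ℝ := fun r => m (r ^ 2) / (2 * r) with hp
  have cg : Continuous g := hc.comp (continuous_id.smul continuous_const)
  have gγ : ∀ r, 0 < r → g r = γ (r ^ 2) := fun r hr => by
    simp only [hg, hγ, Real.sqrt_sq hr.le]
  have dg : ∀ r, 0 < r → HasDerivAt g (p r) r := fun r hr => by
    have h2 : HasDerivAt (fun r : ℝ => r ^ 2) (2 * r) r := by simpa using hasDerivAt_pow 2 r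
    have := (dγ (r ^ 2) (by positivity)).comp r h2
    refine (this.congr_of_eventuallyEq ?_).congr_deriv ?_
    · filter_upwards [Ioi_mem_nhds hr] with x hx using gγ x hx
    · simp only [hp]; field_simp; ring
  have dp : ∀ r, 0 < r → HasDerivAt p (-p r / r + l * g r - g r ^ 3) r := fun r hr => by
    have h2 : HasDerivAt (fun r : ℝ => r ^ 2) (2 * r) r := by simpa using hasDerivAt_pow 2 r
    have := ((dm (r ^ 2)).comp r h2).div ((hasDerivAt_id r).const_mul 2) (by simpa using hr.ne')
    refine this.congr_deriv ?_
    rw [gγ r hr]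
    simp only [hp, hF, Function.comp, id]
    field_simp
    ring
  have gpos : ∀ r, 0 < g r := fun r => hpos _
  have ganti : ∀ r s, 0 < r → r ≤ s → g s ≤ g r := fun r s hr hrs =>
    ha _ _ (by rw [norm_smul_e0 hr.le, norm_smul_e0 (hr.le.trans hrs)]; exact hrs)
  have pnon : ∀ r, 0 < r → p r ≤ 0 := fun r hr => by
    have h1 : AntitoneOn g (Ioi 0) := fun x hx y _ hxy => ganti x y hx hxy
    rw [← (dg r hr).hasDerivWithinAt.derivWithin (isOpen_Ioi.uniqueDiffWithinAt hr)]
    exact h1.derivWithin_nonpos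
  have p0 : Tendsto p (𝓝[>] 0) (𝓝 0) := by
    have hFb : ∀ t, |F t| ≤ |l| * K + K ^ 3 := fun t => by
      refine (abs_sub _ _).trans (add_le_add ?_ ?_)
      · rw [abs_mul]; exact mul_le_mul_of_nonneg_left (h.bdd _) (abs_nonneg _)
      · exact h.abs_cube _
    have hmb : ∀ t, 0 < t → |m t| ≤ (|l| * K + K ^ 3) * t := fun t ht => by
      have := intervalIntegral.norm_integral_le_of_norm_le_const (a := 0) (b := t) (f := F)
        fun x _ => hFb x
      rwa [sub_zero, abs_of_pos ht] at this
    refine squeeze_zero_norm' (a := fun r => (|l| * K + K ^ 3) * r / 2) ?_ ?_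
    · filter_upwards [self_mem_nhdsWithin] with r (hr : 0 < r)
      rw [hp, Real.norm_eq_abs, abs_div, abs_of_pos (by positivity : 0 < 2 * r),
          div_le_iff₀ (by positivity)]
      refine (hmb _ (by positivity)).trans (le_of_eq ?_)
      ring
    · have : Continuous fun r : ℝ => (|l| * K + K ^ 3) * r / 2 := by fun_prop
      simpa using (this.tendsto 0).mono_left nhdsWithin_le_nhds
  have ig : IntegrableOn (fun r => r * g r ^ 2) (Ioi 0) := by
    refine (integrable_radial_iff (k := fun r => g r ^ 2)).1 ?_
    refine hi.congr (Eventually.of_forall fun x => ?_)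
    simp only [hg, ← hw x]
  refine ⟨p, gpos 0, fun r _ => gpos r, dg, dp, cg.continuousWithinAt, p0, ig, ?_⟩
  have pz : p 0 = 0 := by simp [hp]
  have cp : ContinuousOn p (Ici 0) := fun r hr => by
    rcases eq_or_lt_of_le (show (0 : ℝ) ≤ r from hr) with rfl | hr0
    · refine continuousWithinAt_Ioi_iff_Ici.1 ?_
      rw [ContinuousWithinAt, pz]
      exact p0
    · exact (dp r hr0).continuousAt.continuousWithinAt
  have cp2 : ∀ R, 0 ≤ R → IntervalIntegrable (fun r => r * p r ^ 2) volume 0 R := fun R hR => by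
    refine ContinuousOn.intervalIntegrable ?_
    rw [uIcc_of_le hR]
    exact (continuousOn_id.mul (cp.pow 2)).mono Icc_subset_Ici_self
  have cg2 : ∀ n R, IntervalIntegrable (fun r => r * g r ^ n) volume 0 R := fun n R =>
    (continuous_id.mul (cg.pow n)).intervalIntegrable _ _
  refine integrableOn_Ioi_of_intervalIntegral_norm_bounded
    (K ^ 2 * ∫ r in Ioi (0 : ℝ), r * g r ^ 2) 0 (l := atTop) (b := fun R : ℝ => max R 0)
    (fun R => ?_) (tendsto_atTop_mono (fun R => le_max_left R 0) tendsto_id) ?_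
  · rw [← intervalIntegrable_iff_integrableOn_Ioc_of_le (le_max_right _ _)]
    exact cp2 _ (le_max_right _ _)
  · filter_upwards [eventually_gt_atTop 0] with R hR
    rw [max_eq_left hR.le]
    have e := intervalIntegral.integral_eq_sub_of_hasDerivAt_of_le hR.le
      (f := fun r => r * g r * p r) (f' := fun r => r * p r ^ 2 + l * (r * g r ^ 2) - r * g r ^ 4)
      (((continuous_id.mul cg).continuousOn.mul cp).mono Icc_subset_Ici_self) (fun r hr => by
        refine (((hasDerivAt_id' r).mul (dg r hr.1)).mul (dp r hr.1)).congr_deriv ?_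
        have := hr.1.ne'
        simp only [Pi.mul_apply]
        field_simp; ring) ((cp2 R hR.le).add ((cg2 2 R).const_mul l) |>.sub (cg2 4 R))
    rw [intervalIntegral.integral_sub ((cp2 R hR.le).add ((cg2 2 R).const_mul l)) (cg2 4 R),
      intervalIntegral.integral_add (cp2 R hR.le) ((cg2 2 R).const_mul l),
      intervalIntegral.integral_const_mul] at e
    have e1 : ∫ r in (0 : ℝ)..R, ‖r * p r ^ 2‖ = ∫ r in (0 : ℝ)..R, r * p r ^ 2 := by
      refine intervalIntegral.integral_congr fun r hr => ?_
      rw [uIcc_of_le hR.le] at hr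
      exact abs_of_nonneg (mul_nonneg hr.1 (sq_nonneg _))
    have e2 : R * g R * p R ≤ 0 :=
      mul_nonpos_of_nonneg_of_nonpos (mul_pos hR (gpos R)).le (pnon R hR)
    have e3 : 0 ≤ ∫ r in (0 : ℝ)..R, r * g r ^ 2 :=
      intervalIntegral.integral_nonneg hR.le fun r hr => mul_nonneg hr.1 (sq_nonneg _)
    have e4 : ∫ r in (0 : ℝ)..R, r * g r ^ 4 ≤ K ^ 2 * ∫ r in (0 : ℝ)..R, r * g r ^ 2 := by
      rw [← intervalIntegral.integral_const_mul]
      refine intervalIntegral.integral_mono_on hR.le (cg2 4 R) ((cg2 2 R).const_mul _)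
          fun r hr => ?_
      have : g r ^ 2 ≤ K ^ 2 := sq_le_sq' (by linarith [(abs_le.1 (h.bdd (r • e0))).1])
        ((le_abs_self _).trans (h.bdd _))
      nlinarith [mul_nonneg hr.1 (sq_nonneg (g r))]
    have e5 : ∫ r in (0 : ℝ)..R, r * g r ^ 2 ≤ ∫ r in Ioi (0 : ℝ), r * g r ^ 2 := by
      rw [intervalIntegral.integral_of_le hR.le]
      exact setIntegral_mono_set ig ((ae_restrict_iff' measurableSet_Ioi).2
        (Eventually.of_forall fun r hr => mul_nonneg (le_of_lt hr) (sq_nonneg _)))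
        (Eventually.of_forall Ioc_subset_Ioi_self)
    rw [e1]
    nlinarith [mul_nonneg hl e3, mul_le_mul_of_nonneg_left e5 (sq_nonneg K)]

section Affine

variable {E : Type*} [NormedAddCommGroup E]

theorem integral_affine [NormedSpace ℝ E] (f : Plane → E) {b : ℝ} (z : Plane) :
    ∫ x, f (b • x + z) = (b ^ 2)⁻¹ • ∫ x, f x := by
  rw [Measure.integral_comp_smul volume (fun x => f (x + z)), integral_add_right_eq_self]
  simp [finrank_euclideanSpace, abs_of_nonneg (sq_nonneg b)]

theorem integrable_affine {f : Plane → E} (hf : Integrable f) {b : ℝ} (hb : b ≠ 0) (z : Plane) :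
    Integrable fun x => f (b • x + z) :=
  (integrable_comp_smul_iff volume (fun x => f (x + z)) hb).2 (hf.comp_add_right z)

theorem fderiv_affine [NormedSpace ℝ E] (f : Plane → E) (b : ℝ) (z x : Plane) :
    fderiv ℝ (fun y => f (b • y + z)) x = b • fderiv ℝ f (b • x + z) := by
  rw [fderiv_comp_smul (f := fun x => f (x + z)), fderiv_comp_add_right]

end Affine

theorem gradSqR_affine (f : Plane → ℝ) (b : ℝ) (z x : Plane) :
    gradSqR (fun y => f (b • y + z)) x = b ^ 2 * gradSqR f (b • x + z) := by
  rw [gradSqR_eq, gradSqR_eq, fderiv_affine, norm_smul, mul_pow, Real.norm_eq_abs, sq_abs]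

/-! ### The ground state -/

namespace IsGroundState
variable {Q : Plane → ℝ}

theorem diff (h : IsGroundState Q) : Differentiable ℝ Q := h.1.differentiable two_ne_zero

theorem contDiff_d0R (h : IsGroundState Q) : ContDiff ℝ 1 (d0R Q) :=
  (h.1.fderiv_right (m := 1) (by norm_num)).clm_apply contDiff_const

theorem contDiff_d1R (h : IsGroundState Q) : ContDiff ℝ 1 (d1R Q) :=
  (h.1.fderiv_right (m := 1) (by norm_num)).clm_apply contDiff_const

theorem angular (h : IsGroundState Q) (x : Plane) : x 0 * d1R Q x - x 1 * d0R Q x = 0 := by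
  set J : Plane := (-(x 1)) • e0 + x 0 • e1 with hJ
  have hJ0 : J 0 = -(x 1) := by simp [hJ, e0, e1]
  have hJ1 : J 1 = x 0 := by simp [hJ, e0, e1]
  have dc : HasDerivAt (fun θ : ℝ => Real.cos θ • x + Real.sin θ • J) J 0 := by
    have := ((Real.hasDerivAt_cos 0).smul_const x).add ((Real.hasDerivAt_sin 0).smul_const J)
    refine this.congr_deriv (by simp)
  have hd : HasDerivAt (fun θ : ℝ => Q (Real.cos θ • x + Real.sin θ • J)) (fderiv ℝ Q x J) 0 := by
    have := (h.diff (Real.cos 0 • x + Real.sin 0 • J)).hasFDerivAt.comp_hasDerivAt (0 : ℝ) dc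
    simpa [Function.comp_def] using this
  have e : (fun θ : ℝ => Q (Real.cos θ • x + Real.sin θ • J)) = fun _ => Q x := by
    funext θ
    refine h.2.2.1 _ _ ?_
    rw [← sq_eq_sq₀ (norm_nonneg _) (norm_nonneg _), plane_norm_sq, plane_norm_sq]
    simp only [PiLp.add_apply, PiLp.smul_apply, smul_eq_mul, hJ0, hJ1]
    linear_combination (x 0 ^ 2 + x 1 ^ 2) * Real.sin_sq_add_cos_sq θ
  rw [e] at hd
  have := hd.unique (hasDerivAt_const _ _)
  rw [clm_apply_plane, hJ0, hJ1] at this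
  simp only [d0R, d1R]
  linarith

theorem dg (h : IsGroundState Q) (r : ℝ) :
    HasDerivAt (fun r : ℝ => Q (r • e0)) (d0R Q (r • e0)) r := by
  have dc : HasDerivAt (fun r : ℝ => r • e0) e0 r := by
    simpa using (hasDerivAt_id r).smul_const e0
  exact (h.diff (r • e0)).hasFDerivAt.comp_hasDerivAt r dc

theorem dp (h : IsGroundState Q) {r : ℝ} (hr : 0 < r) :
    HasDerivAt (fun r : ℝ => d0R Q (r • e0))
      (-d0R Q (r • e0) / r + 1 * Q (r • e0) - Q (r • e0) ^ 3) r := by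
  have dc : HasDerivAt (fun r : ℝ => r • e0) e0 r := by
    simpa using (hasDerivAt_id r).smul_const e0
  have D0 := h.contDiff_d0R.differentiable one_ne_zero (r • e0)
  have D1 := h.contDiff_d1R.differentiable one_ne_zero (r • e0)
  refine (D0.hasFDerivAt.comp_hasDerivAt r dc).congr_deriv ?_
  have eqn := h.2.2.2.2.2 (r • e0)
  have c0 := (EuclideanSpace.proj (𝕜 := ℝ) (0 : Fin 2) : Plane →L[ℝ] ℝ).hasFDerivAt (x := r • e0)
  have c1 := (EuclideanSpace.proj (𝕜 := ℝ) (1 : Fin 2) : Plane →L[ℝ] ℝ).hasFDerivAt (x := r • e0)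
  have hA := (c0.mul D1.hasFDerivAt).sub (c1.mul D0.hasFDerivAt)
  have hz : (fun x : Plane => x 0 * d1R Q x - x 1 * d0R Q x) = fun _ => 0 := by
    funext x; exact h.angular x
  have := hA.unique ((hasFDerivAt_const (0 : ℝ) (r • e0)).congr_of_eventuallyEq
    (Eventually.of_forall fun x => h.angular x))
  have := congrArg (fun L => L e1) this
  simp [e0, e1] at this
  simp only [lapR] at eqn
  have e : fderiv ℝ (d1R Q) (r • e0) e1 = d0R Q (r • e0) / r := by
    rw [eq_div_iff hr.ne']
    simp only [e0, e1]
    linarith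
  rw [e] at eqn
  rw [neg_div]
  linarith

theorem norm_fderiv_sq (h : IsGroundState Q) {x : Plane} (hx : x ≠ 0) :
    ‖fderiv ℝ Q x‖ ^ 2 = d0R Q (‖x‖ • e0) ^ 2 := by
  have hx0 : 0 < ‖x‖ := norm_pos_iff.2 hx
  have h1 : HasDerivAt (fun s : ℝ => Q (s • x)) (fderiv ℝ Q x x) 1 := by
    have dc : HasDerivAt (fun r : ℝ => r • x) x 1 := by
      simpa using (hasDerivAt_id (1 : ℝ)).smul_const x
    have := (h.diff ((1 : ℝ) • x)).hasFDerivAt.comp_hasDerivAt (1 : ℝ) dc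
    simpa [Function.comp_def] using this
  have h2 : HasDerivAt (fun s : ℝ => Q (s • x)) (d0R Q (‖x‖ • e0) * ‖x‖) 1 := by
    have e : (fun s : ℝ => Q (s • x)) = fun s => Q ((s * ‖x‖) • e0) := by
      funext s
      refine h.2.2.1 _ _ ?_
      simp [norm_smul, e0]
    rw [e]
    have hm : HasDerivAt (fun s : ℝ => s * ‖x‖) ‖x‖ 1 := by
      simpa using (hasDerivAt_id (1 : ℝ)).mul_const ‖x‖
    have := (h.dg (1 * ‖x‖)).comp (1 : ℝ) hm
    simpa [Function.comp_def] using this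
  have h3 := h1.unique h2
  rw [clm_apply_plane] at h3
  have h4 := h.angular x
  rw [clm_norm_sq]
  simp only [d0R, d1R] at h4 h3 ⊢
  have h5 := plane_norm_sq x
  refine mul_left_cancel₀ (pow_pos hx0 2).ne' ?_
  have : ‖x‖ ^ 2 * (fderiv ℝ Q (‖x‖ • e0) e0) ^ 2 =
      (x 0 * fderiv ℝ Q x e0 + x 1 * fderiv ℝ Q x e1) ^ 2 := by rw [h3]; ring
  rw [this, h5]
  linear_combination (x 0 * fderiv ℝ Q x e1 - x 1 * fderiv ℝ Q x e0) * h4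

theorem radSol (h : IsGroundState Q) :
    RadSol 1 (fun r => Q (r • e0)) (fun r => d0R Q (r • e0)) where
  zero_pos := h.2.1 _
  pos := fun r _ => h.2.1 _
  dg := fun r _ => h.dg r
  dp := fun r hr => h.dp hr
  g0 := (h.dg 0).continuousAt.continuousWithinAt
  p0 := by
    have hc : Continuous fun r : ℝ => d0R Q (r • e0) :=
      h.contDiff_d0R.continuous.comp (continuous_id.smul continuous_const)
    have hz : d0R Q ((0 : ℝ) • e0) = 0 := by
      have h1 := h.dg 0
      have h2 : HasDerivAt (fun r : ℝ => Q (r • e0)) (d0R Q ((0 : ℝ) • e0) * -1) 0 := by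
        have e : (fun r : ℝ => Q (r • e0)) = fun r => Q ((-r) • e0) := by
          funext r
          exact h.2.2.1 _ _ (by simp [norm_smul])
        rw [e]
        have := (h.dg (-0)).comp (0 : ℝ) (hasDerivAt_neg (0 : ℝ))
        simpa [Function.comp_def] using this
      linarith [h1.unique h2]
    have := hc.continuousWithinAt (s := Ioi 0) (x := 0)
    rwa [ContinuousWithinAt, hz] at this
  ig := by
    refine (integrable_radial_iff (k := fun r => Q (r • e0) ^ 2)).1 ?_
    refine h.2.2.2.1.congr (Eventually.of_forall fun x => ?_)
    simp only [h.2.2.1 x (‖x‖ • e0) (by simp [norm_smul, e0])]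
  ip := by
    refine (integrable_radial_iff (k := fun r => d0R Q (r • e0) ^ 2)).1 ?_
    refine h.2.2.2.2.1.congr ?_
    filter_upwards [compl_mem_ae_iff.2 (measure_singleton (0 : Plane))] with x hx
    exact h.norm_fderiv_sq hx

theorem eq_radial (h : IsGroundState Q) (x : Plane) : Q x = Q (‖x‖ • e0) :=
  h.2.2.1 _ _ (by simp [norm_smul, e0])

theorem h1R (h : IsGroundState Q) : H1R Q :=
  ⟨h.diff, h.2.2.2.1, h.2.2.2.2.1.congr (Eventually.of_forall fun x => (gradSqR_eq Q x).symm)⟩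

theorem integral_sq (h : IsGroundState Q) : ∫ x, Q x ^ 2 =
    2 * volume.real (ball (0 : Plane) 1) * ∫ r in Ioi (0 : ℝ), r * Q (r • e0) ^ 2 := by
  rw [← integral_radial fun r => Q (r • e0) ^ 2]
  exact integral_congr_ae (Eventually.of_forall fun x => by simp only [← h.eq_radial x])

theorem integral_sq_pos (h : IsGroundState Q) : 0 < ∫ x, Q x ^ 2 := by
  refine (integral_pos_iff_support_of_nonneg (fun x => sq_nonneg _) h.2.2.2.1).2 ?_
  have : Function.support (fun x => Q x ^ 2) = univ :=
    eq_univ_of_forall fun x => (pow_pos (h.2.1 x) 2).ne'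
  rw [this]
  exact isOpen_univ.measure_pos _ univ_nonempty

theorem integral_gradSqR (h : IsGroundState Q) : ∫ x, gradSqR Q x = ∫ x, Q x ^ 2 := by
  have e : ∫ x, gradSqR Q x = ∫ x : Plane, (fun r : ℝ => d0R Q (r • e0) ^ 2) ‖x‖ := by
    refine integral_congr_ae ?_
    filter_upwards [compl_mem_ae_iff.2 (measure_singleton (0 : Plane))] with x hx
    rw [gradSqR_eq, h.norm_fderiv_sq hx]
  rw [e, h.integral_sq, integral_radial fun r => d0R Q (r • e0) ^ 2, h.radSol.nehari one_pos,
      one_mul]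

theorem integrable_four (h : IsGroundState Q) : Integrable fun x => Q x ^ 4 := by
  refine ((integrable_radial_iff (k := fun r => Q (r • e0) ^ 4)).2
    (h.radSol.integrableOn_four one_pos)).congr (Eventually.of_forall fun x => ?_)
  simp only [← h.eq_radial x]

theorem integral_four (h : IsGroundState Q) : ∫ x, Q x ^ 4 = 2 * ∫ x, Q x ^ 2 := by
  have e : ∫ x, Q x ^ 4 = ∫ x : Plane, (fun r : ℝ => Q (r • e0) ^ 4) ‖x‖ :=
    integral_congr_ae (Eventually.of_forall fun x => by simp only [← h.eq_radial x])
  rw [e, h.integral_sq, integral_radial fun r => Q (r • e0) ^ 4, h.radSol.pohozaev one_pos]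
  ring

theorem decay (h : IsGroundState Q) : ∃ C, ∀ x, Q x ≤ C * Real.exp (-(‖x‖ / 2)) := by
  obtain ⟨C, hC⟩ := h.radSol.decay
  refine ⟨max C (Q 0), fun x => ?_⟩
  rcases eq_or_ne x 0 with rfl | hx
  · simp
  · rw [h.eq_radial x]
    refine (hC _ (norm_pos_iff.2 hx)).trans ?_
    gcongr
    exact le_max_left _ _

end IsGroundState

theorem RadSol.scale {g p : ℝ → ℝ} (h : RadSol 1 g p) {b : ℝ} (hb : 0 < b) :
    RadSol (b ^ 2) (fun r => b * g (b * r)) (fun r => b ^ 2 * p (b * r)) where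
  zero_pos := by simpa using mul_pos hb h.zero_pos
  pos := fun r hr => mul_pos hb (h.pos _ (mul_pos hb hr))
  dg := fun r hr => by
    have hm : HasDerivAt (fun r : ℝ => b * r) b r := by simpa using (hasDerivAt_id r).const_mul b
    exact (((h.dg _ (mul_pos hb hr)).comp r hm).const_mul b).congr_deriv (by ring)
  dp := fun r hr => by
    have hm : HasDerivAt (fun r : ℝ => b * r) b r := by simpa using (hasDerivAt_id r).const_mul b
    refine (((h.dp _ (mul_pos hb hr)).comp r hm).const_mul (b ^ 2)).congr_deriv ?_
    field_simp
  g0 := by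
    have ht : Tendsto (fun r : ℝ => b * r) (𝓝[>] 0) (𝓝[>] 0) := by
      refine tendsto_nhdsWithin_iff.2 ⟨?_, ?_⟩
      · have : Continuous fun r : ℝ => b * r := by fun_prop
        simpa using (this.tendsto 0).mono_left nhdsWithin_le_nhds
      · filter_upwards [self_mem_nhdsWithin] with r hr using mul_pos hb hr
    simpa using (h.g0.comp ht).const_mul b
  p0 := by
    have ht : Tendsto (fun r : ℝ => b * r) (𝓝[>] 0) (𝓝[>] 0) := by
      refine tendsto_nhdsWithin_iff.2 ⟨?_, ?_⟩
      · have : Continuous fun r : ℝ => b * r := by fun_prop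
        simpa using (this.tendsto 0).mono_left nhdsWithin_le_nhds
      · filter_upwards [self_mem_nhdsWithin] with r hr using mul_pos hb hr
    simpa using (h.p0.comp ht).const_mul (b ^ 2)
  ig := by
    have := ((integrableOn_Ioi_comp_mul_left_iff (fun r => r * g r ^ 2) 0 hb).2
      (by simpa using h.ig)).const_mul b
    exact this.congr (Eventually.of_forall fun r => by ring)
  ip := by
    have := ((integrableOn_Ioi_comp_mul_left_iff (fun r => r * p r ^ 2) 0 hb).2
      (by simpa using h.ip)).const_mul (b ^ 3)
    exact this.congr (Eventually.of_forall fun r => by ring)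

namespace IsGroundState
variable {Q : Plane → ℝ}

theorem qstar_eq (s : ℝ) (hs : s = ∫ y, Q y ^ 2) :
    Qstar Q = fun x => (Real.sqrt s)⁻¹ * Q ((Real.sqrt s)⁻¹ • x + 0) := by
  funext x; rw [Qstar, hs, add_zero]

theorem qstar_h1R (h : IsGroundState Q) : H1R (Qstar Q) := by
  have hs := h.integral_sq_pos
  set s := ∫ x, Q x ^ 2 with hsd
  have hb : (Real.sqrt s)⁻¹ ≠ 0 := inv_ne_zero (Real.sqrt_pos.2 hs).ne'
  rw [qstar_eq s hsd]
  have hd : Differentiable ℝ fun x : Plane => Q ((Real.sqrt s)⁻¹ • x + 0) :=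
    h.diff.comp (by fun_prop)
  refine H1R.const_mul ⟨hd, integrable_affine h.h1R.2.1 hb 0, ?_⟩ _
  refine ((integrable_affine h.h1R.2.2 hb 0).const_mul ((Real.sqrt s)⁻¹ ^ 2)).congr
    (Eventually.of_forall fun x => ?_)
  rw [gradSqR_affine]

theorem qstar_integrals (h : IsGroundState Q) {s : ℝ} (hs : s = ∫ y, Q y ^ 2) :
    ∫ x, Qstar Q x ^ 2 = s ∧ ∫ x, gradSqR (Qstar Q) x = 1 ∧
      (Integrable fun x => Qstar Q x ^ 4) ∧ ∫ x, Qstar Q x ^ 4 = 2 := by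
  have hp : 0 < s := hs ▸ h.integral_sq_pos
  have hb : (Real.sqrt s)⁻¹ ≠ 0 := inv_ne_zero (Real.sqrt_pos.2 hp).ne'
  have hd : Differentiable ℝ fun x : Plane => Q ((Real.sqrt s)⁻¹ • x + 0) :=
    h.diff.comp (by fun_prop)
  have e2 : (Real.sqrt s)⁻¹ ^ 2 = s⁻¹ := by rw [inv_pow, Real.sq_sqrt hp.le]
  have e4 : (Real.sqrt s)⁻¹ ^ 4 = s⁻¹ ^ 2 := by rw [← e2]; ring
  rw [qstar_eq s hs]
  refine ⟨?_, ?_, ?_, ?_⟩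
  · simp only [mul_pow]
    rw [integral_const_mul, integral_affine (fun x => Q x ^ 2), ← hs, e2, smul_eq_mul]
    field_simp
  · have : ∀ x, gradSqR (fun x => (Real.sqrt s)⁻¹ * Q ((Real.sqrt s)⁻¹ • x + 0)) x =
        s⁻¹ ^ 2 * gradSqR Q ((Real.sqrt s)⁻¹ • x + 0) := fun x => by
      rw [gradSqR_const_mul _ (hd x), gradSqR_affine, e2]; ring
    simp only [this]
    rw [integral_const_mul, integral_affine (gradSqR Q), h.integral_gradSqR, ← hs, e2, smul_eq_mul]
    field_simp
  · simp only [mul_pow]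
    exact (integrable_affine h.integrable_four hb 0).const_mul _
  · simp only [mul_pow]
    rw [integral_const_mul, integral_affine (fun x => Q x ^ 4), h.integral_four, ← hs, e2, e4,
      smul_eq_mul]
    field_simp

theorem qstar_pos (h : IsGroundState Q) (x : Plane) : 0 < Qstar Q x :=
  mul_pos (inv_pos.2 (Real.sqrt_pos.2 h.integral_sq_pos)) (h.2.1 _)

/-- Uniqueness of the positive decreasing limit profile. -/
theorem eq_qstar (h : IsGroundState Q) {s K : ℝ} (hs : s = ∫ y, Q y ^ 2) {w : Plane → ℝ}
    (hw : WeakSol (1 / s) K w) (hc : Continuous w) (hpos : ∀ x, 0 < w x)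
    (ha : ∀ x y : Plane, ‖x‖ ≤ ‖y‖ → w y ≤ w x) (hi : Integrable fun x => w x ^ 2) :
    w = Qstar Q := by
  have hp : 0 < s := hs ▸ h.integral_sq_pos
  obtain ⟨p, hp1⟩ := hw.radSol (by positivity) hc hpos ha hi
  have hb : 0 < (Real.sqrt s)⁻¹ := inv_pos.2 (Real.sqrt_pos.2 hp)
  have h2 := h.radSol.scale hb
  rw [inv_pow, Real.sq_sqrt hp.le, ← one_div] at h2
  funext x
  have e := hp1.unique (one_div_pos.2 hp) h2 ‖x‖ (norm_nonneg x)
  have en := norm_smul_e0 (norm_nonneg x)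
  rw [le_antisymm (ha _ _ en.le) (ha _ _ en.ge), e, Qstar, ← hs]
  congr 1
  refine h.2.2.1 _ _ ?_
  rw [norm_smul_e0 (mul_nonneg hb.le (norm_nonneg _)), norm_smul, Real.norm_eq_abs, abs_of_pos hb]

end IsGroundState

/-! ### The logarithmic kernel -/

theorem integral_le_of_le_nonneg {X : Type*} [MeasurableSpace X] {μ : Measure X} {f g : X → ℝ}
    (hg : Integrable g μ) (h0 : ∀ x, 0 ≤ g x) (h : ∀ x, f x ≤ g x) : ∫ x, f x ∂μ ≤ ∫ x, g x ∂μ := by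
  by_cases hf : Integrable f μ
  · exact integral_mono hf hg h
  · rw [integral_undef hf]; exact integral_nonneg h0

/-- The negative part of `log ‖z‖`. -/
def kneg (z : Plane) : ℝ := max 0 (-Real.log ‖z‖)

theorem kneg_nonneg (z : Plane) : 0 ≤ kneg z := le_max_left _ _

theorem measurable_kneg : Measurable kneg :=
  measurable_const.max (Real.measurable_log.comp measurable_norm).neg

theorem neg_log_le_kneg (z : Plane) : -Real.log ‖z‖ ≤ kneg z := le_max_right _ _

theorem abs_log_le (z : Plane) : |Real.log ‖z‖| ≤ kneg z + ‖z‖ := by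
  rw [abs_le]
  constructor
  · linarith [neg_log_le_kneg z, norm_nonneg z]
  · rcases (norm_nonneg z).eq_or_lt with h | h
    · rw [← h]; simp [kneg_nonneg]
    · linarith [Real.log_le_sub_one_of_pos h, kneg_nonneg z]

theorem integrable_kneg_sq : Integrable fun z => kneg z ^ 2 := by
  refine (integrable_radial_iff (k := fun r => max 0 (-Real.log r) ^ 2)).2 ?_
  have h1 : IntegrableOn (fun r : ℝ => (Ioc (0 : ℝ) 1).indicator (fun _ => (4 : ℝ)) r) (Ioi 0) :=
    ((integrable_indicator_iff measurableSet_Ioc).2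
      (integrableOn_const (by simp) (by simp))).integrableOn
  refine h1.mono' ?_ ?_
  · exact (measurable_id.mul ((measurable_const.max Real.measurable_log.neg).pow_const
      2)).aestronglyMeasurable
  · refine (ae_restrict_iff' measurableSet_Ioi).2 (Eventually.of_forall fun r (hr : 0 < r) => ?_)
    by_cases hr1 : r ≤ 1
    · rw [indicator_of_mem (show r ∈ Ioc (0 : ℝ) 1 from ⟨hr, hr1⟩),
        Real.norm_of_nonneg (mul_nonneg hr.le (sq_nonneg _)), max_eq_right
          (neg_nonneg.2 (Real.log_nonpos hr.le hr1))]
      have hs : 0 < Real.sqrt r := Real.sqrt_pos.2 hr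
      have e : Real.log r = 2 * Real.log (Real.sqrt r) := by rw [Real.log_sqrt hr.le]; ring
      have h2 : -Real.log (Real.sqrt r) ≤ (Real.sqrt r)⁻¹ := by
        rw [← Real.log_inv]
        linarith [Real.log_le_sub_one_of_pos (inv_pos.2 hs)]
      have h3 : 0 ≤ -Real.log (Real.sqrt r) :=
        neg_nonneg.2 (Real.log_nonpos hs.le (Real.sqrt_le_one.2 hr1))
      have h4 : (-Real.log r) ^ 2 ≤ 4 * r⁻¹ := by
        have : (-Real.log (Real.sqrt r)) ^ 2 ≤ ((Real.sqrt r)⁻¹) ^ 2 := by gcongr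
        rw [inv_pow, Real.sq_sqrt hr.le] at this
        rw [e]; nlinarith
      calc r * (-Real.log r) ^ 2 ≤ r * (4 * r⁻¹) := by gcongr
        _ = 4 := by field_simp
    · rw [indicator_of_notMem (fun h => hr1 h.2), max_eq_left
        (neg_nonpos.2 (Real.log_nonneg (not_le.1 hr1).le))]
      simp

/-- The `L²` norm of `kneg`. -/
def kap : ℝ := Real.sqrt (∫ z, kneg z ^ 2)

theorem kap_nonneg : 0 ≤ kap := Real.sqrt_nonneg _

section Density

variable {ρ : Plane → ℝ}

theorem integrable_kneg_sub_sq (x : Plane) : Integrable fun y => kneg (x - y) ^ 2 :=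
  integrable_kneg_sq.comp_sub_left x

theorem integrable_kneg_mul (hm : Measurable ρ) (h2 : Integrable fun x => ρ x ^ 2) (x : Plane) :
    Integrable fun y => kneg (x - y) * ρ y :=
  integrable_mul_of_sq (measurable_kneg.comp
      (measurable_const.sub measurable_id)).aestronglyMeasurable
    hm.aestronglyMeasurable (integrable_kneg_sub_sq x) h2

theorem integral_kneg_mul_le (hm : Measurable ρ) (h2 : Integrable fun x => ρ x ^ 2) (x : Plane) :
    ∫ y, kneg (x - y) * ρ y ≤ kap * Real.sqrt (∫ y, ρ y ^ 2) := by
  have := abs_integral_mul_le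
    (measurable_kneg.comp (measurable_const.sub measurable_id)).aestronglyMeasurable
    hm.aestronglyMeasurable (integrable_kneg_sub_sq x) h2
  refine (le_abs_self _).trans (this.trans (le_of_eq ?_))
  simp only [Function.comp, Pi.sub_apply, id]
  rw [kap, integral_sub_left_eq_self (fun y => kneg y ^ 2)]

theorem neg_log_integral_le (hm : Measurable ρ) (h0 : ∀ x, 0 ≤ ρ x)
    (h2 : Integrable fun x => ρ x ^ 2) {θ : Plane → ℝ} (hθ0 : ∀ x, 0 ≤ θ x) (hθ : Integrable θ) :
    -∫ x, ∫ y, Real.log ‖x - y‖ * θ x * ρ y ≤ kap * Real.sqrt (∫ y, ρ y ^ 2) * ∫ x, θ x := by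
  rw [← integral_neg, ← integral_const_mul]
  refine integral_le_of_le_nonneg (hθ.const_mul _)
    (fun x => mul_nonneg (mul_nonneg kap_nonneg (Real.sqrt_nonneg _)) (hθ0 x)) fun x => ?_
  rw [← integral_neg]
  calc ∫ y, -(Real.log ‖x - y‖ * θ x * ρ y) ≤ ∫ y, θ x * (kneg (x - y) * ρ y) := by
        refine integral_le_of_le_nonneg ((integrable_kneg_mul hm h2 x).const_mul _)
          (fun y => mul_nonneg (hθ0 x) (mul_nonneg (kneg_nonneg _) (h0 y))) fun y => ?_
        have := mul_le_mul_of_nonneg_right (neg_log_le_kneg (x - y)) (mul_nonneg (hθ0 x) (h0 y))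
        linarith
    _ = θ x * ∫ y, kneg (x - y) * ρ y := integral_const_mul _ _
    _ ≤ θ x * (kap * Real.sqrt (∫ y, ρ y ^ 2)) :=
        mul_le_mul_of_nonneg_left (integral_kneg_mul_le hm h2 x) (hθ0 x)
    _ = _ := by ring

theorem integrable_log_prod (hm : Measurable ρ) (h0 : ∀ x, 0 ≤ ρ x) (hi : Integrable ρ)
    (h2 : Integrable fun x => ρ x ^ 2) (hx : Integrable fun x => ‖x‖ * ρ x) :
    Integrable (fun z : Plane × Plane => Real.log ‖z.1 - z.2‖ * ρ z.1 * ρ z.2)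
      (volume.prod volume) := by
  have m1 : Measurable fun z : Plane × Plane => ρ z.1 := hm.comp measurable_fst
  have m2 : Measurable fun z : Plane × Plane => ρ z.2 := hm.comp measurable_snd
  have mk : Measurable fun z : Plane × Plane => kneg (z.1 - z.2) :=
    measurable_kneg.comp (measurable_fst.sub measurable_snd)
  have i1 : Integrable (fun z : Plane × Plane => kneg (z.1 - z.2) * ρ z.1 * ρ z.2)
      (volume.prod volume) := by
    have meas := ((mk.mul m1).mul m2).aestronglyMeasurable (μ := (volume :
        Measure Plane).prod (volume : Measure Plane))
    refine (integrable_prod_iff meas).2 ⟨Eventually.of_forall fun x => ?_, ?_⟩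
    · exact ((integrable_kneg_mul hm h2 x).const_mul (ρ x)).congr (Eventually.of_forall fun y => by
        simp only [Pi.mul_apply]; ring)
    · refine (hi.const_mul (kap * Real.sqrt (∫ y, ρ y ^ 2))).mono' meas.norm.integral_prod_right'
        (Eventually.of_forall fun x => ?_)
      have e : ∫ y, ‖kneg (x - y) * ρ x * ρ y‖ = ρ x * ∫ y, kneg (x - y) * ρ y := by
        rw [← integral_const_mul]
        refine integral_congr_ae (Eventually.of_forall fun y => ?_)
        simp only
        rw [Real.norm_of_nonneg (mul_nonneg (mul_nonneg (kneg_nonneg _) (h0 x)) (h0 y))]; ring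
      simp only [Pi.mul_apply]
      rw [e, Real.norm_of_nonneg (mul_nonneg (h0 x)
        (integral_nonneg fun y => mul_nonneg (kneg_nonneg _) (h0 y))), mul_comm]
      exact mul_le_mul_of_nonneg_right (integral_kneg_mul_le hm h2 x) (h0 x)
  have i2 := hx.mul_prod hi
  have i3 := hi.mul_prod hx
  refine ((i1.add i2).add i3).mono' ?_ (Eventually.of_forall fun z => ?_)
  · exact (((Real.measurable_log.comp (measurable_fst.sub measurable_snd).norm).mul m1).mul
      m2).aestronglyMeasurable
  · rw [mul_assoc, norm_mul, Real.norm_of_nonneg (mul_nonneg (h0 z.1) (h0 z.2)), Real.norm_eq_abs]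
    have h1 := abs_log_le (z.1 - z.2)
    have h3 := norm_sub_le z.1 z.2
    have := mul_le_mul_of_nonneg_right (h1.trans (add_le_add_right h3 _))
      (mul_nonneg (h0 z.1) (h0 z.2))
    refine this.trans (le_of_eq ?_)
    simp only [Pi.add_apply]
    ring

end Density

/-! ### Real-valued competitors and the Gagliardo–Nirenberg inequality -/

theorem d0_ofReal {v : Plane → ℝ} {x : Plane} (h : DifferentiableAt ℝ v x) :
    d0 (fun y => (v y : ℂ)) x = (d0R v x : ℂ) := by
  have := (Complex.ofRealCLM.hasFDerivAt (x := v x)).comp x h.hasFDerivAt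
  unfold d0 d0R
  rw [show (fun y => (v y : ℂ)) = (⇑Complex.ofRealCLM ∘ v) from rfl, this.fderiv]
  simp

theorem d1_ofReal {v : Plane → ℝ} {x : Plane} (h : DifferentiableAt ℝ v x) :
    d1 (fun y => (v y : ℂ)) x = (d1R v x : ℂ) := by
  have := (Complex.ofRealCLM.hasFDerivAt (x := v x)).comp x h.hasFDerivAt
  unfold d1 d1R
  rw [show (fun y => (v y : ℂ)) = (⇑Complex.ofRealCLM ∘ v) from rfl, this.fderiv]
  simp

theorem gradSq_ofReal {v : Plane → ℝ} {x : Plane} (h : DifferentiableAt ℝ v x) :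
    gradSq (fun y => (v y : ℂ)) x = gradSqR v x := by
  simp [gradSq, gradSqR, d0_ofReal h, d1_ofReal h]

theorem momentum_ofReal {v : Plane → ℝ} {x : Plane} (h : DifferentiableAt ℝ v x) :
    momentum (fun y => (v y : ℂ)) x = 0 := by
  simp [momentum, d0_ofReal h, d1_ofReal h]

theorem H1R.mem_Sset {V v : Plane → ℝ} (hv : H1R v) (hV : Integrable fun x => V x * v x ^ 2) :
    (fun x => (v x : ℂ)) ∈ Sset V (∫ x, v x ^ 2) := by
  refine ⟨⟨⟨fun x => ?_, ?_, ?_⟩, ?_⟩, ?_⟩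
  · exact (Complex.ofRealCLM.differentiable (v x)).comp x (hv.1 x)
  · simpa using hv.2.1
  · exact hv.2.2.congr (ae_of_all _ fun x => (gradSq_ofReal (hv.1 x)).symm)
  · simpa using hV
  · simp

theorem H1R.Ea_ofReal {V v : Plane → ℝ} (hv : H1R v) (hV : Integrable fun x => V x * v x ^ 2)
    (Ω : ℝ) : Ea V Ω (fun x => (v x : ℂ)) = (∫ x, gradSqR v x) + (∫ x, V x * v x ^ 2) +
      (1 / 2) * (∫ x, ∫ y, Real.log ‖x - y‖ * v x ^ 2 * v y ^ 2) - (1 / 2) * ∫ x, v x ^ 4 := by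
  unfold Ea logConv
  rw [← integral_add hv.2.2 hV]
  have h4 : ∀ x, |v x| ^ 4 = v x ^ 4 := fun x => by
    rw [show 4 = 2 * 2 from rfl, pow_mul, pow_mul, sq_abs]
  simp [gradSq_ofReal (hv.1 _), momentum_ofReal (hv.1 _), h4]

theorem log_quad_le {v : Plane → ℝ} (hv : Integrable fun x => v x ^ 2) {R : ℝ} (hR : 0 ≤ R)
    (hs : ∀ x, R < ‖x‖ → v x = 0) :
    ∫ x, ∫ y, Real.log ‖x - y‖ * v x ^ 2 * v y ^ 2 ≤ 2 * R * (∫ x, v x ^ 2) ^ 2 := by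
  have h2 : 0 ≤ ∫ y, v y ^ 2 := integral_nonneg fun y => sq_nonneg _
  have hin : ∀ x, ∫ y, Real.log ‖x - y‖ * v x ^ 2 * v y ^ 2 ≤ 2 * R * (∫ y, v y ^ 2) * v x ^ 2 := by
    intro x
    calc _ ≤ ∫ y, 2 * R * v x ^ 2 * v y ^ 2 := by
          refine integral_le_of_le_nonneg (hv.const_mul _) (fun y => by positivity) fun y => ?_
          by_cases hx : R < ‖x‖
          · simp [hs x hx]
          by_cases hy : R < ‖y‖
          · simp [hs y hy]
          have : Real.log ‖x - y‖ ≤ 2 * R := by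
            have := Real.log_le_self (norm_nonneg (x - y))
            have := norm_sub_le x y
            linarith
          gcongr
      _ = _ := by rw [integral_const_mul]; ring
  refine (integral_le_of_le_nonneg (hv.const_mul _) (fun x => by positivity) hin).trans_eq ?_
  rw [integral_const_mul]; ring

theorem H1R.scale {v : Plane → ℝ} (hv : H1R v) (c : ℝ) {b : ℝ} (hb : b ≠ 0) :
    H1R (fun x => c * v (b • x)) ∧ (∫ x, (c * v (b • x)) ^ 2 = c ^ 2 * (b ^ 2)⁻¹ * ∫ x, v x ^ 2) ∧
    (∫ x, gradSqR (fun y => c * v (b • y)) x = c ^ 2 * ∫ x, gradSqR v x) ∧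
    ∫ x, (c * v (b • x)) ^ 4 = c ^ 4 * (b ^ 2)⁻¹ * ∫ x, v x ^ 4 := by
  have hg := gradSqR_affine v b 0
  have i2 := integral_affine (b := b) (fun x => v x ^ 2) 0
  have i3 := integral_affine (b := b) (fun x => gradSqR v x) 0
  have i4 := integral_affine (b := b) (fun x => v x ^ 4) 0
  have hi2 := integrable_affine hv.2.1 hb 0
  have hi3 := integrable_affine hv.2.2 hb 0
  simp only [add_zero, smul_eq_mul] at hg i2 i3 i4 hi2 hi3
  have hvb : H1R (fun x => v (b • x)) := by
    refine ⟨hv.1.comp (differentiable_id.const_smul b), hi2, ?_⟩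
    exact (hi3.const_mul (b ^ 2)).congr (ae_of_all _ fun x => (hg x).symm)
  refine ⟨hvb.const_mul c, ?_, ?_, ?_⟩
  · simp only [mul_pow, integral_const_mul, i2]; ring
  · rw [hvb.integral_gradSqR_const_mul, integral_congr_ae (ae_of_all _ hg), integral_const_mul, i3]
    field_simp
  · simp only [mul_pow, integral_const_mul, i4]; ring

/-- If the energy is bounded below at mass `a`, compactly supported functions of mass `a`
satisfy the sharp inequality. -/
theorem half_pow_four_le {V : Plane → ℝ} (hVm : Measurable V) (hV0 : ∀ x, 0 ≤ V x)
    (hVb : ∀ R : ℝ, ∃ C : ℝ, ∀ x : Plane, ‖x‖ ≤ R → V x ≤ C) {Ω a E : ℝ}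
    (hE : ∀ w ∈ Sset V a, E ≤ Ea V Ω w) {v : Plane → ℝ} (hv : H1R v) (ha : ∫ x, v x ^ 2 = a) {R : ℝ}
    (hR : 0 ≤ R) (hs : ∀ x, R < ‖x‖ → v x = 0) :
    (1 / 2) * ∫ x, v x ^ 4 ≤ ∫ x, gradSqR v x := by
  obtain ⟨C, hC⟩ := hVb R
  have hC0 : 0 ≤ C := (hV0 0).trans (hC 0 (by simpa using hR))
  have ha0 : 0 ≤ a := ha ▸ integral_nonneg fun y => sq_nonneg _
  have key : ∀ t : ℝ, 1 ≤ t →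
      E ≤ t ^ 2 * ((∫ x, gradSqR v x) - (1 / 2) * ∫ x, v x ^ 4) + C * a + R * a ^ 2 := by
    intro t ht
    have ht0 : t ≠ 0 := by positivity
    obtain ⟨h1, h2, h3, h4⟩ := hv.scale t ht0
    have hsup : ∀ x, R < ‖x‖ → t * v (t • x) = 0 := fun x hx => by
      rw [hs _ ?_, mul_zero]
      rw [norm_smul, Real.norm_eq_abs, abs_of_pos (by linarith)]
      nlinarith [norm_nonneg x]
    have hVle : ∀ x, V x * (t * v (t • x)) ^ 2 ≤ C * (t * v (t • x)) ^ 2 := fun x => by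
      by_cases hx : R < ‖x‖
      · rw [hsup x hx]; simp
      · exact mul_le_mul_of_nonneg_right (hC x (not_lt.1 hx)) (sq_nonneg _)
    have hVi : Integrable fun x => V x * (t * v (t • x)) ^ 2 := by
      refine (h1.2.1.const_mul C).mono' (hVm.mul (h1.1.meas.pow_const 2)).aestronglyMeasurable
        (ae_of_all _ fun x => ?_)
      rw [Real.norm_eq_abs, abs_of_nonneg (mul_nonneg (hV0 x) (sq_nonneg _))]
      exact hVle x
    have hm : ∫ x, (t * v (t • x)) ^ 2 = a := by rw [h2, ha]; field_simp
    have hin := hE _ (hm ▸ h1.mem_Sset hVi)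
    rw [h1.Ea_ofReal hVi, h3, h4] at hin
    have hl := log_quad_le h1.2.1 hR hsup
    have hVI := integral_mono hVi (h1.2.1.const_mul C) hVle
    rw [integral_const_mul] at hVI
    rw [hm] at hl hVI
    have : t ^ 4 * (t ^ 2)⁻¹ = t ^ 2 := by field_simp
    rw [this] at hin
    linarith
  by_contra hlt
  push Not at hlt
  set d := (1 / 2) * (∫ x, v x ^ 4) - ∫ x, gradSqR v x with hd
  have hd0 : 0 < d := by linarith
  set X := C * a + R * a ^ 2 - E
  have := key (1 + |X| / d) (by have := div_nonneg (abs_nonneg X) hd0.le; linarith)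
  have h5 : |X| / d * d = |X| := div_mul_cancel₀ _ hd0.ne'
  have h6 := div_nonneg (abs_nonneg X) hd0.le
  have h7 := le_abs_self X
  nlinarith [mul_nonneg h6 h6, mul_nonneg (mul_nonneg h6 h6) hd0.le]

theorem exists_cutoff : ∃ (χ : Plane → ℝ) (D : ℝ), Differentiable ℝ χ ∧ (∀ x, 0 ≤ χ x) ∧
    (∀ x, χ x ≤ 1) ∧ χ 0 = 1 ∧ (∀ x, 2 < ‖x‖ → χ x = 0) ∧ ∀ x, gradSqR χ x ≤ D := by
  let f : ContDiffBump (0 : Plane) := ⟨1, 2, one_pos, one_lt_two⟩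
  have hc : ContDiff ℝ 1 f := f.contDiff
  obtain ⟨D, hD⟩ := (hc.continuous_fderiv one_ne_zero).bounded_above_of_compact_support
    (f.hasCompactSupport.fderiv (𝕜 := ℝ))
  refine ⟨f, D ^ 2, hc.differentiable one_ne_zero, fun x => f.nonneg, fun x => f.le_one,
    f.one_of_mem_closedBall (by simp [f]), fun x hx => ?_, fun x => ?_⟩
  · exact f.zero_of_le_dist (by simpa [f] using hx.le)
  · rw [gradSqR_eq]
    exact pow_le_pow_left₀ (norm_nonneg _) (hD x) 2

theorem tendsto_cutoff {χ : Plane → ℝ} (hχ : Continuous χ) (h0 : χ 0 = 1) (x : Plane) :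
    Tendsto (fun n : ℕ => χ ((1 / ((n : ℝ) + 1)) • x)) atTop (𝓝 1) := by
  have h1 : Tendsto (fun n : ℕ => (1 / ((n : ℝ) + 1)) • x) atTop (𝓝 ((0 : ℝ) • x)) :=
    tendsto_one_div_add_atTop_nhds_zero_nat.smul_const x
  rw [zero_smul] at h1
  simpa [h0, Function.comp_def] using (hχ.tendsto 0).comp h1

theorem tendsto_inv_mul_sin (z : ℝ) :
    Tendsto (fun n : ℕ => (1 / ((n : ℝ) + 1))⁻¹ * Real.sin (1 / ((n : ℝ) + 1) * z)) atTop
        (𝓝 z) := by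
  have h1 : HasDerivAt (fun t : ℝ => Real.sin (t * z)) z 0 := by
    have h2 : HasDerivAt (fun t : ℝ => t * z) z 0 :=
        by simpa using (hasDerivAt_id (0 : ℝ)).mul_const z
    simpa [Function.comp_def] using (Real.hasDerivAt_sin ((0 : ℝ) * z)).comp (0 : ℝ) h2
  have h3 := h1.tendsto_slope_zero_right
  have h4 : Tendsto (fun n : ℕ => 1 / ((n : ℝ) + 1)) atTop (𝓝[>] 0) :=
    tendsto_nhdsWithin_iff.2 ⟨tendsto_one_div_add_atTop_nhds_zero_nat,
      Eventually.of_forall fun n => mem_Ioi.2 (by positivity)⟩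
  simpa [Function.comp_def] using h3.comp h4

/-- Extension of the inequality from bounded compactly supported functions to all of `H¹`. -/
theorem GNIneq.of_compact {s : ℝ} (hs : 0 < s) (h : ∀ g : Plane → ℝ, H1R g →
    (∃ R : ℝ, 0 ≤ R ∧ ∀ x, R < ‖x‖ → g x = 0) →
      s * ∫ x, g x ^ 4 ≤ 2 * (∫ x, gradSqR g x) * ∫ x, g x ^ 2) : GNIneq s := by
  intro f hf
  obtain ⟨χ, D, hχd, hχ0, hχ1, hχz, hχs, hχD⟩ := exists_cutoff
  have hD0 : 0 ≤ D := (gradSqR_nonneg χ 0).trans (hχD 0)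
  set A := ∫ x, gradSqR f x
  set M := ∫ x, f x ^ 2
  have hM0 : 0 ≤ M := integral_nonneg fun y => sq_nonneg _
  have hA0 : 0 ≤ A := integral_nonneg fun y => gradSqR_nonneg f y
  let C : ℝ → ℝ := fun t => 2 / s * ((1 + t) * A + (t + t ^ 2) * (D * M)) * M
  let g : ℝ → Plane → ℝ := fun t x => χ (t • x) * (t⁻¹ * Real.sin (t * f x))
  have hg : ∀ t : ℝ, 0 < t → Integrable (fun x => g t x ^ 4) ∧ ∫ x, g t x ^ 4 ≤ C t := by
    intro t ht
    have hk : ∀ z, HasDerivAt (fun z => t⁻¹ * Real.sin (t * z)) (Real.cos (t * z)) z := fun z => by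
      have h2 : HasDerivAt (fun z : ℝ => t * z) t z := by simpa using (hasDerivAt_id z).const_mul t
      have := ((Real.hasDerivAt_sin (t * z)).comp z h2).const_mul t⁻¹
      refine this.congr_deriv ?_
      field_simp
    have hk1 : ∀ z, |t⁻¹ * Real.sin (t * z)| ≤ |z| := fun z => by
      rw [abs_mul, abs_of_pos (inv_pos.2 ht)]
      have := Real.abs_sin_le_abs (x := t * z)
      rw [abs_mul, abs_of_pos ht] at this
      rwa [inv_mul_le_iff₀ ht]
    have hkB : ∀ z, |t⁻¹ * Real.sin (t * z)| ≤ t⁻¹ := fun z => by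
      rw [abs_mul, abs_of_pos (inv_pos.2 ht)]
      exact mul_le_of_le_one_right (inv_pos.2 ht).le (Real.abs_sin_le_one _)
    obtain ⟨hkf, hkg⟩ := hf.comp hk hk1 fun z => Real.abs_cos_le_one _
    have hcd : Differentiable ℝ fun x : Plane => χ (t • x) :=
      hχd.comp (differentiable_id.const_smul t)
    have hcg : ∀ x, gradSqR (fun y : Plane => χ (t • y)) x ≤ t ^ 2 * D := fun x => by
      have := gradSqR_affine χ t 0 x
      simp only [add_zero] at this
      rw [this]
      exact mul_le_mul_of_nonneg_left (hχD _) (sq_nonneg _)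
    have hcb : ∀ x : Plane, |χ (t • x)| ≤ 1 := fun x => by rw [abs_of_nonneg (hχ0 _)]; exact hχ1 _
    have hgt : H1R (g t) := hkf.bdd_mul hcd hcb hcg
    have hgb : ∀ x, |g t x| ≤ |f x| := fun x => by
      rw [abs_mul]
      calc _ ≤ 1 * |f x| := mul_le_mul (hcb x) (hk1 _) (abs_nonneg _) zero_le_one
        _ = _ := one_mul _
    have hgK : ∀ x, |g t x| ≤ t⁻¹ := fun x => by
      rw [abs_mul]
      calc _ ≤ 1 * t⁻¹ := mul_le_mul (hcb x) (hkB _) (abs_nonneg _) zero_le_one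
        _ = _ := one_mul _
    refine ⟨integrable_pow_four_of_bdd hgt.1.meas.aestronglyMeasurable hgt.2.1 hgK, ?_⟩
    have h1 := h (g t) hgt ⟨2 / t, by positivity, fun x hx => ?_⟩
    · have hgg : ∀ x, gradSqR (g t) x ≤ (1 + t) * gradSqR f x + (t + t ^ 2) * D * f x ^ 2 := by
        intro x
        set k : Plane → ℝ := fun y => t⁻¹ * Real.sin (t * f y)
        have e1 : gradSqR (g t) x ≤ (1 + t) * (χ (t • x) ^ 2 * gradSqR k x) +
            (1 + t⁻¹) * (gradSqR (fun y : Plane => χ (t • y)) x * k x ^ 2) := by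
          have p0 : d0R (g t) x = _ := d0R_mul (hcd x) (hkf.1 x)
          have p1 : d1R (g t) x = _ := d1R_mul (hcd x) (hkf.1 x)
          have q : ∀ a b : ℝ, (a + b) ^ 2 ≤ (1 + t) * a ^ 2 + (1 + t⁻¹) * b ^ 2 := fun a b => by
            have : (1 + t) * a ^ 2 + (1 + t⁻¹) * b ^ 2 - (a + b) ^ 2 = t⁻¹ * (t * a - b) ^ 2 := by
              field_simp; ring
            have := mul_nonneg (inv_pos.2 ht).le (sq_nonneg (t * a - b))
            linarith
          have q0 := q (χ (t • x) * d0R k x) (d0R (fun y : Plane => χ (t • y)) x * k x)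
          have q1 := q (χ (t • x) * d1R k x) (d1R (fun y : Plane => χ (t • y)) x * k x)
          simp only [gradSqR, p0, p1]
          calc _ = (χ (t • x) * d0R k x + d0R (fun y : Plane => χ (t • y)) x * k x) ^ 2 +
                (χ (t • x) * d1R k x + d1R (fun y : Plane => χ (t • y)) x * k x) ^ 2 := by ring
            _ ≤ _ := add_le_add q0 q1
            _ = _ := by ring
        have e2 : χ (t • x) ^ 2 * gradSqR k x ≤ gradSqR f x := by
          have : χ (t • x) ^ 2 ≤ 1 := by nlinarith [hχ0 (t • x), hχ1 (t • x)]
          calc _ ≤ 1 * gradSqR f x := mul_le_mul this (hkg x) (gradSqR_nonneg _ _) zero_le_one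
            _ = _ := one_mul _
        have e3 : gradSqR (fun y : Plane => χ (t • y)) x * k x ^ 2 ≤ t ^ 2 * D * f x ^ 2 :=
          mul_le_mul (hcg x) (sq_le_sq.2 (hk1 _)) (sq_nonneg _) (by positivity)
        calc _ ≤ _ := e1
          _ ≤ (1 + t) * gradSqR f x + (1 + t⁻¹) * (t ^ 2 * D * f x ^ 2) := by gcongr
          _ = _ := by field_simp; ring
      have hI1 : ∫ x, gradSqR (g t) x ≤ (1 + t) * A + (t + t ^ 2) * (D * M) := by
        refine (integral_mono hgt.2.2
            ((hf.2.2.const_mul _).fun_add (hf.2.1.const_mul _)) hgg).trans_eq ?_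
        rw [integral_add (hf.2.2.const_mul _) (hf.2.1.const_mul _), integral_const_mul,
          integral_const_mul]
        ring
      have hI2 : ∫ x, g t x ^ 2 ≤ M := integral_mono hgt.2.1 hf.2.1 fun x => sq_le_sq.2 (hgb x)
      have hI0 : 0 ≤ ∫ x, g t x ^ 2 := integral_nonneg fun y => sq_nonneg _
      have hprod := mul_le_mul hI1 hI2 hI0 (by positivity)
      calc ∫ x, g t x ^ 4 ≤ 2 * (∫ x, gradSqR (g t) x) * (∫ x, g t x ^ 2) / s := by
            rw [le_div_iff₀ hs]; linarith
        _ ≤ 2 * (((1 + t) * A + (t + t ^ 2) * (D * M)) * M) / s := by gcongr ?_ / s; linarith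
        _ = C t := by simp only [C]; ring
    · simp only [g]
      rw [hχs, zero_mul]
      rw [norm_smul, Real.norm_eq_abs, abs_of_pos ht]
      rwa [div_lt_iff₀ ht, mul_comm] at hx
  have hlim : ∀ x, Tendsto (fun n : ℕ => g (1 / ((n : ℝ) + 1)) x ^ 4) atTop (𝓝 (f x ^ 4)) :=
      fun x => by
    have := ((tendsto_cutoff hχd.continuous hχz x).mul (tendsto_inv_mul_sin (f x))).pow 4
    rwa [one_mul] at this
  have hfat : ∀ m : ℕ, Integrable (fun x => f x ^ 4) ∧ ∫ x, f x ^ 4 ≤ C (1 / ((m : ℝ) + 1)) := by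
    intro m
    refine fatou_real (f := fun n x => g (1 / (((n + m : ℕ) : ℝ) + 1)) x ^ 4)
      (fun n => (hg _ (by positivity)).1) (fun n => ae_of_all _ fun x => by positivity)
      (ae_of_all _ fun x => (hlim x).comp (tendsto_add_atTop_nat m)) fun n => ?_
    refine (hg _ (by positivity)).2.trans ?_
    have : 1 / (((n + m : ℕ) : ℝ) + 1) ≤ 1 / ((m : ℝ) + 1) := by
      apply one_div_le_one_div_of_le (by positivity)
      push_cast
      linarith [Nat.cast_nonneg (α := ℝ) n]
    have h0 : (0 : ℝ) ≤ 1 / (((n + m : ℕ) : ℝ) + 1) := by positivity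
    simp only [C]
    gcongr
  refine ⟨(hfat 0).1, ?_⟩
  have hCc : Continuous C := by fun_prop
  have hC0 : Tendsto (fun m : ℕ => C (1 / ((m : ℝ) + 1))) atTop (𝓝 (C 0)) :=
    (hCc.tendsto 0).comp tendsto_one_div_add_atTop_nhds_zero_nat
  have := ge_of_tendsto' hC0 fun m => (hfat m).2
  simpa [C] using this

/-- The sharp Gagliardo–Nirenberg inequality, as a consequence of the solvability of the
minimization problem for all subcritical masses. -/
theorem GNIneq.of_bddBelow {V : Plane → ℝ} (hV : V110 V) {Ω s : ℝ} (hs : 0 < s)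
    (hE : ∀ a ∈ Ioo (0 : ℝ) s, ∃ E, ∀ w ∈ Sset V a, E ≤ Ea V Ω w) : GNIneq s := by
  refine GNIneq.of_compact hs fun g hg ⟨R, hR, hsup⟩ => ?_
  set m := ∫ x, g x ^ 2 with hm
  have hm0 : 0 ≤ m := integral_nonneg fun y => sq_nonneg _
  rcases hm0.eq_or_lt with h0 | hpos
  · have hz : (fun x => g x ^ 2) =ᵐ[volume] 0 :=
      (integral_eq_zero_iff_of_nonneg (fun x => sq_nonneg _) hg.2.1).1 h0.symm
    have h4 : ∫ x, g x ^ 4 = 0 := by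
      rw [← integral_zero Plane ℝ]
      refine integral_congr_ae ?_
      filter_upwards [hz] with x hx
      have : g x = 0 := by simpa using hx
      simp [this]
    rw [h4, ← h0]; simp
  · have key : ∀ a ∈ Ioo (0 : ℝ) s, a * ∫ x, g x ^ 4 ≤ 2 * (∫ x, gradSqR g x) * m := by
      intro a ha
      obtain ⟨E, hEa⟩ := hE a ha
      have hc := Real.sq_sqrt (div_nonneg ha.1.le hm0)
      set c := Real.sqrt (a / m)
      have hcm : c ^ 2 * m = a := by rw [hc]; field_simp
      have := half_pow_four_le hV.1 hV.2.1 hV.2.2.1 hEa (hg.const_mul c)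
        (by simp only [mul_pow, integral_const_mul]; exact hcm) hR
        (fun x hx => by rw [hsup x hx, mul_zero])
      rw [hg.integral_gradSqR_const_mul] at this
      simp only [mul_pow, integral_const_mul] at this
      have hc2 : 0 < c ^ 2 := by rw [hc]; exact div_pos ha.1 hpos
      have h5 : (1 / 2) * (c ^ 2 * ∫ x, g x ^ 4) ≤ ∫ x, gradSqR g x := by
        refine le_of_mul_le_mul_left ?_ hc2
        linarith
      calc a * ∫ x, g x ^ 4 = 2 * ((1 / 2) * (c ^ 2 * ∫ x, g x ^ 4)) * m := by rw [← hcm]; ring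
        _ ≤ _ := by gcongr
    have hlim : Tendsto (fun a : ℝ => a * ∫ x, g x ^ 4) (𝓝[<] s) (𝓝 (s * ∫ x, g x ^ 4)) :=
      (continuous_id.mul continuous_const).continuousWithinAt
    refine le_of_tendsto hlim ?_
    filter_upwards [Ioo_mem_nhdsLT hs] with a ha using key a ha

/-! ### Functions whose square is differentiable -/

/-- Nonnegative functions such as moduli of differentiable functions, with finite `H¹` norm. -/
structure AbsH1 (f : Plane → ℝ) : Prop where
  nonneg : ∀ x, 0 ≤ f x
  diff_sq : Differentiable ℝ fun x => f x ^ 2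
  int : Integrable fun x => f x ^ 2
  int_grad : Integrable (gradSqR f)

namespace AbsH1

variable {f : Plane → ℝ}

theorem eq_sqrt (h : AbsH1 f) : f = fun x => Real.sqrt (f x ^ 2) :=
  funext fun x => (Real.sqrt_sq (h.nonneg x)).symm

theorem continuous (h : AbsH1 f) : Continuous f := by
  rw [h.eq_sqrt]; exact h.diff_sq.continuous.sqrt

theorem diffAt (h : AbsH1 f) {x : Plane} (hx : f x ≠ 0) : DifferentiableAt ℝ f x := by
  rw [h.eq_sqrt]; exact (h.diff_sq x).sqrt (pow_ne_zero 2 hx)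

theorem fderiv_zero (h : AbsH1 f) {x : Plane} (hx : f x = 0) : fderiv ℝ f x = 0 :=
  IsLocalMin.fderiv_eq_zero (Eventually.of_forall fun y => hx ▸ h.nonneg y)

theorem fderiv_sq (h : AbsH1 f) (x : Plane) :
    fderiv ℝ (fun y => f y ^ 2) x = (2 * f x) • fderiv ℝ f x := by
  by_cases hx : f x = 0
  · rw [h.fderiv_zero hx, smul_zero]
    exact IsLocalMin.fderiv_eq_zero (Eventually.of_forall fun y => by
      simpa [hx] using sq_nonneg (f y))
  · have := ((h.diffAt hx).hasFDerivAt.pow 2).fderiv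
    rw [this]; norm_num

theorem fderiv_soft (h : AbsH1 f) {d : ℝ} (hd : 0 < d) (x : Plane) :
    HasFDerivAt (fun y => softAbs d (f y)) ((f x / Real.sqrt (f x ^ 2 + d ^ 2)) • fderiv ℝ f x)
        x := by
  have hp : f x ^ 2 + d ^ 2 ≠ 0 := by positivity
  have h1 := (((h.diff_sq x).hasFDerivAt.add_const (d ^ 2)).sqrt hp).sub_const d
  refine h1.congr_fderiv ?_
  rw [h.fderiv_sq, smul_smul]
  congr 1
  have : 0 < Real.sqrt (f x ^ 2 + d ^ 2) := by positivity
  field_simp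

theorem d0R_soft (h : AbsH1 f) {d : ℝ} (hd : 0 < d) (x : Plane) :
    d0R (fun y => softAbs d (f y)) x = f x / Real.sqrt (f x ^ 2 + d ^ 2) * d0R f x := by
  simp [d0R, (h.fderiv_soft hd x).fderiv]

theorem d1R_soft (h : AbsH1 f) {d : ℝ} (hd : 0 < d) (x : Plane) :
    d1R (fun y => softAbs d (f y)) x = f x / Real.sqrt (f x ^ 2 + d ^ 2) * d1R f x := by
  simp [d1R, (h.fderiv_soft hd x).fderiv]

theorem gradSqR_soft_le (h : AbsH1 f) {d : ℝ} (hd : 0 < d) (x : Plane) :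
    gradSqR (fun y => softAbs d (f y)) x ≤ gradSqR f x := by
  simp only [gradSqR, h.d0R_soft hd, h.d1R_soft hd]
  have : (f x / Real.sqrt (f x ^ 2 + d ^ 2)) ^ 2 ≤ 1 := by
    rw [← sq_abs]
    exact pow_le_one₀ (abs_nonneg _) (softAbs_deriv_le hd (f x))
  nlinarith [sq_nonneg (d0R f x), sq_nonneg (d1R f x)]

theorem soft_le (h : AbsH1 f) {d : ℝ} (hd : 0 < d) (x : Plane) : softAbs d (f x) ≤ f x :=
  (softAbs_le hd _).trans_eq (abs_of_nonneg (h.nonneg x))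

theorem sub_soft_le (h : AbsH1 f) (d : ℝ) (x : Plane) : f x - softAbs d (f x) ≤ d := by
  have := abs_sub_softAbs_le (d := d) (f x)
  rwa [abs_of_nonneg (h.nonneg x)] at this

theorem soft (h : AbsH1 f) {d : ℝ} (hd : 0 < d) : H1R fun x => softAbs d (f x) := by
  have hdiff : Differentiable ℝ fun x => softAbs d (f x) := fun x =>
    (h.fderiv_soft hd x).differentiableAt
  refine ⟨hdiff, h.int.mono' (hdiff.meas.pow_const 2).aestronglyMeasurable
      (ae_of_all _ fun x => ?_),
    h.int_grad.mono' (measurable_gradSqR _).aestronglyMeasurable (ae_of_all _ fun x => ?_)⟩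
  · rw [Real.norm_eq_abs, abs_of_nonneg (sq_nonneg _)]
    exact pow_le_pow_left₀ (softAbs_nonneg _) (h.soft_le hd x) 2
  · rw [Real.norm_eq_abs, abs_of_nonneg (gradSqR_nonneg _ _)]
    exact h.gradSqR_soft_le hd x

theorem tendsto_soft (h : AbsH1 f) {δ : ℕ → ℝ} (hδ : Tendsto δ atTop (𝓝 0)) (x : Plane) :
    Tendsto (fun n => softAbs (δ n) (f x)) atTop (𝓝 (f x)) := by
  have : Continuous fun d : ℝ => Real.sqrt (f x ^ 2 + d ^ 2) - d := by fun_prop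
  have := (this.tendsto 0).comp hδ
  simpa [Real.sqrt_sq (h.nonneg x), softAbs, Function.comp_def] using this

theorem tendsto_soft_sq (h : AbsH1 f) {δ : ℕ → ℝ} (hp : ∀ n, 0 < δ n) (hδ : Tendsto δ atTop (𝓝 0)) :
    Tendsto (fun n => ∫ x, (softAbs (δ n) (f x) - f x) ^ 2) atTop (𝓝 0) := by
  rw [← integral_zero Plane ℝ]
  refine tendsto_integral_of_dominated_convergence (fun x => f x ^ 2)
    (fun n => ((((h.soft (hp n)).1.meas).sub h.continuous.measurable).pow_const
        2).aestronglyMeasurable)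
    h.int (fun n => ae_of_all _ fun x => ?_) (ae_of_all _ fun x => ?_)
  · rw [Real.norm_eq_abs, abs_of_nonneg (sq_nonneg _), ← neg_sub, neg_sq]
    have h1 := h.soft_le (hp n) x
    have h2 := softAbs_nonneg (d := δ n) (f x)
    exact pow_le_pow_left₀ (by linarith) (by linarith) 2
  · simpa using ((h.tendsto_soft hδ x).sub_const (f x)).pow 2

theorem gn {s : ℝ} (hGN : GNIneq s) (hs : 0 < s) (h : AbsH1 f) : Integrable (fun x => f x ^ 4) ∧
    ∫ x, f x ^ 4 ≤ 2 / s * (∫ x, gradSqR f x) * ∫ x, f x ^ 2 := by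
  have hp : ∀ n : ℕ, (0 : ℝ) < 1 / ((n : ℝ) + 1) := fun n => by positivity
  refine fatou_real (f := fun n x => softAbs (1 / ((n : ℝ) + 1)) (f x) ^ 4)
    (fun n => (hGN _ (h.soft (hp n))).1) (fun n => ae_of_all _ fun x => by positivity)
    (ae_of_all _ fun x => (h.tendsto_soft tendsto_one_div_add_atTop_nhds_zero_nat x).pow 4)
    fun n => (hGN _ (h.soft (hp n))).2.trans ?_
  have h1 := integral_mono (h.soft (hp n)).2.2 h.int_grad (h.gradSqR_soft_le (hp n))
  have h2 := integral_mono (h.soft (hp n)).2.1 h.int fun x =>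
    pow_le_pow_left₀ (softAbs_nonneg _) (h.soft_le (hp n) x) 2
  have h3 : 0 ≤ ∫ x, softAbs (1 / ((n : ℝ) + 1)) (f x) ^ 2 := integral_nonneg fun x => sq_nonneg _
  have h4 : 0 ≤ ∫ x, gradSqR f x := integral_nonneg fun x => gradSqR_nonneg _ _
  gcongr

theorem affine (h : AbsH1 f) {c b : ℝ} (hc : 0 ≤ c) (hb : b ≠ 0) (z : Plane) :
    AbsH1 (fun x => c * f (b • x + z)) ∧
    (∫ x, (c * f (b • x + z)) ^ 2 = c ^ 2 * (b ^ 2)⁻¹ * ∫ x, f x ^ 2) ∧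
    (∫ x, gradSqR (fun y => c * f (b • y + z)) x = c ^ 2 * ∫ x, gradSqR f x) ∧
    ∫ x, (c * f (b • x + z)) ^ 4 = c ^ 4 * (b ^ 2)⁻¹ * ∫ x, f x ^ 4 := by
  have hg : ∀ x, gradSqR (fun y => c * f (b • y + z)) x = c ^ 2 * b ^ 2 * gradSqR f (b • x +
      z) := by
    intro x
    have h1 : fderiv ℝ (fun y => c * f (b • y + z)) x = c • fderiv ℝ (fun y => f (b • y + z)) x :=
      congrFun (fderiv_const_smul_field c) x
    rw [gradSqR_eq, h1, norm_smul, mul_pow, ← gradSqR_eq, gradSqR_affine, Real.norm_eq_abs, sq_abs,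
      mul_assoc]
  have i2 := integral_affine (b := b) (fun x => f x ^ 2) z
  have i3 := integral_affine (b := b) (fun x => gradSqR f x) z
  have i4 := integral_affine (b := b) (fun x => f x ^ 4) z
  simp only [smul_eq_mul] at i2 i3 i4
  have hi2 := integrable_affine h.int hb z
  have hi3 := integrable_affine h.int_grad hb z
  refine ⟨⟨fun x => mul_nonneg hc (h.nonneg _), ?_, ?_, ?_⟩, ?_, ?_, ?_⟩
  · simp only [mul_pow]
    exact (h.diff_sq.comp ((differentiable_id.const_smul b).add_const z)).const_mul (c ^ 2)
  · simp only [mul_pow]; exact hi2.const_mul (c ^ 2)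
  · exact (hi3.const_mul (c ^ 2 * b ^ 2)).congr (ae_of_all _ fun x => (hg x).symm)
  · simp only [mul_pow, integral_const_mul, i2]; ring
  · rw [integral_congr_ae (ae_of_all _ hg), integral_const_mul, i3]; field_simp
  · simp only [mul_pow, integral_const_mul, i4]; ring

end AbsH1

/-! ### The energy density -/

/-- The density of the quadratic part of the energy. -/
def eDen (V : Plane → ℝ) (Ω : ℝ) (u : Plane → ℂ) (x : Plane) : ℝ :=
  gradSq u x + V x * ‖u x‖ ^ 2 - Ω * momentum u x

section Complex

variable {V : Plane → ℝ} {Ω : ℝ} {u : Plane → ℂ}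

theorem fderiv_normSq {x : Plane} (h : DifferentiableAt ℝ u x) (v : Plane) :
    fderiv ℝ (fun y => ‖u y‖ ^ 2) x v = 2 * ((starRingEnd ℂ) (u x) * fderiv ℝ u x v).re := by
  rw [(h.hasFDerivAt.norm_sq).fderiv]
  simp [Complex.inner]
  ring

theorem eDen_ge (hu : Differentiable ℝ u) (x : Plane) :
    gradAbsSq u x + (V x - Ω ^ 2 / 4 * ‖x‖ ^ 2) * ‖u x‖ ^ 2 ≤ eDen V Ω u x := by
  have hg : gradAbsSq u x = gradSqR (fun y => ‖u y‖) x := (gradSqR_eq _ x).symm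
  rw [hg]
  by_cases h0 : u x = 0
  · have : fderiv ℝ (fun y => ‖u y‖) x = 0 :=
      IsLocalMin.fderiv_eq_zero (Eventually.of_forall fun y => by simp [h0])
    rw [gradSqR_eq, this]
    simp only [eDen, momentum, h0, gradSq]
    simp
    positivity
  · have hn : 0 < ‖u x‖ := norm_pos_iff.2 h0
    have hd : DifferentiableAt ℝ (fun y => ‖u y‖) x := (hu x).norm ℝ h0
    have hsq : ∀ v, ‖u x‖ * fderiv ℝ (fun y => ‖u y‖) x v =
        ((starRingEnd ℂ) (u x) * fderiv ℝ u x v).re := fun v => by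
      have h1 := fderiv_normSq (hu x) v
      rw [(hd.hasFDerivAt.pow 2).fderiv] at h1
      simp at h1
      simp
      linarith
    have hn2 : ∀ w : ℂ, ‖u x‖ ^ 2 * ‖w‖ ^ 2 = ((starRingEnd ℂ) (u x) * w).re ^ 2 +
        ((starRingEnd ℂ) (u x) * w).im ^ 2 := fun w => by
      rw [← mul_pow, ← Complex.norm_conj (u x), ← norm_mul, Complex.sq_norm, Complex.normSq_apply]
      ring
    have p0 := hsq e0
    have p1 := hsq e1
    have q0 := hn2 (d0 u x)
    have q1 := hn2 (d1 u x)
    have hx := plane_norm_sq x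
    simp only [eDen, momentum, gradSq, gradSqR, d0R, d1R]
    change ‖u x‖ * _ = ((starRingEnd ℂ) (u x) * d0 u x).re at p0
    change ‖u x‖ * _ = ((starRingEnd ℂ) (u x) * d1 u x).re at p1
    rw [← p0] at q0
    rw [← p1] at q1
    generalize ((starRingEnd ℂ) (u x) * d0 u x).im = I0 at *
    generalize ((starRingEnd ℂ) (u x) * d1 u x).im = I1 at *
    generalize ‖d0 u x‖ = D0 at *
    generalize ‖d1 u x‖ = D1 at *
    generalize fderiv ℝ (fun y => ‖u y‖) x e0 = F0 at *
    generalize fderiv ℝ (fun y => ‖u y‖) x e1 = F1 at *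
    generalize ‖u x‖ = n at *
    rw [hx]
    have hn2 : 0 < n ^ 2 := by positivity
    refine le_of_mul_le_mul_left ?_ hn2
    nlinarith [sq_nonneg (I0 + Ω / 2 * x 1 * n ^ 2), sq_nonneg (I1 - Ω / 2 * x 0 * n ^ 2)]

theorem measurable_d0 (u : Plane → ℂ) : Measurable (d0 u) := measurable_fderiv_apply_const ℝ u e0

theorem measurable_d1 (u : Plane → ℂ) : Measurable (d1 u) := measurable_fderiv_apply_const ℝ u e1

theorem measurable_of_diff (hu : Differentiable ℝ u) : Measurable u := hu.continuous.measurable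

/-- Finite potential energy controls the second moment. -/
theorem integrable_moment (hV : V110 V) (hu : InH V u) : Integrable fun x =>
    ‖x‖ ^ 2 * ‖u x‖ ^ 2 := by
  obtain ⟨c, hc, R, hR⟩ := hV.2.2.2
  refine ((hu.1.2.1.const_mul (R ^ 2)).add (hu.2.const_mul c⁻¹)).mono'
    (((measurable_norm.pow_const 2).mul ((measurable_of_diff hu.1.1).norm.pow_const
      2)).aestronglyMeasurable) (ae_of_all _ fun x => ?_)
  rw [Real.norm_eq_abs, abs_of_nonneg (by positivity)]
  simp only [Pi.add_apply]
  have hp := sq_nonneg ‖u x‖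
  have hVx := hV.2.1 x
  by_cases hx : R ≤ ‖x‖
  · have h1 : ‖x‖ ^ 2 ≤ c⁻¹ * V x := by
      rw [inv_mul_eq_div, le_div_iff₀ hc, mul_comm]; exact hR x hx
    have h2 := mul_le_mul_of_nonneg_right h1 hp
    have h3 := mul_nonneg (sq_nonneg R) hp
    linarith
  · have h1 : ‖x‖ ^ 2 ≤ R ^ 2 := pow_le_pow_left₀ (norm_nonneg x) (not_le.1 hx).le 2
    have h2 := mul_le_mul_of_nonneg_right h1 hp
    have h3 := mul_nonneg (inv_pos.2 hc).le (mul_nonneg hVx hp)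
    linarith

theorem abs_momentum_le (u : Plane → ℂ) (x : Plane) :
    |momentum u x| ≤ gradSq u x + ‖x‖ ^ 2 * ‖u x‖ ^ 2 := by
  have h : ∀ w : ℂ, |((starRingEnd ℂ) (u x) * w).im| ≤ ‖u x‖ * ‖w‖ := fun w => by
    refine (Complex.abs_im_le_norm _).trans_eq ?_
    rw [norm_mul, Complex.norm_conj]
  unfold momentum gradSq
  refine (abs_add_le _ _).trans ?_
  rw [abs_mul, abs_mul, abs_neg, plane_norm_sq]
  have h0 := mul_le_mul_of_nonneg_left (h (d0 u x)) (abs_nonneg (x 1))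
  have h1 := mul_le_mul_of_nonneg_left (h (d1 u x)) (abs_nonneg (x 0))
  have q0 := sq_abs (x 0)
  have q1 := sq_abs (x 1)
  nlinarith [sq_nonneg (|x 1| * ‖u x‖ - ‖d0 u x‖), sq_nonneg (|x 0| * ‖u x‖ - ‖d1 u x‖),
    sq_nonneg (|x 1| * ‖u x‖), sq_nonneg (|x 0| * ‖u x‖), sq_nonneg ‖d0 u x‖, sq_nonneg ‖d1 u x‖]

theorem measurable_momentum (hu : Differentiable ℝ u) : Measurable (momentum u) := by
  have hc : Measurable fun x => (starRingEnd ℂ) (u x) :=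
    Complex.continuous_conj.measurable.comp (measurable_of_diff hu)
  have m0 : Measurable fun x : Plane => x 0 := by fun_prop
  have m1 : Measurable fun x : Plane => x 1 := by fun_prop
  exact (m1.neg.mul (Complex.measurable_im.comp (hc.mul (measurable_d0 u)))).add
    (m0.mul (Complex.measurable_im.comp (hc.mul (measurable_d1 u))))

theorem integrable_momentum (hV : V110 V) (hu : InH V u) : Integrable (momentum u) :=
  (hu.1.2.2.add (integrable_moment hV hu)).mono' (measurable_momentum hu.1.1).aestronglyMeasurable
    (ae_of_all _ fun x => abs_momentum_le u x)

theorem integrable_eDen (hV : V110 V) (hu : InH V u) : Integrable (eDen V Ω u) :=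
  (hu.1.2.2.add hu.2).sub ((integrable_momentum hV hu).const_mul Ω)

theorem Ea_eq (hV : V110 V) (hu : InH V u) : Ea V Ω u = (∫ x, eDen V Ω u x) + (1 / 2) * logConv u -
    (1 / 2) * ∫ x, ‖u x‖ ^ 4 := by
  have : ∫ x, eDen V Ω u x = (∫ x, (gradSq u x + V x * ‖u x‖ ^ 2)) - Ω * ∫ x, momentum u x := by
    rw [← integral_const_mul]
    exact integral_sub (hu.1.2.2.add hu.2) ((integrable_momentum hV hu).const_mul Ω)
  rw [this, Ea]; ring

theorem InH.absH1 (hV : V110 V) (hpos : ∀ x : Plane, 0 ≤ V x - Ω ^ 2 / 4 * ‖x‖ ^ 2) (hu : InH V u) :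
    AbsH1 (fun x => ‖u x‖) ∧ ∫ x, gradSqR (fun y => ‖u y‖) x ≤ ∫ x, eDen V Ω u x := by
  have hle : ∀ x, gradSqR (fun y => ‖u y‖) x ≤ eDen V Ω u x := fun x => by
    have := eDen_ge (V := V) (Ω := Ω) hu.1.1 x
    rw [gradSqR_eq]
    exact (le_add_of_nonneg_right (mul_nonneg (hpos x) (sq_nonneg _))).trans this
  have hi : Integrable (gradSqR fun y => ‖u y‖) :=
    (integrable_eDen hV hu).mono' (measurable_gradSqR _).aestronglyMeasurable
      (ae_of_all _ fun x => by
        rw [Real.norm_eq_abs, abs_of_nonneg (gradSqR_nonneg _ _)]; exact hle x)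
  exact ⟨⟨fun x => norm_nonneg _, fun x => (hu.1.1 x).norm_sq ℝ, hu.1.2.1, hi⟩,
    integral_mono hi (integrable_eDen hV hu) hle⟩

end Complex

/-! ### Energy bounds and asymptotics -/

theorem integrable_exp_neg_norm {k : ℝ} (hk : 0 < k) :
    Integrable fun x : Plane => Real.exp (-k * ‖x‖) := by
  refine (integrable_radial_iff (k := fun r => Real.exp (-k * r))).2 ?_
  have := integrableOn_rpow_mul_exp_neg_mul_rpow (s := 1) (p := 1) (b := k) (by norm_num) one_pos hk
  simpa using this

theorem log_quad_le_neg {ρ : Plane → ℝ} (hm : Measurable ρ) (h0 : ∀ x, 0 ≤ ρ x) (hi : Integrable ρ)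
    (h2 : Integrable fun x => ρ x ^ 2) (hx : Integrable fun x => ‖x‖ * ρ x) (L : ℝ) :
    ∫ x, ∫ y, Real.log ‖x - y‖ * ρ x * ρ y ≤
      -L * (∫ x, ρ x) ^ 2 + 2 * Real.exp L * (∫ x, ρ x) * ∫ x, ‖x‖ * ρ x := by
  have hg := integrable_log_prod hm h0 hi h2 hx
  set m := ∫ x, ρ x
  set P := ∫ x, ‖x‖ * ρ x
  have hin : ∀ᵐ x, ∫ y, Real.log ‖x - y‖ * ρ x * ρ y ≤
      (-L * m + Real.exp L * P) * ρ x + Real.exp L * m * (‖x‖ * ρ x) := by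
    filter_upwards [hg.prod_right_ae] with x hxi
    have hR : Integrable fun y => (-L + Real.exp L * ‖x‖) * ρ x * ρ y +
        Real.exp L * ρ x * (‖y‖ * ρ y) := (hi.const_mul _).add (hx.const_mul _)
    have hne : ∀ᵐ y : Plane, y ≠ x := by
      rw [ae_iff]; simp
    calc _ ≤ ∫ y, ((-L + Real.exp L * ‖x‖) * ρ x * ρ y + Real.exp L * ρ x * (‖y‖ * ρ y)) := by
          refine integral_mono_ae hxi hR ?_
          filter_upwards [hne] with y hy
          have hpos : 0 < ‖x - y‖ := norm_pos_iff.2 (sub_ne_zero.2 hy.symm)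
          have h1 : Real.log ‖x - y‖ ≤ -L + Real.exp L * (‖x‖ + ‖y‖) := by
            have h3 := Real.log_le_sub_one_of_pos (mul_pos (Real.exp_pos L) hpos)
            rw [Real.log_mul (Real.exp_pos L).ne' hpos.ne', Real.log_exp] at h3
            have := mul_le_mul_of_nonneg_left (norm_sub_le x y) (Real.exp_pos L).le
            linarith
          have := mul_le_mul_of_nonneg_right h1 (mul_nonneg (h0 x) (h0 y))
          linarith
      _ = _ := by
          rw [integral_add (hi.const_mul _) (hx.const_mul _), integral_const_mul,
              integral_const_mul]
          ring
  refine (integral_mono_ae hg.integral_prod_left ((hi.const_mul _).fun_add (hx.const_mul _))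
    hin).trans_eq ?_
  rw [integral_add (hi.const_mul _) (hx.const_mul _), integral_const_mul, integral_const_mul]
  ring

section

variable {V : Plane → ℝ} {Ω : ℝ}

theorem InH.energy_ge {u : Plane → ℂ} {s : ℝ} (hV : V110 V)
    (hpos : ∀ x : Plane, 0 ≤ V x - Ω ^ 2 / 4 * ‖x‖ ^ 2) (hGN : GNIneq s) (hs : 0 < s)
    (hu : InH V u) :
    (∫ x, gradSqR (fun y => ‖u y‖) x) - (1 / 2) * (kap * Real.sqrt (∫ x, ‖u x‖ ^ 4) * ∫ x, ‖u
        x‖ ^ 2)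
      - (1 / 2) * ∫ x, ‖u x‖ ^ 4 ≤ Ea V Ω u := by
  obtain ⟨hA, hle⟩ := hu.absH1 hV hpos
  rw [Ea_eq hV hu]
  have e4 : ∀ x, (‖u x‖ ^ 2) ^ 2 = ‖u x‖ ^ 4 := fun x => by rw [← pow_mul]
  have h4 := (hA.gn hGN hs).1
  have := neg_log_integral_le (ρ := fun x => ‖u x‖ ^ 2) (θ := fun x => ‖u x‖ ^ 2)
    (hA.continuous.measurable.pow_const 2) (fun x => sq_nonneg _) (by simpa only [e4] using h4)
    (fun x => sq_nonneg _) hA.int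
  simp only [e4] at this
  unfold logConv
  linarith

/-- The energy of a rescaled exponentially decaying function. -/
theorem scaled_energy_le (hV : V110 V) {C γ : ℝ} (hC : ∀ x : Plane, V x ≤ C * Real.exp (γ * ‖x‖))
    {q : Plane → ℝ} (hq : H1R q) (hq0 : ∀ x, 0 < q x) (i1 : ∫ x, gradSqR q x = 1)
    (i4i : Integrable fun x => q x ^ 4) (i4 : ∫ x, q x ^ 4 = 2) {k D : ℝ} (hk : 0 < k)
    (hD : ∀ x, q x ≤ D * Real.exp (-k * ‖x‖)) {c t : ℝ} (hc1 : c ^ 2 ≤ 1) (ht : 0 < t)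
    (htk : γ ≤ k * t) (L : ℝ) (Ω : ℝ) :
    ∃ w ∈ Sset V (c ^ 2 * ∫ x, q x ^ 2), Ea V Ω w ≤ c ^ 2 * (t ^ 2 * (1 - c ^ 2)) +
      (C * D ^ 2 * ∫ x : Plane, Real.exp (-k * ‖x‖)) + (1 / 2) * (-L * (c ^ 2 * ∫ x, q x ^ 2) ^ 2 +
      2 * Real.exp L * (c ^ 2 * ∫ x, q x ^ 2) * (c ^ 2 * t⁻¹ * ∫ x, ‖x‖ * q x ^ 2)) := by
  have hC0 : 0 ≤ C := by
    have := (hV.2.1 0).trans (hC 0)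
    simpa using this
  have hq2 : ∀ x, q x ^ 2 ≤ D ^ 2 * Real.exp (-(2 * k) * ‖x‖) := fun x => by
    refine (pow_le_pow_left₀ (hq0 x).le (hD x) 2).trans_eq ?_
    rw [mul_pow, ← Real.exp_nat_mul]; congr 2; push_cast; ring
  have hP : Integrable fun x => ‖x‖ * q x ^ 2 := by
    refine ((integrable_exp_neg_norm hk).const_mul (D ^ 2 / k)).mono'
      ((measurable_norm.mul (hq.1.meas.pow_const 2))).aestronglyMeasurable (ae_of_all _ fun x => ?_)
    rw [Real.norm_eq_abs, abs_of_nonneg (by positivity)]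
    have h1 : k * ‖x‖ ≤ Real.exp (k * ‖x‖) := by linarith [Real.add_one_le_exp (k * ‖x‖)]
    have h2 := mul_le_mul_of_nonneg_left (hq2 x) (norm_nonneg x)
    refine h2.trans ?_
    rw [div_mul_eq_mul_div, le_div_iff₀ hk]
    calc ‖x‖ * (D ^ 2 * Real.exp (-(2 * k) * ‖x‖)) * k
        = k * ‖x‖ * (D ^ 2 * Real.exp (-(2 * k) * ‖x‖)) := by ring
      _ ≤ Real.exp (k * ‖x‖) * (D ^ 2 * Real.exp (-(2 * k) * ‖x‖)) :=
          mul_le_mul_of_nonneg_right h1 (by positivity)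
      _ = D ^ 2 * Real.exp (-k * ‖x‖) := by
          rw [mul_left_comm, ← Real.exp_add]; congr 2; ring
  obtain ⟨hv, j2, j1, j4⟩ := hq.scale (c * t) ht.ne'
  set v : Plane → ℝ := fun x => c * t * q (t • x) with hvdef
  have hm : ∫ x, v x ^ 2 = c ^ 2 * ∫ x, q x ^ 2 := by
    rw [j2]; field_simp
  have hV0 := hV.2.1
  have hVle : ∀ x, V x * v x ^ 2 ≤ C * D ^ 2 * t ^ 2 * Real.exp (-k * ‖t • x‖) := fun x => by
    have hn : ‖t • x‖ = t * ‖x‖ := by rw [norm_smul, Real.norm_eq_abs, abs_of_pos ht]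
    have h1 : v x ^ 2 ≤ t ^ 2 * (D ^ 2 * Real.exp (-(2 * k) * ‖t • x‖)) := by
      simp only [hvdef, mul_pow]
      have := mul_le_mul_of_nonneg_left (hq2 (t • x)) (sq_nonneg t)
      calc c ^ 2 * t ^ 2 * q (t • x) ^ 2 ≤ 1 * t ^ 2 * q (t • x) ^ 2 := by gcongr
        _ ≤ _ := by rw [one_mul]; exact this
    calc V x * v x ^ 2 ≤ C * Real.exp (γ * ‖x‖) *
          (t ^ 2 * (D ^ 2 * Real.exp (-(2 * k) * ‖t • x‖))) :=
          mul_le_mul (hC x) h1 (sq_nonneg _) (by positivity)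
      _ = C * D ^ 2 * t ^ 2 * Real.exp (γ * ‖x‖ + -(2 * k) * ‖t • x‖) := by
          rw [Real.exp_add]; ring
      _ ≤ _ := by
          refine mul_le_mul_of_nonneg_left (Real.exp_le_exp.2 ?_) (by positivity)
          rw [hn]
          have := mul_le_mul_of_nonneg_right htk (norm_nonneg x)
          linarith
  have hei : Integrable fun x : Plane => C * D ^ 2 * t ^ 2 * Real.exp (-k * ‖t • x‖) := by
    have := integrable_affine (integrable_exp_neg_norm hk) ht.ne' 0
    simp only [add_zero] at this
    exact this.const_mul _
  have hVi : Integrable fun x => V x * v x ^ 2 := by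
    refine hei.mono' (hV.1.mul (hv.1.meas.pow_const 2)).aestronglyMeasurable
        (ae_of_all _ fun x => ?_)
    rw [Real.norm_eq_abs, abs_of_nonneg (mul_nonneg (hV0 x) (sq_nonneg _))]
    exact hVle x
  have hVI : ∫ x, V x * v x ^ 2 ≤ C * D ^ 2 * ∫ x : Plane, Real.exp (-k * ‖x‖) := by
    refine (integral_mono hVi hei hVle).trans_eq ?_
    have := integral_affine (b := t) (fun x : Plane => Real.exp (-k * ‖x‖)) 0
    simp only [add_zero, smul_eq_mul] at this
    rw [integral_const_mul, this]
    field_simp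
  have hPeq : ∀ x, ‖x‖ * v x ^ 2 = c ^ 2 * t * (‖t • x‖ * q (t • x) ^ 2) := fun x => by
    rw [norm_smul, Real.norm_eq_abs, abs_of_pos ht]
    simp only [hvdef]; ring
  have hvP : Integrable fun x => ‖x‖ * v x ^ 2 := by
    simp only [hPeq]
    have := integrable_affine hP ht.ne' 0
    simp only [add_zero] at this
    exact this.const_mul _
  have hvPI : ∫ x, ‖x‖ * v x ^ 2 = c ^ 2 * t⁻¹ * ∫ x, ‖x‖ * q x ^ 2 := by
    simp only [hPeq]
    have := integral_affine (b := t) (fun x : Plane => ‖x‖ * q x ^ 2) 0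
    simp only [add_zero, smul_eq_mul] at this
    rw [integral_const_mul, this]; field_simp
  have e4 : ∀ x, (v x ^ 2) ^ 2 = v x ^ 4 := fun x => by rw [← pow_mul]
  have hv4 : Integrable fun x => v x ^ 4 := by
    have := integrable_affine i4i ht.ne' 0
    simp only [add_zero] at this
    simpa only [hvdef, mul_pow] using this.const_mul _
  have hlog := log_quad_le_neg (ρ := fun x => v x ^ 2) (hv.1.meas.pow_const 2) (fun x =>
      sq_nonneg _)
    hv.2.1 (by simpa only [e4] using hv4) hvP L
  rw [hm, hvPI] at hlog
  refine ⟨_, hm ▸ hv.mem_Sset hVi, ?_⟩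
  rw [hv.Ea_ofReal hVi, j1, j4, i1, i4]
  have hkin : (c * t) ^ 2 * 1 - 1 / 2 * ((c * t) ^ 4 * (t ^ 2)⁻¹ * 2) =
      c ^ 2 * (t ^ 2 * (1 - c ^ 2)) := by
    field_simp
  linarith

/-- Competitors whose energy tends to `-∞` as the mass tends to the critical one. -/
theorem exists_energy_le (hV : V110 V) {Q : Plane → ℝ} (hQ : IsGroundState Q) {s : ℝ}
    (hs : s = ∫ x, Q x ^ 2) (hexp : ∃ C γ : ℝ, 0 < γ ∧ ∀ x : Plane, V x ≤ C * Real.exp (γ * ‖x‖))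
    (Λ : ℝ) : ∀ᶠ a in 𝓝[<] s, ∃ w ∈ Sset V a, Ea V Ω w ≤ -Λ := by
  have hs0 : 0 < s := hs ▸ hQ.integral_sq_pos
  obtain ⟨C, γ, hγ, hC⟩ := hexp
  obtain ⟨i2, i1, i4i, i4⟩ := hQ.qstar_integrals hs
  have hq := hQ.qstar_h1R
  obtain ⟨C', hC'⟩ := hQ.decay
  set q := Qstar Q with hqdef
  obtain ⟨k, hk, D, hD⟩ : ∃ k : ℝ, 0 < k ∧ ∃ D : ℝ, ∀ x, q x ≤ D * Real.exp (-k * ‖x‖) := by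
    have hr : 0 < (Real.sqrt s)⁻¹ := inv_pos.2 (Real.sqrt_pos.2 hs0)
    refine ⟨(Real.sqrt s)⁻¹ / 2, by positivity, (Real.sqrt s)⁻¹ * C', fun x => ?_⟩
    simp only [hqdef, Qstar, ← hs]
    have := mul_le_mul_of_nonneg_left (hC' ((Real.sqrt s)⁻¹ • x)) hr.le
    rw [norm_smul, Real.norm_eq_abs, abs_of_pos hr] at this
    refine this.trans_eq ?_
    rw [mul_assoc]; congr 3; ring
  have hq0 : ∀ x, 0 < q x := hQ.qstar_pos
  set P := ∫ x, ‖x‖ * q x ^ 2 with hPd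
  have hP0 : 0 ≤ P := integral_nonneg fun x => by positivity
  set K := C * D ^ 2 * ∫ x : Plane, Real.exp (-k * ‖x‖) with hKd
  set L := (|Λ + K + 2|) * (8 / s ^ 2) with hL
  set t := 1 + γ / k + Real.exp L * s * P with ht
  have hgk : 0 < γ / k := div_pos hγ hk
  have hE0 : 0 ≤ Real.exp L * s * P := by positivity
  have ht1 : 1 ≤ t := by linarith
  have ht0 : t ≠ 0 := by positivity
  have htk : γ ≤ k * t := by
    have : γ / k ≤ t := by linarith
    rw [div_le_iff₀ hk] at this; linarith
  have htP : Real.exp L * s * P ≤ t := by linarith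
  have hlim : Tendsto (fun a : ℝ => t ^ 2 * (1 - a / s)) (𝓝[<] s) (𝓝 (t ^ 2 * (1 - s / s))) := by
    apply Continuous.continuousWithinAt; fun_prop
  rw [div_self hs0.ne', sub_self, mul_zero] at hlim
  filter_upwards [hlim.eventually (ge_mem_nhds one_pos), Ioo_mem_nhdsLT (half_lt_self hs0)]
    with a ha1 ha
  have ha0 : 0 < a := (half_pos hs0).trans ha.1
  have hc2 := Real.sq_sqrt (div_nonneg ha0.le hs0.le)
  set c := Real.sqrt (a / s)
  have hc1 : c ^ 2 ≤ 1 := by rw [hc2, div_le_one hs0]; exact ha.2.le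
  have hca : c ^ 2 * s = a := by rw [hc2]; field_simp
  obtain ⟨w, hw, hwE⟩ := scaled_energy_le hV hC hq hq0 i1 i4i i4 hk hD hc1
    (show 0 < t by linarith) htk L Ω
  rw [i2, hca, ← hPd, ← hKd] at hwE
  rw [i2, hca] at hw
  refine ⟨w, hw, hwE.trans ?_⟩
  rw [← hc2] at ha1
  have hkin2 : c ^ 2 * (t ^ 2 * (1 - c ^ 2)) ≤ 1 := by
    have : 0 ≤ t ^ 2 * (1 - c ^ 2) := mul_nonneg (sq_nonneg _) (by linarith)
    nlinarith [sq_nonneg c]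
  have hlast : Real.exp L * a * (c ^ 2 * t⁻¹ * P) ≤ 1 := by
    have h1 : Real.exp L * a * P ≤ t :=
      (mul_le_mul_of_nonneg_right (mul_le_mul_of_nonneg_left ha.2.le (Real.exp_pos L).le)
          hP0).trans htP
    have h2 : Real.exp L * a * P * t⁻¹ ≤ 1 := by
      rw [← div_eq_mul_inv, div_le_one (by linarith)]; exact h1
    have h3 : 0 ≤ Real.exp L * a * P * t⁻¹ := by positivity
    calc _ = c ^ 2 * (Real.exp L * a * P * t⁻¹) := by ring
      _ ≤ 1 * 1 := mul_le_mul hc1 h2 h3 zero_le_one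
      _ = 1 := one_mul _
  have hLa : Λ + K + 2 ≤ 1 / 2 * (L * a ^ 2) := by
    have h1 : (s / 2) ^ 2 ≤ a ^ 2 := pow_le_pow_left₀ (by positivity) ha.1.le 2
    have h2 : L * (s / 2) ^ 2 = 2 * |Λ + K + 2| := by rw [hL]; field_simp; ring
    have hL0 : 0 ≤ L := by positivity
    have := mul_le_mul_of_nonneg_left h1 hL0
    have := le_abs_self (Λ + K + 2)
    linarith
  linarith

theorem IsMinimizer.asymptotics (hV : V110 V) (hpos : ∀ x : Plane, 0 ≤ V x - Ω ^ 2 / 4 * ‖x‖ ^ 2)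
    {Q : Plane → ℝ} (hQ : IsGroundState Q) {s : ℝ} (hs : s = ∫ x, Q x ^ 2)
    (hexp : ∃ C γ : ℝ, 0 < γ ∧ ∀ x : Plane, V x ≤ C * Real.exp (γ * ‖x‖))
    {u : ℝ → Plane → ℂ} (hmin : ∀ a ∈ Ioo (0 : ℝ) s, IsMinimizer V Ω a (u a)) :
    (∀ᶠ a in 𝓝[<] s, Ea V Ω (u a) ≤ 0) ∧
    Tendsto (fun a => ∫ x, gradSqR (fun y => ‖u a y‖) x) (𝓝[<] s) atTop ∧
    Tendsto (fun a => (∫ x, ‖u a x‖ ^ 4) / ∫ x, gradSqR (fun y => ‖u a y‖) x) (𝓝[<] s) (𝓝 2) := by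
  have hs0 : 0 < s := hs ▸ hQ.integral_sq_pos
  have hGN : GNIneq s := GNIneq.of_bddBelow hV hs0 fun a ha => ⟨_, (hmin a ha).2⟩
  have hE : ∀ Λ : ℝ, ∀ᶠ a in 𝓝[<] s, Ea V Ω (u a) ≤ -Λ := fun Λ => by
    filter_upwards [exists_energy_le (Ω := Ω) hV hQ hs hexp Λ, Ioo_mem_nhdsLT hs0]
      with a ⟨w, hw, hwE⟩ ha
    exact ((hmin a ha).2 w hw).trans hwE
  set A : ℝ → ℝ := fun a => ∫ x, gradSqR (fun y => ‖u a y‖) x with hA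
  set F : ℝ → ℝ := fun a => ∫ x, ‖u a x‖ ^ 4 with hF
  have hA0 : ∀ a, 0 ≤ A a := fun a => integral_nonneg fun x => gradSqR_nonneg _ _
  have hF0 : ∀ a, 0 ≤ F a := fun a => integral_nonneg fun x => by positivity
  have hbas : ∀ a ∈ Ioo (0 : ℝ) s, F a ≤ 2 * A a ∧
      A a - (1 / 2) * F a ≤ Ea V Ω (u a) + (1 / 2) * (kap * s) * Real.sqrt (2 * A a) := by
    intro a ha
    obtain ⟨hin, hma⟩ := (hmin a ha).1
    have h1 := hin.energy_ge hV hpos hGN hs0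
    have h2 := ((hin.absH1 hV hpos).1.gn hGN hs0).2
    rw [hma] at h1 h2
    have h3 : F a ≤ 2 * A a := by
      refine h2.trans ?_
      calc 2 / s * A a * a = 2 * A a * (a / s) := by ring
        _ ≤ 2 * A a * 1 := by
            refine mul_le_mul_of_nonneg_left ((div_le_one hs0).2 ha.2.le) ?_
            linarith [hA0 a]
        _ = _ := mul_one _
    refine ⟨h3, ?_⟩
    have h4 : kap * Real.sqrt (F a) * a ≤ kap * Real.sqrt (2 * A a) * s :=
      mul_le_mul (mul_le_mul_of_nonneg_left (Real.sqrt_le_sqrt h3) kap_nonneg) ha.2.le ha.1.le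
        (mul_nonneg kap_nonneg (Real.sqrt_nonneg _))
    change A a - 1 / 2 * (kap * Real.sqrt (F a) * a) - 1 / 2 * F a ≤ _ at h1
    linarith
  have hAtop : Tendsto A (𝓝[<] s) atTop := by
    refine tendsto_atTop.2 fun b => ?_
    filter_upwards [hE ((1 / 2) * (kap * s) * Real.sqrt (2 * |b|) + 1), Ioo_mem_nhdsLT hs0]
      with a haE ha
    obtain ⟨h3, h4⟩ := hbas a ha
    by_contra hlt
    push Not at hlt
    have h5 : Real.sqrt (2 * A a) ≤ Real.sqrt (2 * |b|) :=
      Real.sqrt_le_sqrt (by linarith [le_abs_self b])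
    have h6 : (1 / 2) * (kap * s) * Real.sqrt (2 * A a) ≤ (1 / 2) * (kap * s) * Real.sqrt
        (2 * |b|) :=
      mul_le_mul_of_nonneg_left h5 (by have := kap_nonneg; positivity)
    linarith
  refine ⟨by simpa using hE 0, hAtop, ?_⟩
  have hlow : Tendsto (fun a => 2 - kap * s * Real.sqrt (2 * A a) / A a) (𝓝[<] s) (𝓝 2) := by
    have h1 : Tendsto (fun x : ℝ => 2 - kap * s * Real.sqrt 2 / Real.sqrt x) atTop (𝓝 (2 - 0)) :=
      tendsto_const_nhds.sub (tendsto_const_nhds.div_atTop Real.tendsto_sqrt_atTop)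
    rw [sub_zero] at h1
    refine (h1.comp hAtop).congr' ?_
    filter_upwards [hAtop.eventually_gt_atTop 0] with a ha
    simp only [Function.comp]
    rw [Real.sqrt_mul zero_le_two, ← mul_assoc, mul_div_assoc (kap * s * Real.sqrt 2),
      Real.sqrt_div_self', mul_one_div]
  refine tendsto_of_tendsto_of_tendsto_of_le_of_le' hlow tendsto_const_nhds ?_ ?_
  · filter_upwards [hAtop.eventually_gt_atTop 0, Ioo_mem_nhdsLT hs0, hE 0] with a h0 ha hEa
    obtain ⟨h3, h4⟩ := hbas a ha
    rw [le_div_iff₀ h0, sub_mul, div_mul_cancel₀ _ h0.ne']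
    linarith
  · filter_upwards [hAtop.eventually_gt_atTop 0, Ioo_mem_nhdsLT hs0] with a h0 ha
    rw [div_le_iff₀ h0]
    exact (hbas a ha).1

end

/-! ### The variational inequality satisfied by the density of a minimizer -/

section Multiplier

variable {V : Plane → ℝ} {Ω : ℝ} {u : Plane → ℂ} {X : Plane → ℝ}

theorem fderiv_real_mul {x : Plane} (hX : DifferentiableAt ℝ X x) (hu : DifferentiableAt ℝ u x)
    (v : Plane) : fderiv ℝ (fun y => (X y : ℂ) * u y) x v =
      (fderiv ℝ X x v : ℂ) * u x + (X x : ℂ) * fderiv ℝ u x v := by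
  have h1 : HasFDerivAt (fun y => (X y : ℂ)) (Complex.ofRealCLM.comp (fderiv ℝ X x)) x :=
    (Complex.ofRealCLM.hasFDerivAt (x := X x)).comp x hX.hasFDerivAt
  have h2 : HasFDerivAt (fun y => (X y : ℂ) * u y) _ x := h1.mul hu.hasFDerivAt
  rw [h2.fderiv]
  simp
  ring

theorem d0R_normSq {x : Plane} (hu : DifferentiableAt ℝ u x) :
    d0R (fun y => ‖u y‖ ^ 2) x = 2 * ((starRingEnd ℂ) (u x) * d0 u x).re := fderiv_normSq hu e0

theorem d1R_normSq {x : Plane} (hu : DifferentiableAt ℝ u x) :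
    d1R (fun y => ‖u y‖ ^ 2) x = 2 * ((starRingEnd ℂ) (u x) * d1 u x).re := fderiv_normSq hu e1

theorem norm_sq_real_mul_add (p c : ℝ) (z w : ℂ) : ‖(p : ℂ) * z + (c : ℂ) * w‖ ^ 2 =
    c ^ 2 * ‖w‖ ^ 2 + c * p * (2 * ((starRingEnd ℂ) z * w).re) + p ^ 2 * ‖z‖ ^ 2 := by
  simp only [Complex.sq_norm, Complex.normSq_apply]
  simp
  ring

theorem gradSq_mul {x : Plane} (hX : DifferentiableAt ℝ X x) (hu : DifferentiableAt ℝ u x) :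
    gradSq (fun y => (X y : ℂ) * u y) x = X x ^ 2 * gradSq u x +
      X x * (d0R (fun y => ‖u y‖ ^ 2) x * d0R X x + d1R (fun y => ‖u y‖ ^ 2) x * d1R X x) +
      gradSqR X x * ‖u x‖ ^ 2 := by
  rw [d0R_normSq hu, d1R_normSq hu]
  have p0 : d0 (fun y => (X y : ℂ) * u y) x = _ := fderiv_real_mul hX hu e0
  have p1 : d1 (fun y => (X y : ℂ) * u y) x = _ := fderiv_real_mul hX hu e1
  unfold gradSq
  rw [p0, p1, norm_sq_real_mul_add, norm_sq_real_mul_add]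
  simp only [gradSqR, d0R, d1R, d0, d1]
  ring

theorem momentum_mul {x : Plane} (hX : DifferentiableAt ℝ X x) (hu : DifferentiableAt ℝ u x) :
    momentum (fun y => (X y : ℂ) * u y) x = X x ^ 2 * momentum u x := by
  have p0 : d0 (fun y => (X y : ℂ) * u y) x = _ := fderiv_real_mul hX hu e0
  have p1 : d1 (fun y => (X y : ℂ) * u y) x = _ := fderiv_real_mul hX hu e1
  unfold momentum
  rw [p0, p1]
  simp [d0, d1]
  ring

theorem eDen_mul {x : Plane} (hX : DifferentiableAt ℝ X x) (hu : DifferentiableAt ℝ u x) :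
    eDen V Ω (fun y => (X y : ℂ) * u y) x = X x ^ 2 * eDen V Ω u x +
      X x * (d0R (fun y => ‖u y‖ ^ 2) x * d0R X x + d1R (fun y => ‖u y‖ ^ 2) x * d1R X x) +
      gradSqR X x * ‖u x‖ ^ 2 := by
  unfold eDen
  rw [gradSq_mul hX hu, momentum_mul hX hu]
  simp only [norm_mul, mul_pow, Complex.norm_real, Real.norm_eq_abs, sq_abs]
  ring

theorem InH1.integrable_grad_density (hu : InH1 u) : Integrable (d0R fun y => ‖u y‖ ^ 2) ∧
    Integrable (d1R fun y => ‖u y‖ ^ 2) := by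
  have key : ∀ w : Plane → ℂ, Measurable w → Integrable (fun x => ‖w x‖ ^ 2) → ∀ g : Plane → ℝ,
      Measurable g → (∀ x, g x = 2 * ((starRingEnd ℂ) (u x) * w x).re) → Integrable g := by
    intro w hw hwi g hg hgw
    refine (hu.2.1.add hwi).mono' hg.aestronglyMeasurable (ae_of_all _ fun x => ?_)
    have h1 := Complex.abs_re_le_norm ((starRingEnd ℂ) (u x) * w x)
    rw [norm_mul, Complex.norm_conj] at h1
    rw [Real.norm_eq_abs, hgw, abs_mul, abs_two]
    simp only [Pi.add_apply]
    nlinarith [sq_nonneg (‖u x‖ - ‖w x‖)]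
  have i0 : Integrable fun x => ‖d0 u x‖ ^ 2 :=
    hu.2.2.mono' ((measurable_d0 u).norm.pow_const 2).aestronglyMeasurable (ae_of_all _ fun x => by
      rw [Real.norm_eq_abs, abs_of_nonneg (sq_nonneg _)]; exact le_add_of_nonneg_right
          (sq_nonneg _))
  have i1 : Integrable fun x => ‖d1 u x‖ ^ 2 :=
    hu.2.2.mono' ((measurable_d1 u).norm.pow_const 2).aestronglyMeasurable (ae_of_all _ fun x => by
      rw [Real.norm_eq_abs, abs_of_nonneg (sq_nonneg _)]; exact le_add_of_nonneg_left (sq_nonneg _))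
  exact ⟨key _ (measurable_d0 u) i0 _ (measurable_d0R _) fun x => d0R_normSq (hu.1 x),
    key _ (measurable_d1 u) i1 _ (measurable_d1R _) fun x => d1R_normSq (hu.1 x)⟩

theorem abs_d0R_le {φ : Plane → ℝ} {D : ℝ} (hD : ∀ x, gradSqR φ x ≤ D) (x : Plane) :
    |d0R φ x| ≤ Real.sqrt D :=
  Real.abs_le_sqrt (by have := hD x; unfold gradSqR at this; nlinarith [sq_nonneg (d1R φ x)])

theorem abs_d1R_le {φ : Plane → ℝ} {D : ℝ} (hD : ∀ x, gradSqR φ x ≤ D) (x : Plane) :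
    |d1R φ x| ≤ Real.sqrt D :=
  Real.abs_le_sqrt (by have := hD x; unfold gradSqR at this; nlinarith [sq_nonneg (d0R φ x)])

theorem InH1.integrable_cross (hu : InH1 u) {D : ℝ} (hD : ∀ x, gradSqR X x ≤ D) :
    Integrable fun x => d0R (fun y => ‖u y‖ ^ 2) x * d0R X x +
        d1R (fun y => ‖u y‖ ^ 2) x * d1R X x := by
  obtain ⟨h0, h1⟩ := hu.integrable_grad_density
  exact (h0.mul_bdd (c := Real.sqrt D) (measurable_d0R X).aestronglyMeasurable
    (ae_of_all _ fun x => abs_d0R_le hD x)).add (h1.mul_bdd (c := Real.sqrt D)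
      (measurable_d1R X).aestronglyMeasurable (ae_of_all _ fun x => abs_d1R_le hD x))

theorem InH.real_mul (hu : InH V u) (hX : Differentiable ℝ X) {B D : ℝ} (hB : ∀ x, |X x| ≤ B)
    (hD : ∀ x, gradSqR X x ≤ D) : InH V (fun y => (X y : ℂ) * u y) := by
  have hB2 : ∀ x, ‖X x ^ 2‖ ≤ B ^ 2 := fun x => by
    rw [Real.norm_eq_abs, abs_pow]; exact pow_le_pow_left₀ (abs_nonneg _) (hB x) 2
  have hXm := hX.meas
  have hn : ∀ x, ‖(X x : ℂ) * u x‖ ^ 2 = X x ^ 2 * ‖u x‖ ^ 2 := fun x => by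
    simp only [norm_mul, mul_pow, Complex.norm_real, Real.norm_eq_abs, sq_abs]
  refine ⟨⟨fun x => ?_, ?_, ?_⟩, ?_⟩
  · exact ((Complex.ofRealCLM.differentiable (X x)).comp x (hX x)).mul (hu.1.1 x)
  · simp only [hn]
    exact hu.1.2.1.bdd_mul (hXm.pow_const 2).aestronglyMeasurable (ae_of_all _ hB2)
  · have : gradSq (fun y => (X y : ℂ) * u y) = _ := funext fun x => gradSq_mul (hX x) (hu.1.1 x)
    rw [this]
    refine ((hu.1.2.2.bdd_mul (hXm.pow_const 2).aestronglyMeasurable (ae_of_all _ hB2)).add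
      ((hu.1.integrable_cross hD).bdd_mul (c := B) hXm.aestronglyMeasurable
        (ae_of_all _ hB))).add (hu.1.2.1.bdd_mul (c := D)
            (measurable_gradSqR X).aestronglyMeasurable
        (ae_of_all _ fun x => ?_))
    rw [Real.norm_eq_abs, abs_of_nonneg (gradSqR_nonneg _ _)]; exact hD x
  · simp only [hn]
    refine (hu.2.bdd_mul (hXm.pow_const 2).aestronglyMeasurable (ae_of_all _ hB2)).congr
      (ae_of_all _ fun x => ?_)
    simp only; ring

end Multiplier

theorem hasDerivAt_integral_weight {X : Type*} [MeasurableSpace X] {μ : Measure X} {g S p : X → ℝ}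
    (hg : Integrable g μ) (hS : Measurable S) (hp : Measurable p) {B : ℝ} (hSB : ∀ z, |S z| ≤ B)
    (hpB : ∀ z, |p z| ≤ B) :
    HasDerivAt (fun t : ℝ => ∫ z, g z * (1 + t * S z + t ^ 2 * p z) ^ 2 ∂μ)
      (2 * ∫ z, g z * S z ∂μ) 0 := by
  have hm : ∀ {h w : X → ℝ}, Integrable h μ → Measurable w → (∀ z, |w z| ≤ B) →
      Integrable (fun z => h z * w z) μ := fun h1 h2 h3 =>
    h1.mul_bdd (c := B) h2.aestronglyMeasurable (ae_of_all _ h3)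
  have i1 := hm hg hS hSB
  have i2 := hm hg hp hpB
  have i3 := hm i1 hS hSB
  have i4 := hm i1 hp hpB
  have i5 := hm i2 hp hpB
  have key : (fun t : ℝ => ∫ z, g z * (1 + t * S z + t ^ 2 * p z) ^ 2 ∂μ) = fun t =>
      (∫ z, g z ∂μ) + t * (2 * ∫ z, g z * S z ∂μ) + t ^ 2 * ((2 * ∫ z, g z * p z ∂μ) +
        (∫ z, g z * S z * S z ∂μ) + t * (2 * ∫ z, g z * S z * p z ∂μ) +
        t ^ 2 * ∫ z, g z * p z * p z ∂μ) := by
    funext t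
    have e : (fun z => g z * (1 + t * S z + t ^ 2 * p z) ^ 2) = fun z =>
        ((((g z + (2 * t) * (g z * S z)) + (2 * t ^ 2) * (g z * p z)) + t ^ 2 * (g z * S z * S z)) +
          (2 * t ^ 3) * (g z * S z * p z)) + t ^ 4 * (g z * p z * p z) := by
      funext z; ring
    have j1 := hg.fun_add (i1.const_mul (2 * t))
    have j2 := j1.fun_add (i2.const_mul (2 * t ^ 2))
    have j3 := j2.fun_add (i3.const_mul (t ^ 2))
    have j4 := j3.fun_add (i4.const_mul (2 * t ^ 3))
    rw [e, integral_add j4 (i5.const_mul _), integral_add j3 (i4.const_mul _),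
      integral_add j2 (i3.const_mul _), integral_add j1 (i2.const_mul _),
      integral_add hg (i1.const_mul _)]
    simp only [integral_const_mul]
    ring
  rw [key]
  generalize (∫ z, g z ∂μ) = c0
  generalize (2 * ∫ z, g z * S z ∂μ) = c1
  generalize (2 * ∫ z, g z * p z ∂μ) + (∫ z, g z * S z * S z ∂μ) = c2
  generalize (2 * ∫ z, g z * S z * p z ∂μ) = c3
  generalize (∫ z, g z * p z * p z ∂μ) = c4
  have h1 := (hasDerivAt_id (0 : ℝ)).mul_const c1
  have h2 := ((hasDerivAt_id (0 : ℝ)).mul_const c3).const_add c2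
  have h3 := h2.add ((hasDerivAt_pow 2 (0 : ℝ)).mul_const c4)
  have h4 := (h1.const_add c0).add ((hasDerivAt_pow 2 (0 : ℝ)).mul h3)
  exact h4.congr_deriv (by simp)

theorem InH1.integrable_pow_four_of_le {u : Plane → ℂ} (hu : InH1 u) {K : ℝ} (hK : ∀ x, ‖u x‖ ≤ K) :
    Integrable fun x => (‖u x‖ ^ 2) ^ 2 := by
  have hum := measurable_of_diff hu.1
  refine hu.2.1.mul_bdd (c := K ^ 2) (hum.norm.pow_const 2).aestronglyMeasurable
    (ae_of_all _ fun x => ?_) |>.congr (ae_of_all _ fun x => by simp only; ring)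
  rw [Real.norm_eq_abs, abs_of_nonneg (by positivity)]
  exact pow_le_pow_left₀ (norm_nonneg _) (hK x) 2

section Variation

variable {V : Plane → ℝ} {Ω : ℝ} {u : Plane → ℂ}

theorem InH.integrable_log_prod (hV : V110 V) (hu : InH V u) {K : ℝ} (hK : ∀ x, ‖u x‖ ≤ K) :
    Integrable (fun z : Plane × Plane => Real.log ‖z.1 - z.2‖ * ‖u z.1‖ ^ 2 * ‖u z.2‖ ^ 2)
      (volume.prod volume) := by
  have hum := measurable_of_diff hu.1.1
  refine _root_.integrable_log_prod (ρ := fun x => ‖u x‖ ^ 2) (hum.norm.pow_const 2)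
    (fun x => sq_nonneg _) hu.1.2.1 (hu.1.integrable_pow_four_of_le hK) ?_
  refine (hu.1.2.1.add (integrable_moment hV hu)).mono'
    (measurable_norm.mul (hum.norm.pow_const 2)).aestronglyMeasurable (ae_of_all _ fun x => ?_)
  rw [Real.norm_eq_abs, abs_of_nonneg (by positivity)]
  simp only [Pi.add_apply]
  nlinarith [sq_nonneg (‖x‖ - 1), sq_nonneg ‖u x‖, norm_nonneg x]

/-- The energy of `X u` in terms of the densities of `u`. -/
theorem Ea_real_mul (hV : V110 V) (hu : InH V u) {K : ℝ} (hK : ∀ x, ‖u x‖ ≤ K) {X : Plane → ℝ}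
    (hX : Differentiable ℝ X) {B D : ℝ} (hB : ∀ x, |X x| ≤ B) (hD : ∀ x, gradSqR X x ≤ D) :
    Ea V Ω (fun y => (X y : ℂ) * u y) =
      (∫ x, eDen V Ω u x * X x ^ 2) + (∫ x, X x * (d0R (fun y => ‖u y‖ ^ 2) x * d0R X x +
        d1R (fun y => ‖u y‖ ^ 2) x * d1R X x)) + (∫ x, gradSqR X x * ‖u x‖ ^ 2) +
      (1 / 2) * (∫ z : Plane × Plane, Real.log ‖z.1 - z.2‖ * ‖u z.1‖ ^ 2 * ‖u z.2‖ ^ 2 *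
        (X z.1 * X z.2) ^ 2 ∂(volume.prod volume)) -
      (1 / 2) * ∫ x, (‖u x‖ ^ 2) ^ 2 * (X x ^ 2) ^ 2 := by
  have hB2 : ∀ x, ‖X x ^ 2‖ ≤ B ^ 2 := fun x => by
    rw [Real.norm_eq_abs, abs_pow]; exact pow_le_pow_left₀ (abs_nonneg _) (hB x) 2
  have hXm := hX.meas
  have i1 : Integrable fun x => eDen V Ω u x * X x ^ 2 :=
    (integrable_eDen hV hu).mul_bdd (hXm.pow_const 2).aestronglyMeasurable (ae_of_all _ hB2)
  have i2 := (hu.1.integrable_cross hD).bdd_mul (c := B) hXm.aestronglyMeasurable (ae_of_all _ hB)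
  have i3 := hu.1.2.1.bdd_mul (c := D) (measurable_gradSqR X).aestronglyMeasurable
    (ae_of_all _ fun x => by rw [Real.norm_eq_abs, abs_of_nonneg (gradSqR_nonneg _ _)]; exact hD x)
  rw [Ea_eq hV (hu.real_mul hX hB hD)]
  have e1 : eDen V Ω (fun y => (X y : ℂ) * u y) = fun x => eDen V Ω u x * X x ^ 2 +
      X x * (d0R (fun y => ‖u y‖ ^ 2) x * d0R X x + d1R (fun y => ‖u y‖ ^ 2) x * d1R X x) +
      gradSqR X x * ‖u x‖ ^ 2 := by
    funext x; rw [eDen_mul (hX x) (hu.1.1 x)]; ring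
  have hn : ∀ x, ‖(X x : ℂ) * u x‖ ^ 2 = X x ^ 2 * ‖u x‖ ^ 2 := fun x => by
    simp only [norm_mul, mul_pow, Complex.norm_real, Real.norm_eq_abs, sq_abs]
  have e2 : logConv (fun y => (X y : ℂ) * u y) = ∫ z : Plane × Plane,
      Real.log ‖z.1 - z.2‖ * ‖u z.1‖ ^ 2 * ‖u z.2‖ ^ 2 * (X z.1 * X z.2) ^ 2
          ∂(volume.prod volume) := by
    have hi : Integrable (fun z : Plane × Plane => Real.log ‖z.1 - z.2‖ * ‖u z.1‖ ^ 2 *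
        ‖u z.2‖ ^ 2 * (X z.1 * X z.2) ^ 2) (volume.prod volume) := by
      refine (hu.integrable_log_prod hV hK).mul_bdd (c := B ^ 2 * B ^ 2)
        (((hXm.comp measurable_fst).mul (hXm.comp measurable_snd)).pow_const 2).aestronglyMeasurable
        (ae_of_all _ fun z => ?_)
      rw [mul_pow, norm_mul]
      exact mul_le_mul (hB2 _) (hB2 _) (norm_nonneg _) (by positivity)
    rw [integral_prod _ hi]
    unfold logConv
    refine integral_congr_ae (ae_of_all _ fun x => integral_congr_ae (ae_of_all _ fun y => ?_))
    simp only [hn]; ring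
  have e3 : (fun x => ‖(X x : ℂ) * u x‖ ^ 4) = fun x => (‖u x‖ ^ 2) ^ 2 * (X x ^ 2) ^ 2 := by
    funext x
    rw [show ‖(X x : ℂ) * u x‖ ^ 4 = (‖(X x : ℂ) * u x‖ ^ 2) ^ 2 by ring, hn]; ring
  rw [e1, e2, e3, integral_add (i1.fun_add i2) i3, integral_add i1 i2]

/-- A minimizer with nonpositive energy has a density that is a weak subsolution. -/
theorem IsMinimizer.variation (hV : V110 V) (hpos : ∀ x : Plane, 0 ≤ V x - Ω ^ 2 / 4 * ‖x‖ ^ 2)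
    {a K : ℝ} (ha : 0 < a) (h : IsMinimizer V Ω a u) (hE : Ea V Ω u ≤ 0) (hK : ∀ x, ‖u x‖ ≤ K)
    {φ : Plane → ℝ} (hφ : TestFn φ) (hφ0 : ∀ x, 0 ≤ φ x) :
    -∫ y, ‖u y‖ ^ 2 * lapR φ y ≤ 2 * (∫ y, φ y * (‖u y‖ ^ 2) ^ 2) +
      2 * (kap * Real.sqrt (∫ y, (‖u y‖ ^ 2) ^ 2) * ∫ y, ‖u y‖ ^ 2 * φ y) := by
  obtain ⟨⟨hu, hmass⟩, hmin⟩ := h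
  obtain ⟨B, hB0, hφB, hgB, -⟩ := hφ.bdd
  have hum := measurable_of_diff hu.1.1
  have hφm := hφ.d.meas
  have iT := integrable_eDen (Ω := Ω) hV hu
  have iρ := hu.1.2.1
  have iρ2 := hu.1.integrable_pow_four_of_le hK
  have iC := hu.1.integrable_cross hgB
  have iL := hu.integrable_log_prod hV hK
  have hg := gradSqR_nonneg φ
  set C : Plane → ℝ := fun x => d0R (fun y => ‖u y‖ ^ 2) x * d0R φ x +
    d1R (fun y => ‖u y‖ ^ 2) x * d1R φ x with hC
  have iφC : Integrable fun x => φ x * C x :=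
    iC.bdd_mul hφm.aestronglyMeasurable (ae_of_all _ hφB)
  set gL : Plane × Plane → ℝ := fun z => Real.log ‖z.1 - z.2‖ * ‖u z.1‖ ^ 2 * ‖u z.2‖ ^ 2 with hgL
  set kin : ℝ → ℝ := fun t => (∫ x, eDen V Ω u x * (1 + t * φ x + t ^ 2 * 0) ^ 2) +
    (t * (∫ x, C x) + t ^ 2 * ((∫ x, φ x * C x) + ∫ x, gradSqR φ x * ‖u x‖ ^ 2)) with hkin
  set pot : ℝ → ℝ := fun t => (1 / 2) * (∫ z, gL z * (1 + t * (φ z.1 + φ z.2) +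
    t ^ 2 * (φ z.1 * φ z.2)) ^ 2 ∂(volume.prod volume)) -
    (1 / 2) * ∫ x, (‖u x‖ ^ 2) ^ 2 * (1 + t * (2 * φ x) + t ^ 2 * (φ x * φ x)) ^ 2 with hpot
  set mas : ℝ → ℝ := fun t => ∫ x, ‖u x‖ ^ 2 * (1 + t * φ x + t ^ 2 * 0) ^ 2 with hmas
  have hχd : ∀ (t c : ℝ) x, fderiv ℝ (fun y => c * (1 + t * φ y)) x = (c * t) • fderiv ℝ φ x := by
    intro t c x
    rw [((((hφ.d x).hasFDerivAt.const_mul t).const_add 1).const_mul c).fderiv, smul_smul]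
  have hEa : ∀ t c : ℝ, Ea V Ω (fun y => ((c * (1 + t * φ y) : ℝ) : ℂ) * u y) =
      c ^ 2 * kin t + c ^ 4 * pot t ∧ InH V (fun y => ((c * (1 + t * φ y) : ℝ) : ℂ) * u y) := by
    intro t c
    have hX : Differentiable ℝ fun y => c * (1 + t * φ y) :=
        ((hφ.d.const_mul t).const_add 1).const_mul c
    have h0 : ∀ x, d0R (fun y => c * (1 + t * φ y)) x = c * t * d0R φ x := fun x => by
      simp only [d0R, hχd, FunLike.coe_smul, Pi.smul_apply, smul_eq_mul]
    have h1 : ∀ x, d1R (fun y => c * (1 + t * φ y)) x = c * t * d1R φ x := fun x => by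
      simp only [d1R, hχd, FunLike.coe_smul, Pi.smul_apply, smul_eq_mul]
    have h2 : ∀ x, gradSqR (fun y => c * (1 + t * φ y)) x = (c * t) ^ 2 * gradSqR φ x := fun x => by
      simp only [gradSqR, h0, h1]; ring
    have hXB : ∀ x, |c * (1 + t * φ x)| ≤ |c| * (1 + |t| * B) := fun x => by
      rw [abs_mul]
      refine mul_le_mul_of_nonneg_left ((abs_add_le _ _).trans ?_) (abs_nonneg c)
      rw [abs_one, abs_mul]
      gcongr
      exact hφB x
    have hXD : ∀ x, gradSqR (fun y => c * (1 + t * φ y)) x ≤ (c * t) ^ 2 * B := fun x => by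
      rw [h2]; exact mul_le_mul_of_nonneg_left (hgB x) (sq_nonneg _)
    refine ⟨?_, hu.real_mul hX hXB hXD⟩
    rw [Ea_real_mul hV hu hK hX hXB hXD]
    have q1 : ∫ x, eDen V Ω u x * (c * (1 + t * φ x)) ^ 2 =
        c ^ 2 * ∫ x, eDen V Ω u x * (1 + t * φ x + t ^ 2 * 0) ^ 2 := by
      rw [← integral_const_mul]; congr 1; funext x; ring
    have q2 : ∫ x, c * (1 + t * φ x) * (d0R (fun y => ‖u y‖ ^ 2) x * d0R (fun y =>
        c * (1 + t * φ y)) x +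
        d1R (fun y => ‖u y‖ ^ 2) x * d1R (fun y => c * (1 + t * φ y)) x) =
        c ^ 2 * (t * (∫ x, C x) + t ^ 2 * ∫ x, φ x * C x) := by
      rw [← integral_const_mul, ← integral_const_mul, ← integral_add (iC.const_mul t)
        (iφC.const_mul (t ^ 2)), ← integral_const_mul]
      congr 1; funext x; simp only [h0, h1, hC]; ring
    have q3 : ∫ x, gradSqR (fun y => c * (1 + t * φ y)) x * ‖u x‖ ^ 2 =
        c ^ 2 * (t ^ 2 * ∫ x, gradSqR φ x * ‖u x‖ ^ 2) := by
      rw [← integral_const_mul, ← integral_const_mul]; congr 1; funext x; rw [h2]; ring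
    have q4 : ∫ z : Plane × Plane, Real.log ‖z.1 - z.2‖ * ‖u z.1‖ ^ 2 * ‖u z.2‖ ^ 2 *
        (c * (1 + t * φ z.1) * (c * (1 + t * φ z.2))) ^ 2 ∂(volume.prod volume) =
        c ^ 4 * ∫ z, gL z * (1 + t * (φ z.1 + φ z.2) + t ^ 2 * (φ z.1 * φ z.2)) ^ 2
          ∂(volume.prod volume) := by
      rw [← integral_const_mul]; congr 1; funext z; simp only [hgL]; ring
    have q5 : ∫ x, (‖u x‖ ^ 2) ^ 2 * ((c * (1 + t * φ x)) ^ 2) ^ 2 =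
        c ^ 4 * ∫ x, (‖u x‖ ^ 2) ^ 2 * (1 + t * (2 * φ x) + t ^ 2 * (φ x * φ x)) ^ 2 := by
      rw [← integral_const_mul]; congr 1; funext x; ring
    rw [q1, q2, q3, q4, q5, hkin, hpot]
    ring
  have hE0 : Ea V Ω u = kin 0 + pot 0 := by
    have := (hEa 0 1).1
    simpa using this
  have hkin0 : 0 ≤ kin 0 := by
    have : kin 0 = ∫ x, eDen V Ω u x := by simp [hkin]
    rw [this]
    exact (integral_nonneg (gradSqR_nonneg _)).trans (hu.absH1 hV hpos).2
  have hmas0 : mas 0 = a := by simp [hmas, hmass]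
  have dK := ((hasDerivAt_integral_weight iT hφm measurable_const (B := B) hφB
    (p := fun _ => 0) (fun _ =>
        by simpa using hB0)).add (((hasDerivAt_id (0 : ℝ)).mul_const (∫ x, C x)).add
    ((hasDerivAt_pow 2 (0 : ℝ)).mul_const ((∫ x, φ x * C x) + ∫ x, gradSqR φ x * ‖u x‖ ^ 2))))
  have dM := hasDerivAt_integral_weight iρ hφm measurable_const (B := B) hφB
    (p := fun _ => 0) (fun _ => by simpa using hB0)
  have hpB : ∀ x y, |φ x * φ y| ≤ 2 * B + B * B := fun x y => by
    rw [abs_mul]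
    nlinarith [mul_le_mul (hφB x) (hφB y) (abs_nonneg _) hB0]
  have dP1 := hasDerivAt_integral_weight iL
      ((hφm.comp measurable_fst).add (hφm.comp measurable_snd))
    ((hφm.comp measurable_fst).mul (hφm.comp measurable_snd)) (B := 2 * B + B * B)
    (fun z => (abs_add_le _ _).trans (by
      have h1 := hφB z.1; have h2 := hφB z.2
      simp only [Function.comp_apply]
      nlinarith [mul_nonneg hB0 hB0])) fun z => hpB z.1 z.2
  have dP2 := hasDerivAt_integral_weight iρ2 (hφm.const_mul 2) (hφm.mul hφm) (B := 2 * B + B * B)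
    (fun x => by
      have h1 := hφB x
      rw [abs_mul, abs_two]
      nlinarith [mul_nonneg hB0 hB0]) fun x => hpB x x
  have dK' : HasDerivAt kin (2 * (∫ x, eDen V Ω u x * φ x) + ∫ x, C x) 0 :=
    dK.congr_deriv (by simp)
  have dM' : HasDerivAt mas (2 * ∫ x, ‖u x‖ ^ 2 * φ x) 0 := dM
  have dP' : HasDerivAt pot ((∫ z, gL z * (φ z.1 + φ z.2) ∂(volume.prod volume)) -
      2 * ∫ x, (‖u x‖ ^ 2) ^ 2 * φ x) 0 := by
    refine ((dP1.const_mul (1 / 2)).sub (dP2.const_mul (1 / 2))).congr_deriv ?_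
    have : ∫ x, (‖u x‖ ^ 2) ^ 2 * (2 * φ x) = 2 * ∫ x, (‖u x‖ ^ 2) ^ 2 * φ x := by
      rw [← integral_const_mul]; congr 1; funext x; ring
    rw [this]
    simp only [Pi.add_apply, Function.comp_apply]
    ring
  have hloc : IsLocalMin (fun t => a * mas t * kin t + a ^ 2 * pot t - mas t ^ 2 * Ea V Ω u) 0 := by
    have hev : ∀ᶠ t in 𝓝 (0 : ℝ), 0 < mas t :=
      dM'.continuousAt.eventually (lt_mem_nhds (by rw [hmas0]; exact ha))
    filter_upwards [hev] with t ht
    simp only [hmas0]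
    have h1 : a * a * kin 0 + a ^ 2 * pot 0 - a ^ 2 * Ea V Ω u = 0 := by rw [hE0]; ring
    rw [h1]
    obtain ⟨e1, e2⟩ := hEa t (Real.sqrt (a / mas t))
    have hc2 : Real.sqrt (a / mas t) ^ 2 = a / mas t := Real.sq_sqrt (by positivity)
    have hc4 : Real.sqrt (a / mas t) ^ 4 = (a / mas t) ^ 2 := by
      rw [show (4 : ℕ) = 2 * 2 from rfl, pow_mul, hc2]
    have hS := hmin _ (show _ ∈ Sset V a from ⟨e2, by
      have : ∀ x, ‖((Real.sqrt (a / mas t) * (1 + t * φ x) : ℝ) : ℂ) * u x‖ ^ 2 =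
          a / mas t * (‖u x‖ ^ 2 * (1 + t * φ x + t ^ 2 * 0) ^ 2) := fun x => by
        rw [norm_mul, mul_pow, Complex.norm_real, Real.norm_eq_abs, sq_abs, mul_pow, hc2]; ring
      simp only [this]
      rw [integral_const_mul]
      exact div_mul_cancel₀ a ht.ne'⟩)
    rw [e1, hc2, hc4] at hS
    have := mul_le_mul_of_nonneg_left hS (sq_nonneg (mas t))
    have h3 : mas t ^ 2 * (a / mas t * kin t + (a / mas t) ^ 2 * pot t) =
        a * mas t * kin t + a ^ 2 * pot t := by field_simp
    rw [h3] at this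
    linarith
  have hd := hloc.hasDerivAt_eq_zero ((((dM'.const_mul a).mul dK').add (dP'.const_mul (a ^ 2))).sub
    ((dM'.pow 2).mul_const (Ea V Ω u)))
  simp only [hmas0] at hd
  have hM1 : 0 ≤ ∫ x, ‖u x‖ ^ 2 * φ x := integral_nonneg fun x => mul_nonneg (sq_nonneg _) (hφ0 x)
  have hT1 : 0 ≤ ∫ x, eDen V Ω u x * φ x := integral_nonneg fun x => mul_nonneg (by
    have h1 := eDen_ge (V := V) (Ω := Ω) hu.1.1 x
    have h2 := mul_nonneg (hpos x) (sq_nonneg ‖u x‖)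
    have h3 : 0 ≤ gradAbsSq u x := sq_nonneg _
    linarith) (hφ0 x)
  have hlin : (∫ x, C x) + ((∫ z, gL z * (φ z.1 + φ z.2) ∂(volume.prod volume)) -
      2 * ∫ x, (‖u x‖ ^ 2) ^ 2 * φ x) ≤ 0 := by
    have h2 : a * (2 * (∫ x, eDen V Ω u x * φ x) + (∫ x, C x) +
        ((∫ z, gL z * (φ z.1 + φ z.2) ∂(volume.prod volume)) - 2 * ∫ x, (‖u x‖ ^ 2) ^ 2 * φ x)) =
        2 * (∫ x, ‖u x‖ ^ 2 * φ x) * (2 * Ea V Ω u - kin 0) := by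
      refine mul_left_cancel₀ ha.ne' ?_
      linear_combination hd
    have h3 : 2 * (∫ x, ‖u x‖ ^ 2 * φ x) * (2 * Ea V Ω u - kin 0) ≤ 0 :=
      mul_nonpos_of_nonneg_of_nonpos (by positivity) (by linarith)
    rw [← h2] at h3
    have h4 := nonpos_of_mul_nonpos_right h3 ha
    linarith
  have hlog : (∫ z, gL z * (φ z.1 + φ z.2) ∂(volume.prod volume)) =
      2 * ∫ x, ∫ y, Real.log ‖x - y‖ * (‖u x‖ ^ 2 * φ x) * ‖u y‖ ^ 2 := by
    have j1 : Integrable (fun z : Plane × Plane => gL z * φ z.1) (volume.prod volume) :=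
      iL.mul_bdd (c := B) (hφm.comp measurable_fst).aestronglyMeasurable (ae_of_all _ fun z =>
          hφB _)
    have j2 : Integrable (fun z : Plane × Plane => gL z * φ z.2) (volume.prod volume) :=
      iL.mul_bdd (c := B) (hφm.comp measurable_snd).aestronglyMeasurable (ae_of_all _ fun z =>
          hφB _)
    have e1 : ∫ z, gL z * φ z.2 ∂(volume.prod volume) = ∫ z, gL z * φ z.1
        ∂(volume.prod volume) := by
      rw [← integral_prod_swap]
      refine integral_congr_ae (ae_of_all _ fun z => ?_)
      simp only [hgL, Prod.fst_swap, Prod.snd_swap, norm_sub_rev z.2 z.1]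
      ring
    have e2 : ∫ z, gL z * φ z.1 ∂(volume.prod volume) =
        ∫ x, ∫ y, Real.log ‖x - y‖ * (‖u x‖ ^ 2 * φ x) * ‖u y‖ ^ 2 := by
      rw [integral_prod _ j1]
      refine integral_congr_ae (ae_of_all _ fun x => integral_congr_ae (ae_of_all _ fun y => ?_))
      simp only [hgL]; ring
    simp only [mul_add]
    rw [integral_add j1 j2, e1, e2]; ring
  have hneg := neg_log_integral_le (ρ := fun x => ‖u x‖ ^ 2) (hum.norm.pow_const 2)
    (fun x => sq_nonneg _) iρ2 (θ := fun x => ‖u x‖ ^ 2 * φ x)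
    (fun x => mul_nonneg (sq_nonneg _) (hφ0 x)) (hφ.int (GaussInt.of_integrable iρ))
  have hibp : ∫ x, C x = _ := integral_grad_mul_grad (f := fun y => ‖u y‖ ^ 2)
    (fun x => (hu.1.1 x).norm_sq ℝ) (GaussInt.of_integrable iρ)
    (GaussInt.of_integrable hu.1.integrable_grad_density.1)
    (GaussInt.of_integrable hu.1.integrable_grad_density.2) hφ
  have hcomm : ∫ y, φ y * (‖u y‖ ^ 2) ^ 2 = ∫ x, (‖u x‖ ^ 2) ^ 2 * φ x := by
    congr 1; funext x; ring
  rw [hcomm, ← hibp]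
  rw [hlog] at hlin
  linarith

end Variation

theorem le_of_tendsto_of_deriv_nonneg {D D' : ℝ → ℝ} {L : ℝ}
    (h : ∀ s, 0 < s → HasDerivAt D (D' s) s)
    (h0 : ∀ s, 0 < s → 0 ≤ D' s) (hl : Tendsto D (𝓝[>] 0) (𝓝 L)) {s : ℝ} (hs : 0 < s) :
        L ≤ D s := by
  have hmono : MonotoneOn D (Ioi 0) := by
    refine monotoneOn_of_deriv_nonneg (convex_Ioi 0)
      (fun t ht => (h t ht).continuousAt.continuousWithinAt) ?_ ?_
    · rw [interior_Ioi]; exact fun t ht => (h t ht).differentiableAt.differentiableWithinAt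
    · rw [interior_Ioi]; intro t ht; rw [(h t ht).deriv]; exact h0 t ht
  refine le_of_tendsto hl ?_
  filter_upwards [Ioo_mem_nhdsGT hs] with t ht
  exact hmono ht.1 hs ht.2.le

/-- A bounded density satisfying `-Δρ ≤ 2ρ² + 2κρ` when tested with heat kernels. -/
structure SubDensity (κ M : ℝ) (ρ : Plane → ℝ) : Prop where
  cont : Continuous ρ
  nonneg : ∀ x, 0 ≤ ρ x
  le : ∀ x, ρ x ≤ M
  int : Integrable ρ
  ineq : ∀ s, 0 < s → ∀ x, -∫ y, ρ y * LG s x y ≤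
    2 * (∫ y, ρ y ^ 2 * G s x y) + 2 * (κ * ∫ y, ρ y * G s x y)

namespace SubDensity
variable {κ M : ℝ} {ρ : Plane → ℝ}

theorem abs_le (h : SubDensity κ M ρ) (x : Plane) : |ρ x| ≤ M := by
  rw [abs_of_nonneg (h.nonneg x)]; exact h.le x

theorem M_nonneg (h : SubDensity κ M ρ) : 0 ≤ M := (h.nonneg 0).trans (h.le 0)

theorem gaussInt (h : SubDensity κ M ρ) : GaussInt ρ := GaussInt.of_integrable h.int

theorem int_sq (h : SubDensity κ M ρ) : Integrable fun x => ρ x ^ 2 :=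
  (h.int.mul_bdd (c := M) h.cont.aestronglyMeasurable (ae_of_all _ h.abs_le)).congr
    (ae_of_all _ fun x => by simp only; ring)

theorem heat_nonneg (h : SubDensity κ M ρ) {s : ℝ} (hs : 0 < s) (x : Plane) : 0 ≤ heat ρ s x :=
  integral_nonneg fun y => mul_nonneg (h.nonneg y) (G_pos hs x y).le

theorem deriv_ge (h : SubDensity κ M ρ) {s : ℝ} (hs : 0 < s) (x : Plane) :
    -((2 * M + 2 * κ) * heat ρ s x) ≤ ∫ y, ρ y * LG s x y := by
  have h1 := h.ineq s hs x
  have h2 : ∫ y, ρ y ^ 2 * G s x y ≤ M * heat ρ s x := by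
    unfold heat
    rw [← integral_const_mul]
    refine integral_mono ((GaussInt.of_integrable h.int_sq).mul_G hs x)
      ((h.gaussInt.mul_G hs x).const_mul _) fun y => ?_
    have := mul_le_mul_of_nonneg_right (h.le y) (mul_nonneg (h.nonneg y) (G_pos hs x y).le)
    simp only
    nlinarith
  change _ ≤ 2 * _ + 2 * (κ * heat ρ s x) at h1
  linarith

theorem heat_le (h : SubDensity κ M ρ) {s : ℝ} (hs : 0 < s) (x : Plane) : heat ρ s x ≤ M := by
  have := integral_mono (h.gaussInt.mul_G hs x) ((integrable_G hs x).const_mul M) fun y =>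
    mul_le_mul_of_nonneg_right (h.le y) (G_pos hs x y).le
  rwa [integral_const_mul, integral_G hs, mul_one] at this

theorem le_heat_add (h : SubDensity κ M ρ) (hκ : 0 ≤ κ) {s : ℝ} (hs : 0 < s) (x : Plane) :
    ρ x ≤ heat ρ s x + (2 * M + 2 * κ) * M * s := by
  have hM := h.M_nonneg
  refine le_of_tendsto_of_deriv_nonneg (D := fun s => heat ρ s x + (2 * M + 2 * κ) * M * s)
    (D' := fun s => (∫ y, ρ y * LG s x y) + (2 * M + 2 * κ) * M * 1)
    (fun t ht => (heat_hasDerivAt h.gaussInt ht x).fun_add ((hasDerivAt_id' t).const_mul _))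
    (fun t ht => ?_) ?_ hs
  · have h1 := h.deriv_ge ht x
    have h2 := mul_le_mul_of_nonneg_left (h.heat_le ht x) (by positivity : 0 ≤ 2 * M + 2 * κ)
    linarith
  · have h1 := heat_tendsto h.cont.aestronglyMeasurable h.abs_le h.cont.continuousAt (x := x)
    have h2 : Tendsto (fun s : ℝ =>
        (2 * M + 2 * κ) * M * s) (𝓝[>] 0) (𝓝 ((2 * M + 2 * κ) * M * 0)) :=
      (continuous_const.mul continuous_id).continuousAt.tendsto.mono_left nhdsWithin_le_nhds
    simpa using h1.add h2

theorem heat_le_inv_sqrt (h : SubDensity κ M ρ) (hq : ∫ x, ρ x ^ 2 ≤ 3) {s : ℝ} (hs : 0 < s)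
    (x : Plane) : heat ρ s x ≤ 2 / 5 * (1 / Real.sqrt s) := by
  have h1 := abs_integral_mul_le h.cont.aestronglyMeasurable (continuous_G s x).aestronglyMeasurable
    h.int_sq (integrable_G_sq hs x)
  have h2 : Real.sqrt (∫ x, ρ x ^ 2) * Real.sqrt (∫ y, G s x y ^ 2) ≤ 2 /
      5 * (1 / Real.sqrt s) := by
    rw [integral_G_sq hs, ← Real.sqrt_mul (integral_nonneg fun x => sq_nonneg _)]
    refine Real.sqrt_le_iff.2 ⟨by positivity, ?_⟩
    rw [mul_pow, div_pow, div_pow, Real.sq_sqrt hs.le]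
    have hpi := Real.pi_gt_three
    have h3 : (8 * Real.pi * s)⁻¹ ≤ (24 * s)⁻¹ := by gcongr; linarith
    have h4 : (∫ x, ρ x ^ 2) * (8 * Real.pi * s)⁻¹ ≤ 3 * (24 * s)⁻¹ :=
      mul_le_mul hq h3 (by positivity) (by norm_num)
    refine h4.trans ?_
    rw [show 3 * (24 * s)⁻¹ = 1 / 8 * (1 / s) by field_simp; norm_num, one_pow]
    have : 0 < 1 / s := by positivity
    nlinarith
  exact (le_abs_self _).trans (h1.trans h2)

theorem M_le (h : SubDensity κ M ρ) (hκ1 : κ ≤ 1) (hq : ∫ x, ρ x ^ 2 ≤ 3) {x : Plane}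
    (hx : ρ x = M) : M ≤ 5 := by
  have hM := h.M_nonneg
  have key := le_of_tendsto_of_deriv_nonneg
    (D := fun s => heat ρ s x + (2 * M + 2) * (4 / 5) * Real.sqrt s)
    (D' := fun s => (∫ y, ρ y * LG s x y) + (2 * M + 2) * (4 / 5) * (1 / (2 * Real.sqrt s)))
    (L := M) (s := 1 / 64)
    (fun t ht => (heat_hasDerivAt h.gaussInt ht
        x).fun_add ((Real.hasDerivAt_sqrt ht.ne').const_mul _))
    (fun t ht => ?_) ?_ (by norm_num)
  · have h1 := h.heat_le_inv_sqrt hq (s := 1 / 64) (by norm_num) x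
    have h2 : Real.sqrt (1 / 64) = 1 / 8 := by
      rw [show (1 / 64 : ℝ) = (1 / 8) ^ 2 by norm_num]; exact Real.sqrt_sq (by norm_num)
    rw [h2] at h1 key
    norm_num at h1 key
    linarith
  · have h1 := h.deriv_ge ht x
    have h2 := h.heat_le_inv_sqrt hq ht x
    have h3 := h.heat_nonneg ht x
    have h4 : (2 * M + 2 * κ) * heat ρ t x ≤ (2 * M + 2) * (2 / 5 * (1 / Real.sqrt t)) :=
      mul_le_mul (by linarith) h2 h3 (by linarith)
    have h5 : (2 * M + 2) * (4 / 5) * (1 / (2 * Real.sqrt t)) = (2 * M +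
        2) * (2 / 5 * (1 / Real.sqrt t)) := by
      rw [show 1 / (2 * Real.sqrt t) = 1 / 2 * (1 / Real.sqrt t) by rw [one_div_mul_one_div]]; ring
    rw [h5]; linarith
  · have h1 := heat_tendsto h.cont.aestronglyMeasurable h.abs_le h.cont.continuousAt (x := x)
    have h2 : Tendsto (fun s : ℝ => (2 * M + 2) * (4 / 5) * Real.sqrt s) (𝓝[>] 0)
        (𝓝 ((2 * M + 2) * (4 / 5) * Real.sqrt 0)) :=
      (continuous_const.mul Real.continuous_sqrt).continuousAt.tendsto.mono_left nhdsWithin_le_nhds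
    rw [hx] at h1
    simpa using h1.add h2

theorem integral_sq_le (h : SubDensity κ M ρ) : ∫ x, ρ x ^ 2 ≤ M * ∫ x, ρ x := by
  rw [← integral_const_mul]
  refine integral_mono h.int_sq (h.int.const_mul M) fun x => ?_
  have := mul_le_mul_of_nonneg_right (h.le x) (h.nonneg x)
  simp only; nlinarith

end SubDensity

section Rescaled

variable {V : Plane → ℝ} {Ω : ℝ} {u : Plane → ℂ}

theorem G_affine {ε : ℝ} (hε : 0 < ε) (s : ℝ) (x y z : Plane) :
    G s x y = ε ^ 2 * G (ε ^ 2 * s) (ε • x + z) (ε • y + z) := by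
  unfold G gw
  have : ε • y + z - (ε • x + z) = ε • (y - x) := by rw [smul_sub]; abel
  rw [this, norm_smul, Real.norm_of_nonneg hε.le]
  have e1 : -(4 * (ε ^ 2 * s))⁻¹ * (ε * ‖y - x‖) ^ 2 = -(4 * s)⁻¹ * ‖y - x‖ ^ 2 := by
    by_cases hs : s = 0
    · simp [hs]
    · field_simp
  rw [e1, ← mul_assoc]
  congr 1
  by_cases hs : s = 0
  · simp [hs]
  · have := Real.pi_ne_zero; field_simp

theorem LG_affine {ε : ℝ} (hε : 0 < ε) {s : ℝ} (hs : 0 < s) (x y z : Plane) :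
    LG s x y = ε ^ 4 * LG (ε ^ 2 * s) (ε • x + z) (ε • y + z) := by
  unfold LG
  have : ε • y + z - (ε • x + z) = ε • (y - x) := by rw [smul_sub]; abel
  rw [G_affine hε s x y z, this, norm_smul, Real.norm_of_nonneg hε.le]
  field_simp

theorem IsMinimizer.subDensity (hV : V110 V) (hpos : ∀ x : Plane, 0 ≤ V x - Ω ^ 2 / 4 * ‖x‖ ^ 2)
    {a ε : ℝ} (ha : 0 < a) (hε : 0 < ε) (h : IsMinimizer V Ω a u) (hE : Ea V Ω u ≤ 0) {z : Plane}
    (hz : ∀ x, ‖u x‖ ≤ ‖u z‖) :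
    SubDensity (kap * ε * Real.sqrt (ε ^ 2 * ∫ x, ‖u x‖ ^ 4)) ((ε * ‖u z‖) ^ 2)
      (fun y => (ε * ‖u (ε • y + z)‖) ^ 2) := by
  have hu := h.1.1
  have huc := hu.1.1.continuous
  refine ⟨by fun_prop, fun x => sq_nonneg _, fun x => ?_, ?_, fun s hs x => ?_⟩
  · have := hz (ε • x + z); gcongr
  · simp only [mul_pow]
    exact (integrable_affine hu.1.2.1 hε.ne' z).const_mul _
  · have hs' : 0 < ε ^ 2 * s := by positivity
    have key := h.variation hV hpos ha hE hz (testFn_G hs' (ε • x + z))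
      (fun y => (G_pos hs' _ y).le)
    simp only [lapR_G hs'] at key
    have e1 : ∫ y, (ε * ‖u (ε • y + z)‖) ^ 2 * LG s x y =
        ε ^ 4 * ∫ y, ‖u y‖ ^ 2 * LG (ε ^ 2 * s) (ε • x + z) y := by
      have : ∀ y, (ε * ‖u (ε • y + z)‖) ^ 2 * LG s x y = ε ^ 6 * ((fun y => ‖u y‖ ^ 2 *
          LG (ε ^ 2 * s) (ε • x + z) y) (ε • y + z)) := fun y => by
        simp only; rw [LG_affine hε hs x y z]; ring
      simp only [this]
      rw [integral_const_mul, integral_affine (fun y => ‖u y‖ ^ 2 *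
          LG (ε ^ 2 * s) (ε • x + z) y) z, smul_eq_mul]
      field_simp
    have e2 : ∫ y, (ε * ‖u (ε • y + z)‖) ^ 2 * G s x y =
        ε ^ 2 * ∫ y, ‖u y‖ ^ 2 * G (ε ^ 2 * s) (ε • x + z) y := by
      have : ∀ y, (ε * ‖u (ε • y + z)‖) ^ 2 * G s x y = ε ^ 4 * ((fun y => ‖u y‖ ^ 2 *
          G (ε ^ 2 * s) (ε • x + z) y) (ε • y + z)) := fun y => by
        simp only; rw [G_affine hε s x y z]; ring
      simp only [this]
      rw [integral_const_mul, integral_affine (fun y => ‖u y‖ ^ 2 *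
          G (ε ^ 2 * s) (ε • x + z) y) z, smul_eq_mul]
      field_simp
    have e3 : ∫ y, ((ε * ‖u (ε • y + z)‖) ^ 2) ^ 2 * G s x y =
        ε ^ 4 * ∫ y, G (ε ^ 2 * s) (ε • x + z) y * (‖u y‖ ^ 2) ^ 2 := by
      have : ∀ y, ((ε * ‖u (ε • y + z)‖) ^ 2) ^ 2 * G s x y = ε ^ 6 * ((fun y =>
          G (ε ^ 2 * s) (ε • x + z) y * (‖u y‖ ^ 2) ^ 2) (ε • y + z)) := fun y => by
        simp only; rw [G_affine hε s x y z]; ring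
      simp only [this]
      rw [integral_const_mul, integral_affine (fun y =>
          G (ε ^ 2 * s) (ε • x + z) y * (‖u y‖ ^ 2) ^ 2) z, smul_eq_mul]
      field_simp
    have e4 : Real.sqrt (ε ^ 2 * ∫ x, ‖u x‖ ^ 4) = ε * Real.sqrt (∫ y, (‖u y‖ ^ 2) ^ 2) := by
      rw [Real.sqrt_mul (sq_nonneg ε), Real.sqrt_sq hε.le]
      simp only [← pow_mul]
    rw [e1, e2, e3, e4]
    have := mul_le_mul_of_nonneg_left key (by positivity : 0 ≤ ε ^ 4)
    linarith

end Rescaled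

namespace AbsH1
variable {f : Plane → ℝ}

theorem meas (h : AbsH1 f) : AEStronglyMeasurable f := h.continuous.aestronglyMeasurable

theorem integral_sub_soft_mul_le (h : AbsH1 f) {d : ℝ} (hd : 0 < d) :
    Integrable (fun x => (f x - softAbs d (f x)) * f x) ∧ ∫ x, (f x - softAbs d (f x)) * f x ≤
      Real.sqrt (∫ x, (softAbs d (f x) - f x) ^ 2) * Real.sqrt (∫ x, f x ^ 2) := by
  have hm := (h.soft hd).1.meas.aestronglyMeasurable (μ := volume)
  have h2 := integrable_sq_sub h.meas hm h.int (h.soft hd).2.1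
  refine ⟨integrable_mul_of_sq (h.meas.sub hm) h.meas h2 h.int, ?_⟩
  have h3 := (le_abs_self _).trans (abs_integral_mul_le (h.meas.sub hm) h.meas h2 h.int)
  have e : ∫ x, (softAbs d (f x) - f x) ^ 2 = ∫ x, ((f - fun x => softAbs d (f x)) x) ^ 2 :=
    integral_congr_ae (ae_of_all _ fun x => by simp only [Pi.sub_apply]; ring)
  rw [e]
  exact h3

theorem integral_soft_sq (h : AbsH1 f) {d : ℝ} (hd : 0 < d) :
    ∫ x, softAbs d (f x) ^ 2 ≤ ∫ x, f x ^ 2 ∧ ∫ x, f x ^ 2 ≤ (∫ x, softAbs d (f x) ^ 2) +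
      2 * (Real.sqrt (∫ x, (softAbs d (f x) - f x) ^ 2) * Real.sqrt (∫ x, f x ^ 2)) := by
  obtain ⟨h1, h2⟩ := h.integral_sub_soft_mul_le hd
  refine ⟨integral_mono (h.soft hd).2.1 h.int fun x =>
    pow_le_pow_left₀ (softAbs_nonneg _) (h.soft_le hd x) 2, ?_⟩
  have h3 := integral_mono h.int ((h.soft hd).2.1.fun_add (h1.const_mul 2)) fun x => by
    have := softAbs_nonneg (d := d) (f x)
    have := h.soft_le hd x
    simp only; nlinarith
  rw [integral_add (h.soft hd).2.1 (h1.const_mul 2), integral_const_mul] at h3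
  linarith

theorem integral_soft_pow_four (h : AbsH1 f) {d K : ℝ} (hd : 0 < d) (hK : ∀ x, f x ≤ K) :
    ∫ x, softAbs d (f x) ^ 4 ≤ ∫ x, f x ^ 4 ∧ ∫ x, f x ^ 4 ≤ (∫ x, softAbs d (f x) ^ 4) +
      4 * K ^ 2 * (Real.sqrt (∫ x, (softAbs d (f x) - f x) ^ 2) * Real.sqrt (∫ x, f x ^ 2)) := by
  obtain ⟨h1, h2⟩ := h.integral_sub_soft_mul_le hd
  have hf4 := integrable_pow_four_of_bdd h.meas h.int (K := K) fun x => by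
    rw [abs_of_nonneg (h.nonneg x)]; exact hK x
  have hs4 := integrable_pow_four_of_bdd (h.soft hd).1.meas.aestronglyMeasurable (h.soft hd).2.1
      (K := K)
    fun x => by rw [abs_of_nonneg (softAbs_nonneg _)]; exact (h.soft_le hd x).trans (hK x)
  refine ⟨integral_mono hs4 hf4 fun x => pow_le_pow_left₀ (softAbs_nonneg _) (h.soft_le hd x) 4, ?_⟩
  have h3 := integral_mono hf4 (hs4.fun_add (h1.const_mul (4 * K ^ 2))) fun x => by
    have h0 := softAbs_nonneg (d := d) (f x)
    have hle := h.soft_le hd x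
    have hf0 := h.nonneg x
    set p := softAbs d (f x)
    have a1 : p ^ 2 ≤ K ^ 2 := pow_le_pow_left₀ h0 (hle.trans (hK x)) 2
    have a2 : f x ^ 2 ≤ K ^ 2 := pow_le_pow_left₀ hf0 (hK x) 2
    have a3 : (f x - p) * (f x + p) ≤ 2 * ((f x - p) * f x) := by nlinarith
    have a4 : (f x - p) * (f x + p) * (f x ^ 2 + p ^ 2) ≤ 2 * ((f x - p) * f x) * (2 * K ^ 2) :=
      mul_le_mul a3 (by linarith) (by positivity)
        (mul_nonneg two_pos.le (mul_nonneg (sub_nonneg.2 hle) hf0))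
    change f x ^ 4 ≤ p ^ 4 + 4 * K ^ 2 * ((f x - p) * f x)
    nlinarith
  rw [integral_add hs4 (h1.const_mul _), integral_const_mul] at h3
  have := mul_le_mul_of_nonneg_left h2 (by positivity : 0 ≤ 4 * K ^ 2)
  linarith

theorem heat_sq_le (h : AbsH1 f) {d K σ : ℝ} (hd : 0 < d) (hK : ∀ x, f x ≤ K) (hσ : 0 < σ)
    (x : Plane) :
    heat (fun y => f y ^ 2) σ x ≤ heat (fun y => softAbs d (f y) ^ 2) σ x + 2 * K * d := by
  have h1 := (GaussInt.of_integrable (h.soft hd).2.1).mul_G hσ x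
  have h2 := (integrable_G hσ x).const_mul (2 * K * d)
  have h3 := integral_mono ((GaussInt.of_integrable h.int).mul_G hσ x) (h1.fun_add h2) fun y => by
    have h0 := softAbs_nonneg (d := d) (f y)
    have hle := h.soft_le hd y
    have hf0 := h.nonneg y
    have hsub := h.sub_soft_le d y
    have : f y ^ 2 ≤ softAbs d (f y) ^ 2 + 2 * K * d := by
      have hK0 := hK y
      set p := softAbs d (f y)
      have : (f y - p) * (f y + p) ≤ d * (2 * K) :=
        mul_le_mul hsub (by linarith) (by positivity) hd.le
      nlinarith
    have := mul_le_mul_of_nonneg_right this (G_pos hσ x y).le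
    simp only; linarith
  rw [integral_add h1 h2, integral_const_mul, integral_G hσ, mul_one] at h3
  exact h3

end AbsH1

theorem forall_of_ae_of_isClosed {p : Plane → Prop} (hc : IsClosed {x | p x}) (h : ∀ᵐ x, p x)
    (x : Plane) :
    p x :=
  hc.closure_subset (Measure.dense_of_ae h x)

/-- A strong limit of near-optimisers that almost peak at the origin is the ground state. -/
theorem IsGroundState.eq_limit {Q : Plane → ℝ} (hQ : IsGroundState Q) {s : ℝ}
    (hs : s = ∫ x, Q x ^ 2)
    (hs0 : 0 < s) (hGN : GNIneq s) {F : ℕ → Plane → ℝ} {W : Plane → ℝ} {K C : ℝ} {η : ℕ → ℝ}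
    (hF : ∀ n, H1R (F n)) (hF0 : ∀ n x, 0 ≤ F n x) (hFK : ∀ n x, F n x ≤ K)
    (hA : ∀ n, ∫ x, gradSqR (F n) x ≤ 1) (h4 : Tendsto (fun n => ∫ x, F n x ^ 4) atTop (𝓝 2))
    (hWm : Measurable W) (hW0 : ∀ x, 0 ≤ W x) (hWK : ∀ x, W x ≤ K)
    (hae : ∀ᵐ x, Tendsto (fun n => F n x) atTop (𝓝 (W x))) (hWi : Integrable fun x => W x ^ 2)
    (hWs : ∫ x, W x ^ 2 = s) (hl : Tendsto (fun n => ∫ x, (F n x - W x) ^ 2) atTop (𝓝 0))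
    (hη : Tendsto η atTop (𝓝 0))
    (hmax : ∀ n x σ, 0 < σ → F n x ^ 2 ≤ heat (fun y => F n y ^ 2) σ 0 + η n + C * σ) :
    W =ᵐ[volume] Qstar Q := by
  have hFa : ∀ n x, |F n x| ≤ K := fun n x => by rw [abs_of_nonneg (hF0 n x)]; exact hFK n x
  have hWa : ∀ x, |W x| ≤ K := fun x => by rw [abs_of_nonneg (hW0 x)]; exact hWK x
  have hW4 : ∫ x, W x ^ 4 = 2 := tendsto_nhds_unique
    (tendsto_integral_pow_four (fun n =>
        (hF n).1.meas.aestronglyMeasurable) hWm.aestronglyMeasurable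
      (fun n => (hF n).2.1) hWi hFa hWa hl) h4
  have hWL : H1Lim K W := ⟨hWm, hWa, hWi, F, hF, hFa, hA, hl⟩
  have hWS : WeakSol (1 / s) K W := ⟨hWm, hWa, fun φ hφ => hWL.euler hs0 hGN hWs hW4 hφ⟩
  obtain ⟨v, hvc, hvK, hv⟩ := hWL.exists_continuous hWS
  have hv0 : ∀ x, 0 ≤ v x := forall_of_ae_of_isClosed (isClosed_Ici.preimage hvc)
    (hv.mono fun x hx => by rw [← hx]; exact hW0 x)
  have hvL := hWL.congr hvc.measurable hvK hv
  have hvs : ∫ x, v x ^ 2 = s := by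
    rw [← hWs]; exact integral_congr_ae (hv.mono fun x hx => by simp only [hx])
  have hv4 : ∫ x, v x ^ 4 = 2 := by
    rw [← hW4]; exact integral_congr_ae (hv.mono fun x hx => by simp only [hx])
  have hvS : WeakSol (1 / s) K v := ⟨hvc.measurable, hvK, fun φ hφ => hvL.euler hs0 hGN hvs hv4 hφ⟩
  have hheat : ∀ σ, 0 < σ → Tendsto (fun n => heat (fun y => F n y ^ 2) σ 0) atTop
      (𝓝 (heat (fun y => v y ^ 2) σ 0)) := by
    intro σ hσ
    refine tendsto_integral_of_dominated_convergence (fun y => K ^ 2 * G σ 0 y)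
      (fun n => ((hF n).1.meas.pow_const 2).aestronglyMeasurable.mul
        (continuous_G σ 0).aestronglyMeasurable) ((integrable_G hσ 0).const_mul _)
      (fun n => ae_of_all _ fun y => ?_) ?_
    · rw [norm_mul, Real.norm_of_nonneg (sq_nonneg _), Real.norm_of_nonneg (G_pos hσ 0 y).le]
      exact mul_le_mul_of_nonneg_right (pow_le_pow_left₀ (hF0 n y) (hFK n y) 2) (G_pos hσ 0 y).le
    · filter_upwards [hae, hv] with y hy hvy
      rw [hvy] at hy
      exact (hy.pow 2).mul_const _
  have hle : ∀ᵐ x, ∀ σ, 0 < σ → v x ^ 2 ≤ heat (fun y => v y ^ 2) σ 0 + C * σ := by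
    filter_upwards [hae, hv] with x hx hvx σ hσ
    rw [hvx] at hx
    have := le_of_tendsto_of_tendsto' (hx.pow 2) (((hheat σ hσ).add hη).add_const (C * σ))
      fun n => hmax n x σ hσ
    simpa using this
  have hmax0 : ∀ᵐ x, v x ≤ v 0 := by
    filter_upwards [hle] with x hx
    have h1 := heat_tendsto (F := fun y => v y ^ 2) (hvc.pow 2).aestronglyMeasurable (K := K ^ 2)
      (fun y => by rw [abs_pow]; exact pow_le_pow_left₀ (abs_nonneg _) (hvK y) 2)
      (hvc.pow 2).continuousAt (x := 0)
    have h2 : Tendsto (fun σ : ℝ => C * σ) (𝓝[>] 0) (𝓝 (C * 0)) :=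
      (continuous_const.mul continuous_id).continuousAt.tendsto.mono_left nhdsWithin_le_nhds
    have h3 := ge_of_tendsto (h1.add h2) (b := v x ^ 2)
      (eventually_mem_nhdsWithin.mono fun σ hσ => hx σ hσ)
    rw [mul_zero, add_zero] at h3
    exact le_of_sq_le_sq h3 (hv0 0)
  have hmaxv : ∀ x, v x ≤ v 0 := forall_of_ae_of_isClosed (isClosed_Iic.preimage hvc) hmax0
  have hne : ∃ x, v x ≠ 0 := by
    by_contra! h0
    simp [h0] at hvs
    linarith
  have hvQ := hQ.eq_qstar hs hvS hvc (hvS.pos hvc hv0 hne)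
    (fun x y hxy => hvL.radial_anti hs0 hGN hvs hv4 hvc hmaxv hxy)
    (hWi.congr (hv.mono fun x hx => by simp only [hx]))
  rwa [← hvQ]

/-- Rescaled ground states converge in `L²`, along a subsequence, to the optimal profile. -/
theorem IsGroundState.exists_subseq_tendsto {Q : Plane → ℝ} (hQ : IsGroundState Q) {s : ℝ}
    (hs : s = ∫ x, Q x ^ 2) (hs0 : 0 < s) (hGN : GNIneq s) {w : ℕ → Plane → ℝ} {κ : ℕ → ℝ}
    (hw : ∀ n, AbsH1 (w n)) (hκ : ∀ n, 0 ≤ κ n) (hκ1 : ∀ n, κ n ≤ 1)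
    (hsub : ∀ n, SubDensity (κ n) (w n 0 ^ 2) fun x => w n x ^ 2)
    (hms : ∀ n, ∫ x, w n x ^ 2 ≤ s) (hm : Tendsto (fun n => ∫ x, w n x ^ 2) atTop (𝓝 s))
    (hA : ∀ n, ∫ x, gradSqR (w n) x ≤ 1) (h41 : ∀ n, 1 ≤ ∫ x, w n x ^ 4)
    (h43 : ∀ n, ∫ x, w n x ^ 4 ≤ 3) (h4 : Tendsto (fun n => ∫ x, w n x ^ 4) atTop (𝓝 2)) :
    ∃ φ : ℕ → ℕ, Tendsto (fun n => ∫ x, (w (φ n) x - Qstar Q x) ^ 2) atTop (𝓝 0) := by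
  have e4 : ∀ n, ∫ x, (w n x ^ 2) ^ 2 = ∫ x, w n x ^ 4 := fun n => by simp only [← pow_mul]
  have hM : ∀ n, w n 0 ^ 2 ≤ 5 := fun n =>
      (hsub n).M_le (hκ1 n) (by rw [e4]; exact h43 n) (x := 0) rfl
  have hw3 : ∀ n x, w n x ≤ 3 := fun n x => by
    have h1 := (hsub n).le x
    nlinarith [hM n, (hw n).nonneg x]
  have hM1 : ∀ n, 1 / s ≤ w n 0 ^ 2 := fun n => by
    have h1 := (hsub n).integral_sq_le
    rw [e4] at h1
    rw [div_le_iff₀ hs0]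
    exact (h41 n).trans (h1.trans (mul_le_mul_of_nonneg_left (hms n) (sq_nonneg _)))
  have hheat : ∀ n σ, 0 < σ → w n 0 ^ 2 ≤ heat (fun y => w n y ^ 2) σ 0 + 60 * σ := fun n σ hσ => by
    refine ((hsub n).le_heat_add (hκ n) hσ 0).trans ?_
    have h1 : (2 * w n 0 ^ 2 + 2 * κ n) * w n 0 ^ 2 * σ ≤ (2 * 5 + 2 * 1) * 5 * σ := by
      have := hM n; have := hκ1 n; have := hκ n
      gcongr
    linarith
  have hδ : ∀ n : ℕ, ∃ d : ℝ, 0 < d ∧ d ≤ 1 / ((n : ℝ) + 1) ∧ d ≤ 1 / (24 * s) ∧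
      ∫ x, (softAbs d (w n x) - w n x) ^ 2 ≤ 1 / ((n : ℝ) + 1) := by
    intro n
    have hp : ∀ k : ℕ, (0 : ℝ) < 1 / ((k : ℝ) + 1) := fun k => by positivity
    have ht := tendsto_one_div_add_atTop_nhds_zero_nat (𝕜 := ℝ)
    have h1 := (hw n).tendsto_soft_sq hp ht
    obtain ⟨k, hk1, hk2, hk3⟩ := ((ht.eventually (ge_mem_nhds (hp n))).and
      ((ht.eventually (ge_mem_nhds (by positivity : (0 : ℝ) < 1 / (24 * s)))).and
        (h1.eventually (ge_mem_nhds (hp n))))).exists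
    exact ⟨_, hp k, hk1, hk2, hk3⟩
  choose δ hδ0 hδn hδs hδi using hδ
  have hδt : Tendsto δ atTop (𝓝 0) := squeeze_zero (fun n => (hδ0 n).le) hδn
    tendsto_one_div_add_atTop_nhds_zero_nat
  have hclose : Tendsto (fun n => ∫ x, (softAbs (δ n) (w n x) - w n x) ^ 2) atTop (𝓝 0) :=
    squeeze_zero (fun n => integral_nonneg fun x => sq_nonneg _) hδi
      tendsto_one_div_add_atTop_nhds_zero_nat
  have herr : Tendsto (fun n => Real.sqrt (∫ x, (softAbs (δ n) (w n x) - w n x) ^ 2) *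
      Real.sqrt (∫ x, w n x ^ 2)) atTop (𝓝 0) := by
    have := hclose.sqrt.mul hm.sqrt
    rwa [Real.sqrt_zero, zero_mul] at this
  have hf2 : Tendsto (fun n => ∫ x, softAbs (δ n) (w n x) ^ 2) atTop (𝓝 s) := by
    refine tendsto_of_tendsto_of_tendsto_of_le_of_le (by simpa using hm.sub (herr.const_mul 2)) hm
      (fun n => ?_) fun n => ((hw n).integral_soft_sq (hδ0 n)).1
    have := ((hw n).integral_soft_sq (hδ0 n)).2
    simp only; linarith
  have hf4 : Tendsto (fun n => ∫ x, softAbs (δ n) (w n x) ^ 4) atTop (𝓝 2) := by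
    refine tendsto_of_tendsto_of_tendsto_of_le_of_le
      (by simpa using h4.sub (herr.const_mul (4 * 3 ^ 2))) h4
      (fun n => ?_) fun n => ((hw n).integral_soft_pow_four (hδ0 n) (hw3 n)).1
    have := ((hw n).integral_soft_pow_four (hδ0 n) (hw3 n)).2
    simp only; linarith
  have hfH : ∀ n, H1R fun x => softAbs (δ n) (w n x) := fun n => (hw n).soft (hδ0 n)
  have hf3 : ∀ n x, softAbs (δ n) (w n x) ≤ 3 := fun n x =>
      ((hw n).soft_le (hδ0 n) x).trans (hw3 n x)
  have hfA : ∀ n, ∫ x, gradSqR (fun y => softAbs (δ n) (w n y)) x ≤ 1 := fun n =>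
    (integral_mono (hfH n).2.2 (hw n).int_grad ((hw n).gradSqR_soft_le (hδ0 n))).trans (hA n)
  have hnear : ∀ n σ, 0 < σ →
      w n 0 ^ 2 ≤ heat (fun y => softAbs (δ n) (w n y) ^ 2) σ 0 + 2 * 3 * δ n + 60 * σ :=
          fun n σ hσ => by
    linarith [hheat n σ hσ, (hw n).heat_sq_le (hδ0 n) (hw3 n) hσ 0]
  have hlow : ∀ n, 1 / (4 * s) ≤ ∫ x, G (1 / (120 * s)) 0 x * softAbs (δ n) (w n x) ^ 2 :=
      fun n => by
    have h1 := hnear n (1 / (120 * s)) (by positivity)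
    have h2 := hM1 n
    have h3 := hδs n
    have h5 : ∫ x, G (1 / (120 * s)) 0 x * softAbs (δ n) (w n x) ^ 2 =
        heat (fun y => softAbs (δ n) (w n y) ^ 2) (1 / (120 * s)) 0 := by
      unfold heat; simp only [mul_comm]
    rw [h5]
    have e1 : 1 / (4 * s) = 1 / 4 * (1 / s) := by rw [one_div_mul_one_div]
    have e2 : 1 / (120 * s) = 1 / 120 * (1 / s) := by rw [one_div_mul_one_div]
    have e3 : 1 / (24 * s) = 1 / 24 * (1 / s) := by rw [one_div_mul_one_div]
    rw [e2] at h1 ⊢; rw [e3] at h3; rw [e1]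
    linarith
  obtain ⟨φ, hφ, W, hWm, hW0, hWK, hae, hWi, hWs, hl⟩ := exists_strong_limit hs0 hGN hfH
    (fun n x => softAbs_nonneg _) hf3 hfA hf2 hf4 (by positivity) (by positivity) hlow
  have hη : Tendsto (fun n => 2 * 3 * δ (φ n)) atTop (𝓝 0) := by
    simpa using (hδt.comp hφ.tendsto_atTop).const_mul (2 * 3)
  have hWQ := hQ.eq_limit hs hs0 hGN (C := 60) (fun n => hfH (φ n)) (fun n x => softAbs_nonneg _)
    (fun n => hf3 (φ n)) (fun n => hfA (φ n)) (hf4.comp hφ.tendsto_atTop) hWm hW0 hWK hae hWi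
        hWs hl hη
    fun n x σ hσ => (pow_le_pow_left₀ (softAbs_nonneg _) ((hw _).soft_le (hδ0 _) x) 2).trans
      (((hsub _).le x).trans (hnear _ σ hσ))
  refine ⟨φ, squeeze_zero (fun n => integral_nonneg fun x => sq_nonneg _) (fun n => ?_)
    (g := fun n => 2 * (∫ x, (softAbs (δ (φ n)) (w (φ n) x) - w (φ n) x) ^ 2) +
      2 * ∫ x, (softAbs (δ (φ n)) (w (φ n) x) - W x) ^ 2) ?_⟩
  · have i1 := (integrable_sq_sub (hfH (φ n)).1.meas.aestronglyMeasurable (hw (φ n)).meas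
      (hfH (φ n)).2.1
      (hw (φ n)).int).const_mul 2
    have i2 := (integrable_sq_sub (hfH (φ n)).1.meas.aestronglyMeasurable hWm.aestronglyMeasurable
      (hfH (φ n)).2.1 hWi).const_mul 2
    have h1 := integral_mono_of_nonneg (f := fun x => (w (φ n) x - W x) ^ 2)
      (ae_of_all _ fun x => sq_nonneg _) (i1.fun_add i2) (ae_of_all _ fun x => by
        simp only
        nlinarith [sq_nonneg (softAbs (δ (φ n)) (w (φ n) x) - w (φ n) x +
          (softAbs (δ (φ n)) (w (φ n) x) - W x))])
    rw [integral_add i1 i2, integral_const_mul, integral_const_mul] at h1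
    refine le_trans (le_of_eq ?_) h1
    exact integral_congr_ae (hWQ.mono fun x hx => by simp only [hx])
  · simpa using ((hclose.comp hφ.tendsto_atTop).const_mul 2).add (hl.const_mul 2)

theorem AbsH1.gradSqR_sub_le {w q : Plane → ℝ} (hw : AbsH1 w) (hq : Differentiable ℝ q)
    (x : Plane) :
    gradSqR (fun y => w y - q y) x ≤ gradSqR w x + gradSqR q x -
      2 * (d0R w x * d0R q x + d1R w x * d1R q x) := by
  by_cases hd : DifferentiableAt ℝ w x
  · have h : fderiv ℝ (fun y => w y - q y) x = fderiv ℝ w x - fderiv ℝ q x :=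
      (hd.hasFDerivAt.fun_sub (hq x).hasFDerivAt).fderiv
    refine le_of_eq ?_
    simp only [gradSqR, d0R, d1R, h, _root_.sub_apply]
    ring
  · have hw0 : w x = 0 := by
      by_contra hne
      exact hd (hw.diffAt hne)
    have hd' : ¬ DifferentiableAt ℝ (fun y => w y - q y) x := fun hc =>
      hd ((hc.fun_add (hq x)).congr_of_eventuallyEq (Eventually.of_forall fun y => by ring))
    have h1 := fderiv_zero_of_not_differentiableAt hd'
    have h2 := hw.fderiv_zero hw0
    have h3 := gradSqR_nonneg q x
    simp only [gradSqR, d0R, d1R, h1, h2, zero_apply] at h3 ⊢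
    linarith

theorem H1R.integrable_cube_sq {q : Plane → ℝ} {B : ℝ} (hq : H1R q) (hB : ∀ x, |q x| ≤ B) :
    Integrable fun x => (q x ^ 3) ^ 2 := by
  have hqm := hq.1.meas.aestronglyMeasurable (μ := volume)
  refine ((integrable_pow_four_of_bdd hqm hq.2.1 hB).mul_bdd (c := B ^ 2) (hqm.pow 2)
    (ae_of_all _ fun x => ?_)).congr (ae_of_all _ fun x => ?_)
  · rw [Pi.pow_apply, Real.norm_of_nonneg (sq_nonneg _), ← sq_abs]
    exact pow_le_pow_left₀ (abs_nonneg _) (hB x) 2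
  · simp only [Pi.pow_apply]; ring

/-- Nearly optimal functions close to an optimizer in `L²` are close to it in `H¹`. -/
theorem AbsH1.integral_gradSqR_sub_le {s : ℝ} (hs : 0 < s) (hGN : GNIneq s) {q w : Plane → ℝ}
    {B : ℝ}
    (hq : H1R q) (hq0 : ∀ x, 0 ≤ q x) (hqB : ∀ x, q x ≤ B) (hqs : ∫ x, q x ^ 2 = s)
    (hqg : ∫ x, gradSqR q x = 1) (hq4 : ∫ x, q x ^ 4 = 2) (hw : AbsH1 w) (hA :
        ∫ x, gradSqR w x = 1) :
    ∫ x, gradSqR (fun y => w y - q y) x ≤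
      4 - 16 * s * (1 + ∫ x, q x ^ 3 * (w x - q x)) / ∫ x, (w x + q x) ^ 2 := by
  have hqm := hq.1.meas.aestronglyMeasurable (μ := volume)
  have hqa : ∀ x, |q x| ≤ B := fun x => by rw [abs_of_nonneg (hq0 x)]; exact hqB x
  have hq4i := integrable_pow_four_of_bdd hqm hq.2.1 hqa
  have hq6 := hq.integrable_cube_sq hqa
  have hmi := integrable_sq_add hw.meas hqm hw.int hq.2.1
  have hm : s ≤ ∫ x, (w x + q x) ^ 2 := by
    rw [← hqs]
    exact integral_mono hq.2.1 hmi fun x => pow_le_pow_left₀ (hq0 x) (by linarith [hw.nonneg x]) 2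
  have hm0 : 0 < ∫ x, (w x + q x) ^ 2 := hs.trans_le hm
  have hd0m : ∀ {f : Plane → ℝ}, AEStronglyMeasurable (d0R f) volume :=
      (measurable_d0R _).aestronglyMeasurable
  have hd1m : ∀ {f : Plane → ℝ}, AEStronglyMeasurable (d1R f) volume :=
      (measurable_d1R _).aestronglyMeasurable
  have hsq0 : ∀ {f : Plane → ℝ}, Integrable (gradSqR f) → Integrable fun x => d0R f x ^ 2 :=
      fun {f} hf =>
    hf.mono' (hd0m.pow 2) (ae_of_all _ fun x => by
      rw [Real.norm_of_nonneg (sq_nonneg _), gradSqR]; linarith [sq_nonneg (d1R f x)])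
  have hsq1 : ∀ {f : Plane → ℝ}, Integrable (gradSqR f) → Integrable fun x => d1R f x ^ 2 :=
      fun {f} hf =>
    hf.mono' (hd1m.pow 2) (ae_of_all _ fun x => by
      rw [Real.norm_of_nonneg (sq_nonneg _), gradSqR]; linarith [sq_nonneg (d0R f x)])
  have hX : Integrable fun x => d0R w x * d0R q x + d1R w x * d1R q x :=
    (integrable_mul_of_sq hd0m hd0m (hsq0 hw.int_grad) (hsq0 hq.2.2)).fun_add
      (integrable_mul_of_sq hd1m hd1m (hsq1 hw.int_grad) (hsq1 hq.2.2))
  set X := ∫ x, (d0R w x * d0R q x + d1R w x * d1R q x) with hXd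
  set δ : ℕ → ℝ := fun n => 1 / ((n : ℝ) + 1)
  have hδ0 : ∀ n, 0 < δ n := fun n => by positivity
  have hδ : Tendsto δ atTop (𝓝 0) := tendsto_one_div_add_atTop_nhds_zero_nat
  have hlimX : Tendsto (fun n => ∫ x, (d0R (fun y => softAbs (δ n) (w y)) x * d0R q x +
      d1R (fun y => softAbs (δ n) (w y)) x * d1R q x)) atTop (𝓝 X) := by
    refine tendsto_integral_of_dominated_convergence
      (fun x => |d0R w x * d0R q x + d1R w x * d1R q x|) (fun n =>
          (hd0m.mul hd0m).add (hd1m.mul hd1m))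
      hX.abs (fun n => ae_of_all _ fun x => ?_) (ae_of_all _ fun x => ?_)
    · rw [hw.d0R_soft (hδ0 n), hw.d1R_soft (hδ0 n), mul_assoc, mul_assoc, ← mul_add, norm_mul,
        Real.norm_eq_abs, Real.norm_eq_abs]
      exact mul_le_of_le_one_left (abs_nonneg _) (softAbs_deriv_le (hδ0 n) (w x))
    · simp only [hw.d0R_soft (hδ0 _), hw.d1R_soft (hδ0 _), mul_assoc, ← mul_add]
      by_cases hx : w x = 0
      · simp [d0R, d1R, hw.fderiv_zero hx]
      · have hpos : 0 < w x := (hw.nonneg x).lt_of_ne' hx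
        have h1 : Tendsto (fun n => w x / Real.sqrt (w x ^ 2 + δ n ^ 2)) atTop
            (𝓝 (w x / Real.sqrt (w x ^ 2 + 0 ^ 2))) :=
          tendsto_const_nhds.div (((hδ.pow 2).const_add _).sqrt) (by positivity)
        rw [zero_pow two_ne_zero, add_zero, Real.sqrt_sq hpos.le, div_self hx] at h1
        simpa using h1.mul_const (d0R w x * d0R q x + d1R w x * d1R q x)
  have hlimE : Tendsto (fun n => ∫ x, q x ^ 3 * (softAbs (δ n) (w x) - q x)) atTop
      (𝓝 (∫ x, q x ^ 3 * (w x - q x))) := by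
    have hsm : ∀ n, AEStronglyMeasurable (fun x => softAbs (δ n) (w x)) volume := fun n =>
      (hw.soft (hδ0 n)).1.meas.aestronglyMeasurable
    refine tendsto_integral_mul (fun _ => hqm.pow 3) (fun n => (hsm n).sub hqm) (hqm.pow 3)
      (hw.meas.sub hqm) (fun _ => hq6) (fun n =>
          integrable_sq_sub (hsm n) hqm (hw.soft (hδ0 n)).2.1 hq.2.1)
      hq6 (integrable_sq_sub hw.meas hqm hw.int hq.2.1) (by simp) ?_
    simpa using hw.tendsto_soft_sq hδ0 hδ
  have key : 32 + 32 * ∫ x, q x ^ 3 * (w x - q x) ≤ 2 / s * (1 + 1 + 2 * X) * ∫ x, (w x +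
      q x) ^ 2 := by
    refine le_of_tendsto_of_tendsto' ((hlimE.const_mul 32).const_add 32)
      ((((hlimX.const_mul 2).const_add (1 + 1)).const_mul (2 / s)).mul_const _) fun n => ?_
    have hS := hw.soft (hδ0 n)
    have hH := hS.add hq
    obtain ⟨h4i, h4⟩ := hGN _ hH
    have hE : Integrable fun x => q x ^ 3 * (softAbs (δ n) (w x) - q x) :=
      integrable_mul_of_sq (hqm.pow 3) (hS.1.meas.aestronglyMeasurable.sub hqm) hq6
        (integrable_sq_sub hS.1.meas.aestronglyMeasurable hqm hS.2.1 hq.2.1)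
    have h5 := integral_mono ((hq4i.const_mul 16).fun_add (hE.const_mul 32)) h4i fun x => by
      have := pow_four_convex (2 * q x) (softAbs (δ n) (w x) - q x)
      simp only
      rw [show softAbs (δ n) (w x) + q x = 2 * q x + (softAbs (δ n) (w x) - q x) by ring]
      nlinarith
    rw [integral_add (hq4i.const_mul 16) (hE.const_mul 32), integral_const_mul, integral_const_mul,
        hq4] at h5
    have h6 : ∫ x, gradSqR (fun y => softAbs (δ n) (w y) + q y) x ≤ 1 + 1 +
        2 * ∫ x, (d0R (fun y => softAbs (δ n) (w y)) x * d0R q x +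
          d1R (fun y => softAbs (δ n) (w y)) x * d1R q x) := by
      rw [hS.integral_gradSqR_add hq, hqg]
      have := integral_mono hS.2.2 hw.int_grad (hw.gradSqR_soft_le (hδ0 n))
      rw [hA] at this
      linarith
    have h7 : ∫ x, (softAbs (δ n) (w x) + q x) ^ 2 ≤ ∫ x, (w x + q x) ^ 2 :=
      integral_mono hH.2.1 hmi fun x => pow_le_pow_left₀ (add_nonneg (softAbs_nonneg _) (hq0 x))
        (by linarith [hw.soft_le (hδ0 n) x]) 2
    have h8 : 0 ≤ ∫ x, gradSqR (fun y => softAbs (δ n) (w y) + q y) x :=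
      integral_nonneg fun x => gradSqR_nonneg _ _
    have h9 : 0 ≤ ∫ x, (softAbs (δ n) (w x) + q x) ^ 2 := integral_nonneg fun x => sq_nonneg _
    have h10 : 2 / s * (∫ x, gradSqR (fun y => softAbs (δ n) (w y) + q y) x) *
        (∫ x, (softAbs (δ n) (w x) + q x) ^ 2) ≤ 2 / s * (1 + 1 +
        2 * ∫ x, (d0R (fun y => softAbs (δ n) (w y)) x * d0R q x +
          d1R (fun y => softAbs (δ n) (w y)) x * d1R q x)) * ∫ x, (w x + q x) ^ 2 := by
      have h12 := h8.trans h6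
      gcongr
    linarith
  have h1 := integral_mono_of_nonneg (f := gradSqR fun y => w y - q y)
    (ae_of_all _ fun x => gradSqR_nonneg _ _)
    ((hw.int_grad.fun_add hq.2.2).sub' (hX.const_mul 2)) (ae_of_all _ (hw.gradSqR_sub_le hq.1))
  rw [integral_sub (hw.int_grad.fun_add hq.2.2) (hX.const_mul 2), integral_add hw.int_grad hq.2.2,
    integral_const_mul, hA, hqg, ← hXd] at h1
  refine h1.trans ?_
  have h2 : 16 * s * (1 + ∫ x, q x ^ 3 * (w x - q x)) / (∫ x, (w x + q x) ^ 2) ≤ 2 + 2 * X := by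
    rw [div_le_iff₀ hm0]
    have h3 := mul_le_mul_of_nonneg_left key (by positivity : 0 ≤ s / 2)
    have h4 : s / 2 * (2 / s * (1 + 1 + 2 * X) * ∫ x, (w x + q x) ^ 2) =
        (2 + 2 * X) * ∫ x, (w x + q x) ^ 2 := by field_simp; ring
    rw [h4] at h3
    linarith
  linarith

theorem tendsto_of_forall_seq {l : Filter ℝ} [l.IsCountablyGenerated] {f : ℝ → ℝ} {y : ℝ}
    {p : ℝ → Prop}
    (hp : ∀ᶠ a in l, p a) (h : ∀ a : ℕ → ℝ, (∀ n, p (a n)) → Tendsto a atTop l →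
      ∃ φ : ℕ → ℕ, Tendsto (fun n => f (a (φ n))) atTop (𝓝 y)) : Tendsto f l (𝓝 y) := by
  refine tendsto_of_subseq_tendsto fun a ha => ?_
  obtain ⟨N, hN⟩ := eventually_atTop.1 (ha.eventually hp)
  obtain ⟨φ, hφ⟩ := h (fun n => a (n + N)) (fun n => hN _ (by omega))
    (ha.comp (tendsto_add_atTop_nat N))
  exact ⟨fun n => φ n + N, hφ⟩

theorem norm_wfam (Ω : ℝ) (u : ℝ → Plane → ℂ) (xa : ℝ → Plane) (a θv : ℝ) (y : Plane) :
    ‖wfam Ω u xa a θv y‖ = epsOf u a * ‖u a (epsOf u a • y + xa a)‖ := by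
  have h0 : 0 ≤ epsOf u a := Real.rpow_nonneg (integral_nonneg fun x => sq_nonneg _) _
  unfold wfam
  rw [norm_mul, norm_mul, Complex.norm_real, Real.norm_of_nonneg h0, neg_mul, ← mul_neg,
      mul_comm Complex.I,
    ← Complex.ofReal_neg, Complex.norm_exp_ofReal_mul_I, mul_one]

theorem epsOf_sq {u : ℝ → Plane → ℂ} {a : ℝ} (h : 0 < ∫ x, gradSqR (fun y => ‖u a y‖) x) :
    0 < epsOf u a ∧ epsOf u a ^ 2 = 1 / ∫ x, gradSqR (fun y => ‖u a y‖) x := by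
  have e : ∫ x, gradAbsSq (u a) x = ∫ x, gradSqR (fun y => ‖u a y‖) x :=
    integral_congr_ae (ae_of_all _ fun x => (gradSqR_eq _ x).symm)
  unfold epsOf
  rw [e]
  refine ⟨Real.rpow_pos_of_pos h _, ?_⟩
  rw [← Real.rpow_natCast, ← Real.rpow_mul h.le]
  norm_num [Real.rpow_neg_one]

theorem modulus_convergence_H1
    (V : Plane → ℝ) (Ω α : ℝ) (Q : Plane → ℝ)
    (hV : V110 V) (hΩ : 0 < Ω) (hsub : SubCritical V Ω) (hCV : CondV V Ω α)
    (hQ : IsGroundState Q)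
    (astar : ℝ) (hastar : astar = ∫ x : Plane, (Q x) ^ 2)
    (u : ℝ → Plane → ℂ)
    (hmin : ∀ a ∈ Ioo (0 : ℝ) astar, IsMinimizer V Ω a (u a))
    (xa : ℝ → Plane) (θ : ℝ → ℝ)
    (hxa : ∀ a ∈ Ioo (0 : ℝ) astar, ∀ y : Plane, ‖u a y‖ ≤ ‖u a (xa a)‖)
    (hθ : ∀ a, θ a ∈ Ico (0 : ℝ) (2 * Real.pi))
 :
    Tendsto (fun a => ∫ x : Plane, (‖wfam Ω u xa a (θ a) x‖ - Qstar Q x) ^ 2)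
      (𝓝[<] astar) (𝓝 0) ∧
    Tendsto (fun a => ∫ x : Plane, gradSqR (fun y => ‖wfam Ω u xa a (θ a) y‖ - Qstar Q y) x)
      (𝓝[<] astar) (𝓝 0) := by
  have hs0 : 0 < astar := hastar ▸ hQ.integral_sq_pos
  have hpos := hCV.2.1
  have hGN : GNIneq astar := GNIneq.of_bddBelow hV hs0 fun a ha => ⟨_, (hmin a ha).2⟩
  obtain ⟨hE, hA, h4⟩ := IsMinimizer.asymptotics hV hpos hQ hastar hCV.2.2.2.2 hmin
  simp only [norm_wfam]
  set A : ℝ → ℝ := fun a => ∫ x, gradSqR (fun y => ‖u a y‖) x with hAd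
  set w : ℝ → Plane → ℝ := fun a x => epsOf u a * ‖u a (epsOf u a • x + xa a)‖ with hwd
  set κ : ℝ → ℝ := fun a => kap * epsOf u a * Real.sqrt (epsOf u a ^ 2 * ∫ x, ‖u a x‖ ^ 4) with hκd
  have hw : ∀ a ∈ Ioo 0 astar, 0 < A a → AbsH1 (w a) ∧ ∫ x, w a x ^ 2 = a ∧
      ∫ x, gradSqR (w a) x = 1 ∧ ∫ x, w a x ^ 4 = (∫ x, ‖u a x‖ ^ 4) / A a := by
    intro a ha hAa
    obtain ⟨hε, hε2⟩ := epsOf_sq hAa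
    obtain ⟨h1, h2, h3, h5⟩ := (InH.absH1 hV hpos (hmin a ha).1.1).1.affine hε.le hε.ne' (xa a)
    have hne := hAa.ne'
    refine ⟨h1, h2.trans ?_, h3.trans ?_, h5.trans ?_⟩
    · rw [mul_inv_cancel₀ (by positivity), one_mul]; exact (hmin a ha).1.2
    · rw [hε2]; exact one_div_mul_cancel hne
    · rw [show epsOf u a ^ 4 = epsOf u a ^ 2 * epsOf u a ^ 2 by ring, mul_assoc (epsOf u a ^ 2),
        mul_inv_cancel₀ (by positivity), mul_one, hε2, one_div, inv_mul_eq_div]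
  have hκ0 : ∀ a, 0 < A a → 0 ≤ κ a := fun a ha =>
    mul_nonneg (mul_nonneg kap_nonneg (epsOf_sq ha).1.le) (Real.sqrt_nonneg _)
  have hεt : Tendsto (fun a => epsOf u a) (𝓝[<] astar) (𝓝 0) := by
    have h1 : Tendsto (fun a => Real.sqrt (1 / A a)) (𝓝[<] astar) (𝓝 0) := by
      simpa using (hA.inv_tendsto_atTop).sqrt
    refine h1.congr' ?_
    filter_upwards [hA.eventually_gt_atTop 0] with a ha
    rw [← (epsOf_sq ha).2, Real.sqrt_sq (epsOf_sq ha).1.le]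
  have hκt : Tendsto κ (𝓝[<] astar) (𝓝 0) := by
    have h1 := (hεt.const_mul kap).mul h4.sqrt
    rw [mul_zero, zero_mul] at h1
    refine h1.congr' ?_
    filter_upwards [hA.eventually_gt_atTop 0] with a ha
    rw [hκd]
    simp only
    rw [(epsOf_sq ha).2, one_div, inv_mul_eq_div]
  have hgood : ∀ᶠ a in 𝓝[<] astar, a ∈ Ioo 0 astar ∧ 0 < A a ∧ κ a ≤ 1 ∧ Ea V Ω (u a) ≤ 0 ∧
      (∫ x, ‖u a x‖ ^ 4) / A a ∈ Ioo 1 3 := by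
    filter_upwards [Ioo_mem_nhdsLT hs0, hA.eventually_gt_atTop 0,
      hκt.eventually (ge_mem_nhds one_pos), hE,
      h4.eventually (Ioo_mem_nhds (by norm_num : (1 : ℝ) < 2) (by norm_num : (2 : ℝ) < 3))] with a
          h1 h2 h3 h5 h6
    exact ⟨h1, h2, h3, h5, h6⟩
  have hL2 : Tendsto (fun a => ∫ x, (w a x - Qstar Q x) ^ 2) (𝓝[<] astar) (𝓝 0) := by
    refine tendsto_of_forall_seq hgood fun a ha hat => ?_
    have hwa := fun n => hw (a n) (ha n).1 (ha n).2.1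
    refine hQ.exists_subseq_tendsto hastar hs0 hGN (κ := fun n => κ (a n)) (w := fun n => w (a n))
      (fun n => (hwa n).1) (fun n => hκ0 _ (ha n).2.1) (fun n => (ha n).2.2.1) (fun n => ?_)
      (fun n => (hwa n).2.1.le.trans (ha n).1.2.le) ?_ (fun n => (hwa n).2.2.1.le)
      (fun n => (ha n).2.2.2.2.1.le.trans_eq (hwa n).2.2.2.symm)
      (fun n => (hwa n).2.2.2.trans_le (ha n).2.2.2.2.2.le) ?_
    · have h1 := (hmin _ (ha n).1).subDensity hV hpos (ha n).1.1 (epsOf_sq (ha n).2.1).1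
        (ha n).2.2.2.1
        (hxa _ (ha n).1)
      have h2 : w (a n) 0 = epsOf u (a n) * ‖u (a n) (xa (a n))‖ := by
        simp only [hwd, smul_zero, zero_add]
      rw [h2]
      exact h1
    · refine (tendsto_nhdsWithin_iff.1 hat).1.congr fun n => ((hwa n).2.1).symm
    · exact (h4.comp hat).congr fun n => ((hwa n).2.2.2).symm
  refine ⟨hL2, ?_⟩
  obtain ⟨hqs, hqg, -, hq4⟩ := hQ.qstar_integrals hastar
  have hq := hQ.qstar_h1R
  have hqm := hq.1.meas.aestronglyMeasurable (μ := volume)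
  obtain ⟨B, hB⟩ : ∃ B, ∀ x, Qstar Q x ≤ B := by
    obtain ⟨C, hC⟩ := hQ.decay
    have hC' : ∀ y, Q y ≤ |C| := fun y => (hC y).trans
      ((mul_le_mul_of_nonneg_right (le_abs_self C) (Real.exp_pos _).le).trans
        (mul_le_of_le_one_right (abs_nonneg C)
          (Real.exp_le_one_iff.2 (by have := norm_nonneg y; linarith))))
    exact ⟨_, fun x => mul_le_mul_of_nonneg_left (hC' _) (inv_nonneg.2 (Real.sqrt_nonneg _))⟩
  refine tendsto_of_forall_seq hgood fun a ha hat => ⟨id, ?_⟩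
  have hwa := fun n => hw (a n) (ha n).1 (ha n).2.1
  have hl : Tendsto (fun n => ∫ x, (w (a n) x - Qstar Q x) ^ 2) atTop (𝓝 0) := hL2.comp hat
  refine squeeze_zero (fun n => integral_nonneg fun x => gradSqR_nonneg _ _)
    (fun n => (hwa n).1.integral_gradSqR_sub_le hs0 hGN hq (fun x =>
        (hQ.qstar_pos x).le) hB hqs hqg hq4
      (hwa n).2.2.1) ?_
  have hqa : ∀ x, |Qstar Q x| ≤ B := fun x => by rw [abs_of_pos (hQ.qstar_pos x)]; exact hB x
  have hq6 : Integrable fun x => (Qstar Q x ^ 3) ^ 2 := hq.integrable_cube_sq hqa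
  have he : Tendsto (fun n => ∫ x, Qstar Q x ^ 3 * (w (a n) x - Qstar Q x)) atTop (𝓝 0) := by
    have := tendsto_integral_mul (f := fun _ x => Qstar Q x ^ 3) (F := fun x => Qstar Q x ^ 3)
      (g := fun n x => w (a n) x - Qstar Q x) (G := fun _ => (0 : ℝ)) (fun _ => hqm.pow 3)
      (fun n => (hwa n).1.meas.sub hqm) (hqm.pow 3) aestronglyMeasurable_const (fun _ => hq6)
      (fun n => integrable_sq_sub (hwa n).1.meas hqm (hwa n).1.int hq.2.1) hq6 (by simp) (by simp)
      (by simpa using hl)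
    simpa using this
  have hm : Tendsto (fun n => ∫ x, (w (a n) x + Qstar Q x) ^ 2) atTop (𝓝 (4 * astar)) := by
    have := tendsto_integral_sq (f := fun n x => w (a n) x + Qstar Q x) (F := fun x =>
        2 * Qstar Q x)
      (fun n => (hwa n).1.meas.add hqm) (hqm.const_mul 2)
      (fun n => integrable_sq_add (hwa n).1.meas hqm (hwa n).1.int hq.2.1)
      (by simp only [mul_pow]; exact hq.2.1.const_mul _)
      (hl.congr fun n => integral_congr_ae (ae_of_all _ fun x => by simp only; ring))
    simp only [mul_pow, integral_const_mul, hqs] at this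
    norm_num at this
    exact this
  have hfin := (((he.const_add 1).const_mul (16 * astar)).div hm (by positivity)).const_sub 4
  have e : 4 - 16 * astar * (1 + 0) / (4 * astar) = 0 := by field_simp; norm_num
  rw [e] at hfin
  exact hfin

end
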